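/- Fix an admissible cutoff profile φ. For every M > 0 and δ > 0 there exist η > 0 and Λ > 0 depending only on a, b, c, δ, M (and φ) such that the following holds. Let ε ∈ (0,1), x ∈ ℝ³, r ∈ (Λε, 1), and let Q : B_{10r}(x) → S₀ be a smooth local minimizer of E_ε with r⁻¹E_ε(Q, B_{10r}(x)) + sup_{B_{10r}(x)} |Q| ≤ M. If Θ_r^φ(Q,x) − Θ_{r/2}^φ(Q,x) < η and inf_{v ∈ S²} r⁻¹ ∫_{B_r(x)} |v·∇Q|² < η, then dist(Q(y),N) < δ for every y ∈ B_{r/2}(x), and the regular scale satisfies r(Q,x) ≥ r/2. -/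

import Mathlib

noncomputable section

open Matrix MeasureTheory Metric Set

attribute [local instance] Matrix.normedAddCommGroup Matrix.normedSpace

abbrev E3 : Type := EuclideanSpace ℝ (Fin 3)
abbrev M3 : Type := Matrix (Fin 3) (Fin 3) ℝ

/-- The space of symmetric traceless real 3×3 matrices. -/
def S0 : Set M3 := {Q | Q.IsSymm ∧ Q.trace = 0}

def sstar (a b c : ℝ) : ℝ := (b + Real.sqrt (b ^ 2 + 24 * a * c)) / (4 * c)

def kconst (a b c : ℝ) : ℝ :=
  sstar a b c ^ 2 / 27 * (9 * a + 2 * b * sstar a b c - 3 * c * sstar a b c ^ 2)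

/-- Bulk potential. -/
def fbulk (a b c : ℝ) (Q : M3) : ℝ :=
  kconst a b c - a / 2 * (Q * Q).trace - b / 3 * (Q * Q * Q).trace
    + c / 4 * ((Q * Q).trace) ^ 2

/-- Partial derivative `∂ₖ Q` (componentwise). -/
def pd (Q : E3 → M3) (k : Fin 3) (x : E3) : M3 :=
  Matrix.of fun i j => fderiv ℝ (fun y => Q y i j) x (EuclideanSpace.single k 1)

/-- Squared Frobenius norm of a matrix. -/
def frobSq (A : M3) : ℝ := ∑ i, ∑ j, (A i j) ^ 2

def frobNorm (A : M3) : ℝ := Real.sqrt (frobSq A)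

/-- `|∇Q|²`. -/
def gradSq (Q : E3 → M3) (x : E3) : ℝ := ∑ k : Fin 3, frobSq (pd Q k x)

/-- Energy density `e_ε(Q)`. -/
def eDen (a b c ε : ℝ) (Q : E3 → M3) (x : E3) : ℝ :=
  1 / 2 * gradSq Q x + 1 / ε ^ 2 * fbulk a b c (Q x)

/-- Energy `E_ε(Q, U)`. -/
def energy (a b c ε : ℝ) (Q : E3 → M3) (U : Set E3) : ℝ :=
  ∫ x in U, eDen a b c ε Q x

/-- Componentwise Laplacian. -/
def lapM (Q : E3 → M3) (x : E3) : M3 :=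
  ∑ k : Fin 3, Matrix.of fun i j =>
    fderiv ℝ (fun y => pd Q k y i j) x (EuclideanSpace.single k 1)

/-- `|Q|² = tr(Q²)`. -/
def normSqM (Q : M3) : ℝ := (Q * Q).trace

/-- The Euler–Lagrange equation at a point. -/
def ELeq (a b c ε : ℝ) (Q : E3 → M3) (x : E3) : Prop :=
  (-(ε ^ 2)) • lapM Q x - a • Q x - b • (Q x * Q x)
    + (b / 3 * normSqM (Q x)) • (1 : M3) + (c * normSqM (Q x)) • Q x = 0

/-- Local minimizer of the Landau–de Gennes energy on an open set `ω`. -/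
def IsLDGMin (a b c ε : ℝ) (ω : Set E3) (Q : E3 → M3) : Prop :=
  ∀ (x : E3) (r : ℝ), 0 < r → closedBall x r ⊆ ω →
    ∀ P : E3 → M3, ContDiffOn ℝ (⊤ : ℕ∞) P ω → (∀ y ∈ ω, P y ∈ S0) →
      (∃ K : Set E3, IsCompact K ∧ K ⊆ ball x r ∧ ∀ y ∉ K, P y = Q y) →
      energy a b c ε Q (ball x r) ≤ energy a b c ε P (ball x r)

/-- The vacuum manifold `N`. -/
def Nman (a b c : ℝ) : Set M3 :=
  {P | ∃ n : Fin 3 → ℝ, (∑ i, (n i) ^ 2) = 1 ∧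
    P = sstar a b c • (Matrix.vecMulVec n n - (1 / 3 : ℝ) • (1 : M3))}

/-- Frobenius distance to the vacuum manifold. -/
def distN (a b c : ℝ) (Q : M3) : ℝ :=
  sInf ((fun P => frobNorm (Q - P)) '' Nman a b c)

/-- Directional derivative `v·∇Q = Σₖ vₖ ∂ₖQ`. -/
def dirD (Q : E3 → M3) (v : E3) (x : E3) : M3 := ∑ k : Fin 3, v k • pd Q k x

/-- Admissible cutoff profile. -/
def AdmissibleCutoff (φ : ℝ → ℝ) : Prop :=
  ContDiff ℝ (⊤ : ℕ∞) φ ∧ (∀ t, 0 ≤ φ t) ∧ (∀ t, 10 ≤ t → φ t = 0) ∧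
    (∀ t ∈ Icc (0 : ℝ) 8, 1 ≤ φ t) ∧ φ 0 = 60 ∧
    (∀ t, 0 ≤ t → |deriv φ t| ≤ 100) ∧
    (∀ t ∈ Icc (0 : ℝ) 8, deriv φ t ∈ Icc (-2 : ℝ) (-1)) ∧
    (∀ t, 0 ≤ t → deriv φ t ≤ 0)

/-- The density `Θ_ρ^φ(Q, x)`. -/
def Theta (a b c ε : ℝ) (φ : ℝ → ℝ) (Q : E3 → M3) (x : E3) (ρ : ℝ) : ℝ :=
  ρ⁻¹ * ∫ y in ball x (Real.sqrt 10 * ρ), eDen a b c ε Q y * φ (‖y - x‖ ^ 2 / ρ ^ 2)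

/-- The regular scale `r(Q, x)`. -/
def regScale (a b c ε : ℝ) (Q : E3 → M3) (x : E3) : ℝ :=
  sSup {ρ : ℝ | 0 ≤ ρ ∧ ρ ≤ 1 ∧ ∀ y ∈ ball x ρ, ρ ^ 2 * eDen a b c ε Q y ≤ 1}

/-- The bad set `Bad(Q; s, δ)`. -/
def badSet (a b c ε : ℝ) (Q : E3 → M3) (s δ : ℝ) : Set E3 :=
  {y | regScale a b c ε Q y < s} ∪ {y | δ < distN a b c (Q y)}



set_option linter.unusedSimpArgs false
set_option linter.unusedVariables false

namespace LDG

open scoped ContDiff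

section Part1

/-- Frobenius inner product. -/
def dot (A B : M3) : ℝ := ∑ i, ∑ j, A i j * B i j

/-- Gradient of the bulk potential inside `S0`. -/
def fp (a b c : ℝ) (Q : M3) : M3 :=
  (-a) • Q - b • (Q * Q) + (b / 3 * frobSq Q) • (1 : M3) + (c * frobSq Q) • Q

/-- Second derivative (quadratic form) of the bulk potential inside `S0`. -/
def Hf (a b c : ℝ) (Q ξ : M3) : ℝ :=
  -a * frobSq ξ - 2 * b * dot Q (ξ * ξ) + c * frobSq Q * frobSq ξ + 2 * c * (dot Q ξ) ^ 2

lemma S0_form {Q : M3} (h : Q ∈ S0) : ∃ x1 x2 x3 x4 x5 : ℝ,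
    Q = !![x1, x2, x3; x2, x4, x5; x3, x5, -x1 - x4] := by
  obtain ⟨hs, ht⟩ := h
  refine ⟨Q 0 0, Q 0 1, Q 0 2, Q 1 1, Q 1 2, ?_⟩
  have h1 : Q 1 0 = Q 0 1 := hs.apply 0 1
  have h2 : Q 2 0 = Q 0 2 := hs.apply 0 2
  have h3 : Q 2 1 = Q 1 2 := hs.apply 1 2
  simp only [Matrix.trace, Matrix.diag, Fin.sum_univ_three] at ht
  ext i j
  fin_cases i <;> fin_cases j <;> simp <;> linarith

lemma S0_add {P Q : M3} (hP : P ∈ S0) (hQ : Q ∈ S0) : P + Q ∈ S0 :=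
  ⟨hP.1.add hQ.1, by rw [Matrix.trace_add, hP.2, hQ.2, add_zero]⟩

lemma S0_smul {Q : M3} (t : ℝ) (hQ : Q ∈ S0) : t • Q ∈ S0 :=
  ⟨hQ.1.smul t, by rw [Matrix.trace_smul, hQ.2, smul_zero]⟩

lemma S0_sub {P Q : M3} (hP : P ∈ S0) (hQ : Q ∈ S0) : P - Q ∈ S0 :=
  ⟨hP.1.sub hQ.1, by rw [Matrix.trace_sub, hP.2, hQ.2, sub_zero]⟩

lemma S0_zero : (0 : M3) ∈ S0 := ⟨by simp [Matrix.IsSymm], by simp⟩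

lemma frobSq_nonneg (A : M3) : 0 ≤ frobSq A :=
  Finset.sum_nonneg fun _ _ => Finset.sum_nonneg fun _ _ => sq_nonneg _

lemma frobSq_eq_dot (A : M3) : frobSq A = dot A A := by
  simp [frobSq, dot, sq]

lemma dot_sq_le (A B : M3) : (dot A B) ^ 2 ≤ frobSq A * frobSq B := by
  have := Finset.sum_mul_sq_le_sq_mul_sq (Finset.univ : Finset (Fin 3 × Fin 3))
    (fun p => A p.1 p.2) (fun p => B p.1 p.2)
  simpa [dot, frobSq, Fintype.sum_prod_type] using this

lemma abs_dot_le (A B : M3) : |dot A B| ≤ frobNorm A * frobNorm B := by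
  unfold frobNorm
  rw [← Real.sqrt_mul (frobSq_nonneg A)]
  exact Real.abs_le_sqrt (dot_sq_le A B)

lemma frobNorm_sq (A : M3) : frobNorm A ^ 2 = frobSq A := Real.sq_sqrt (frobSq_nonneg A)

lemma frobNorm_nonneg (A : M3) : 0 ≤ frobNorm A := Real.sqrt_nonneg _

lemma frobSq_mul_le (A B : M3) : frobSq (A * B) ≤ frobSq A * frobSq B := by
  have h : ∀ i j, ((A * B) i j) ^ 2 ≤ (∑ k, A i k ^ 2) * (∑ k, B k j ^ 2) := by
    intro i j
    rw [Matrix.mul_apply]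
    exact Finset.sum_mul_sq_le_sq_mul_sq _ _ _
  calc frobSq (A * B) ≤ ∑ i, ∑ j, (∑ k, A i k ^ 2) * (∑ k, B k j ^ 2) :=
        Finset.sum_le_sum fun i _ => Finset.sum_le_sum fun j _ => h i j
    _ = frobSq A * frobSq B := by
        simp only [frobSq, Fin.sum_univ_three]; ring

lemma frobNorm_mul_le (A B : M3) : frobNorm (A * B) ≤ frobNorm A * frobNorm B := by
  unfold frobNorm
  rw [← Real.sqrt_mul (frobSq_nonneg A)]
  exact Real.sqrt_le_sqrt (frobSq_mul_le A B)

lemma frobSq_add_le (A B : M3) : frobSq (A + B) ≤ 2 * frobSq A + 2 * frobSq B := by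
  simp only [frobSq, Fin.sum_univ_three, Matrix.add_apply]
  nlinarith [sq_nonneg (A 0 0 - B 0 0), sq_nonneg (A 0 1 - B 0 1), sq_nonneg (A 0 2 - B 0 2),
    sq_nonneg (A 1 0 - B 1 0), sq_nonneg (A 1 1 - B 1 1), sq_nonneg (A 1 2 - B 1 2),
    sq_nonneg (A 2 0 - B 2 0), sq_nonneg (A 2 1 - B 2 1), sq_nonneg (A 2 2 - B 2 2)]

lemma frobSq_smul (t : ℝ) (A : M3) : frobSq (t • A) = t ^ 2 * frobSq A := by
  simp only [frobSq, Fin.sum_univ_three, Matrix.smul_apply, smul_eq_mul]; ring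

lemma dot_add_right (A B C : M3) : dot A (B + C) = dot A B + dot A C := by
  simp only [dot, Fin.sum_univ_three, Matrix.add_apply]; ring
lemma dot_add_left (A B C : M3) : dot (A + B) C = dot A C + dot B C := by
  simp only [dot, Fin.sum_univ_three, Matrix.add_apply]; ring
lemma dot_sub_left (A B C : M3) : dot (A - B) C = dot A C - dot B C := by
  simp only [dot, Fin.sum_univ_three, Matrix.sub_apply]; ring
lemma dot_smul_right (t : ℝ) (A B : M3) : dot A (t • B) = t * dot A B := by
  simp only [dot, Fin.sum_univ_three, Matrix.smul_apply, smul_eq_mul]; ring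

lemma trace_sq_S0 {Q : M3} (h : Q ∈ S0) : (Q * Q).trace = frobSq Q := by
  obtain ⟨x1, x2, x3, x4, x5, rfl⟩ := S0_form h
  simp [Matrix.trace, frobSq, Fin.sum_univ_three, Matrix.mul_apply]; ring

/-- Exact Taylor expansion of the bulk potential on `S0`. -/
lemma fbulk_taylor (a b c : ℝ) {p w : M3} (hp : p ∈ S0) (hw : w ∈ S0) :
    fbulk a b c (p + w) = fbulk a b c p + dot (fp a b c p) w + 1 / 2 * Hf a b c p w
      - b / 3 * dot w (w * w) + c * dot p w * frobSq w + c / 4 * (frobSq w) ^ 2 := by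
  have hpw := S0_add hp hw
  rw [fbulk, fbulk, trace_sq_S0 hpw, trace_sq_S0 hp]
  obtain ⟨x1, x2, x3, x4, x5, rfl⟩ := S0_form hp
  obtain ⟨y1, y2, y3, y4, y5, rfl⟩ := S0_form hw
  simp [Matrix.trace, frobSq, dot, Hf, fp, Fin.sum_univ_three, Matrix.mul_apply]
  ring

lemma fp_S0 (a b c : ℝ) {p : M3} (hp : p ∈ S0) : fp a b c p ∈ S0 := by
  obtain ⟨x1, x2, x3, x4, x5, rfl⟩ := S0_form hp
  constructor
  · ext i j
    fin_cases i <;> fin_cases j <;>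
    simp [fp, frobSq, Fin.sum_univ_three, Matrix.mul_apply] <;> first | (left; ring) | ring
  · simp [fp, frobSq, Matrix.trace, Fin.sum_univ_three, Matrix.mul_apply]; ring

end Part1

section Part2

lemma sstar_pos {a b c : ℝ} (ha : 0 ≤ a) (hb : 0 < b) (hc : 0 < c) : 0 < sstar a b c := by
  unfold sstar
  have := Real.sqrt_nonneg (b ^ 2 + 24 * a * c)
  positivity

lemma sstar_eq {a b c : ℝ} (ha : 0 ≤ a) (hb : 0 < b) (hc : 0 < c) :
    2 * c * sstar a b c ^ 2 = b * sstar a b c + 3 * a := by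
  unfold sstar
  have h := Real.sq_sqrt (show 0 ≤ b ^ 2 + 24 * a * c by positivity)
  set r := Real.sqrt (b ^ 2 + 24 * a * c)
  field_simp
  nlinarith

lemma sstar_ge {a b c : ℝ} (ha : 0 ≤ a) (hb : 0 < b) (hc : 0 < c) :
    b ≤ 2 * c * sstar a b c := by
  have h1 := sstar_eq ha hb hc
  have h2 := sstar_pos ha hb hc
  nlinarith [mul_pos hb h2]

/-- Diagonal model. -/
def dg (x β : ℝ) : M3 := Matrix.diagonal ![2 * x / 3, -x / 3 + β, -x / 3 - β]

lemma S0_diag {Q : M3} (h : Q ∈ S0) : ∃ (U : M3) (x β : ℝ), Uᵀ * U = 1 ∧ U * Uᵀ = 1 ∧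
    |β| ≤ x ∧ Q = U * dg x β * Uᵀ := by
  have hH : Q.IsHermitian := by
    rw [Matrix.IsHermitian, Matrix.conjTranspose_eq_transpose_of_trivial]; exact h.1
  obtain ⟨V, d, hV1, hV2, hQ⟩ : ∃ (V : M3) (d : Fin 3 → ℝ), Vᵀ * V = 1 ∧ V * Vᵀ = 1 ∧
      Q = V * Matrix.diagonal d * Vᵀ := by
    refine ⟨hH.eigenvectorUnitary, hH.eigenvalues, ?_, ?_, ?_⟩
    · have := (Matrix.mem_unitaryGroup_iff').1 hH.eigenvectorUnitary.2
      simpa [Matrix.star_eq_conjTranspose, Matrix.conjTranspose_eq_transpose_of_trivial] using this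
    · have := (Matrix.mem_unitaryGroup_iff).1 hH.eigenvectorUnitary.2
      simpa [Matrix.star_eq_conjTranspose, Matrix.conjTranspose_eq_transpose_of_trivial] using this
    · have := hH.spectral_theorem
      conv_lhs => rw [this]
      simp [Unitary.conjStarAlgAut_apply, Matrix.star_eq_conjTranspose,
        Matrix.conjTranspose_eq_transpose_of_trivial]
  obtain ⟨i, -, hi⟩ := Finset.exists_max_image (Finset.univ : Finset (Fin 3)) d ⟨0, Finset.mem_univ _⟩
  let σ : Equiv.Perm (Fin 3) := Equiv.swap 0 i
  have h0 : σ 0 = i := Equiv.swap_apply_left _ _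
  have htr : d 0 + d 1 + d 2 = 0 := by
    have := h.2
    rw [hQ, Matrix.trace_mul_comm, ← Matrix.mul_assoc, hV1, Matrix.one_mul] at this
    simpa [Matrix.trace, Fin.sum_univ_three] using this
  have htr' : d (σ 0) + d (σ 1) + d (σ 2) = 0 := by
    have := Equiv.sum_comp σ d
    simp only [Fin.sum_univ_three] at this
    linarith
  have m1 : d (σ 1) ≤ d (σ 0) := by rw [h0]; exact hi _ (Finset.mem_univ _)
  have m2 : d (σ 2) ≤ d (σ 0) := by rw [h0]; exact hi _ (Finset.mem_univ _)
  refine ⟨V.submatrix id σ, 3 * d (σ 0) / 2, (d (σ 1) - d (σ 2)) / 2, ?_, ?_, ?_, ?_⟩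
  · have : (V.submatrix id σ)ᵀ * V.submatrix id σ = (Vᵀ * V).submatrix σ σ := by
      rw [Matrix.transpose_submatrix, ← Matrix.submatrix_mul _ _ σ id σ Function.bijective_id]
    rw [this, hV1]; simp
  · have : V.submatrix id σ * (V.submatrix id σ)ᵀ = (V * Vᵀ).submatrix id id := by
      rw [Matrix.transpose_submatrix, ← Matrix.submatrix_mul _ _ id σ id σ.bijective]
    rw [this, hV2]; simp
  · rw [abs_le]; constructor <;> linarith
  · have e : dg (3 * d (σ 0) / 2) ((d (σ 1) - d (σ 2)) / 2) = (Matrix.diagonal d).submatrix σ σ := by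
      ext j k
      rw [dg, Matrix.submatrix_apply, Matrix.diagonal_apply, Matrix.diagonal_apply]
      simp only [σ.injective.eq_iff]
      split_ifs with hjk
      · fin_cases j <;> simp <;> linarith
      · rfl
    rw [e, Matrix.transpose_submatrix, ← Matrix.submatrix_mul _ _ id σ σ σ.bijective,
      ← Matrix.submatrix_mul _ _ id σ id σ.bijective, hQ]
    rfl

lemma conj_mul {U : M3} (hU : Uᵀ * U = 1) (A B : M3) :
    (U * A * Uᵀ) * (U * B * Uᵀ) = U * (A * B) * Uᵀ := by
  calc (U * A * Uᵀ) * (U * B * Uᵀ) = U * A * (Uᵀ * U) * B * Uᵀ := by simp only [Matrix.mul_assoc]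
    _ = _ := by rw [hU, Matrix.mul_one, Matrix.mul_assoc U A B]

lemma conj_trace {U : M3} (hU : Uᵀ * U = 1) (A : M3) : (U * A * Uᵀ).trace = A.trace := by
  rw [Matrix.trace_mul_comm, ← Matrix.mul_assoc, hU, Matrix.one_mul]

lemma dot_eq_trace (A B : M3) : dot A B = (A * Bᵀ).trace := by
  simp [dot, Matrix.trace, Matrix.mul_apply]

lemma conj_dot {U : M3} (hU : Uᵀ * U = 1) (A B : M3) :
    dot (U * A * Uᵀ) (U * B * Uᵀ) = dot A B := by
  rw [dot_eq_trace, dot_eq_trace, Matrix.transpose_mul, Matrix.transpose_mul,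
    Matrix.transpose_transpose, ← Matrix.mul_assoc U, conj_mul hU, conj_trace hU]

lemma conj_frobSq {U : M3} (hU : Uᵀ * U = 1) (A : M3) : frobSq (U * A * Uᵀ) = frobSq A := by
  rw [frobSq_eq_dot, conj_dot hU, ← frobSq_eq_dot]

lemma conj_fbulk {U : M3} (hU : Uᵀ * U = 1) (a b c : ℝ) (A : M3) :
    fbulk a b c (U * A * Uᵀ) = fbulk a b c A := by
  unfold fbulk
  rw [conj_mul hU, conj_mul hU, conj_trace hU, conj_trace hU]

lemma conj_fp {U : M3} (hU : Uᵀ * U = 1) (hU' : U * Uᵀ = 1) (a b c : ℝ) (A : M3) :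
    fp a b c (U * A * Uᵀ) = U * fp a b c A * Uᵀ := by
  unfold fp
  rw [conj_mul hU, conj_frobSq hU]
  simp only [Matrix.mul_add, Matrix.add_mul, Matrix.mul_sub, Matrix.sub_mul, Matrix.mul_smul,
    Matrix.smul_mul, Matrix.mul_one, hU']

lemma frobSq_dg (x β : ℝ) : frobSq (dg x β) = 2 / 3 * x ^ 2 + 2 * β ^ 2 := by
  simp [frobSq, dg, Fin.sum_univ_three]; ring

lemma dg_sub (x β x' β' : ℝ) : dg x β - dg x' β' = dg (x - x') (β - β') := by
  ext i j
  fin_cases i <;> fin_cases j <;> simp [dg] <;> ring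

lemma dg_mem_N {a b c : ℝ} {U : M3} (hU : Uᵀ * U = 1) (hU' : U * Uᵀ = 1) :
    U * dg (sstar a b c) 0 * Uᵀ ∈ Nman a b c := by
  refine ⟨fun i => U i 0, ?_, ?_⟩
  · have := congrFun (congrFun hU 0) 0
    simpa [Matrix.mul_apply, sq] using this
  · have e : dg (sstar a b c) 0 = sstar a b c • (Matrix.single 0 0 (1:ℝ) - (1/3 : ℝ) • (1 : M3)) := by
      ext i j
      fin_cases i <;> fin_cases j <;> simp [dg, Matrix.single] <;> ring
    rw [e]
    simp only [Matrix.mul_smul, Matrix.smul_mul, Matrix.mul_sub, Matrix.sub_mul, Matrix.mul_one, hU']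
    congr 2
    ext i j
    simp [Matrix.mul_apply, Matrix.vecMulVec_apply, Matrix.single, Fin.sum_univ_three]

lemma fbulk_dg (a b c x β : ℝ) : fbulk a b c (dg x β) = kconst a b c - a * (x ^ 2 / 3 + β ^ 2)
    - b * (2 * x ^ 3 / 27 - 2 * x * β ^ 2 / 3) + c * (x ^ 2 / 3 + β ^ 2) ^ 2 := by
  simp [fbulk, dg, Matrix.trace, Fin.sum_univ_three]; ring

lemma fp_dg_dot {a b c : ℝ} (ha : 0 ≤ a) (hb : 0 < b) (hc : 0 < c) (x β : ℝ) :
    dot (fp a b c (dg x β)) (dg (x - sstar a b c) β) =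
    2 * x / 3 * (x - sstar a b c) ^ 2 * (2 * c / 3 * (x + sstar a b c) - b / 3)
      + β ^ 2 * ((2 * b / 3 + 4 * c * x / 3) * (x - sstar a b c)
        + 2 * (-a + 2 * b * x / 3 + 2 * c * x ^ 2 / 3)) + 4 * c * β ^ 4 := by
  have h := sstar_eq ha hb hc
  set s := sstar a b c
  have h' : a = (2 * c * s ^ 2 - b * s) / 3 := by linarith
  rw [h']
  simp [fp, dg, dot, frobSq, Fin.sum_univ_three]
  ring

end Part2

section Part3

lemma fbulk_dg_X {a b c : ℝ} (ha : 0 ≤ a) (hb : 0 < b) (hc : 0 < c) (x β X : ℝ)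
    (hX : X ^ 2 = x ^ 2 + 3 * β ^ 2) : fbulk a b c (dg x β) =
    (X - sstar a b c) ^ 2 * (c / 9 * X ^ 2 + (2 * sstar a b c * c / 9 - 2 * b / 27) * X
      + (3 * c * sstar a b c ^ 2 - b * sstar a b c) / 27)
      + 2 * b / 27 * (X ^ 3 - x ^ 3 + 9 * x * β ^ 2) := by
  have h := sstar_eq ha hb hc
  rw [fbulk_dg, kconst]
  set s := sstar a b c
  have h' : a = (2 * c * s ^ 2 - b * s) / 3 := by linarith
  have hB : β ^ 2 = (X ^ 2 - x ^ 2) / 3 := by linarith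
  rw [h', hB]
  ring

/-- the quadratic growth constant -/
def qc (a b c : ℝ) : ℝ := (3 * c * sstar a b c ^ 2 - b * sstar a b c) / 27

lemma qc_pos {a b c : ℝ} (ha : 0 ≤ a) (hb : 0 < b) (hc : 0 < c) : 0 < qc a b c := by
  have h1 := sstar_ge ha hb hc
  have h2 := sstar_pos ha hb hc
  unfold qc
  have : 0 < c * sstar a b c ^ 2 := by positivity
  nlinarith [mul_le_mul_of_nonneg_right h1 h2.le]

lemma fbulk_dg_ge {a b c : ℝ} (ha : 0 ≤ a) (hb : 0 < b) (hc : 0 < c) {x β X : ℝ}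
    (hx : |β| ≤ x) (hX0 : 0 ≤ X) (hX : X ^ 2 = x ^ 2 + 3 * β ^ 2) :
    qc a b c * (X - sstar a b c) ^ 2 + 2 * b / 3 * x * β ^ 2 ≤ fbulk a b c (dg x β) := by
  have hx0 : 0 ≤ x := (abs_nonneg β).trans hx
  have hxX : x ≤ X := by
    apply (pow_le_pow_iff_left₀ hx0 hX0 two_ne_zero).1
    nlinarith [sq_nonneg β]
  have h1 := sstar_ge ha hb hc
  have h2 := sstar_pos ha hb hc
  rw [fbulk_dg_X ha hb hc x β X hX]
  have e1 : 0 ≤ (2 * sstar a b c * c / 9 - 2 * b / 27) * X := by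
    apply mul_nonneg _ hX0; nlinarith [mul_pos hc h2]
  have e2 : 0 ≤ c / 9 * X ^ 2 := by positivity
  have e3 : x ^ 3 ≤ X ^ 3 := pow_le_pow_left₀ hx0 hxX 3
  have e4 : 2 * b / 3 * x * β ^ 2 ≤ 2 * b / 27 * (X ^ 3 - x ^ 3 + 9 * x * β ^ 2) := by
    have : 0 ≤ b * (X ^ 3 - x ^ 3) := mul_nonneg hb.le (by linarith)
    nlinarith
  have e5 : qc a b c * (X - sstar a b c) ^ 2 ≤ (X - sstar a b c) ^ 2 * (c / 9 * X ^ 2 +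
      (2 * sstar a b c * c / 9 - 2 * b / 27) * X
      + (3 * c * sstar a b c ^ 2 - b * sstar a b c) / 27) := by
    rw [mul_comm]
    apply mul_le_mul_of_nonneg_left _ (sq_nonneg _)
    unfold qc; linarith
  linarith

lemma fbulk_nonneg {a b c : ℝ} (ha : 0 ≤ a) (hb : 0 < b) (hc : 0 < c) {Q : M3} (hQ : Q ∈ S0) :
    0 ≤ fbulk a b c Q := by
  obtain ⟨U, x, β, hU, hU', hx, rfl⟩ := S0_diag hQ
  rw [conj_fbulk hU]
  have hx0 : 0 ≤ x := (abs_nonneg β).trans hx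
  refine le_trans ?_ (fbulk_dg_ge ha hb hc hx (Real.sqrt_nonneg _) (Real.sq_sqrt (by positivity)))
  have := qc_pos ha hb hc
  positivity

def C2 (a b c : ℝ) : ℝ := 12 / qc a b c + 36 / (b * sstar a b c)

lemma C2_pos {a b c : ℝ} (ha : 0 ≤ a) (hb : 0 < b) (hc : 0 < c) : 0 < C2 a b c := by
  have := qc_pos ha hb hc
  have := sstar_pos ha hb hc
  unfold C2; positivity

lemma dg_dist {a b c : ℝ} (ha : 0 ≤ a) (hb : 0 < b) (hc : 0 < c) {x β : ℝ}
    (hx : |β| ≤ x) : 2 / 3 * (x - sstar a b c) ^ 2 + 2 * β ^ 2 ≤ C2 a b c * fbulk a b c (dg x β) := by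
  have hx0 : 0 ≤ x := (abs_nonneg β).trans hx
  have hs := sstar_pos ha hb hc
  have hq := qc_pos ha hb hc
  obtain ⟨X, hX0, hX⟩ : ∃ X : ℝ, 0 ≤ X ∧ X ^ 2 = x ^ 2 + 3 * β ^ 2 :=
    ⟨_, Real.sqrt_nonneg _, Real.sq_sqrt (by positivity)⟩
  have hf := fbulk_dg_ge ha hb hc hx hX0 hX
  set f := fbulk a b c (dg x β)
  set s := sstar a b c
  set q := qc a b c
  have hβ : β ^ 2 ≤ x ^ 2 := by rw [← sq_abs β]; exact pow_le_pow_left₀ (abs_nonneg _) hx 2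
  have hxX : x ≤ X := by
    apply (pow_le_pow_iff_left₀ hx0 hX0 two_ne_zero).1
    nlinarith [sq_nonneg β]
  have hXx : (X - x) ^ 2 ≤ 3 * β ^ 2 := by nlinarith
  have h1 : 2 / 3 * (x - s) ^ 2 + 2 * β ^ 2 ≤ 4 / 3 * (X - s) ^ 2 + 6 * β ^ 2 := by
    nlinarith [sq_nonneg (x - s - (X - s) - (x - X)), sq_nonneg ((X - s) + (X - x))]
  have hf0 : 0 ≤ f := le_trans (by positivity) hf
  have e1 : q * (X - s) ^ 2 ≤ f := le_trans (by have : 0 ≤ 2 * b / 3 * x * β ^ 2 := by positivity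
                                                linarith) hf
  have e2 : 2 * b / 3 * x * β ^ 2 ≤ f := le_trans (by
    have : 0 ≤ q * (X - s) ^ 2 := by positivity
    linarith) hf
  have g1 : (X - s) ^ 2 ≤ f / q := by rw [le_div_iff₀ hq]; linarith
  have hC : C2 a b c * f = 12 * (f / q) + 36 * (f / (b * s)) := by
    simp only [C2]; ring
  have p1 : 0 ≤ f / q := by positivity
  have p2 : 0 ≤ f / (b * s) := by positivity
  rw [hC]
  rcases le_or_gt (s / 2) X with h | h
  · have hx4 : s / 4 ≤ x := by
      apply (pow_le_pow_iff_left₀ (by positivity) hx0 two_ne_zero).1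
      nlinarith
    have g2 : β ^ 2 ≤ 6 * (f / (b * s)) := by
      rw [← mul_div_assoc, le_div_iff₀ (by positivity)]
      have := mul_le_mul_of_nonneg_right hx4 (mul_nonneg hb.le (sq_nonneg β))
      nlinarith
    linarith
  · have g3 : s ^ 2 / 4 ≤ (X - s) ^ 2 := by nlinarith
    have g4 : (X - s) ^ 2 ≤ s ^ 2 := by nlinarith
    have g5 : X ^ 2 ≤ s ^ 2 / 4 := by nlinarith
    nlinarith

end Part3

section Part4

lemma frobSq_sub_comm (A B : M3) : frobSq (A - B) = frobSq (B - A) := by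
  simp only [frobSq, Matrix.sub_apply]
  exact Finset.sum_congr rfl fun i _ => Finset.sum_congr rfl fun j _ => by ring

lemma frobNorm_add_le (A B : M3) : frobNorm (A + B) ≤ frobNorm A + frobNorm B := by
  apply abs_le_of_sq_le_sq' _ (add_nonneg (frobNorm_nonneg A) (frobNorm_nonneg B)) |>.2
  have h1 : frobSq (A + B) = frobSq A + 2 * dot A B + frobSq B := by
    simp only [frobSq, dot, Fin.sum_univ_three, Matrix.add_apply]; ring
  have := le_of_abs_le (abs_dot_le A B)
  rw [frobNorm_sq, h1, add_sq, frobNorm_sq, frobNorm_sq]; linarith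

lemma frobNorm_smul (t : ℝ) (A : M3) : frobNorm (t • A) = |t| * frobNorm A := by
  rw [frobNorm, frobSq_smul, Real.sqrt_mul (sq_nonneg t), Real.sqrt_sq_eq_abs]; rfl

lemma frobNorm_le_of_sq {A : M3} {R : ℝ} (hR : 0 ≤ R) (h : frobSq A ≤ R ^ 2) : frobNorm A ≤ R :=
  Real.sqrt_le_iff.2 ⟨hR, h⟩

lemma dot_comm (A B : M3) : dot A B = dot B A := by
  simp only [dot, mul_comm]

lemma frobNorm_one : frobNorm (1 : M3) ≤ 2 := by
  apply frobNorm_le_of_sq (by norm_num)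
  simp [frobSq, Fin.sum_univ_three, Matrix.one_apply]; norm_num

/-- elements of `N` in diagonal form -/
lemma Nman_S0 {a b c : ℝ} {p : M3} (hp : p ∈ Nman a b c) : p ∈ S0 := by
  obtain ⟨n, hn, rfl⟩ := hp
  apply S0_smul
  constructor
  · ext i j
    fin_cases i <;> fin_cases j <;> simp [Matrix.vecMulVec_apply] <;> ring
  · rw [Fin.sum_univ_three] at hn
    simp [Matrix.trace, Fin.sum_univ_three, Matrix.vecMulVec_apply]; linarith

lemma Nman_frobSq {a b c : ℝ} {p : M3} (hp : p ∈ Nman a b c) :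
    frobSq p = 2 / 3 * sstar a b c ^ 2 := by
  obtain ⟨n, hn, rfl⟩ := hp
  rw [frobSq_smul]
  rw [Fin.sum_univ_three] at hn
  have : frobSq (Matrix.vecMulVec n n - (1 / 3 : ℝ) • (1 : M3)) = 2 / 3 := by
    simp [frobSq, Fin.sum_univ_three, Matrix.vecMulVec_apply, Matrix.one_apply]
    have h2 : n 2 ^ 2 = 1 - n 0 ^ 2 - n 1 ^ 2 := by linarith
    linear_combination (n 0 ^ 2 + n 1 ^ 2 + n 2 ^ 2 + 1 - 2/3) * hn
  rw [this]; ring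

lemma Nman_fp {a b c : ℝ} (ha : 0 ≤ a) (hb : 0 < b) (hc : 0 < c) {p : M3} (hp : p ∈ Nman a b c) :
    fp a b c p = 0 := by
  have hfr := Nman_frobSq hp
  have h := sstar_eq ha hb hc
  obtain ⟨n, hn, hp⟩ := hp
  rw [Fin.sum_univ_three] at hn
  have hpp : p * p = (sstar a b c / 3) • p + (2 / 9 * sstar a b c ^ 2) • (1 : M3) := by
    rw [hp]
    have hv : Matrix.vecMulVec n n * Matrix.vecMulVec n n = Matrix.vecMulVec n n := by
      ext i j
      simp only [Matrix.mul_apply, Matrix.vecMulVec_apply, Fin.sum_univ_three]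
      linear_combination (n i * n j) * hn
    simp only [Matrix.smul_mul, Matrix.mul_smul, Matrix.sub_mul, Matrix.mul_sub, hv, Matrix.one_mul,
      Matrix.mul_one]
    module
  unfold fp
  rw [hpp, hfr]
  clear hpp hfr hp
  generalize sstar a b c = s at *
  have h' : a = (2 * c * s ^ 2 - b * s) / 3 := by linarith
  rw [h']
  module

lemma Nman_fbulk {a b c : ℝ} (ha : 0 ≤ a) (hb : 0 < b) (hc : 0 < c) {p : M3}
    (hp : p ∈ Nman a b c) : fbulk a b c p = 0 := by
  have hfr := Nman_frobSq hp
  have hS := Nman_S0 hp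
  have h := sstar_eq ha hb hc
  have h0 := Nman_fp ha hb hc hp
  -- tr (p^3) from fp p · p = 0
  have h1 : dot (fp a b c p) p = 0 := by rw [h0]; simp [dot]
  have h2 : dot (fp a b c p) p = -a * frobSq p - b * (p * p * p).trace + c * frobSq p ^ 2 := by
    obtain ⟨x1, x2, x3, x4, x5, rfl⟩ := S0_form hS
    simp [Matrix.trace, frobSq, dot, fp, Fin.sum_univ_three, Matrix.mul_apply]; ring
  rw [fbulk, trace_sq_S0 hS, kconst]
  rw [h1] at h2
  rw [hfr] at h2 ⊢
  clear h1 h0 hfr hp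
  generalize sstar a b c = s at *
  have h' : a = (2 * c * s ^ 2 - b * s) / 3 := by linarith
  rw [h'] at h2 ⊢
  linear_combination (-1/3) * h2

lemma exists_near_N {a b c : ℝ} (ha : 0 ≤ a) (hb : 0 < b) (hc : 0 < c) {Q : M3} (hQ : Q ∈ S0) :
    ∃ p ∈ Nman a b c, frobSq (Q - p) ≤ C2 a b c * fbulk a b c Q := by
  obtain ⟨U, x, β, hU, hU', hx, rfl⟩ := S0_diag hQ
  refine ⟨_, dg_mem_N hU hU', ?_⟩
  rw [← Matrix.sub_mul, ← Matrix.mul_sub, conj_frobSq hU, conj_fbulk hU, dg_sub, frobSq_dg]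
  simpa using dg_dist ha hb hc hx

lemma Hf_nonneg_N {a b c : ℝ} (ha : 0 ≤ a) (hb : 0 < b) (hc : 0 < c) {p ξ : M3}
    (hp : p ∈ Nman a b c) (hξ : ξ ∈ S0) : 0 ≤ Hf a b c p ξ := by
  by_contra hneg
  push Not at hneg
  have key : ∀ t : ℝ, 0 ≤ 1 / 2 * (t ^ 2 * Hf a b c p ξ) + t ^ 3 * (- b / 3 * dot ξ (ξ * ξ)
      + c * dot p ξ * frobSq ξ) + t ^ 4 * (c / 4 * (frobSq ξ) ^ 2) := by
    intro t
    have h := fbulk_taylor a b c (Nman_S0 hp) (S0_smul t hξ)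
    rw [Nman_fbulk ha hb hc hp, Nman_fp ha hb hc hp] at h
    have h0 := fbulk_nonneg ha hb hc (S0_add (Nman_S0 hp) (S0_smul t hξ))
    rw [h] at h0
    have e1 : Hf a b c p (t • ξ) = t ^ 2 * Hf a b c p ξ := by
      simp only [Hf, frobSq_smul, dot_smul_right, Matrix.smul_mul, Matrix.mul_smul]; ring
    have e2 : dot (t • ξ) (t • ξ * t • ξ) = t ^ 3 * dot ξ (ξ * ξ) := by
      rw [dot_comm]; simp only [dot_smul_right, Matrix.smul_mul, Matrix.mul_smul]
      rw [dot_comm]; simp only [dot_smul_right]; ring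
    have e3 : dot 0 (t • ξ) = 0 := by simp [dot]
    rw [e1, e2, e3, dot_smul_right, frobSq_smul] at h0
    linarith
  set B := c / 4 * (frobSq ξ) ^ 2
  have hB : 0 ≤ B := by positivity
  have k2 : ∀ t : ℝ, 0 < t → 0 ≤ Hf a b c p ξ + t ^ 2 * (2 * B) := by
    intro t ht
    have h1 := key t
    have h2 := key (-t)
    have : 0 ≤ t ^ 2 * (Hf a b c p ξ + t ^ 2 * (2 * B)) := by nlinarith
    exact nonneg_of_mul_nonneg_right this (by positivity)
  set H := Hf a b c p ξ
  have hpos : 0 < -H / (2 * (2 * B + 1)) := div_pos (by linarith) (by linarith)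
  have := k2 (Real.sqrt (-H / (2 * (2 * B + 1)))) (Real.sqrt_pos.2 hpos)
  rw [Real.sq_sqrt hpos.le] at this
  have h3 : -H / (2 * (2 * B + 1)) * (2 * B) ≤ -H / 2 := by
    rw [div_mul_eq_mul_div, div_le_div_iff₀ (by linarith) (by norm_num)]
    nlinarith
  linarith

lemma Hf_lip {a b c : ℝ} (hb : 0 < b) (hc : 0 < c) {p Q ξ : M3} {R : ℝ}
    (hR : 0 ≤ R) (hp : frobNorm p ≤ R) (hQ : frobNorm Q ≤ R) :
    Hf a b c p ξ - (2 * b + 6 * c * R) * frobNorm (Q - p) * frobSq ξ ≤ Hf a b c Q ξ := by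
  have e : Hf a b c Q ξ - Hf a b c p ξ = -2 * b * dot (Q - p) (ξ * ξ)
      + c * dot (Q - p) (Q + p) * frobSq ξ + 2 * c * (dot (Q - p) ξ * dot (Q + p) ξ) := by
    have h2 : frobSq Q - frobSq p = dot (Q - p) (Q + p) := by
      simp only [frobSq, dot, Fin.sum_univ_three, Matrix.add_apply, Matrix.sub_apply]; ring
    simp only [Hf]
    rw [← h2, dot_sub_left, dot_sub_left, dot_add_left]; ring
  set d := frobNorm (Q - p)
  have hd : 0 ≤ d := frobNorm_nonneg _
  have hx := frobNorm_nonneg ξ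
  have hqp : frobNorm (Q + p) ≤ 2 * R := (frobNorm_add_le _ _).trans (by linarith)
  have n1 : |dot (Q - p) (ξ * ξ)| ≤ d * frobSq ξ := by
    refine (abs_dot_le _ _).trans (mul_le_mul_of_nonneg_left ?_ hd)
    rw [← frobNorm_sq, sq]; exact frobNorm_mul_le _ _
  have n2 : |dot (Q - p) (Q + p)| ≤ d * (2 * R) :=
    (abs_dot_le _ _).trans (mul_le_mul_of_nonneg_left hqp hd)
  have n3 : |dot (Q - p) ξ * dot (Q + p) ξ| ≤ d * (2 * R) * frobSq ξ := by
    rw [abs_mul, ← frobNorm_sq]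
    calc _ ≤ (d * frobNorm ξ) * ((2 * R) * frobNorm ξ) := by
          apply mul_le_mul (abs_dot_le _ _) _ (abs_nonneg _) (by positivity)
          exact (abs_dot_le _ _).trans (mul_le_mul_of_nonneg_right hqp hx)
      _ = _ := by ring
  have hs := frobSq_nonneg ξ
  have m1 := (abs_le.1 n1).2
  have m2 := mul_le_mul_of_nonneg_right (abs_le.1 n2).1 hs
  have m3 := (abs_le.1 n3).1
  have k1 := mul_le_mul_of_nonneg_left m1 hb.le
  have k2 := mul_le_mul_of_nonneg_left m2 hc.le
  have k3 := mul_le_mul_of_nonneg_left m3 hc.le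
  nlinarith

lemma Hf_ge {a b c : ℝ} (ha : 0 ≤ a) (hb : 0 < b) (hc : 0 < c) {Q ξ : M3} {R : ℝ}
    (hQ : frobNorm Q ≤ R) : - (a + 2 * b * R) * frobSq ξ ≤ Hf a b c Q ξ := by
  have hs := frobSq_nonneg ξ
  have n1 : |dot Q (ξ * ξ)| ≤ R * frobSq ξ := by
    refine (abs_dot_le _ _).trans (mul_le_mul hQ ?_ (frobNorm_nonneg _) ((frobNorm_nonneg _).trans hQ))
    rw [← frobNorm_sq, sq]; exact frobNorm_mul_le _ _
  have m1 := mul_le_mul_of_nonneg_left (abs_le.1 n1).2 hb.le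
  have h2 : 0 ≤ c * frobSq Q * frobSq ξ + 2 * c * (dot Q ξ) ^ 2 := by
    have := frobSq_nonneg Q
    positivity
  unfold Hf; nlinarith

lemma fp_bound {a b c : ℝ} (ha : 0 ≤ a) (hb : 0 < b) (hc : 0 < c) {Q : M3} {R : ℝ}
    (hQ : frobNorm Q ≤ R) : frobNorm (fp a b c Q) ≤ a * R + 2 * b * R ^ 2 + c * R ^ 3 := by
  have h0 := frobNorm_nonneg Q
  have hR : 0 ≤ R := h0.trans hQ
  have hsq : frobSq Q ≤ R ^ 2 := by rw [← frobNorm_sq]; exact pow_le_pow_left₀ h0 hQ 2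
  have hsq0 := frobSq_nonneg Q
  unfold fp
  have e : (-a) • Q - b • (Q * Q) + (b / 3 * frobSq Q) • (1 : M3) + (c * frobSq Q) • Q
    = (-a) • Q + (-b) • (Q * Q) + (b / 3 * frobSq Q) • (1 : M3) + (c * frobSq Q) • Q := by
    rw [neg_smul b, sub_eq_add_neg]
  rw [e]
  refine (frobNorm_add_le _ _).trans ?_
  refine (add_le_add_left ((frobNorm_add_le _ _).trans (add_le_add_left (frobNorm_add_le _ _) _)) _).trans ?_
  simp only [frobNorm_smul, abs_neg, abs_of_nonneg ha, abs_of_pos hb]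
  rw [abs_of_nonneg (by positivity : 0 ≤ b / 3 * frobSq Q),
    abs_of_nonneg (by positivity : 0 ≤ c * frobSq Q)]
  have h1 : a * frobNorm Q ≤ a * R := mul_le_mul_of_nonneg_left hQ ha
  have h2 : b * frobNorm (Q * Q) ≤ b * R ^ 2 := by
    apply mul_le_mul_of_nonneg_left _ hb.le
    refine (frobNorm_mul_le _ _).trans ?_
    rw [sq]; exact mul_le_mul hQ hQ h0 hR
  have h3 : b / 3 * frobSq Q * frobNorm (1 : M3) ≤ b / 3 * R ^ 2 * 2 :=
    mul_le_mul (mul_le_mul_of_nonneg_left hsq (by positivity)) frobNorm_one (frobNorm_nonneg _)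
      (by positivity)
  have h4 : c * frobSq Q * frobNorm Q ≤ c * R ^ 2 * R :=
    mul_le_mul (mul_le_mul_of_nonneg_left hsq hc.le) hQ h0 (by positivity)
  nlinarith [mul_nonneg hb.le (sq_nonneg R)]

/-- quadratic upper bound of f near N (and crude everywhere bounded) -/
lemma fbulk_le_quad {a b c : ℝ} (ha : 0 ≤ a) (hb : 0 < b) (hc : 0 < c) (R : ℝ) (hR : 0 ≤ R) :
    ∃ C : ℝ, 0 < C ∧ ∀ p ∈ Nman a b c, ∀ w ∈ S0, frobNorm w ≤ R →
      fbulk a b c (p + w) ≤ C * frobSq w := by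
  have hs := sstar_pos ha hb hc
  set s := sstar a b c with hsdef
  refine ⟨c * s ^ 2 + b * s + c * s ^ 2 + b * R + c * s * R + c * R ^ 2 + 1, by positivity, ?_⟩
  intro p hp w hw hwR
  rw [fbulk_taylor a b c (Nman_S0 hp) hw, Nman_fbulk ha hb hc hp, Nman_fp ha hb hc hp]
  have hps : frobNorm p ≤ s := frobNorm_le_of_sq hs.le (by rw [Nman_frobSq hp]; nlinarith)
  have hfp : frobSq p ≤ s ^ 2 := by rw [Nman_frobSq hp]; nlinarith
  have h0 : dot 0 w = 0 := by simp [dot]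
  have w0 := frobNorm_nonneg w
  have W0 := frobSq_nonneg w
  have hww : frobNorm (w * w) ≤ frobSq w := by
    rw [← frobNorm_sq, sq]; exact frobNorm_mul_le _ _
  have n1 : |dot p (w * w)| ≤ s * frobSq w :=
    (abs_dot_le _ _).trans (mul_le_mul hps hww (frobNorm_nonneg _) hs.le)
  have n2 : |dot w (w * w)| ≤ R * frobSq w :=
    (abs_dot_le _ _).trans (mul_le_mul hwR hww (frobNorm_nonneg _) hR)
  have n3 : dot p w ^ 2 ≤ s ^ 2 * frobSq w :=
    (dot_sq_le _ _).trans (mul_le_mul_of_nonneg_right hfp W0)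
  have n4 : |dot p w| ≤ s * R :=
    (abs_dot_le _ _).trans (mul_le_mul hps hwR w0 hs.le)
  have n5 : frobSq w ≤ R ^ 2 := by rw [← frobNorm_sq]; exact pow_le_pow_left₀ w0 hwR 2
  have m1 := mul_le_mul_of_nonneg_left (abs_le.1 n1).1 hb.le
  have m2 := mul_le_mul_of_nonneg_left (abs_le.1 n2).1 hb.le
  have m3 := mul_le_mul_of_nonneg_left n3 hc.le
  have m4 := mul_le_mul_of_nonneg_left (mul_le_mul_of_nonneg_right (abs_le.1 n4).2 W0) hc.le
  have m5 := mul_le_mul_of_nonneg_left (mul_le_mul_of_nonneg_right n5 W0) hc.le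
  have m6 := mul_le_mul_of_nonneg_left (mul_le_mul_of_nonneg_right hfp W0) hc.le
  have q1 : 0 ≤ b * (R * frobSq w) := by positivity
  have q2 : 0 ≤ a * frobSq w := by positivity
  have q3 : 0 ≤ c * (R ^ 2 * frobSq w) := by positivity
  rw [h0]; unfold Hf
  nlinarith

set_option maxHeartbeats 1000000 in
/-- key nondegeneracy: near `N`, gradient controls the distance and the Hessian is almost nonnegative -/
lemma fbulk_nondeg {a b c : ℝ} (ha : 0 ≤ a) (hb : 0 < b) (hc : 0 < c) (R : ℝ) (hR : 0 ≤ R) :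
    ∃ C δ₁ : ℝ, 0 < C ∧ 0 < δ₁ ∧ ∀ Q ∈ S0, frobNorm Q ≤ R → fbulk a b c Q ≤ δ₁ →
      ∃ d : ℝ, 0 ≤ d ∧ d ^ 2 ≤ C * frobSq (fp a b c Q) ∧
        ∀ ξ ∈ S0, - (C * d) * frobSq ξ ≤ Hf a b c Q ξ := by
  have hs := sstar_pos ha hb hc
  have hC2 := C2_pos ha hb hc
  have hge := sstar_ge ha hb hc
  set s := sstar a b c with hsdef
  set ρ := b / (2 * b + 7 * c * s) with hρ
  have hρ0 : 0 < ρ := by positivity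
  have hρ1 : ρ * (2 * b + 7 * c * s) = b := by rw [hρ]; field_simp
  set m := min (c * s ^ 2 / 6) (b * s / 2) with hm
  have hm0 : 0 < m := lt_min (by positivity) (by positivity)
  refine ⟨1 / m ^ 2 + (2 * b + 6 * c * (R + s)), 2 * ρ ^ 2 * s ^ 2 / (3 * C2 a b c), by positivity,
    by positivity, ?_⟩
  intro Q hQ hQR hf
  obtain ⟨U, x, β, hU, hU', hx, rfl⟩ := S0_diag hQ
  rw [conj_fbulk hU] at hf
  have hdist := dg_dist ha hb hc hx
  rw [← hsdef] at hdist
  have hα : (x - s) ^ 2 ≤ (ρ * s) ^ 2 := by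
    have h1 : C2 a b c * fbulk a b c (dg x β) ≤ 2 * ρ ^ 2 * s ^ 2 / 3 := by
      calc _ ≤ C2 a b c * (2 * ρ ^ 2 * s ^ 2 / (3 * C2 a b c)) :=
            mul_le_mul_of_nonneg_left hf hC2.le
        _ = _ := by field_simp
    nlinarith [sq_nonneg β]
  have hα' := abs_le.1 (abs_le_of_sq_le_sq hα (by positivity))
  set p := U * dg s 0 * Uᵀ with hp
  have hpN : p ∈ Nman a b c := dg_mem_N hU hU'
  have hQp : U * dg x β * Uᵀ - p = U * dg (x - s) β * Uᵀ := by
    rw [hp, ← Matrix.sub_mul, ← Matrix.mul_sub, dg_sub, sub_zero]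
  set W := frobSq (U * dg x β * Uᵀ - p) with hW
  have hWe : W = 2 / 3 * (x - s) ^ 2 + 2 * β ^ 2 := by rw [hW, hQp, conj_frobSq hU, frobSq_dg]
  have hdot : m * W ≤ dot (fp a b c (U * dg x β * Uᵀ)) (U * dg x β * Uᵀ - p) := by
    rw [hQp, conj_fp hU hU', conj_dot hU, fp_dg_dot ha hb hc, hWe, ← hsdef]
    have hρh : ρ ≤ 1 / 2 := by
      rw [hρ, div_le_div_iff₀ (by positivity) (by norm_num)]
      have : 0 < c * s := by positivity
      linarith
    have hxs : s / 2 ≤ x := by nlinarith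
    have hxs2 : x ≤ 3 * s / 2 := by nlinarith
    have t1 : c * s ^ 2 / 6 * (2 / 3 * (x - s) ^ 2) ≤
        2 * x / 3 * (x - s) ^ 2 * (2 * c / 3 * (x + s) - b / 3) := by
      have i1 : c * s / 3 ≤ 2 * c / 3 * (x + s) - b / 3 := by nlinarith
      have i2 : s / 3 * (c * s / 3) ≤ 2 * x / 3 * (2 * c / 3 * (x + s) - b / 3) :=
        mul_le_mul (by linarith) i1 (by positivity) (by linarith)
      nlinarith [mul_le_mul_of_nonneg_right i2 (sq_nonneg (x - s))]
    have t2 : b * s / 2 * (2 * β ^ 2) ≤ β ^ 2 * ((2 * b / 3 + 4 * c * x / 3) * (x - s)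
        + 2 * (-a + 2 * b * x / 3 + 2 * c * x ^ 2 / 3)) := by
      have heq := sstar_eq ha hb hc
      rw [← hsdef] at heq
      have e : (2 * b / 3 + 4 * c * x / 3) * (x - s)
        + 2 * (-a + 2 * b * x / 3 + 2 * c * x ^ 2 / 3)
        = 2 * b * s + (x - s) * (2 * b + 8 * c * x / 3 + 4 * c * s / 3) := by
        have h' : a = (2 * c * s ^ 2 - b * s) / 3 := by linarith
        rw [h']; ring
      rw [e]
      have i1 : 2 * b + 8 * c * x / 3 + 4 * c * s / 3 ≤ 2 * b + 7 * c * s := by nlinarith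
      have i0 : 0 ≤ 2 * b + 8 * c * x / 3 + 4 * c * s / 3 := by
        have : 0 ≤ c * x := mul_nonneg hc.le (by linarith)
        have : 0 ≤ c * s := by positivity
        linarith
      have i2 : -(b * s) ≤ (x - s) * (2 * b + 8 * c * x / 3 + 4 * c * s / 3) := by
        have j1 : (ρ * s) * (2 * b + 8 * c * x / 3 + 4 * c * s / 3) ≤ (ρ * s) * (2 * b + 7 * c * s) :=
          mul_le_mul_of_nonneg_left i1 (by positivity)
        have j2 := mul_le_mul_of_nonneg_right hα'.1 i0
        have j3 : (ρ * s) * (2 * b + 7 * c * s) = b * s := by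
          rw [mul_right_comm, hρ1]
        linarith
      nlinarith [mul_le_mul_of_nonneg_left i2 (sq_nonneg β)]
    have t3 : 0 ≤ 4 * c * β ^ 4 := by positivity
    have u1 : m * (2 / 3 * (x - s) ^ 2) ≤ c * s ^ 2 / 6 * (2 / 3 * (x - s) ^ 2) :=
      mul_le_mul_of_nonneg_right (min_le_left _ _) (by positivity)
    have u2 : m * (2 * β ^ 2) ≤ b * s / 2 * (2 * β ^ 2) :=
      mul_le_mul_of_nonneg_right (min_le_right _ _) (by positivity)
    linarith
  have hW0 : 0 ≤ W := frobSq_nonneg _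
  refine ⟨frobNorm (U * dg x β * Uᵀ - p), frobNorm_nonneg _, ?_, ?_⟩
  · rw [frobNorm_sq, ← hW]
    set F := frobSq (fp a b c (U * dg x β * Uᵀ))
    have hF0 : 0 ≤ F := frobSq_nonneg _
    have h1 : (m * W) ^ 2 ≤ F * W :=
      (pow_le_pow_left₀ (by positivity) hdot 2).trans (dot_sq_le _ _)
    have h2 : m ^ 2 * W ≤ F := by
      rcases hW0.eq_or_lt with h | h
      · rw [← h]; simpa using hF0
      · have : m ^ 2 * W * W ≤ F * W := by nlinarith
        exact le_of_mul_le_mul_right this h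
    have h3 : W ≤ 1 / m ^ 2 * F := by
      rw [one_div, inv_mul_eq_div, le_div_iff₀ (by positivity)]; linarith
    have h4 : 0 ≤ (2 * b + 6 * c * (R + s)) * F := by positivity
    linarith
  · intro ξ hξ
    have hps : frobNorm p ≤ R + s := (frobNorm_le_of_sq hs.le
      (by rw [Nman_frobSq hpN]; nlinarith)).trans (by linarith)
    have h1 := Hf_lip (a := a) (ξ := ξ) hb hc (by positivity) hps (hQR.trans (by linarith : R ≤ R + s))
    have h2 := Hf_nonneg_N ha hb hc hpN hξ
    have h3 : 0 ≤ 1 / m ^ 2 * frobNorm (U * dg x β * Uᵀ - p) * frobSq ξ := by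
      have := frobNorm_nonneg (U * dg x β * Uᵀ - p)
      have := frobSq_nonneg ξ
      positivity
    nlinarith

lemma distN_le {a b c : ℝ} {Q p : M3} (hp : p ∈ Nman a b c) : distN a b c Q ≤ frobNorm (Q - p) :=
  csInf_le ⟨0, by rintro _ ⟨P, -, rfl⟩; exact frobNorm_nonneg _⟩ ⟨p, hp, rfl⟩

end Part4

section Part5

/-- standard basis vector -/
abbrev ee (k : Fin 3) : E3 := EuclideanSpace.single k (1 : ℝ)

/-- scalar partial derivative -/
def D (k : Fin 3) (g : E3 → ℝ) (x : E3) : ℝ := fderiv ℝ g x (ee k)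

/-- Laplacian -/
def lap (g : E3 → ℝ) (x : E3) : ℝ := ∑ k, D k (D k g) x

lemma pd_apply (u : E3 → M3) (k : Fin 3) (x : E3) (i j : Fin 3) :
    pd u k x i j = D k (fun y => u y i j) x := rfl

lemma smM {u : E3 → M3} : ContDiff ℝ ∞ u ↔ ∀ i j, ContDiff ℝ ∞ (fun x => u x i j) := by
  constructor
  · intro h i j
    exact contDiff_pi.1 (contDiff_pi.1 h i) j
  · intro h
    exact contDiff_pi.2 fun i => contDiff_pi.2 fun j => h i j

lemma sm_diff {g : E3 → ℝ} (h : ContDiff ℝ ∞ g) (x : E3) : DifferentiableAt ℝ g x :=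
  (h.differentiable (by simp)) x

lemma contDiff_D {g : E3 → ℝ} (h : ContDiff ℝ ∞ g) (k : Fin 3) : ContDiff ℝ ∞ (D k g) := by
  have h1 : ContDiff ℝ ∞ (fderiv ℝ g) := h.fderiv_right (m := ∞) (by simp)
  exact h1.clm_apply contDiff_const

lemma contDiff_pd {u : E3 → M3} (h : ContDiff ℝ ∞ u) (k : Fin 3) : ContDiff ℝ ∞ (pd u k) :=
  smM.2 fun i j => contDiff_D (smM.1 h i j) k

lemma contDiff_lap {g : E3 → ℝ} (h : ContDiff ℝ ∞ g) : ContDiff ℝ ∞ (lap g) := by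
  unfold lap
  exact ContDiff.sum fun k _ => contDiff_D (contDiff_D h k) k

lemma D_add {f g : E3 → ℝ} (hf : ContDiff ℝ ∞ f) (hg : ContDiff ℝ ∞ g) (k : Fin 3) (x : E3) :
    D k (fun y => f y + g y) x = D k f x + D k g x := by
  unfold D; rw [fderiv_fun_add (sm_diff hf x) (sm_diff hg x)]; rfl

lemma D_sub {f g : E3 → ℝ} (hf : ContDiff ℝ ∞ f) (hg : ContDiff ℝ ∞ g) (k : Fin 3) (x : E3) :
    D k (fun y => f y - g y) x = D k f x - D k g x := by
  unfold D; rw [fderiv_fun_sub (sm_diff hf x) (sm_diff hg x)]; rfl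

lemma D_mul {f g : E3 → ℝ} (hf : ContDiff ℝ ∞ f) (hg : ContDiff ℝ ∞ g) (k : Fin 3) (x : E3) :
    D k (fun y => f y * g y) x = D k f x * g x + f x * D k g x := by
  unfold D; rw [fderiv_fun_mul (sm_diff hf x) (sm_diff hg x)]
  simp; ring

lemma D_const (r : ℝ) (k : Fin 3) (x : E3) : D k (fun _ => r) x = 0 := by
  unfold D; simp

lemma D_cmul {g : E3 → ℝ} (r : ℝ) (hg : ContDiff ℝ ∞ g) (k : Fin 3) (x : E3) :
    D k (fun y => r * g y) x = r * D k g x := by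
  rw [D_mul contDiff_const hg, D_const]; ring

lemma D_sum {ι : Type*} (s : Finset ι) {f : ι → E3 → ℝ} (hf : ∀ i, ContDiff ℝ ∞ (f i)) (k : Fin 3)
    (x : E3) : D k (fun y => ∑ i ∈ s, f i y) x = ∑ i ∈ s, D k (f i) x := by
  unfold D; rw [fderiv_fun_sum (fun i _ => sm_diff (hf i) x)]; simp

lemma D_comm {g : E3 → ℝ} (h : ContDiff ℝ ∞ g) (j k : Fin 3) (x : E3) :
    D j (D k g) x = D k (D j g) x := by
  have h1 : ContDiff ℝ ∞ (fderiv ℝ g) := h.fderiv_right (m := ∞) (by simp)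
  have hd : DifferentiableAt ℝ (fderiv ℝ g) x := h1.differentiable (by simp) x
  have e : ∀ j k, D j (D k g) x = fderiv ℝ (fderiv ℝ g) x (ee j) (ee k) := by
    intro j k
    unfold D
    rw [fderiv_clm_apply hd (differentiableAt_const _)]
    simp
  rw [e, e]
  have hs : IsSymmSndFDerivAt ℝ g x := by
    apply ContDiffAt.isSymmSndFDerivAt h.contDiffAt
    simp only [minSmoothness_of_isRCLikeNormedField]
    exact (WithTop.coe_le_coe (b := (2 : ℕ∞)) (a := (⊤ : ℕ∞))).2 le_top
  exact hs _ _

lemma pd_comm {u : E3 → M3} (h : ContDiff ℝ ∞ u) (j k : Fin 3) (x : E3) :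
    pd (pd u k) j x = pd (pd u j) k x := by
  ext i l
  exact D_comm (smM.1 h i l) j k x

lemma sm_dot {A B : E3 → M3} (hA : ContDiff ℝ ∞ A) (hB : ContDiff ℝ ∞ B) :
    ContDiff ℝ ∞ (fun y => dot (A y) (B y)) := by
  unfold dot
  exact ContDiff.sum fun i _ => ContDiff.sum fun j _ => (smM.1 hA i j).mul (smM.1 hB i j)

lemma sm_frobSq {A : E3 → M3} (hA : ContDiff ℝ ∞ A) : ContDiff ℝ ∞ (fun y => frobSq (A y)) := by
  simp only [frobSq_eq_dot]; exact sm_dot hA hA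

lemma sm_mmul {A B : E3 → M3} (hA : ContDiff ℝ ∞ A) (hB : ContDiff ℝ ∞ B) :
    ContDiff ℝ ∞ (fun y => A y * B y) := by
  rw [smM]; intro i j
  simp only [Matrix.mul_apply]
  exact ContDiff.sum fun l _ => (smM.1 hA i l).mul (smM.1 hB l j)

lemma sm_msmul {g : E3 → ℝ} {B : E3 → M3} (hg : ContDiff ℝ ∞ g) (hB : ContDiff ℝ ∞ B) :
    ContDiff ℝ ∞ (fun y => g y • B y) := by
  rw [smM]; intro i j
  exact hg.mul (smM.1 hB i j)

lemma D_dot {A B : E3 → M3} (hA : ContDiff ℝ ∞ A) (hB : ContDiff ℝ ∞ B) (k : Fin 3) (x : E3) :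
    D k (fun y => dot (A y) (B y)) x = dot (pd A k x) (B x) + dot (A x) (pd B k x) := by
  unfold dot
  rw [D_sum _ (fun i => ContDiff.sum fun j _ => (smM.1 hA i j).mul (smM.1 hB i j)),
    ← Finset.sum_add_distrib]
  refine Finset.sum_congr rfl fun i _ => ?_
  rw [D_sum _ (fun j => (smM.1 hA i j).mul (smM.1 hB i j)), ← Finset.sum_add_distrib]
  refine Finset.sum_congr rfl fun j _ => ?_
  rw [D_mul (smM.1 hA i j) (smM.1 hB i j)]; rfl

lemma D_frobSq {A : E3 → M3} (hA : ContDiff ℝ ∞ A) (k : Fin 3) (x : E3) :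
    D k (fun y => frobSq (A y)) x = 2 * dot (A x) (pd A k x) := by
  simp only [frobSq_eq_dot]; rw [D_dot hA hA, dot_comm]; ring

lemma pd_mul {A B : E3 → M3} (hA : ContDiff ℝ ∞ A) (hB : ContDiff ℝ ∞ B) (k : Fin 3) (x : E3) :
    pd (fun y => A y * B y) k x = pd A k x * B x + A x * pd B k x := by
  ext i j
  rw [pd_apply, Matrix.add_apply, Matrix.mul_apply, Matrix.mul_apply, ← Finset.sum_add_distrib]
  simp only [Matrix.mul_apply]
  rw [D_sum _ (fun l => (smM.1 hA i l).mul (smM.1 hB l j))]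
  refine Finset.sum_congr rfl fun l _ => ?_
  rw [D_mul (smM.1 hA i l) (smM.1 hB l j)]; rfl

lemma pd_add {A B : E3 → M3} (hA : ContDiff ℝ ∞ A) (hB : ContDiff ℝ ∞ B) (k : Fin 3) (x : E3) :
    pd (fun y => A y + B y) k x = pd A k x + pd B k x := by
  ext i j
  exact D_add (smM.1 hA i j) (smM.1 hB i j) k x

lemma pd_smul {g : E3 → ℝ} {B : E3 → M3} (hg : ContDiff ℝ ∞ g) (hB : ContDiff ℝ ∞ B) (k : Fin 3)
    (x : E3) : pd (fun y => g y • B y) k x = D k g x • B x + g x • pd B k x := by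
  ext i j
  exact D_mul hg (smM.1 hB i j) k x

lemma pd_const (A : M3) (k : Fin 3) (x : E3) : pd (fun _ => A) k x = 0 := by
  ext i j
  exact D_const _ k x

lemma pd_csmul {B : E3 → M3} (r : ℝ) (hB : ContDiff ℝ ∞ B) (k : Fin 3)
    (x : E3) : pd (fun y => r • B y) k x = r • pd B k x := by
  rw [pd_smul contDiff_const hB, D_const]; simp

lemma pd_S0 {u : E3 → M3} (hu : ContDiff ℝ ∞ u) (hS : ∀ x, u x ∈ S0) (k : Fin 3) (x : E3) :
    pd u k x ∈ S0 := by
  constructor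
  · ext i j
    rw [Matrix.transpose_apply, pd_apply, pd_apply]
    congr 1
    ext y
    exact (hS y).1.apply i j
  · have : (fun y => ∑ i, u y i i) = fun _ => (0:ℝ) := by
      ext y; exact (hS y).2
    have h2 := D_sum Finset.univ (fun i => smM.1 hu i i) k x
    rw [this, D_const] at h2
    exact h2.symm

/-- product rule for the gradient of f at u, contracted -/
lemma sm_fp (a b c : ℝ) {u : E3 → M3} (hu : ContDiff ℝ ∞ u) : ContDiff ℝ ∞ (fun y => fp a b c (u y)) := by
  unfold fp
  have h1 := sm_mmul hu hu
  have h2 := sm_frobSq hu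
  exact ((((sm_msmul contDiff_const hu).sub (sm_msmul contDiff_const h1))).add
    (sm_msmul (contDiff_const.mul h2) contDiff_const)).add (sm_msmul (contDiff_const.mul h2) hu)

lemma dot_pd_fp (a b c : ℝ) {u : E3 → M3} (hu : ContDiff ℝ ∞ u) (hS : ∀ x, u x ∈ S0) (k : Fin 3)
    (x : E3) : dot (pd (fun y => fp a b c (u y)) k x) (pd u k x) = Hf a b c (u x) (pd u k x) := by
  have h1 := sm_mmul hu hu
  have h2 := sm_frobSq hu
  have e : (fun y => fp a b c (u y)) = fun y => (((-a) • u y + (-b) • (u y * u y)) +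
      (b / 3 * frobSq (u y)) • (1 : M3)) + (c * frobSq (u y)) • u y := by
    ext1 y; simp only [fp, neg_smul, sub_eq_add_neg]
  have s1 : ContDiff ℝ ∞ (fun y => (-a) • u y) := sm_msmul contDiff_const hu
  have s2 : ContDiff ℝ ∞ (fun y => (-b) • (u y * u y)) := sm_msmul contDiff_const h1
  have s3 : ContDiff ℝ ∞ (fun y => (b / 3 * frobSq (u y)) • (1 : M3)) :=
    sm_msmul (contDiff_const.mul h2) contDiff_const
  have s4 : ContDiff ℝ ∞ (fun y => (c * frobSq (u y)) • u y) :=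
    sm_msmul (contDiff_const.mul h2) hu
  rw [e, pd_add ((s1.add s2).add s3) s4, pd_add (s1.add s2) s3, pd_add s1 s2,
    pd_csmul _ hu, pd_csmul _ h1, pd_mul hu hu, pd_smul (contDiff_const.mul h2) contDiff_const,
    pd_smul (contDiff_const.mul h2) hu, D_cmul _ h2, D_cmul _ h2, D_frobSq hu, pd_const]
  have hp := pd_S0 hu hS k x
  have hq := hS x
  generalize pd u k x = w at *
  generalize u x = q at *
  obtain ⟨x1, x2, x3, x4, x5, rfl⟩ := S0_form hq
  obtain ⟨y1, y2, y3, y4, y5, rfl⟩ := S0_form hp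
  simp [frobSq, dot, Hf, Fin.sum_univ_three, Matrix.mul_apply, Matrix.one_apply]
  ring

lemma fbulk_S0 (a b c : ℝ) {Q : M3} (h : Q ∈ S0) : fbulk a b c Q = kconst a b c - a / 2 * frobSq Q
    - b / 3 * dot Q (Q * Q) + c / 4 * frobSq Q ^ 2 := by
  rw [fbulk, trace_sq_S0 h]
  congr 3
  obtain ⟨x1, x2, x3, x4, x5, rfl⟩ := S0_form h
  simp [Matrix.trace, dot, Fin.sum_univ_three, Matrix.mul_apply]; ring

lemma sm_fbulk (a b c : ℝ) {u : E3 → M3} (hu : ContDiff ℝ ∞ u) (hS : ∀ x, u x ∈ S0) :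
    ContDiff ℝ ∞ (fun y => fbulk a b c (u y)) := by
  simp only [fun y => fbulk_S0 a b c (hS y)]
  exact ((contDiff_const.sub (contDiff_const.mul (sm_frobSq hu))).sub
    (contDiff_const.mul (sm_dot hu (sm_mmul hu hu)))).add (contDiff_const.mul ((sm_frobSq hu).pow 2))

lemma D_fbulk (a b c : ℝ) {u : E3 → M3} (hu : ContDiff ℝ ∞ u) (hS : ∀ x, u x ∈ S0) (k : Fin 3)
    (x : E3) : D k (fun y => fbulk a b c (u y)) x = dot (fp a b c (u x)) (pd u k x) := by
  have h1 := sm_mmul hu hu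
  have h2 := sm_frobSq hu
  have h3 := sm_dot hu h1
  have e : (fun y => fbulk a b c (u y)) = fun y => ((kconst a b c + (-(a / 2)) * frobSq (u y))
    + (- (b / 3)) * dot (u y) (u y * u y)) + c / 4 * (frobSq (u y) * frobSq (u y)) := by
    ext1 y; rw [fbulk_S0 a b c (hS y)]; ring
  rw [e, D_add ((contDiff_const.add (contDiff_const.mul h2)).add (contDiff_const.mul h3))
    (contDiff_const.mul (h2.mul h2)), D_add (contDiff_const.add (contDiff_const.mul h2))
    (contDiff_const.mul h3), D_add contDiff_const (contDiff_const.mul h2), D_const, D_cmul _ h2,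
    D_cmul _ h3, D_cmul _ (h2.mul h2), D_mul h2 h2, D_dot hu h1, pd_mul hu hu, D_frobSq hu]
  have hp := pd_S0 hu hS k x
  have hq := hS x
  generalize pd u k x = w at *
  generalize u x = q at *
  obtain ⟨x1, x2, x3, x4, x5, rfl⟩ := S0_form hq
  obtain ⟨y1, y2, y3, y4, y5, rfl⟩ := S0_form hp
  simp [frobSq, dot, fp, Fin.sum_univ_three, Matrix.mul_apply, Matrix.one_apply]
  ring

lemma sm_gradSq {u : E3 → M3} (hu : ContDiff ℝ ∞ u) : ContDiff ℝ ∞ (gradSq u) := by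
  unfold gradSq
  exact ContDiff.sum fun k _ => sm_frobSq (contDiff_pd hu k)

lemma sm_eDen (a b c ε : ℝ) {u : E3 → M3} (hu : ContDiff ℝ ∞ u) (hS : ∀ x, u x ∈ S0) :
    ContDiff ℝ ∞ (eDen a b c ε u) := by
  unfold eDen
  exact (contDiff_const.mul (sm_gradSq hu)).add (contDiff_const.mul (sm_fbulk a b c hu hS))

lemma gradSq_nonneg (u : E3 → M3) (x : E3) : 0 ≤ gradSq u x :=
  Finset.sum_nonneg fun _ _ => frobSq_nonneg _

lemma eDen_nonneg {a b c : ℝ} (ha : 0 ≤ a) (hb : 0 < b) (hc : 0 < c) (ε : ℝ) {u : E3 → M3} {x : E3}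
    (hS : u x ∈ S0) : 0 ≤ eDen a b c ε u x := by
  have := gradSq_nonneg u x
  have := fbulk_nonneg ha hb hc hS
  unfold eDen; positivity

lemma D_eDen (a b c ε : ℝ) {u : E3 → M3} (hu : ContDiff ℝ ∞ u) (hS : ∀ x, u x ∈ S0) (j : Fin 3) (x : E3) :
    D j (eDen a b c ε u) x = (∑ k, dot (pd u k x) (pd (pd u k) j x))
      + 1 / ε ^ 2 * dot (fp a b c (u x)) (pd u j x) := by
  unfold eDen
  rw [D_add (contDiff_const.mul (sm_gradSq hu)) (contDiff_const.mul (sm_fbulk a b c hu hS)),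
    D_cmul _ (sm_gradSq hu), D_cmul _ (sm_fbulk a b c hu hS), D_fbulk a b c hu hS]
  unfold gradSq
  rw [D_sum _ (fun k => sm_frobSq (contDiff_pd hu k)), Finset.mul_sum]
  congr 1
  refine Finset.sum_congr rfl fun k _ => ?_
  rw [D_frobSq (contDiff_pd hu k)]; ring

/-- integration by parts -/
lemma ibp {f g : E3 → ℝ} (hf : ContDiff ℝ ∞ f) (hg : ContDiff ℝ ∞ g) (hs : HasCompactSupport g)
    (k : Fin 3) : ∫ x, D k f x * g x = - ∫ x, f x * D k g x := by
  have hDg : HasCompactSupport (D k g) := by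
    have := hs.fderiv (𝕜 := ℝ)
    exact this.comp_left (g := fun (L : E3 →L[ℝ] ℝ) => L (ee k)) rfl
  have cD : ∀ {h : E3 → ℝ}, ContDiff ℝ ∞ h → Continuous (D k h) := fun hh => (contDiff_D hh k).continuous
  rw [← neg_eq_iff_eq_neg]
  have := integral_mul_fderiv_eq_neg_fderiv_mul_of_integrable (μ := (volume : Measure E3)) (𝕜 := ℝ)
    (f := f) (g := g) (v := ee k)
    (((cD hf).mul hg.continuous).integrable_of_hasCompactSupport hs.mul_left)
    ((hf.continuous.mul (cD hg)).integrable_of_hasCompactSupport hDg.mul_left)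
    ((hf.continuous.mul hg.continuous).integrable_of_hasCompactSupport hs.mul_left)
    (fun x _ => sm_diff hf x) (fun x _ => sm_diff hg x)
  exact this.symm

end Part5

section Part6

/-- normalized solution on `B_4` -/
structure Sol (a b c M ε : ℝ) (u : E3 → M3) : Prop where
  sm : ContDiff ℝ ∞ u
  s0 : ∀ x, u x ∈ S0
  bdd : ∀ x ∈ ball (0 : E3) 4, frobNorm (u x) ≤ M
  min : ∀ P : E3 → M3, ContDiff ℝ ∞ P → (∀ x, P x ∈ S0) →
    (∃ R < 4, ∀ y, R ≤ ‖y‖ → P y = u y) →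
    energy a b c ε u (ball 0 4) ≤ energy a b c ε P (ball 0 4)

/-- vector Laplacian -/
def lapv (u : E3 → M3) (x : E3) : M3 := ∑ k, pd (pd u k) k x

lemma intOn_ball {g : E3 → ℝ} (hg : Continuous g) (x : E3) (R : ℝ) : IntegrableOn g (ball x R) :=
  (hg.continuousOn.integrableOn_compact (isCompact_closedBall x R)).mono_set ball_subset_closedBall

lemma dot_zero_of_S0 {Z : M3} (h : frobSq Z = 0) : Z = 0 := by
  ext i j
  unfold frobSq at h
  have h1 := (Finset.sum_eq_zero_iff_of_nonneg (fun i _ => Finset.sum_nonneg fun j _ => sq_nonneg (Z i j))).1 h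
    i (Finset.mem_univ _)
  have h2 := (Finset.sum_eq_zero_iff_of_nonneg (fun j _ => sq_nonneg (Z i j))).1 h1 j (Finset.mem_univ _)
  simpa using h2

lemma S0_sum {ι : Type*} (s : Finset ι) {f : ι → M3} (h : ∀ i, f i ∈ S0) : ∑ i ∈ s, f i ∈ S0 := by
  classical
  induction s using Finset.induction_on with
  | empty => simpa using S0_zero
  | insert i s hi ih => rw [Finset.sum_insert hi]; exact S0_add (h i) ih

lemma lapv_S0 {u : E3 → M3} (hu : ContDiff ℝ ∞ u) (hS : ∀ x, u x ∈ S0) (x : E3) : lapv u x ∈ S0 :=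
  S0_sum _ fun k => pd_S0 (contDiff_pd hu k) (fun y => pd_S0 hu hS k y) k x

lemma sm_msum {f : Fin 3 → E3 → M3} (h : ∀ i, ContDiff ℝ ∞ (f i)) :
    ContDiff ℝ ∞ (fun x => ∑ i, f i x) := ContDiff.sum fun i _ => h i

lemma sm_lapv {u : E3 → M3} (hu : ContDiff ℝ ∞ u) : ContDiff ℝ ∞ (lapv u) :=
  sm_msum fun k => contDiff_pd (contDiff_pd hu k) k

lemma first_var {a b c M ε : ℝ} {u : E3 → M3} (h : Sol a b c M ε u) {ζ : E3 → ℝ}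
    (hζ : ContDiff ℝ ∞ ζ) (hsupp : ∃ R < 4, ∀ y, R ≤ ‖y‖ → ζ y = 0) {A : M3} (hA : A ∈ S0) :
    ∫ x in ball (0:E3) 4, ((∑ k, D k ζ x * dot (pd u k x) A)
      + 1 / ε ^ 2 * (ζ x * dot (fp a b c (u x)) A)) = 0 := by
  have hu := h.sm
  set l : E3 → ℝ := fun x => (∑ k, D k ζ x * dot (pd u k x) A)
      + 1 / ε ^ 2 * (ζ x * dot (fp a b c (u x)) A) with hl
  set m2 : E3 → ℝ := fun x => 1 / 2 * (∑ k, (D k ζ x) ^ 2 * frobSq A)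
      + 1 / ε ^ 2 * (1 / 2 * ((ζ x) ^ 2 * Hf a b c (u x) A)) with hm2
  set m3 : E3 → ℝ := fun x => 1 / ε ^ 2 * ((ζ x) ^ 3 * (- b / 3 * dot A (A * A)
      + c * dot (u x) A * frobSq A)) with hm3
  set m4 : E3 → ℝ := fun x => 1 / ε ^ 2 * ((ζ x) ^ 4 * (c / 4 * (frobSq A) ^ 2)) with hm4
  have cA : ContDiff ℝ ∞ (fun _ : E3 => A) := contDiff_const
  have cD : ∀ k, Continuous (D k ζ) := fun k => (contDiff_D hζ k).continuous
  have cl : Continuous l := by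
    refine (continuous_finsetSum _ fun k _ => (cD k).mul
      (sm_dot (contDiff_pd hu k) cA).continuous).add (continuous_const.mul (hζ.continuous.mul
        (sm_dot (sm_fp a b c hu) cA).continuous))
  have c2 : Continuous m2 := by
    refine (continuous_const.mul (continuous_finsetSum _ fun k _ => ((cD k).pow 2).mul
      continuous_const)).add (continuous_const.mul (continuous_const.mul ((hζ.continuous.pow 2).mul ?_)))
    unfold Hf
    have k1 := (sm_dot hu (contDiff_const (c := A * A))).continuous
    have k2 := (sm_dot hu cA).continuous
    have k3 := (sm_frobSq hu).continuous
    fun_prop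
  have c3 : Continuous m3 := by
    have k2 := (sm_dot hu cA).continuous
    have := hζ.continuous
    fun_prop
  have c4 : Continuous m4 := by
    have := hζ.continuous
    fun_prop
  have hP : ∀ t : ℝ, ContDiff ℝ ∞ (fun x => u x + (t * ζ x) • A) := fun t =>
    hu.add (sm_msmul (contDiff_const.mul hζ) cA)
  have key : ∀ t x, eDen a b c ε (fun x => u x + (t * ζ x) • A) x =
      eDen a b c ε u x + (t * l x + t ^ 2 * m2 x + t ^ 3 * m3 x + t ^ 4 * m4 x) := by
    intro t x
    have hpd : ∀ k, pd (fun x => u x + (t * ζ x) • A) k x = pd u k x + (t * D k ζ x) • A := by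
      intro k
      rw [pd_add hu (sm_msmul (contDiff_const.mul hζ) cA), pd_smul (contDiff_const.mul hζ) cA,
        pd_const, D_cmul _ hζ]; simp
    have hfr : ∀ k, frobSq (pd u k x + (t * D k ζ x) • A) = frobSq (pd u k x)
        + 2 * (t * D k ζ x) * dot (pd u k x) A + (t * D k ζ x) ^ 2 * frobSq A := by
      intro k
      simp only [frobSq, dot, Fin.sum_univ_three, Matrix.add_apply, Matrix.smul_apply, smul_eq_mul]
      ring
    simp only [eDen, gradSq, hpd, hfr]
    rw [fbulk_taylor a b c (h.s0 x) (S0_smul _ hA)]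
    have e1 : Hf a b c (u x) ((t * ζ x) • A) = (t * ζ x) ^ 2 * Hf a b c (u x) A := by
      simp only [Hf, frobSq_smul, dot_smul_right, Matrix.smul_mul, Matrix.mul_smul]; ring
    have e2 : dot ((t * ζ x) • A) ((t * ζ x) • A * (t * ζ x) • A) = (t * ζ x) ^ 3 * dot A (A * A) := by
      rw [dot_comm]; simp only [dot_smul_right, Matrix.smul_mul, Matrix.mul_smul]
      rw [dot_comm]; simp only [dot_smul_right]; ring
    rw [e1, e2, dot_smul_right, dot_smul_right, frobSq_smul]
    simp only [hl, hm2, hm3, hm4, Fin.sum_univ_three]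
    ring
  have hmin : ∀ t : ℝ, 0 ≤ t * (∫ x in ball (0:E3) 4, l x) + t ^ 2 * (∫ x in ball (0:E3) 4, m2 x)
      + t ^ 3 * (∫ x in ball (0:E3) 4, m3 x) + t ^ 4 * (∫ x in ball (0:E3) 4, m4 x) := by
    intro t
    obtain ⟨R, hR, hRz⟩ := hsupp
    have := h.min (fun x => u x + (t * ζ x) • A) (hP t)
      (fun x => S0_add (h.s0 x) (S0_smul _ hA)) ⟨R, hR, fun y hy => by simp [hRz y hy]⟩
    unfold energy at this
    have i0 := intOn_ball (sm_eDen a b c ε hu h.s0).continuous 0 4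
    have i1 := (intOn_ball cl 0 4).const_mul t
    have i2 := (intOn_ball c2 0 4).const_mul (t ^ 2)
    have i3 := (intOn_ball c3 0 4).const_mul (t ^ 3)
    have i4 := (intOn_ball c4 0 4).const_mul (t ^ 4)
    simp only [key] at this
    have i12 : Integrable (fun x => t * l x + t ^ 2 * m2 x) (volume.restrict (ball 0 4)) := i1.add i2
    have i13 : Integrable (fun x => t * l x + t ^ 2 * m2 x + t ^ 3 * m3 x)
      (volume.restrict (ball 0 4)) := i12.add i3
    have i14 : Integrable (fun x => t * l x + t ^ 2 * m2 x + t ^ 3 * m3 x + t ^ 4 * m4 x)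
      (volume.restrict (ball 0 4)) := i13.add i4
    rw [integral_add i0 i14, integral_add i13 i4, integral_add i12 i3, integral_add i1 i2, integral_const_mul t l,
      integral_const_mul (t ^ 2) m2, integral_const_mul (t ^ 3) m3, integral_const_mul (t ^ 4) m4] at this
    linarith
  set L := ∫ x in ball (0:E3) 4, l x
  set I2 := ∫ x in ball (0:E3) 4, m2 x
  set I3 := ∫ x in ball (0:E3) 4, m3 x
  set I4 := ∫ x in ball (0:E3) 4, m4 x
  have hloc : IsLocalMin (fun t : ℝ => t * L + t ^ 2 * I2 + t ^ 3 * I3 + t ^ 4 * I4) 0 :=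
    Filter.Eventually.of_forall fun t => by simpa using hmin t
  refine hloc.hasDerivAt_eq_zero ?_
  have := ((((hasDerivAt_id (0:ℝ)).mul_const L).add (((hasDerivAt_id (0:ℝ)).pow 2).mul_const I2)).add
    (((hasDerivAt_id (0:ℝ)).pow 3).mul_const I3)).add (((hasDerivAt_id (0:ℝ)).pow 4).mul_const I4)
  exact this.congr_deriv (by simp)

lemma dot_sum_left {ι : Type*} (s : Finset ι) (f : ι → M3) (A : M3) :
    dot (∑ i ∈ s, f i) A = ∑ i ∈ s, dot (f i) A := by
  classical
  induction s using Finset.induction_on with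
  | empty => simp [dot]
  | insert i s hi ih => rw [Finset.sum_insert hi, Finset.sum_insert hi, dot_add_left, ih]

lemma dot_smul_left (t : ℝ) (A B : M3) : dot (t • A) B = t * dot A B := by
  rw [dot_comm, dot_smul_right, dot_comm]

/-- Euler–Lagrange equation -/
lemma EL {a b c M ε : ℝ} {u : E3 → M3} (h : Sol a b c M ε u) {x : E3} (hx : x ∈ ball (0:E3) 4) :
    lapv u x = (1 / ε ^ 2) • fp a b c (u x) := by
  have hu := h.sm
  have key : ∀ A ∈ S0, ∀ x ∈ ball (0:E3) 4, dot (lapv u x) A = 1 / ε ^ 2 * dot (fp a b c (u x)) A := by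
    intro A hA
    have cA : ContDiff ℝ ∞ (fun _ : E3 => A) := contDiff_const
    set G : E3 → ℝ := fun x => 1 / ε ^ 2 * dot (fp a b c (u x)) A - dot (lapv u x) A with hG
    have cG : Continuous G := (continuous_const.mul (sm_dot (sm_fp a b c hu) cA).continuous).sub
      (sm_dot (sm_lapv hu) cA).continuous
    have hz : ∀ᵐ x, x ∈ ball (0:E3) 4 → G x = 0 := by
      apply isOpen_ball.ae_eq_zero_of_integral_contDiff_smul_eq_zero
      · exact cG.locallyIntegrable.locallyIntegrableOn _
      · intro ζ hζ hcs hsup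
        have hsupp : ∃ R < 4, ∀ y, R ≤ ‖y‖ → ζ y = 0 := by
          rcases (tsupport ζ).eq_empty_or_nonempty with he | hne
          · refine ⟨0, by norm_num, fun y _ => ?_⟩
            exact image_eq_zero_of_notMem_tsupport (by simp [he])
          · obtain ⟨z, hz, hmax⟩ := hcs.isCompact.exists_isMaxOn hne continuous_norm.continuousOn
            have hz4 : ‖z‖ < 4 := by simpa using hsup hz
            refine ⟨(‖z‖ + 4) / 2, by linarith, fun y hy => ?_⟩
            apply image_eq_zero_of_notMem_tsupport
            intro hy'
            have : ‖y‖ ≤ ‖z‖ := hmax hy'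
            linarith
        have fv := first_var h hζ hsupp hA
        obtain ⟨R, hR, hRz⟩ := hsupp
        have hz0 : ∀ x, x ∉ ball (0:E3) 4 → x ∉ tsupport ζ := fun x hx hx' => hx (hsup hx')
        have hD0 : ∀ k x, x ∉ ball (0:E3) 4 → D k ζ x = 0 := by
          intro k x hx
          have : fderiv ℝ ζ x = 0 := by
            by_contra hne
            exact hz0 x hx (support_fderiv_subset ℝ hne)
          simp [D, this]
        rw [setIntegral_eq_integral_of_forall_compl_eq_zero] at fv
        · have i1 : ∀ k, Integrable (fun x => D k ζ x * dot (pd u k x) A) := fun k =>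
            ((contDiff_D hζ k).continuous.mul (sm_dot (contDiff_pd hu k) cA).continuous).integrable_of_hasCompactSupport
              (HasCompactSupport.mul_right ((hcs.fderiv (𝕜 := ℝ)).comp_left
                (g := fun (L : E3 →L[ℝ] ℝ) => L (ee k)) rfl))
          have i2 : Integrable (fun x => 1 / ε ^ 2 * (ζ x * dot (fp a b c (u x)) A)) :=
            ((hζ.continuous.mul (sm_dot (sm_fp a b c hu) cA).continuous).integrable_of_hasCompactSupport
              hcs.mul_right).const_mul _
          rw [integral_add (integrable_finsetSum _ fun k _ => i1 k) i2,
            integral_finsetSum _ fun k _ => i1 k] at fv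
          have e3 : ∀ k, ∫ x, D k ζ x * dot (pd u k x) A = - ∫ x, ζ x * dot (pd (pd u k) k x) A := by
            intro k
            have := ibp (sm_dot (contDiff_pd hu k) cA) hζ hcs k
            have e4 : ∀ x, D k (fun y => dot (pd u k y) A) x = dot (pd (pd u k) k x) A := by
              intro x
              rw [D_dot (contDiff_pd hu k) cA, pd_const]; simp [dot]
            simp only [e4] at this
            simp only [mul_comm (D k ζ _), mul_comm (ζ _)]
            linarith
          have i3 : ∀ k, Integrable (fun x => ζ x * dot (pd (pd u k) k x) A) := fun k =>
            (hζ.continuous.mul (sm_dot (contDiff_pd (contDiff_pd hu k) k) cA).continuous).integrable_of_hasCompactSupport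
              hcs.mul_right
          simp only [e3] at fv
          rw [Finset.sum_neg_distrib, ← integral_finsetSum _ fun k _ => i3 k, neg_add_eq_sub,
            ← integral_sub i2 (integrable_finsetSum _ fun k _ => i3 k)] at fv
          rw [← fv]
          congr 1
          ext x
          simp only [hG, lapv, dot_sum_left, smul_eq_mul, Finset.mul_sum, mul_sub]
          ring
        · intro x hx
          simp [hD0 _ x hx, image_eq_zero_of_notMem_tsupport (hz0 x hx)]
    have : EqOn G 0 (ball (0:E3) 4) := by
      apply Measure.eqOn_open_of_ae_eq (μ := volume) _ isOpen_ball cG.continuousOn continuousOn_const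
      exact (ae_restrict_iff' measurableSet_ball).2 hz
    intro x hx
    have := this hx
    simp only [hG, Pi.zero_apply] at this
    linarith
  have hZ : lapv u x - (1 / ε ^ 2) • fp a b c (u x) ∈ S0 :=
    S0_sub (lapv_S0 hu h.s0 x) (S0_smul _ (fp_S0 a b c (h.s0 x)))
  have := key _ hZ x hx
  rw [← sub_eq_zero]
  apply dot_zero_of_S0
  rw [frobSq_eq_dot]
  rw [← sub_eq_zero, ← dot_smul_left, ← dot_sub_left] at this
  exact this

end Part6

section Part7

lemma pd_congr {A B : E3 → M3} {x : E3} (h : A =ᶠ[nhds x] B) (k : Fin 3) : pd A k x = pd B k x := by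
  ext i j
  rw [pd_apply, pd_apply, D, D]
  have : (fun y => A y i j) =ᶠ[nhds x] (fun y => B y i j) := h.mono fun y hy => by simp [hy]
  rw [this.fderiv_eq]

lemma pd_sum3 {f : Fin 3 → E3 → M3} (h : ∀ i, ContDiff ℝ ∞ (f i)) (k : Fin 3) (x : E3) :
    pd (fun y => ∑ i, f i y) k x = ∑ i, pd (f i) k x := by
  ext i j
  rw [pd_apply, Matrix.sum_apply]
  simp only [Matrix.sum_apply]
  rw [D_sum _ (fun l => smM.1 (h l) i j)]; rfl

lemma dot_sum_right {ι : Type*} (s : Finset ι) (f : ι → M3) (A : M3) :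
    dot A (∑ i ∈ s, f i) = ∑ i ∈ s, dot A (f i) := by
  rw [dot_comm, dot_sum_left]; simp only [dot_comm]

lemma bochner {a b c M ε : ℝ} {u : E3 → M3} (h : Sol a b c M ε u) {x : E3} (hx : x ∈ ball (0:E3) 4) :
    2 * (1 / ε ^ 2) * (∑ k, Hf a b c (u x) (pd u k x)) + (1 / ε ^ 2) ^ 2 * frobSq (fp a b c (u x))
      ≤ lap (eDen a b c ε u) x := by
  have hu := h.sm
  have hS := h.s0
  have sp := fun k => contDiff_pd hu k
  have spp := fun k j => contDiff_pd (sp k) j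
  have hfp := sm_fp a b c hu
  have e1 : ∀ j, D j (eDen a b c ε u) = fun x => (∑ k, dot (pd u k x) (pd (pd u k) j x))
      + 1 / ε ^ 2 * dot (fp a b c (u x)) (pd u j x) := fun j => funext fun x => D_eDen a b c ε hu hS j x
  have e2 : ∀ j, D j (D j (eDen a b c ε u)) x = (∑ k, (frobSq (pd (pd u k) j x)
      + dot (pd u k x) (pd (pd (pd u k) j) j x))) + 1 / ε ^ 2 * (Hf a b c (u x) (pd u j x)
        + dot (fp a b c (u x)) (pd (pd u j) j x)) := by
    intro j
    rw [e1 j, D_add (ContDiff.sum fun k _ => sm_dot (sp k) (spp k j))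
      (contDiff_const.mul (sm_dot hfp (sp j))), D_cmul _ (sm_dot hfp (sp j)), D_dot hfp (sp j),
      dot_pd_fp a b c hu hS, D_sum _ (fun k => sm_dot (sp k) (spp k j))]
    congr 1
    refine Finset.sum_congr rfl fun k _ => ?_
    rw [D_dot (sp k) (spp k j), frobSq_eq_dot]
  have e3 : ∀ k, ∑ j, pd (pd (pd u k) j) j x = (1 / ε ^ 2) • pd (fun y => fp a b c (u y)) k x := by
    intro k
    have : pd (lapv u) k x = pd (fun y => (1 / ε ^ 2) • fp a b c (u y)) k x := by
      apply pd_congr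
      filter_upwards [isOpen_ball.mem_nhds hx] with y hy
      exact EL h hy
    rw [pd_csmul _ hfp] at this
    rw [← this]
    unfold lapv
    rw [pd_sum3 (fun j => spp j j)]
    refine Finset.sum_congr rfl fun j _ => ?_
    rw [pd_comm (sp j) k j]
    apply congrArg (fun g => pd g j x)
    funext y
    exact pd_comm hu j k y
  unfold lap
  simp only [e2, Finset.sum_add_distrib, ← Finset.mul_sum, ← dot_sum_right]
  rw [Finset.sum_comm (f := fun j k => dot (pd u k x) (pd (pd (pd u k) j) j x))]
  simp only [← dot_sum_right, e3, dot_smul_right]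
  rw [show ∑ j, pd (pd u j) j x = (1 / ε ^ 2) • fp a b c (u x) from EL h hx, dot_smul_right,
    ← frobSq_eq_dot]
  simp only [dot_comm (pd u _ x), dot_pd_fp a b c hu hS]
  have : 0 ≤ ∑ j, ∑ k, frobSq (pd (pd u k) j x) :=
    Finset.sum_nonneg fun _ _ => Finset.sum_nonneg fun _ _ => frobSq_nonneg _
  rw [← Finset.mul_sum]
  nlinarith

lemma gradSq_le {a b c : ℝ} (ha : 0 ≤ a) (hb : 0 < b) (hc : 0 < c) (ε : ℝ) {u : E3 → M3} {x : E3}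
    (hS : u x ∈ S0) : gradSq u x ≤ 2 * eDen a b c ε u x := by
  have := fbulk_nonneg ha hb hc hS
  have h2 : 0 ≤ 1 / ε ^ 2 * fbulk a b c (u x) := by positivity
  unfold eDen; linarith

lemma pot_le {a b c : ℝ} (ε : ℝ) {u : E3 → M3} {x : E3} :
    1 / ε ^ 2 * fbulk a b c (u x) ≤ eDen a b c ε u x := by
  have := gradSq_nonneg u x
  unfold eDen; linarith

lemma bochner_lin {a b c M ε : ℝ} (ha : 0 ≤ a) (hb : 0 < b) (hc : 0 < c) {u : E3 → M3}
    (h : Sol a b c M ε u) {x : E3} (hx : x ∈ ball (0:E3) 4) :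
    -(4 * (a + 2 * b * M) / ε ^ 2) * eDen a b c ε u x ≤ lap (eDen a b c ε u) x := by
  refine le_trans ?_ (bochner h hx)
  have h1 : -(a + 2 * b * M) * gradSq u x ≤ ∑ k, Hf a b c (u x) (pd u k x) := by
    unfold gradSq; rw [Finset.mul_sum]
    exact Finset.sum_le_sum fun k _ => Hf_ge ha hb hc (h.bdd x hx)
  have h2 : 0 ≤ (1 / ε ^ 2) ^ 2 * frobSq (fp a b c (u x)) :=
    mul_nonneg (sq_nonneg _) (frobSq_nonneg _)
  have hM : 0 ≤ M := (frobNorm_nonneg _).trans (h.bdd x hx)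
  have h3 : -(2 * (a + 2 * b * M)) * eDen a b c ε u x ≤ -(a + 2 * b * M) * gradSq u x := by
    have := mul_le_mul_of_nonneg_left (gradSq_le ha hb hc ε (h.s0 x)) (by positivity : 0 ≤ a + 2 * b * M)
    linarith
  have h4 := mul_le_mul_of_nonneg_left (h3.trans h1) (by positivity : 0 ≤ 2 * (1 / ε ^ 2))
  calc _ = 2 * (1 / ε ^ 2) * (-(2 * (a + 2 * b * M)) * eDen a b c ε u x) := by ring
    _ ≤ _ := by linarith

lemma bochner_sq {a b c : ℝ} (ha : 0 ≤ a) (hb : 0 < b) (hc : 0 < c) (M : ℝ) (hM : 0 ≤ M) :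
    ∃ C : ℝ, 0 < C ∧ ∀ ε : ℝ, 0 < ε → ∀ u, Sol a b c M ε u → ∀ x ∈ ball (0:E3) 4,
      -C * eDen a b c ε u x ^ 2 ≤ lap (eDen a b c ε u) x := by
  obtain ⟨C, δ₁, hC, hδ, key⟩ := fbulk_nondeg ha hb hc M hM
  refine ⟨4 * C ^ 3 + 4 * (a + 2 * b * M) / δ₁, by positivity, ?_⟩
  intro ε hε u h x hx
  set e := eDen a b c ε u x with he
  have he0 : 0 ≤ e := eDen_nonneg ha hb hc ε (h.s0 x)
  rcases le_or_gt (fbulk a b c (u x)) δ₁ with hf | hf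
  · obtain ⟨d, hd0, hd1, hd2⟩ := key _ (h.s0 x) (h.bdd x hx) hf
    refine le_trans ?_ (bochner h hx)
    have h1 : -(C * d) * gradSq u x ≤ ∑ k, Hf a b c (u x) (pd u k x) := by
      unfold gradSq; rw [Finset.mul_sum]
      exact Finset.sum_le_sum fun k _ => hd2 _ (pd_S0 h.sm h.s0 k x)
    have h3 : -(2 * (C * d)) * e ≤ -(C * d) * gradSq u x := by
      have := mul_le_mul_of_nonneg_left (gradSq_le ha hb hc ε (h.s0 x)) (by positivity : 0 ≤ C * d)
      linarith
    set i := 1 / ε ^ 2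
    have hi : 0 < i := by positivity
    have h4 := mul_le_mul_of_nonneg_left (h3.trans h1) (by positivity : 0 ≤ 2 * i)
    have h5 : i ^ 2 * (d ^ 2 / C) ≤ i ^ 2 * frobSq (fp a b c (u x)) := by
      apply mul_le_mul_of_nonneg_left _ (by positivity)
      rw [div_le_iff₀ hC]; linarith
    have h6 : 0 ≤ 4 * (a + 2 * b * M) / δ₁ * e ^ 2 := by positivity
    have h7 : 0 ≤ i ^ 2 * (d ^ 2 / C) - 4 * C * i * d * e + 4 * C ^ 3 * e ^ 2 := by
      have : i ^ 2 * (d ^ 2 / C) - 4 * C * i * d * e + 4 * C ^ 3 * e ^ 2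
        = (i * d - 2 * C ^ 2 * e) ^ 2 / C := by field_simp; ring
      rw [this]; positivity
    nlinarith
  · refine le_trans ?_ (bochner_lin ha hb hc h hx)
    have h1 : 1 / ε ^ 2 * δ₁ ≤ e :=
      (mul_le_mul_of_nonneg_left hf.le (by positivity)).trans (pot_le ε)
    have h2 : 1 / ε ^ 2 ≤ e / δ₁ := by rw [le_div_iff₀ hδ]; exact h1
    have h3 : 4 * (a + 2 * b * M) / ε ^ 2 ≤ 4 * (a + 2 * b * M) / δ₁ * e := by
      calc _ = 4 * (a + 2 * b * M) * (1 / ε ^ 2) := by ring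
        _ ≤ 4 * (a + 2 * b * M) * (e / δ₁) := mul_le_mul_of_nonneg_left h2 (by positivity)
        _ = _ := by ring
    have h4 := mul_le_mul_of_nonneg_right h3 he0
    have h5 : 0 ≤ 4 * C ^ 3 * e ^ 2 := by positivity
    nlinarith

end Part7

section Part8

/-! ### P8: parametric integrals and mean value -/

lemma deriv_int {F F' : ℝ → E3 → ℝ} {K : Set E3} (hK : IsCompact K)
    (hF : Continuous fun p : ℝ × E3 => F p.1 p.2) (hF' : Continuous fun p : ℝ × E3 => F' p.1 p.2)
    (hd : ∀ t y, HasDerivAt (fun t => F t y) (F' t y) t) (h0 : ∀ t, ∀ y ∉ K, F t y = 0) (t : ℝ) :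
    HasDerivAt (fun t => ∫ y, F t y) (∫ y, F' t y) t := by
  have h0' : ∀ t, ∀ y ∉ K, F' t y = 0 := by
    intro t y hy
    have h1 := hd t y
    have h2 : (fun t => F t y) = fun _ => 0 := by ext t; exact h0 t y hy
    rw [h2] at h1
    exact h1.unique (hasDerivAt_const t 0)
  have hcomp : IsCompact (closedBall t 1 ×ˢ K) := (isCompact_closedBall t 1).prod hK
  obtain ⟨C, hC⟩ := hcomp.exists_bound_of_continuousOn hF'.continuousOn
  have cF : ∀ s, Continuous (F s) := fun s => hF.comp (Continuous.prodMk_right s)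
  have cF' : ∀ s, Continuous (F' s) := fun s => hF'.comp (Continuous.prodMk_right s)
  refine (hasDerivAt_integral_of_dominated_loc_of_deriv_le (bound := K.indicator fun _ => C)
    (closedBall_mem_nhds t one_pos) (.of_forall fun s => (cF s).aestronglyMeasurable) ?_
    (cF' t).aestronglyMeasurable (.of_forall ?_) ?_ (.of_forall fun y s _ => hd s y)).2
  · exact (cF t).integrable_of_hasCompactSupport (HasCompactSupport.intro hK (h0 t))
  · intro y s hs
    by_cases hy : y ∈ K
    · rw [indicator_of_mem hy]; exact hC (s, y) ⟨hs, hy⟩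
    · rw [indicator_of_notMem hy, h0' s y hy]; simp
  · rw [integrable_indicator_iff hK.measurableSet]
    exact continuous_const.continuousOn.integrableOn_compact hK

lemma E3_sum (y : E3) : y = ∑ k, y k • ee k := by
  ext i
  fin_cases i <;> simp [ee, Fin.sum_univ_three]

lemma fderiv_sum (g : E3 → ℝ) (x y : E3) : fderiv ℝ g x y = ∑ k, y k * D k g x := by
  conv_lhs => rw [E3_sum y]
  simp [D]

lemma D_scale {g : E3 → ℝ} (hg : ContDiff ℝ ∞ g) (x0 : E3) (t : ℝ) (k : Fin 3) (y : E3) :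
    D k (fun y => g (x0 + t • y)) y = t * D k g (x0 + t • y) := by
  unfold D
  have h1 : HasFDerivAt (fun y : E3 => x0 + t • y) (t • ContinuousLinearMap.id ℝ E3) y :=
    ((hasFDerivAt_id y).const_smul t).const_add x0
  have h2 := (sm_diff hg (x0 + t • y)).hasFDerivAt.comp y h1
  rw [show (fun y => g (x0 + t • y)) = g ∘ fun y => x0 + t • y from rfl, h2.fderiv]
  simp

lemma sm_scale {g : E3 → ℝ} (hg : ContDiff ℝ ∞ g) (x0 : E3) (t : ℝ) :
    ContDiff ℝ ∞ (fun y => g (x0 + t • y)) :=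
  hg.comp (contDiff_const.add (contDiff_id.const_smul t))

lemma hasDerivAt_scale {g : E3 → ℝ} (hg : ContDiff ℝ ∞ g) (x0 : E3) (t : ℝ) (y : E3) :
    HasDerivAt (fun t : ℝ => g (x0 + t • y)) (∑ k, y k * D k g (x0 + t • y)) t := by
  rw [← fderiv_sum]
  have h1 : HasDerivAt (fun t : ℝ => x0 + t • y) y t := by
    simpa using ((hasDerivAt_id t).smul_const y).const_add x0
  exact (sm_diff hg (x0 + t • y)).hasFDerivAt.comp_hasDerivAt t h1

lemma sm_rad {h : ℝ → ℝ} (hh : ContDiff ℝ ∞ h) : ContDiff ℝ ∞ (fun y : E3 => h (‖y‖ ^ 2)) :=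
  hh.comp (contDiff_norm_sq ℝ)

lemma D_rad {h : ℝ → ℝ} (hh : ContDiff ℝ ∞ h) (k : Fin 3) (y : E3) :
    D k (fun y : E3 => h (‖y‖ ^ 2)) y = 2 * y k * deriv h (‖y‖ ^ 2) := by
  unfold D
  have h1 : HasFDerivAt (fun y : E3 => ‖y‖ ^ 2) (2 • innerSL ℝ y) y := by
    simpa using (hasStrictFDerivAt_norm_sq y).hasFDerivAt
  have h2 := ((hh.differentiable (by simp)) (‖y‖ ^ 2)).hasDerivAt.hasFDerivAt.comp y h1
  rw [show (fun y : E3 => h (‖y‖ ^ 2)) = h ∘ fun y => ‖y‖ ^ 2 from rfl, h2.fderiv]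
  simp [ee, EuclideanSpace.inner_single_right]; ring

lemma cptK {h : ℝ → ℝ} (h10 : ∀ t, 10 ≤ t → h t = 0) (y : E3) (hy : y ∉ closedBall (0:E3) 4) : h (‖y‖ ^ 2) = 0 := by
  apply h10
  simp at hy
  nlinarith

lemma cpt_rad {h : ℝ → ℝ} (h10 : ∀ t, 10 ≤ t → h t = 0) : HasCompactSupport (fun y : E3 => h (‖y‖ ^ 2)) :=
  HasCompactSupport.intro (isCompact_closedBall (0:E3) 4) (cptK h10)

/-- derivative of scaled integrals -/
lemma deriv_scale {g : E3 → ℝ} (hg : ContDiff ℝ ∞ g) {h : ℝ → ℝ} (hh : Continuous h)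
    (h10 : ∀ t, 10 ≤ t → h t = 0) (x0 : E3) (t : ℝ) :
    HasDerivAt (fun t : ℝ => ∫ y, g (x0 + t • y) * h (‖y‖ ^ 2))
      (∫ y, (∑ k, y k * D k g (x0 + t • y)) * h (‖y‖ ^ 2)) t := by
  refine deriv_int (F := fun t y => g (x0 + t • y) * h (‖y‖ ^ 2))
    (F' := fun t y => (∑ k, y k * D k g (x0 + t • y)) * h (‖y‖ ^ 2)) (isCompact_closedBall (0:E3) 4) ?_ ?_ ?_ ?_ t
  · have := hg.continuous
    fun_prop
  · have := fun k => (contDiff_D hg k).continuous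
    fun_prop
  · intro t y
    exact (hasDerivAt_scale hg x0 t y).mul_const _
  · intro t y hy
    rw [cptK h10 y hy, mul_zero]

end Part8

section Part9

/-! ### P9: mean value -/

def Ph (φ : ℝ → ℝ) (q : ℝ) : ℝ := 1 / 2 * ∫ s in (10:ℝ)..q, φ s

lemma Ph_deriv {φ : ℝ → ℝ} (hφ : AdmissibleCutoff φ) : deriv (Ph φ) = fun q => 1 / 2 * φ q := by
  ext q
  have hc : Continuous φ := hφ.1.continuous
  exact ((hc.integral_hasStrictDerivAt 10 q).hasDerivAt.const_mul (1/2)).deriv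

lemma Ph_hasDeriv {φ : ℝ → ℝ} (hφ : AdmissibleCutoff φ) (q : ℝ) : HasDerivAt (Ph φ) (1 / 2 * φ q) q := by
  have hc : Continuous φ := hφ.1.continuous
  exact ((hc.integral_hasStrictDerivAt 10 q).hasDerivAt.const_mul (1/2))

lemma Ph_sm {φ : ℝ → ℝ} (hφ : AdmissibleCutoff φ) : ContDiff ℝ ∞ (Ph φ) := by
  rw [contDiff_infty_iff_deriv]
  refine ⟨fun q => (Ph_hasDeriv hφ q).differentiableAt, ?_⟩
  rw [Ph_deriv hφ]
  exact contDiff_const.mul hφ.1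

lemma Ph_zero {φ : ℝ → ℝ} (hφ : AdmissibleCutoff φ) (q : ℝ) (hq : 10 ≤ q) : Ph φ q = 0 := by
  unfold Ph
  rw [intervalIntegral.integral_zero_ae, mul_zero]
  refine .of_forall fun s hs => hφ.2.2.1 s ?_
  rw [uIoc_of_le hq] at hs; exact hs.1.le

lemma phi_anti {φ : ℝ → ℝ} (hφ : AdmissibleCutoff φ) : AntitoneOn φ (Ici 0) := by
  refine antitoneOn_of_deriv_nonpos (convex_Ici 0) hφ.1.continuous.continuousOn
    (hφ.1.differentiable (by simp)).differentiableOn ?_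
  intro x hx
  rw [interior_Ici] at hx
  exact hφ.2.2.2.2.2.2.2 x hx.le

lemma phi_le {φ : ℝ → ℝ} (hφ : AdmissibleCutoff φ) {q : ℝ} (hq : 0 ≤ q) : φ q ≤ 60 := by
  rw [← hφ.2.2.2.2.1]; exact phi_anti hφ (by simp) hq hq

lemma Ph_bd {φ : ℝ → ℝ} (hφ : AdmissibleCutoff φ) {q : ℝ} (hq : 0 ≤ q) : 0 ≤ - Ph φ q ∧ - Ph φ q ≤ 5 * φ q := by
  by_cases h10 : 10 ≤ q
  · rw [Ph_zero hφ q h10, hφ.2.2.1 q h10]; simp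
  push Not at h10
  have hc : Continuous φ := hφ.1.continuous
  have e : - Ph φ q = 1 / 2 * ∫ s in q..10, φ s := by
    unfold Ph; rw [intervalIntegral.integral_symm]; ring
  rw [e]
  have h1 : 0 ≤ ∫ s in q..10, φ s := intervalIntegral.integral_nonneg h10.le fun s _ => hφ.2.1 s
  have h2 : ∫ s in q..10, φ s ≤ ∫ s in q..10, φ q := by
    refine intervalIntegral.integral_mono_on h10.le (hc.intervalIntegrable _ _) (by simp) ?_
    intro s hs
    exact phi_anti hφ hq (hq.trans hs.1) hs.1
  simp at h2
  have := hφ.2.1 q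
  constructor
  · positivity
  · nlinarith

lemma mv_deriv {φ : ℝ → ℝ} (hφ : AdmissibleCutoff φ) {g : E3 → ℝ} (hg : ContDiff ℝ ∞ g) (x0 : E3) (t : ℝ) :
    HasDerivAt (fun t : ℝ => ∫ y, g (x0 + t • y) * φ (‖y‖ ^ 2))
      (t * ∫ y, lap g (x0 + t • y) * (- Ph φ (‖y‖ ^ 2))) t := by
  convert deriv_scale hg hφ.1.continuous hφ.2.2.1 x0 t using 1
  have cP : HasCompactSupport (fun y : E3 => Ph φ (‖y‖ ^ 2)) := cpt_rad (Ph_zero hφ)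
  have sP := sm_rad (Ph_sm hφ)
  have e1 : ∀ y : E3, (∑ k, y k * D k g (x0 + t • y)) * φ (‖y‖ ^ 2)
      = ∑ k, D k g (x0 + t • y) * D k (fun y : E3 => Ph φ (‖y‖ ^ 2)) y := by
    intro y
    rw [Finset.sum_mul]
    refine Finset.sum_congr rfl fun k _ => ?_
    rw [D_rad (Ph_sm hφ), Ph_deriv hφ]; ring
  simp only [e1]
  have cg : ∀ k, Continuous (fun y => D k (D k g) (x0 + t • y)) := fun k =>
    (sm_scale (contDiff_D (contDiff_D hg k) k) x0 t).continuous
  rw [integral_finsetSum]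
  · have e2 : ∀ k : Fin 3, ∫ y, D k g (x0 + t • y) * D k (fun y : E3 => Ph φ (‖y‖ ^ 2)) y
        = t * ∫ y, D k (D k g) (x0 + t • y) * (- Ph φ (‖y‖ ^ 2)) := by
      intro k
      have := ibp (sm_scale (contDiff_D hg k) x0 t) sP cP k
      simp only [D_scale (contDiff_D hg k)] at this
      rw [← neg_eq_iff_eq_neg] at this
      rw [← this, ← integral_neg, ← integral_const_mul]
      congr 1; ext y; ring
    simp only [e2]
    rw [← Finset.mul_sum, ← integral_finsetSum]
    · simp only [lap, Finset.sum_mul]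
    · intro k _
      exact ((cg k).mul sP.continuous.neg).integrable_of_hasCompactSupport (cP.neg.mul_left)
  · intro k _
    have cD : HasCompactSupport (D k (fun y : E3 => Ph φ (‖y‖ ^ 2))) := by
      have := cP.fderiv (𝕜 := ℝ)
      exact this.comp_left (g := fun (L : E3 →L[ℝ] ℝ) => L (ee k)) rfl
    exact ((sm_scale (contDiff_D hg k) x0 t).continuous.mul (contDiff_D sP k).continuous).integrable_of_hasCompactSupport
      cD.mul_left

lemma int_gphi {φ : ℝ → ℝ} (hφ : AdmissibleCutoff φ) {g : E3 → ℝ} (hg : Continuous g) :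
    Integrable (fun y : E3 => g y * φ (‖y‖ ^ 2)) :=
  (hg.mul (sm_rad hφ.1).continuous).integrable_of_hasCompactSupport (cpt_rad hφ.2.2.1).mul_left

lemma mv_mono {φ : ℝ → ℝ} (hφ : AdmissibleCutoff φ) {g : E3 → ℝ} (hg : ContDiff ℝ ∞ g) (x0 : E3) {t A : ℝ}
    (ht : 0 < t) (hA : 0 ≤ A) (h0 : ∀ y ∈ ball x0 (4 * t), 0 ≤ g y)
    (hl : ∀ y ∈ ball x0 (4 * t), - A * g y ≤ lap g y) :
    g x0 * ∫ y : E3, φ (‖y‖ ^ 2) ≤ (∫ y, g (x0 + t • y) * φ (‖y‖ ^ 2)) * Real.exp (5 * A / 2 * t ^ 2) := by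
  set m : ℝ → ℝ := fun t => ∫ y, g (x0 + t • y) * φ (‖y‖ ^ 2) with hm
  have hd : ∀ s, HasDerivAt (fun s => m s * Real.exp (5 * A / 2 * s ^ 2))
      ((s * ∫ y, lap g (x0 + s • y) * (- Ph φ (‖y‖ ^ 2))) * Real.exp (5 * A / 2 * s ^ 2)
        + m s * (Real.exp (5 * A / 2 * s ^ 2) * (5 * A / 2 * (2 * s)))) s := by
    intro s
    have h2 : HasDerivAt (fun s : ℝ => Real.exp (5 * A / 2 * s ^ 2)) (Real.exp (5 * A / 2 * s ^ 2) * (5 * A / 2 * (2 * s))) s := by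
      have := ((hasDerivAt_pow 2 s).const_mul (5 * A / 2)).exp
      simpa using this
    exact (mv_deriv hφ hg x0 s).mul h2
  have mono : MonotoneOn (fun s => m s * Real.exp (5 * A / 2 * s ^ 2)) (Icc 0 t) := by
    refine monotoneOn_of_deriv_nonneg (convex_Icc 0 t) (fun s _ => (hd s).continuousAt.continuousWithinAt)
      (fun s _ => (hd s).differentiableAt.differentiableWithinAt) ?_
    intro s hs
    rw [interior_Icc] at hs
    rw [(hd s).deriv]
    have hE := Real.exp_pos (5 * A / 2 * s ^ 2)
    have key : - (5 * A) * m s ≤ ∫ y, lap g (x0 + s • y) * (- Ph φ (‖y‖ ^ 2)) := by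
      rw [hm]; simp only
      rw [← integral_const_mul]
      refine integral_mono ((int_gphi hφ (sm_scale hg x0 s).continuous).const_mul _) ?_ ?_
      · exact ((sm_scale (contDiff_lap hg) x0 s).continuous.mul (sm_rad (Ph_sm hφ)).continuous.neg).integrable_of_hasCompactSupport
          ((cpt_rad (Ph_zero hφ)).neg.mul_left)
      · intro y
        simp only
        by_cases hy : 10 ≤ ‖y‖ ^ 2
        · rw [Ph_zero hφ _ hy, hφ.2.2.1 _ hy]; simp
        · have hyb : x0 + s • y ∈ ball x0 (4 * t) := by
            rw [mem_ball, dist_eq_norm, add_sub_cancel_left, norm_smul, Real.norm_of_nonneg hs.1.le]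
            have h4 : ‖y‖ < 4 := by nlinarith [norm_nonneg y]
            nlinarith [norm_nonneg y, hs.1, hs.2]
          have b1 := Ph_bd hφ (sq_nonneg ‖y‖)
          have b2 := h0 _ hyb
          have b3 := hl _ hyb
          nlinarith [mul_le_mul_of_nonneg_right b3 b1.1, mul_le_mul_of_nonneg_left b1.2 (mul_nonneg hA b2)]
    have h3 : 0 ≤ s * ((∫ y, lap g (x0 + s • y) * (- Ph φ (‖y‖ ^ 2))) + 5 * A * m s) :=
      mul_nonneg hs.1.le (by linarith)
    have := mul_nonneg h3 hE.le
    nlinarith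
  have := mono (show (0:ℝ) ∈ Icc 0 t from ⟨le_rfl, ht.le⟩) (show t ∈ Icc 0 t from ⟨ht.le, le_rfl⟩) ht.le
  simp only [hm, zero_smul, add_zero, integral_const_mul] at this
  simpa using this

lemma int_scale {g : E3 → ℝ} (x0 : E3) {t : ℝ} (ht : 0 < t) (R : ℝ) :
    ∫ y in ball (0:E3) R, g (x0 + t • y) = (t ^ 3)⁻¹ * ∫ y in ball x0 (t * R), g y := by
  have h1 := Measure.setIntegral_comp_smul_of_pos (μ := (volume : Measure E3)) (fun y => g (x0 + y)) (ball (0:E3) R) ht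
  rw [h1, _root_.smul_ball ht.ne', smul_zero, Real.norm_of_nonneg ht.le]
  simp only [finrank_euclideanSpace, Fintype.card_fin, smul_eq_mul]
  congr 1
  have := (measurePreserving_add_left (volume : Measure E3) x0).setIntegral_preimage_emb
    (measurableEmbedding_addLeft x0) g (ball x0 (t * R))
  rw [← this]
  congr 2
  ext y; simp

def VB : ℝ := (volume (ball (0:E3) 1)).toReal

lemma VB_pos : 0 < VB := ENNReal.toReal_pos (measure_ball_pos _ _ one_pos).ne' measure_ball_lt_top.ne

lemma phi_int_ge {φ : ℝ → ℝ} (hφ : AdmissibleCutoff φ) : VB ≤ ∫ y : E3, φ (‖y‖ ^ 2) := by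
  have hi : Integrable (fun y : E3 => φ (‖y‖ ^ 2)) := by simpa using int_gphi hφ (g := fun _ => 1) continuous_const
  have h1 : ∫ y in ball (0:E3) 1, (1:ℝ) ≤ ∫ y in ball (0:E3) 1, φ (‖y‖ ^ 2) := by
    refine setIntegral_mono_on (by simp [measure_ball_lt_top.ne]) hi.integrableOn measurableSet_ball ?_
    intro y hy
    simp at hy
    exact hφ.2.2.2.1 _ ⟨by positivity, by nlinarith [norm_nonneg y]⟩
  have h2 : ∫ y in ball (0:E3) 1, φ (‖y‖ ^ 2) ≤ ∫ y : E3, φ (‖y‖ ^ 2) :=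
    setIntegral_le_integral hi (.of_forall fun y => hφ.2.1 _)
  refine le_trans (le_of_eq ?_) (h1.trans h2)
  simp [VB, Measure.real]

lemma mean_value {φ : ℝ → ℝ} (hφ : AdmissibleCutoff φ) {g : E3 → ℝ} (hg : ContDiff ℝ ∞ g) (x0 : E3) {t A : ℝ}
    (ht : 0 < t) (hA : 0 ≤ A) (h0 : ∀ y ∈ ball x0 (4 * t), 0 ≤ g y)
    (hl : ∀ y ∈ ball x0 (4 * t), - A * g y ≤ lap g y) :
    g x0 ≤ 60 / VB * Real.exp (5 * A / 2 * t ^ 2) * ((t ^ 3)⁻¹ * ∫ y in ball x0 (4 * t), g y) := by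
  have h1 := mv_mono hφ hg x0 ht hA h0 hl
  have hE := Real.exp_pos (5 * A / 2 * t ^ 2)
  have hV := VB_pos
  have hIφ := phi_int_ge hφ
  have hgx : 0 ≤ g x0 := h0 x0 (mem_ball_self (by positivity))
  have h2 : ∫ y, g (x0 + t • y) * φ (‖y‖ ^ 2) ≤ 60 * ((t ^ 3)⁻¹ * ∫ y in ball x0 (4 * t), g y) := by
    rw [show 4 * t = t * 4 by ring, ← int_scale x0 ht 4]
    rw [← setIntegral_eq_integral_of_forall_compl_eq_zero (s := ball (0:E3) 4), ← integral_const_mul]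
    · refine setIntegral_mono_on ((int_gphi hφ (sm_scale hg x0 t).continuous).integrableOn)
        ((intOn_ball (sm_scale hg x0 t).continuous 0 4).const_mul _) measurableSet_ball ?_
      intro y hy
      have hyb : x0 + t • y ∈ ball x0 (4 * t) := by
        rw [mem_ball, dist_eq_norm, add_sub_cancel_left, norm_smul, Real.norm_of_nonneg ht.le]
        simp at hy
        nlinarith
      have := h0 _ hyb
      nlinarith [phi_le hφ (sq_nonneg ‖y‖)]
    · intro y hy
      rw [hφ.2.2.1, mul_zero]
      simp at hy
      nlinarith
  rw [show 60 / VB * Real.exp (5 * A / 2 * t ^ 2) * ((t ^ 3)⁻¹ * ∫ y in ball x0 (4 * t), g y)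
    = (60 * ((t ^ 3)⁻¹ * ∫ y in ball x0 (4 * t), g y)) * Real.exp (5 * A / 2 * t ^ 2) / VB by ring, le_div_iff₀ hV]
  calc g x0 * VB ≤ g x0 * ∫ y : E3, φ (‖y‖ ^ 2) := by gcongr
    _ ≤ _ := h1
    _ ≤ _ := by gcongr

end Part9

section Part10

/-! ### P10: gradient bound `e ≤ C/ε²` -/

lemma lap_frobSq {u : E3 → M3} (hu : ContDiff ℝ ∞ u) (x : E3) :
    lap (fun y => frobSq (u y)) x = 2 * gradSq u x + 2 * dot (u x) (lapv u x) := by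
  unfold lap
  have e : ∀ k, D k (fun y => frobSq (u y)) = fun y => 2 * dot (u y) (pd u k y) := fun k => by
    ext y; exact D_frobSq hu k y
  have : ∀ k, D k (D k (fun y => frobSq (u y))) x = 2 * frobSq (pd u k x) + 2 * dot (u x) (pd (pd u k) k x) := by
    intro k
    rw [e k, D_cmul _ (sm_dot hu (contDiff_pd hu k)), D_dot hu (contDiff_pd hu k), frobSq_eq_dot]; ring
  simp only [this, Finset.sum_add_distrib, ← Finset.mul_sum]
  unfold gradSq lapv
  rw [dot_sum_right]

lemma cpt_D {g : E3 → ℝ} (hs : HasCompactSupport g) (k : Fin 3) : HasCompactSupport (D k g) := by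
  have := hs.fderiv (𝕜 := ℝ)
  exact this.comp_left (g := fun (L : E3 →L[ℝ] ℝ) => L (ee k)) rfl

lemma lap_ibp {f g : E3 → ℝ} (hf : ContDiff ℝ ∞ f) (hg : ContDiff ℝ ∞ g) (hs : HasCompactSupport g) :
    ∫ x, lap f x * g x = ∫ x, f x * lap g x := by
  unfold lap
  simp only [Finset.sum_mul, Finset.mul_sum]
  rw [integral_finsetSum, integral_finsetSum]
  · refine Finset.sum_congr rfl fun k _ => ?_
    rw [ibp (contDiff_D hf k) hg hs, ibp hf (contDiff_D hg k) (cpt_D hs k), neg_neg]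
  · intro k _
    exact (hf.continuous.mul (contDiff_D (contDiff_D hg k) k).continuous).integrable_of_hasCompactSupport
      (cpt_D (cpt_D hs k) k).mul_left
  · intro k _
    exact ((contDiff_D (contDiff_D hf k) k).continuous.mul hg.continuous).integrable_of_hasCompactSupport hs.mul_left

lemma lap_scale {g : E3 → ℝ} (hg : ContDiff ℝ ∞ g) (x0 : E3) (t : ℝ) (y : E3) :
    lap (fun y => g (x0 + t • y)) y = t ^ 2 * lap g (x0 + t • y) := by
  unfold lap
  rw [Finset.mul_sum]
  refine Finset.sum_congr rfl fun k _ => ?_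
  have : D k (fun y => g (x0 + t • y)) = fun y => t * D k g (x0 + t • y) := by
    ext y; exact D_scale hg x0 t k y
  rw [this, D_cmul _ (sm_scale (contDiff_D hg k) x0 t), D_scale (contDiff_D hg k)]; ring

lemma Nman_nonempty (a b c : ℝ) : (Nman a b c).Nonempty :=
  ⟨_, ![1, 0, 0], by simp [Fin.sum_univ_three], rfl⟩

lemma f_bdd {a b c : ℝ} (ha : 0 ≤ a) (hb : 0 < b) (hc : 0 < c) (M : ℝ) (hM : 0 ≤ M) :
    ∃ C > 0, ∀ Q ∈ S0, frobNorm Q ≤ M → fbulk a b c Q ≤ C := by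
  obtain ⟨p, hp⟩ := Nman_nonempty a b c
  have h0 := frobNorm_nonneg ((-1:ℝ) • p)
  obtain ⟨C, hC, h⟩ := fbulk_le_quad ha hb hc (M + frobNorm ((-1:ℝ) • p)) (by positivity)
  refine ⟨C * (M + frobNorm ((-1:ℝ) • p)) ^ 2 + 1, by positivity, fun Q hQ hQM => ?_⟩
  have hw : frobNorm (Q - p) ≤ M + frobNorm ((-1:ℝ) • p) := by
    have := frobNorm_add_le Q ((-1:ℝ) • p)
    rw [show Q + (-1:ℝ) • p = Q - p by simp [sub_eq_add_neg]] at this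
    linarith
  have := h p hp (Q - p) (S0_sub hQ (Nman_S0 hp)) hw
  rw [show p + (Q - p) = Q by abel] at this
  have h3 : frobSq (Q - p) ≤ (M + frobNorm ((-1:ℝ) • p)) ^ 2 := by
    rw [← frobNorm_sq]
    exact pow_le_pow_left₀ (frobNorm_nonneg _) hw 2
  nlinarith

lemma ball_sub {x0 : E3} {R s S : ℝ} (hx : x0 ∈ ball (0:E3) s) (h : s + R ≤ S) : ball x0 R ⊆ ball (0:E3) S := by
  intro y hy
  simp only [mem_ball, dist_zero_right] at *
  have := dist_triangle y x0 0
  simp only [dist_zero_right] at this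
  linarith

lemma grad_bound {a b c : ℝ} (ha : 0 ≤ a) (hb : 0 < b) (hc : 0 < c) {φ : ℝ → ℝ} (hφ : AdmissibleCutoff φ)
    (M : ℝ) (hM : 0 ≤ M) :
    ∃ C > 0, ∀ ε, 0 < ε → ε ≤ 1 / 4 → ∀ u, Sol a b c M ε u → ∀ x ∈ ball (0:E3) 3,
      eDen a b c ε u x ≤ C / ε ^ 2 := by
  obtain ⟨Cf, hCf, hf⟩ := f_bdd ha hb hc M hM
  set ζ : E3 → ℝ := fun y => - Ph φ (‖y‖ ^ 2) with hζ
  have sζ : ContDiff ℝ ∞ ζ := (sm_rad (Ph_sm hφ)).neg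
  have cζ : HasCompactSupport ζ := (cpt_rad (Ph_zero hφ)).neg
  set J := ∫ y, |lap ζ y| with hJ
  set I := ∫ y, ζ y with hI
  have ζ0 : ∀ y, 0 ≤ ζ y := fun y => (Ph_bd hφ (sq_nonneg _)).1
  have hJ0 : 0 ≤ J := integral_nonneg fun y => abs_nonneg _
  have hI0 : 0 ≤ I := integral_nonneg ζ0
  have clap : HasCompactSupport (lap ζ) := by
    unfold lap
    have : (fun x => ∑ k, D k (D k ζ) x) = fun x => D 0 (D 0 ζ) x + D 1 (D 1 ζ) x + D 2 (D 2 ζ) x := by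
      ext x; rw [Fin.sum_univ_three]
    rw [this]
    exact ((cpt_D (cpt_D cζ 0) 0).add (cpt_D (cpt_D cζ 1) 1)).add (cpt_D (cpt_D cζ 2) 2)
  set B := (a * M + 2 * b * M ^ 2 + c * M ^ 3) * M with hB
  have hB0 : 0 ≤ B := by positivity
  set K := (M ^ 2 * J / 4 + (B / 2 + Cf) * I) with hK
  have hK0 : 0 ≤ K := by positivity
  have hV := VB_pos
  refine ⟨60 / VB * Real.exp (5 * (4 * (a + 2 * b * M)) / 32) * (64 * K) + 1, by positivity, ?_⟩
  intro ε hε hε1 u h x hx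
  have hu := h.sm
  have hS := h.s0
  have hball : ∀ y : E3, ζ y ≠ 0 ∨ lap ζ y ≠ 0 → x + ε • y ∈ ball (0:E3) 4 := by
    intro y hy
    have : y ∈ closedBall (0:E3) (7/2) := by
      by_contra hc
      have hc' : 7 / 2 < ‖y‖ := by simpa using hc
      have hev : ζ =ᶠ[nhds y] fun _ => 0 := by
        have : ∀ᶠ z in nhds y, 7 / 2 < ‖z‖ := continuous_norm.continuousAt.eventually (lt_mem_nhds hc')
        filter_upwards [this] with z hz
        rw [hζ]; simp only; rw [Ph_zero hφ _ (by nlinarith)]; simp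
      have hD : ∀ k, D k ζ =ᶠ[nhds y] fun _ => 0 := by
        intro k
        filter_upwards [hev.eventuallyEq_nhds] with z hz
        unfold D; rw [hz.fderiv_eq]; simp
      rcases hy with hy | hy
      · exact hy hev.eq_of_nhds
      · apply hy
        unfold lap
        refine Finset.sum_eq_zero fun k _ => ?_
        show fderiv ℝ (D k ζ) y (ee k) = 0
        rw [(hD k).fderiv_eq]; simp
    refine ball_sub hx (R := 1) (by norm_num) ?_
    rw [mem_ball, dist_eq_norm, add_sub_cancel_left, norm_smul, Real.norm_of_nonneg hε.le]
    simp at this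
    nlinarith
  have sx := sm_scale (sm_frobSq hu) x ε
  have h1 := lap_ibp sx sζ cζ
  simp only [lap_scale (sm_frobSq hu)] at h1
  -- upper bound of RHS
  have h2 : ∫ y, frobSq (u (x + ε • y)) * lap ζ y ≤ M ^ 2 * J := by
    rw [hJ, ← integral_const_mul]
    refine integral_mono ((sx.continuous.mul (contDiff_lap sζ).continuous).integrable_of_hasCompactSupport clap.mul_left)
      (((contDiff_lap sζ).continuous.abs.integrable_of_hasCompactSupport clap.abs).const_mul _) ?_
    intro y
    simp only
    by_cases hy : lap ζ y = 0
    · rw [hy]; simp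
    have hb := h.bdd _ (hball y (Or.inr hy))
    have h3 : frobSq (u (x + ε • y)) ≤ M ^ 2 := by
      rw [← frobNorm_sq]; exact pow_le_pow_left₀ (frobNorm_nonneg _) hb 2
    have := frobSq_nonneg (u (x + ε • y))
    calc _ ≤ frobSq (u (x + ε • y)) * |lap ζ y| := by gcongr; exact le_abs_self _
      _ ≤ _ := by gcongr
  have se := sm_scale (sm_eDen a b c ε hu hS) x ε
  have h4 : ∫ y, eDen a b c ε u (x + ε • y) * ζ y ≤ K / ε ^ 2 := by
    have : ∫ y, eDen a b c ε u (x + ε • y) * ζ y ≤ ∫ y, (1 / 4 * (1 / ε ^ 2) * (ε ^ 2 * lap (fun y => frobSq (u y)) (x + ε • y) * ζ y)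
        + (1 / ε ^ 2 * (B / 2 + Cf)) * ζ y) := by
      refine integral_mono ((se.continuous.mul sζ.continuous).integrable_of_hasCompactSupport cζ.mul_left) ?_ ?_
      · exact (((contDiff_const.mul (sm_scale (contDiff_lap (sm_frobSq hu)) x ε)).continuous.mul sζ.continuous).integrable_of_hasCompactSupport
          cζ.mul_left).const_mul _ |>.add ((sζ.continuous.integrable_of_hasCompactSupport cζ).const_mul _)
      · intro y
        simp only
        by_cases hy : ζ y = 0
        · rw [hy]; simp
        have hb4 := hball y (Or.inl hy)
        have hbd := h.bdd _ hb4
        rw [lap_frobSq hu, EL h hb4, dot_smul_right]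
        have hfp := fp_bound ha hb hc hbd
        have hd : -B ≤ dot (u (x + ε • y)) (fp a b c (u (x + ε • y))) := by
          have := abs_dot_le (u (x + ε • y)) (fp a b c (u (x + ε • y)))
          have h5 : frobNorm (u (x + ε • y)) * frobNorm (fp a b c (u (x + ε • y))) ≤ M * (a * M + 2 * b * M ^ 2 + c * M ^ 3) := by
            exact mul_le_mul hbd hfp (frobNorm_nonneg _) hM
          rw [abs_le] at this
          linarith [this.1, mul_comm M (a * M + 2 * b * M ^ 2 + c * M ^ 3)]
        have hff := hf _ (hS (x + ε • y)) hbd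
        have hz := ζ0 y
        have he : eDen a b c ε u (x + ε • y) ≤ 1 / 4 * (1 / ε ^ 2) * (ε ^ 2 * (2 * gradSq u (x + ε • y) +
            2 * (1 / ε ^ 2 * dot (u (x + ε • y)) (fp a b c (u (x + ε • y)))))) + (1 / ε ^ 2 * (B / 2 + Cf)) := by
          unfold eDen
          have hp : 0 < 1 / ε ^ 2 := by positivity
          have e1 : 1 / 4 * (1 / ε ^ 2) * (ε ^ 2 * (2 * gradSq u (x + ε • y) +
            2 * (1 / ε ^ 2 * dot (u (x + ε • y)) (fp a b c (u (x + ε • y)))))) = 1 / 2 * gradSq u (x + ε • y) +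
              1 / 2 * (1 / ε ^ 2 * dot (u (x + ε • y)) (fp a b c (u (x + ε • y)))) := by
            field_simp; ring
          rw [e1]
          nlinarith
        nlinarith [mul_le_mul_of_nonneg_right he hz]
    refine this.trans ?_
    rw [integral_add, integral_const_mul, integral_const_mul, h1]
    · have hp : 0 < 1 / ε ^ 2 := by positivity
      calc _ ≤ 1 / 4 * (1 / ε ^ 2) * (M ^ 2 * J) + 1 / ε ^ 2 * (B / 2 + Cf) * I := by gcongr
        _ = _ := by rw [hK]; ring
    · exact (((contDiff_const.mul (sm_scale (contDiff_lap (sm_frobSq hu)) x ε)).continuous.mul sζ.continuous).integrable_of_hasCompactSupport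
          cζ.mul_left).const_mul _
    · exact ((sζ.continuous.integrable_of_hasCompactSupport cζ).const_mul _)
  have h5 : ∫ y in ball (0:E3) 1, eDen a b c ε u (x + ε • y) ≤ K / ε ^ 2 := by
    refine le_trans ?_ h4
    have hInt0 := (se.continuous.mul sζ.continuous).integrable_of_hasCompactSupport (μ := volume) cζ.mul_left
    refine le_trans ?_ (setIntegral_le_integral hInt0 (s := ball (0:E3) 1) (.of_forall fun y => mul_nonneg (eDen_nonneg ha hb hc ε (hS _)) (ζ0 y)))
    refine setIntegral_mono_on (intOn_ball se.continuous 0 1) hInt0.integrableOn measurableSet_ball ?_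
    intro y hy
    have he := eDen_nonneg ha hb hc ε (hS (x + ε • y))
    have : 1 ≤ ζ y := by
      simp only [mem_ball, dist_zero_right] at hy
      have hq : ‖y‖ ^ 2 ≤ 1 := by nlinarith [norm_nonneg y]
      have hcφ : Continuous φ := hφ.1.continuous
      rw [hζ]; simp only; unfold Ph
      rw [intervalIntegral.integral_symm]
      have i1 : ∫ s in (1:ℝ)..8, (1:ℝ) ≤ ∫ s in (1:ℝ)..8, φ s :=
        intervalIntegral.integral_mono_on (by norm_num) (by simp) (hcφ.intervalIntegrable _ _)
          fun s hs => hφ.2.2.2.1 s ⟨by linarith [hs.1], hs.2⟩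
      have i2 : ∫ s in (1:ℝ)..8, φ s ≤ ∫ s in (‖y‖ ^ 2)..10, φ s := by
        refine intervalIntegral.integral_mono_interval hq (by norm_num) (by norm_num) (.of_forall hφ.2.1) (hcφ.intervalIntegrable _ _)
      norm_num at i1
      linarith
    nlinarith
  have hm := mean_value hφ (sm_eDen a b c ε hu hS) x (t := ε / 4) (A := 4 * (a + 2 * b * M) / ε ^ 2) (by positivity) (by positivity)
    (fun y _ => eDen_nonneg ha hb hc ε (hS y))
    (fun y hy => bochner_lin ha hb hc h (ball_sub hx (by linarith) hy))
  rw [show 4 * (ε / 4) = ε * 1 by ring] at hm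
  have hsc := int_scale (g := eDen a b c ε u) x hε 1
  have e2 : ∫ y in ball x (ε * 1), eDen a b c ε u y = ε ^ 3 * ∫ y in ball (0:E3) 1, eDen a b c ε u (x + ε • y) := by
    rw [hsc]; field_simp
  rw [e2, show ((ε / 4) ^ 3)⁻¹ * (ε ^ 3 * ∫ y in ball (0:E3) 1, eDen a b c ε u (x + ε • y)) =
    64 * ∫ y in ball (0:E3) 1, eDen a b c ε u (x + ε • y) by field_simp; ring,
    show 5 * (4 * (a + 2 * b * M) / ε ^ 2) / 2 * (ε / 4) ^ 2 = 5 * (4 * (a + 2 * b * M)) / 32 by field_simp; ring] at hm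
  refine hm.trans ?_
  rw [add_div]
  calc _ ≤ 60 / VB * Real.exp (5 * (4 * (a + 2 * b * M)) / 32) * (64 * (K / ε ^ 2)) := by gcongr
    _ = 60 / VB * Real.exp (5 * (4 * (a + 2 * b * M)) / 32) * (64 * K) / ε ^ 2 := by ring
    _ ≤ _ := by have : 0 < 1 / ε ^ 2 := by positivity
                linarith

end Part10

section Part11

/-! ### P11: monotonicity formula -/

lemma div_stress {a b c M ε : ℝ} {u : E3 → M3} (h : Sol a b c M ε u) {x : E3} (hx : x ∈ ball (0:E3) 4) (j : Fin 3) :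
    D j (eDen a b c ε u) x = ∑ i, D i (fun y => dot (pd u i y) (pd u j y)) x := by
  have hu := h.sm
  rw [D_eDen a b c ε hu h.s0]
  simp only [fun i => D_dot (contDiff_pd hu i) (contDiff_pd hu j) i x, Finset.sum_add_distrib]
  rw [← dot_smul_left, ← EL h hx, ← dot_sum_left]
  rw [add_comm]
  congr 1
  refine Finset.sum_congr rfl fun k _ => ?_
  rw [pd_comm hu]

lemma sm_coord (j : Fin 3) : ContDiff ℝ ∞ (fun y : E3 => y j) := by fun_prop

lemma D_coord (i j : Fin 3) (y : E3) : D i (fun y : E3 => y j) y = if i = j then 1 else 0 := by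
  unfold D
  have : HasFDerivAt (fun y : E3 => y j) (EuclideanSpace.proj j : E3 →L[ℝ] ℝ) y :=
    (EuclideanSpace.proj j : E3 →L[ℝ] ℝ).hasFDerivAt
  rw [this.fderiv]
  simp [ee, eq_comm, Pi.single_apply]

lemma frobSq_dirD (u : E3 → M3) (y x : E3) :
    frobSq (dirD u y x) = ∑ i, ∑ j, y i * y j * dot (pd u i x) (pd u j x) := by
  rw [frobSq_eq_dot, dirD, dot_sum_left]
  refine Finset.sum_congr rfl fun i _ => ?_
  rw [dot_sum_right]
  refine Finset.sum_congr rfl fun j _ => ?_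
  rw [dot_smul_left, dot_smul_right]; ring

lemma sm_stress {u : E3 → M3} (hu : ContDiff ℝ ∞ u) (i j : Fin 3) :
    ContDiff ℝ ∞ (fun y => dot (pd u i y) (pd u j y)) := sm_dot (contDiff_pd hu i) (contDiff_pd hu j)

lemma cont_dirD {u : E3 → M3} (hu : ContDiff ℝ ∞ u) {X Y : E3 → E3} (hX : Continuous X) (hY : Continuous Y) :
    Continuous (fun y => frobSq (dirD u (X y) (Y y))) := by
  simp only [frobSq_dirD]
  have := fun i j => (sm_stress hu i j).continuous.comp hY
  simp only [Function.comp_def] at this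
  have h2 := fun i : Fin 3 => (sm_coord i).continuous.comp hX
  simp only [Function.comp_def] at h2
  exact continuous_finsetSum _ fun i _ => continuous_finsetSum _ fun j _ => ((h2 i).mul (h2 j)).mul (this i j)

def Fm (a b c ε : ℝ) (φ : ℝ → ℝ) (u : E3 → M3) (x0 : E3) (t : ℝ) : ℝ :=
  t ^ 2 * ∫ y, eDen a b c ε u (x0 + t • y) * φ (‖y‖ ^ 2)

lemma dphi_zero {φ : ℝ → ℝ} (hφ : AdmissibleCutoff φ) (t : ℝ) (ht : 10 ≤ t) : deriv φ t = 0 := by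
  have hcd : Continuous (deriv φ) := (contDiff_infty_iff_deriv.1 hφ.1).2.continuous
  have : ∀ t > 10, deriv φ t = 0 := by
    intro t ht
    have : φ =ᶠ[nhds t] fun _ => 0 := by
      filter_upwards [lt_mem_nhds ht] with s hs using hφ.2.2.1 s hs.le
    rw [this.deriv_eq]; simp
  rcases ht.lt_or_eq with h | h
  · exact this t h
  · rw [← h]
    have hcl : closure (Ioi (10:ℝ)) ⊆ {t | deriv φ t = 0} := 
      closure_minimal (fun t ht => this t ht) (isClosed_eq hcd continuous_const)
    exact hcl (by rw [closure_Ioi]; simp)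

lemma mono_deriv {a b c M ε : ℝ} {φ : ℝ → ℝ} (hφ : AdmissibleCutoff φ) {u : E3 → M3} (h : Sol a b c M ε u) (x0 : E3) {t : ℝ}
    (hx : ∀ y : E3, ‖y‖ ^ 2 < 10 → x0 + t • y ∈ ball (0:E3) 4) :
    HasDerivAt (Fm a b c ε φ u x0) (2 * t * ∫ y, (1 / ε ^ 2 * fbulk a b c (u (x0 + t • y)) * φ (‖y‖ ^ 2)
      - deriv φ (‖y‖ ^ 2) * frobSq (dirD u y (x0 + t • y)))) t := by
  have hu := h.sm
  have he := sm_eDen a b c ε hu h.s0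
  have h1 := (hasDerivAt_pow 2 t).mul (deriv_scale he hφ.1.continuous hφ.2.2.1 x0 t)
  refine HasDerivAt.congr_deriv (f := Fm a b c ε φ u x0) h1 ?_
  have cφ := cpt_rad hφ.2.2.1
  have sφ := sm_rad hφ.1
  have sdφ : Continuous fun y : E3 => deriv φ (‖y‖ ^ 2) :=
    (contDiff_infty_iff_deriv.1 hφ.1).2.continuous.comp (by fun_prop)
  have cdφ : HasCompactSupport fun y : E3 => deriv φ (‖y‖ ^ 2) := cpt_rad (dphi_zero hφ)
  -- key integration by parts
  have key : ∀ i j : Fin 3, t * ∫ y, D i (fun y => dot (pd u i y) (pd u j y)) (x0 + t • y) * (y j * φ (‖y‖ ^ 2))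
      = - ∫ y, dot (pd u i (x0 + t • y)) (pd u j (x0 + t • y)) * ((if i = j then 1 else 0) * φ (‖y‖ ^ 2)
        + y j * (2 * y i * deriv φ (‖y‖ ^ 2))) := by
    intro i j
    have := ibp (sm_scale (sm_stress hu i j) x0 t) ((sm_coord j).mul sφ) (cφ.mul_left) i
    simp only [D_scale (sm_stress hu i j), D_mul (sm_coord j) sφ, D_coord, D_rad hφ.1] at this
    rw [← this, ← integral_const_mul]
    congr 1; ext y; simp only [Pi.mul_apply]; ring
  have cst : ∀ i j, Continuous fun y => dot (pd u i (x0 + t • y)) (pd u j (x0 + t • y)) := fun i j =>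
    (sm_scale (sm_stress hu i j) x0 t).continuous
  have cdst : ∀ i j, Continuous fun y => D i (fun y => dot (pd u i y) (pd u j y)) (x0 + t • y) := fun i j =>
    (sm_scale (contDiff_D (sm_stress hu i j) i) x0 t).continuous
  have cy : ∀ j : Fin 3, Continuous fun y : E3 => y j := fun j => (sm_coord j).continuous
  have e1 : ∫ y, (∑ k, y k * D k (eDen a b c ε u) (x0 + t • y)) * φ (‖y‖ ^ 2)
      = ∑ j, ∑ i, ∫ y, D i (fun y => dot (pd u i y) (pd u j y)) (x0 + t • y) * (y j * φ (‖y‖ ^ 2)) := by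
    have int : ∀ i j, Integrable fun y : E3 => D i (fun y => dot (pd u i y) (pd u j y)) (x0 + t • y) * (y j * φ (‖y‖ ^ 2)) :=
      fun i j => ((cdst i j).mul ((cy j).mul sφ.continuous)).integrable_of_hasCompactSupport (cφ.mul_left.mul_left)
    rw [show (∑ j, ∑ i, ∫ y, D i (fun y => dot (pd u i y) (pd u j y)) (x0 + t • y) * (y j * φ (‖y‖ ^ 2)))
      = ∑ j, ∫ y, ∑ i, D i (fun y => dot (pd u i y) (pd u j y)) (x0 + t • y) * (y j * φ (‖y‖ ^ 2)) from
      Finset.sum_congr rfl fun j _ => (integral_finsetSum _ fun i _ => int i j).symm]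
    rw [← integral_finsetSum _ fun j _ => integrable_finsetSum _ fun i _ => int i j]
    congr 1; ext y
    by_cases hy : 10 ≤ ‖y‖ ^ 2
    · rw [hφ.2.2.1 _ hy]; simp
    · push Not at hy
      rw [Finset.sum_mul]
      refine Finset.sum_congr rfl fun j _ => ?_
      rw [div_stress h (hx y hy) j, Finset.mul_sum, Finset.sum_mul]
      refine Finset.sum_congr rfl fun i _ => by ring
  have e2 : t * ∫ y, (∑ k, y k * D k (eDen a b c ε u) (x0 + t • y)) * φ (‖y‖ ^ 2)
      = - ∫ y, (gradSq u (x0 + t • y) * φ (‖y‖ ^ 2) + 2 * (deriv φ (‖y‖ ^ 2) * frobSq (dirD u y (x0 + t • y)))) := by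
    rw [e1, Finset.mul_sum]
    simp only [Finset.mul_sum, key]
    simp only [Finset.sum_neg_distrib]
    congr 1
    have int : ∀ i j : Fin 3, Integrable fun y : E3 => dot (pd u i (x0 + t • y)) (pd u j (x0 + t • y)) * ((if i = j then 1 else 0) * φ (‖y‖ ^ 2)
        + y j * (2 * y i * deriv φ (‖y‖ ^ 2))) := fun i j =>
      ((cst i j).mul ((continuous_const.mul sφ.continuous).add ((cy j).mul ((continuous_const.mul (cy i)).mul sdφ)))).integrable_of_hasCompactSupport
        ((cφ.mul_left.add (cdφ.mul_left.mul_left)).mul_left)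
    rw [show (∑ j, ∑ i, ∫ y, dot (pd u i (x0 + t • y)) (pd u j (x0 + t • y)) * ((if i = j then 1 else 0) * φ (‖y‖ ^ 2)
        + y j * (2 * y i * deriv φ (‖y‖ ^ 2)))) = ∑ j, ∫ y, ∑ i, dot (pd u i (x0 + t • y)) (pd u j (x0 + t • y)) * ((if i = j then 1 else 0) * φ (‖y‖ ^ 2)
        + y j * (2 * y i * deriv φ (‖y‖ ^ 2))) from Finset.sum_congr rfl fun j _ => (integral_finsetSum _ fun i _ => int i j).symm]
    rw [← integral_finsetSum _ fun j _ => integrable_finsetSum _ fun i _ => int i j]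
    congr 1; ext y
    rw [frobSq_dirD]
    simp only [gradSq, frobSq_eq_dot, Fin.sum_univ_three, dot_comm (pd u 1 _) (pd u 0 _),
      dot_comm (pd u 2 _) (pd u 0 _), dot_comm (pd u 2 _) (pd u 1 _)]
    norm_num [Fin.ext_iff]
    ring
  rw [show t ^ 2 * ∫ y, (∑ k, y k * D k (eDen a b c ε u) (x0 + t • y)) * φ (‖y‖ ^ 2)
    = t * (t * ∫ y, (∑ k, y k * D k (eDen a b c ε u) (x0 + t • y)) * φ (‖y‖ ^ 2)) by ring, e2]
  rw [← integral_neg, ← integral_const_mul, ← integral_const_mul, ← integral_const_mul, ← integral_add]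
  · congr 1; ext y; unfold eDen; norm_num; ring
  · exact (int_gphi hφ (sm_scale he x0 t).continuous).const_mul _
  · refine Integrable.const_mul (Integrable.neg (Integrable.add (int_gphi hφ (sm_scale (sm_gradSq hu) x0 t).continuous) ?_)) _
    refine Integrable.const_mul ?_ _
    exact (sdφ.mul (cont_dirD hu continuous_id (by fun_prop))).integrable_of_hasCompactSupport cdφ.mul_right

end Part11

section Part12

/-! ### P12: consequences of monotonicity -/

lemma dirD_smul (u : E3 → M3) (t : ℝ) (v x : E3) : dirD u (t • v) x = t • dirD u v x := by
  unfold dirD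
  rw [Finset.smul_sum]
  refine Finset.sum_congr rfl fun k _ => ?_
  simp [mul_smul]

lemma mem_scale {x0 y : E3} {t R S : ℝ} (ht : 0 < t) (hy : ‖y‖ < R) (h : t * R ≤ S) : x0 + t • y ∈ ball x0 S := by
  rw [mem_ball, dist_eq_norm, add_sub_cancel_left, norm_smul, Real.norm_of_nonneg ht.le]
  nlinarith

lemma lt4 {y : E3} (h : ‖y‖ ^ 2 < 10) : ‖y‖ < 4 := by nlinarith [norm_nonneg y]

lemma Fm_int_nonneg {a b c M ε : ℝ} (ha : 0 ≤ a) (hb : 0 < b) (hc : 0 < c) {φ : ℝ → ℝ} (hφ : AdmissibleCutoff φ) {u : E3 → M3}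
    (h : Sol a b c M ε u) (x0 : E3) (t : ℝ) (y : E3) :
    0 ≤ 1 / ε ^ 2 * fbulk a b c (u (x0 + t • y)) * φ (‖y‖ ^ 2)
      - deriv φ (‖y‖ ^ 2) * frobSq (dirD u y (x0 + t • y)) := by
  have h1 := fbulk_nonneg ha hb hc (h.s0 (x0 + t • y))
  have h2 := hφ.2.1 (‖y‖ ^ 2)
  have h3 := hφ.2.2.2.2.2.2.2 (‖y‖ ^ 2) (sq_nonneg _)
  have h4 := frobSq_nonneg (dirD u y (x0 + t • y))
  have : 0 ≤ 1 / ε ^ 2 * fbulk a b c (u (x0 + t • y)) * φ (‖y‖ ^ 2) := by positivity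
  nlinarith

lemma Fm_int {a b c M ε : ℝ} {φ : ℝ → ℝ} (hφ : AdmissibleCutoff φ) {u : E3 → M3}
    (h : Sol a b c M ε u) (x0 : E3) (t : ℝ) :
    Integrable fun y => 1 / ε ^ 2 * fbulk a b c (u (x0 + t • y)) * φ (‖y‖ ^ 2)
      - deriv φ (‖y‖ ^ 2) * frobSq (dirD u y (x0 + t • y)) := by
  have sdφ : Continuous fun y : E3 => deriv φ (‖y‖ ^ 2) :=
    (contDiff_infty_iff_deriv.1 hφ.1).2.continuous.comp (by fun_prop)
  have cdφ : HasCompactSupport fun y : E3 => deriv φ (‖y‖ ^ 2) := cpt_rad (dphi_zero hφ)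
  refine Integrable.sub (int_gphi hφ (g := fun y => 1 / ε ^ 2 * fbulk a b c (u (x0 + t • y))) ?_) ?_
  · exact continuous_const.mul (sm_scale (sm_fbulk a b c h.sm h.s0) x0 t).continuous
  · exact (sdφ.mul (cont_dirD h.sm continuous_id (by fun_prop))).integrable_of_hasCompactSupport cdφ.mul_right

lemma pinch {a b c M ε : ℝ} (ha : 0 ≤ a) (hb : 0 < b) (hc : 0 < c) {φ : ℝ → ℝ} (hφ : AdmissibleCutoff φ) {u : E3 → M3}
    (h : Sol a b c M ε u) {η : ℝ} (hη : Fm a b c ε φ u 0 1 - Fm a b c ε φ u 0 (1/2) < η) :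
    ∫ y in ball (0:E3) (7/5), (1 / ε ^ 2 * fbulk a b c (u y) + frobSq (dirD u y y)) ≤ η := by
  have hmem : ∀ t ∈ Icc (1/2:ℝ) 1, ∀ y : E3, ‖y‖ ^ 2 < 10 → (0:E3) + t • y ∈ ball (0:E3) 4 := by
    intro t ht y hy
    exact mem_scale (R := 4) (by linarith [ht.1]) (lt4 hy) (by linarith [ht.2])
  obtain ⟨t, ht, hd⟩ := exists_hasDerivAt_eq_slope (Fm a b c ε φ u 0) _ (show (1/2:ℝ) < 1 by norm_num)
    (fun t ht => (mono_deriv hφ h 0 (hmem t ht)).continuousAt.continuousWithinAt)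
    (fun t ht => mono_deriv hφ h 0 (hmem t ⟨ht.1.le, ht.2.le⟩))
  have ht0 : 0 < t := by linarith [ht.1]
  set G : E3 → ℝ := fun z => 1 / ε ^ 2 * fbulk a b c (u z) + (t ^ 2)⁻¹ * frobSq (dirD u z z) with hG
  have cG : Continuous G := (continuous_const.mul (sm_fbulk a b c h.sm h.s0).continuous).add
    (continuous_const.mul (cont_dirD h.sm continuous_id continuous_id))
  have G0 : ∀ z, 0 ≤ G z := fun z => by
    have := fbulk_nonneg ha hb hc (h.s0 z)
    have := frobSq_nonneg (dirD u z z)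
    rw [hG]; positivity
  have h1 : ∫ y in ball (0:E3) (14/5), G (0 + t • y) ≤ ∫ y, (1 / ε ^ 2 * fbulk a b c (u (0 + t • y)) * φ (‖y‖ ^ 2)
      - deriv φ (‖y‖ ^ 2) * frobSq (dirD u y (0 + t • y))) := by
    refine le_trans ?_ (setIntegral_le_integral (Fm_int hφ h 0 t) (s := ball (0:E3) (14/5)) (.of_forall (Fm_int_nonneg ha hb hc hφ h 0 t)))
    refine setIntegral_mono_on (intOn_ball (cG.comp (by fun_prop)) 0 _) (Fm_int hφ h 0 t).integrableOn measurableSet_ball ?_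
    intro y hy
    simp only [mem_ball, dist_zero_right] at hy
    have hq : ‖y‖ ^ 2 ∈ Icc (0:ℝ) 8 := ⟨sq_nonneg _, by nlinarith [norm_nonneg y]⟩
    have b1 := hφ.2.2.2.1 _ hq
    have b2 := (hφ.2.2.2.2.2.2.1 _ hq).2
    have b3 := fbulk_nonneg ha hb hc (h.s0 (0 + t • y))
    have b4 := frobSq_nonneg (dirD u y (0 + t • y))
    have e : G (0 + t • y) = 1 / ε ^ 2 * fbulk a b c (u (0 + t • y)) + frobSq (dirD u y (0 + t • y)) := by
      rw [hG]; simp only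
      rw [show dirD u (0 + t • y) (0 + t • y) = t • dirD u y (0 + t • y) by rw [← dirD_smul, zero_add], frobSq_smul]
      field_simp
    rw [e]
    have b5 : 0 ≤ 1 / ε ^ 2 * fbulk a b c (u (0 + t • y)) := by positivity
    nlinarith
  rw [int_scale 0 ht0] at h1
  have h2 : ∫ y in ball (0:E3) (7/5), (1 / ε ^ 2 * fbulk a b c (u y) + frobSq (dirD u y y)) ≤ ∫ z in ball (0:E3) (t * (14/5)), G z := by
    refine le_trans ?_ (setIntegral_mono_set (intOn_ball cG 0 _) (.of_forall G0)
      (ball_subset_ball (show (7/5:ℝ) ≤ t * (14/5) by linarith [ht.1])).eventuallyLE)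
    refine setIntegral_mono (intOn_ball ((continuous_const.mul (sm_fbulk a b c h.sm h.s0).continuous).add
      (cont_dirD h.sm continuous_id continuous_id)) 0 _) (intOn_ball cG 0 _) fun z => ?_
    have := frobSq_nonneg (dirD u z z)
    have h3 : 1 ≤ (t ^ 2)⁻¹ := (one_le_inv₀ (by positivity)).2 (by nlinarith [ht.2])
    rw [hG]; simp only
    nlinarith
  set W := ∫ y in ball (0:E3) (7/5), (1 / ε ^ 2 * fbulk a b c (u y) + frobSq (dirD u y y))
  have hW : 0 ≤ W := by
    refine integral_nonneg fun z => ?_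
    have := fbulk_nonneg ha hb hc (h.s0 z)
    have := frobSq_nonneg (dirD u z z)
    simp only [Pi.zero_apply]
    positivity
  have h4 : (t ^ 3)⁻¹ * W ≤ ∫ y, (1 / ε ^ 2 * fbulk a b c (u (0 + t • y)) * φ (‖y‖ ^ 2)
      - deriv φ (‖y‖ ^ 2) * frobSq (dirD u y (0 + t • y))) :=
    le_trans (mul_le_mul_of_nonneg_left h2 (by positivity)) h1
  have h5 : 2 * W ≤ 2 * t * ((t ^ 3)⁻¹ * W) := by
    rw [show 2 * t * ((t ^ 3)⁻¹ * W) = 2 * ((t ^ 2)⁻¹ * W) by field_simp]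
    have h3 : 1 ≤ (t ^ 2)⁻¹ := (one_le_inv₀ (by positivity)).2 (by nlinarith [ht.2])
    nlinarith
  have h6 := mul_le_mul_of_nonneg_left h4 (show 0 ≤ 2 * t by positivity)
  rw [hd] at h6
  have : (Fm a b c ε φ u 0 1 - Fm a b c ε φ u 0 (1/2)) / (1 - 1/2) = 2 * (Fm a b c ε φ u 0 1 - Fm a b c ε φ u 0 (1/2)) := by ring
  linarith

lemma mono_energy {a b c M ε : ℝ} (ha : 0 ≤ a) (hb : 0 < b) (hc : 0 < c) {φ : ℝ → ℝ} (hφ : AdmissibleCutoff φ) {u : E3 → M3}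
    (h : Sol a b c M ε u) {x0 : E3} {ρ R : ℝ} (hρ : 0 < ρ) (hR : ρ ≤ R) (hb4 : ball x0 (4 * R) ⊆ ball (0:E3) 4) :
    ρ⁻¹ * ∫ y in ball x0 (2 * ρ), eDen a b c ε u y ≤ 60 * (R⁻¹ * ∫ y in ball x0 (4 * R), eDen a b c ε u y) := by
  have hR0 : 0 < R := hρ.trans_le hR
  have he := (sm_eDen a b c ε h.sm h.s0)
  have hmem : ∀ t ∈ Icc ρ R, ∀ y : E3, ‖y‖ ^ 2 < 10 → x0 + t • y ∈ ball (0:E3) 4 := by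
    intro t ht y hy
    exact hb4 (mem_scale (R := 4) (by linarith [ht.1]) (lt4 hy) (by linarith [ht.2]))
  have mono : MonotoneOn (Fm a b c ε φ u x0) (Icc ρ R) := by
    refine monotoneOn_of_deriv_nonneg (convex_Icc ρ R)
      (fun t ht => (mono_deriv hφ h x0 (hmem t ht)).continuousAt.continuousWithinAt)
      (fun t ht => (mono_deriv hφ h x0 (hmem t (interior_subset ht))).differentiableAt.differentiableWithinAt) ?_
    intro t ht
    rw [(mono_deriv hφ h x0 (hmem t (interior_subset ht))).deriv]
    have := (interior_subset ht : t ∈ Icc ρ R).1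
    exact mul_nonneg (by linarith) (integral_nonneg (Fm_int_nonneg ha hb hc hφ h x0 t))
  have h1 := mono ⟨le_rfl, hR⟩ ⟨hR, le_rfl⟩ hR
  have e0 : ∀ y, 0 ≤ eDen a b c ε u y := fun y => eDen_nonneg ha hb hc ε (h.s0 y)
  have lo : ρ⁻¹ * ∫ y in ball x0 (2 * ρ), eDen a b c ε u y ≤ Fm a b c ε φ u x0 ρ := by
    have e1 := int_scale (g := eDen a b c ε u) x0 hρ 2
    rw [mul_comm ρ 2] at e1
    have : ρ⁻¹ * ∫ y in ball x0 (2 * ρ), eDen a b c ε u y = ρ ^ 2 * ∫ y in ball (0:E3) 2, eDen a b c ε u (x0 + ρ • y) := by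
      rw [e1]; field_simp
    rw [this]
    unfold Fm
    gcongr
    refine le_trans ?_ (setIntegral_le_integral (int_gphi hφ (sm_scale he x0 ρ).continuous) (s := ball (0:E3) 2)
      (.of_forall fun y => mul_nonneg (e0 _) (hφ.2.1 _)))
    refine setIntegral_mono_on (intOn_ball (sm_scale he x0 ρ).continuous 0 _) (int_gphi hφ (sm_scale he x0 ρ).continuous).integrableOn measurableSet_ball ?_
    intro y hy
    simp only [mem_ball, dist_zero_right] at hy
    have b1 := hφ.2.2.2.1 (‖y‖ ^ 2) ⟨sq_nonneg _, by nlinarith [norm_nonneg y]⟩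
    nlinarith [e0 (x0 + ρ • y)]
  have hi : Fm a b c ε φ u x0 R ≤ 60 * (R⁻¹ * ∫ y in ball x0 (4 * R), eDen a b c ε u y) := by
    have e1 := int_scale (g := eDen a b c ε u) x0 hR0 4
    rw [mul_comm R 4] at e1
    have : 60 * (R⁻¹ * ∫ y in ball x0 (4 * R), eDen a b c ε u y) = R ^ 2 * (∫ y in ball (0:E3) 4, 60 * eDen a b c ε u (x0 + R • y)) := by
      rw [integral_const_mul, e1]; field_simp
    rw [this]
    unfold Fm
    gcongr
    rw [← setIntegral_eq_integral_of_forall_compl_eq_zero (s := ball (0:E3) 4)]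
    · refine setIntegral_mono_on (int_gphi hφ (sm_scale he x0 R).continuous).integrableOn
        ((intOn_ball (sm_scale he x0 R).continuous 0 _).const_mul _) measurableSet_ball ?_
      intro y hy
      nlinarith [e0 (x0 + R • y), phi_le hφ (sq_nonneg ‖y‖)]
    · intro y hy
      simp at hy
      rw [hφ.2.2.1 _ (by nlinarith), mul_zero]
  linarith

end Part12

section Part13

/-! ### P13: epsilon regularity -/

lemma eps_reg {a b c : ℝ} (ha : 0 ≤ a) (hb : 0 < b) (hc : 0 < c) {φ : ℝ → ℝ} (hφ : AdmissibleCutoff φ)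
    (M : ℝ) (hM : 0 ≤ M) :
    ∃ τ > 0, ∀ ε, 0 < ε → ∀ u, Sol a b c M ε u → (∫ y in ball (0:E3) (3/4), eDen a b c ε u y) ≤ τ →
      ∀ x ∈ ball (0:E3) (1/2), eDen a b c ε u x ≤ 4 := by
  obtain ⟨C, hC, hboch⟩ := bochner_sq ha hb hc M hM
  have hV := VB_pos
  set K := 60 / VB * Real.exp (5 * (4 * C) / 2 / 1024) with hK
  have hK0 : 0 < K := by positivity
  refine ⟨1 / (K * 1024 * 3840 * 2), by positivity, ?_⟩
  intro ε hε u h hE y0 hy0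
  set e := eDen a b c ε u with he
  have hesm : ContDiff ℝ ∞ e := sm_eDen a b c ε h.sm h.s0
  have he0 : ∀ y, 0 ≤ e y := fun y => eDen_nonneg ha hb hc ε (h.s0 y)
  obtain ⟨y1, hy1, hmax⟩ := (isCompact_closedBall y0 (1/8:ℝ)).exists_isMaxOn ⟨y0, mem_closedBall_self (by norm_num)⟩
    (f := fun y => (1/8 - ‖y - y0‖) ^ 2 * e y) (by
      have := hesm.continuous
      fun_prop)
  by_contra! hcon
  set σ := 1/8 - ‖y1 - y0‖ with hσ
  set e1 := e y1 with he1
  have hy1' : ‖y1 - y0‖ ≤ 1/8 := by simpa [dist_eq_norm] using hy1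
  have hσ0 : 0 ≤ σ := by linarith
  have hσ8 : σ ≤ 1/8 := by linarith [norm_nonneg (y1 - y0)]
  have h1 : 1/16 < σ ^ 2 * e1 := by
    have := hmax (mem_closedBall_self (x := y0) (show (0:ℝ) ≤ 1/8 by norm_num))
    simp only [mem_ofPred_eq, sub_self, norm_zero, sub_zero] at this
    rw [← hσ, ← he1] at this
    norm_num at this
    linarith
  have he1p : 0 < e1 := by
    rcases (he0 y1).lt_or_eq with h | h
    · exact h
    · rw [← he1] at h; rw [← h] at h1; norm_num at h1
  set q := Real.sqrt e1 with hq
  have hqp : 0 < q := Real.sqrt_pos.2 he1p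
  have hq2 : q ^ 2 = e1 := Real.sq_sqrt he1p.le
  have hσq : 1/4 < σ * q := by
    rw [← hq2] at h1
    by_contra! hh
    have : 0 ≤ σ * q := by positivity
    nlinarith
  set t := 1 / (32 * q) with ht
  have htp : 0 < t := by positivity
  have htq : t * q = 1/32 := by rw [ht]; field_simp
  have h8t : 8 * t < σ := by
    by_contra! hh
    nlinarith
  have hsub : ball y1 (4 * t) ⊆ closedBall y0 (1/8) := by
    intro y hy
    rw [mem_ball] at hy; rw [mem_closedBall]
    have := dist_triangle y y1 y0
    rw [dist_eq_norm y1 y0] at this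
    linarith
  have hb4 : ∀ y ∈ ball y1 (4 * t), e y ≤ 4 * e1 := by
    intro y hy
    have h2 := hmax (hsub hy)
    simp only [mem_ofPred_eq] at h2
    rw [← hσ, ← he1] at h2
    have h3 : σ / 2 ≤ 1/8 - ‖y - y0‖ := by
      rw [mem_ball] at hy
      have := dist_triangle y y1 y0
      rw [dist_eq_norm y1 y0, dist_eq_norm y y0] at this
      linarith
    have h4 : (σ/2) ^ 2 ≤ (1/8 - ‖y - y0‖) ^ 2 := by gcongr
    have h5 : (σ/2) ^ 2 * e y ≤ σ ^ 2 * e1 := (mul_le_mul_of_nonneg_right h4 (he0 y)).trans h2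
    have : 0 < σ ^ 2 := by
      have : 0 < σ := by linarith
      positivity
    nlinarith
  have hy1b : y1 ∈ ball (0:E3) (5/8) := by
    rw [mem_ball] at *
    have := dist_triangle y1 y0 0
    rw [dist_eq_norm y1 y0] at this
    linarith
  have hs3 : ball y1 (1/8) ⊆ ball (0:E3) (3/4) := ball_sub hy1b (by norm_num)
  have hm := mean_value hφ hesm y1 htp (A := 4 * C * e1) (by positivity) (fun y _ => he0 y) (by
    intro y hy
    have h34 : y ∈ ball (0:E3) (3/4) := hs3 (ball_subset_ball (by linarith) hy)
    have hB := hboch ε hε u h y (ball_subset_ball (by norm_num) h34)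
    refine le_trans ?_ hB
    have := hb4 y hy
    have h0 := he0 y
    change -(4 * C * e1) * e y ≤ -C * e y ^ 2
    have : C * (e y * e y) ≤ C * (4 * e1 * e y) := by gcongr
    nlinarith)
  have hmo := mono_energy ha hb hc hφ h (x0 := y1) (ρ := 2 * t) (R := 1/32) (by positivity) (by linarith) (by
    rw [show (4:ℝ) * (1/32) = 1/8 by norm_num]
    exact hs3.trans (ball_subset_ball (by norm_num)))
  rw [show (2:ℝ) * (2 * t) = 4 * t by ring, show (4:ℝ) * (1/32) = 1/8 by norm_num] at hmo
  have hle : ∫ y in ball y1 (1/8), e y ≤ ∫ y in ball (0:E3) (3/4), e y :=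
    setIntegral_mono_set (intOn_ball hesm.continuous _ _) (ae_of_all _ he0) (LE.le.eventuallyLE hs3)
  rw [show 5 * (4 * C * e1) / 2 * t ^ 2 = 5 * (4 * C) / 2 / 1024 by
    have : e1 * t ^ 2 = 1/1024 := by rw [← hq2, ← mul_pow, mul_comm, htq]; norm_num
    linear_combination (5 * (4 * C) / 2) * this, ← hK] at hm
  set I := ∫ y in ball y1 (4 * t), e y with hI
  have hI2 : t⁻¹ * I ≤ 3840 * (1 / (K * 1024 * 3840 * 2)) := by
    have : (2 * t)⁻¹ * I = t⁻¹ * I / 2 := by rw [mul_inv]; ring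
    rw [this] at hmo
    have : (1/32:ℝ)⁻¹ = 32 := by norm_num
    rw [this] at hmo
    linarith
  have h9 : (t ^ 3)⁻¹ * I = 1024 * e1 * (t⁻¹ * I) := by
    have : (t^2)⁻¹ = 1024 * e1 := by
      rw [← hq2, ht]; field_simp; norm_num
    rw [← this]
    rw [pow_succ, mul_inv]; ring
  rw [h9] at hm
  have : K * (1024 * e1 * (t⁻¹ * I)) ≤ K * (1024 * e1 * (3840 * (1 / (K * 1024 * 3840 * 2)))) := by gcongr
  have h10 : K * (1024 * e1 * (3840 * (1 / (K * 1024 * 3840 * 2)))) = e1 / 2 := by field_simp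
  linarith

end Part13

section Part14

/-! ### P14: topological lifting of rank-one projections -/

/-- outer product -/
def op (n : E3) : M3 := Matrix.of fun i j => n i * n j

lemma op_apply (n : E3) (i j : Fin 3) : op n i j = n i * n j := rfl

lemma op_cont : Continuous op := by
  refine continuous_matrix fun i j => ?_
  simp only [op_apply]
  fun_prop

lemma norm_sq_E3 (n : E3) : ‖n‖ ^ 2 = n 0 ^ 2 + n 1 ^ 2 + n 2 ^ 2 := by
  rw [EuclideanSpace.norm_sq_eq, Fin.sum_univ_three]; simp

lemma inner_E3 (n m : E3) : inner ℝ n m = n 0 * m 0 + n 1 * m 1 + n 2 * m 2 := by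
  rw [PiLp.inner_apply, Fin.sum_univ_three]; simp; ring

lemma op_neg (n : E3) : op (-n) = op n := by
  ext i j; simp [op_apply]

lemma op_eq {n m : E3} (hn : ‖n‖ = 1) (hm : ‖m‖ = 1) (h : op n = op m) : n = m ∨ n = -m := by
  have h' : ∀ i j, n i * n j = m i * m j := fun i j => by
    have := congrFun (congrFun h i) j
    simpa [op_apply] using this
  have h1 : (inner ℝ n m) ^ 2 = 1 := by
    have e : (inner ℝ n m) ^ 2 = ‖m‖ ^ 2 * ‖m‖ ^ 2 := by
      rw [inner_E3, norm_sq_E3]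
      linear_combination m 0 * m 0 * h' 0 0 + 2 * m 0 * m 1 * h' 0 1 + 2 * m 0 * m 2 * h' 0 2 + m 1 * m 1 * h' 1 1 + 2 * m 1 * m 2 * h' 1 2 + m 2 * m 2 * h' 2 2
    rw [e, hm]; norm_num
  have h2 : (inner ℝ n m - 1) * (inner ℝ n m + 1) = (0:ℝ) := by linear_combination h1
  rcases mul_eq_zero.1 h2 with h3 | h3
  · left
    have : inner ℝ n m = (1:ℝ) := by linarith
    exact (inner_eq_one_iff_of_norm_eq_one hn hm).1 this
  · right
    have : inner ℝ n (-m) = (1:ℝ) := by rw [inner_neg_right]; linarith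
    exact (inner_eq_one_iff_of_norm_eq_one hn (by rwa [norm_neg])).1 this

/-- the unit sphere -/
abbrev Sp : Type := sphere (0:E3) 1

instance : MulAction ℤˣ Sp where
  smul g x := ⟨((g:ℤ):ℝ) • x.1, by
    rw [mem_sphere_zero_iff_norm, norm_smul, norm_eq_of_mem_sphere, mul_one]
    rcases Int.units_eq_one_or g with h | h <;> simp [h]⟩
  one_smul x := by
    apply Subtype.ext
    change (((1:ℤˣ):ℤ):ℝ) • x.1 = x.1
    simp
  mul_smul g h x := by
    apply Subtype.ext
    change (((g * h:ℤˣ):ℤ):ℝ) • x.1 = ((g:ℤ):ℝ) • (((h:ℤ):ℝ) • x.1)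
    rw [smul_smul]; push_cast; rfl

lemma Sp_smul (g : ℤˣ) (x : Sp) : (g • x).1 = ((g:ℤ):ℝ) • x.1 := rfl

instance : ContinuousConstSMul ℤˣ Sp where
  continuous_const_smul g := by
    refine Continuous.subtype_mk ?_ _
    fun_prop

instance : IsCancelSMul ℤˣ Sp := by
  rw [isCancelSMul_iff_eq_one_of_smul_eq]
  intro g x h
  have h1 := congrArg Subtype.val h
  rw [Sp_smul] at h1
  rcases Int.units_eq_one_or g with hg | hg
  · exact hg
  · exfalso
    rw [hg] at h1
    have h2 : -x.1 = x.1 := by simpa using h1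
    have h3 : x.1 = 0 := by
      have h4 : (2:ℝ) • x.1 = 0 := by
        rw [two_smul]; nth_rewrite 1 [← h2]; simp
      exact (smul_eq_zero.1 h4).resolve_left (by norm_num)
    have := norm_eq_of_mem_sphere x
    rw [h3] at this; simp at this

/-- the projection to rank one projectors -/
def prj (x : Sp) : range (fun x : Sp => op x.1) := ⟨op x.1, x, rfl⟩

lemma prj_cov : IsCoveringMap prj := by
  have hc : Continuous prj := Continuous.subtype_mk (op_cont.comp continuous_subtype_val) _
  have hs : Function.Surjective prj := by
    rintro ⟨_, x, rfl⟩; exact ⟨x, rfl⟩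
  have hq : Topology.IsQuotientMap prj := hc.isClosedMap.isQuotientMap hc hs
  refine (hq.isQuotientCoveringMap_of_properlyDiscontinuousSMul (G := ℤˣ) ?_).isCoveringMap
  intro e₁ e₂
  constructor
  · intro h
    have h1 : op e₁.1 = op e₂.1 := congrArg Subtype.val h
    rcases op_eq (norm_eq_of_mem_sphere e₁) (norm_eq_of_mem_sphere e₂) h1 with h2 | h2
    · exact ⟨1, by simp only [one_smul]; exact Subtype.ext h2.symm⟩
    · exact ⟨-1, Subtype.ext (by simp only [Sp_smul]; rw [h2]; simp)⟩
  · rintro ⟨g, rfl⟩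
    apply Subtype.ext
    change op (g • e₂).1 = op e₂.1
    rw [Sp_smul]
    rcases Int.units_eq_one_or g with h | h <;> simp [h, op_neg]

lemma lift_star {Pm : E3 → M3} {Y : Set E3} (hY : IsOpen Y) {v : E3} (hv : v ∈ Y) (hst : StarConvex ℝ v Y)
    (hc : ContinuousOn Pm Y) (hr : ∀ y ∈ Y, ∃ n : E3, ‖n‖ = 1 ∧ Pm y = op n) :
    ∃ n : E3 → E3, ContinuousOn n Y ∧ ∀ y ∈ Y, ‖n y‖ = 1 ∧ Pm y = op (n y) := by
  have := hst.contractibleSpace ⟨v, hv⟩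
  have := hY.locallyPathConnectedSpace
  have hmem : ∀ y : Y, Pm y.1 ∈ range (fun x : Sp => op x.1) := by
    rintro ⟨y, hy⟩
    obtain ⟨n, hn, h⟩ := hr y hy
    exact ⟨⟨n, by simpa using hn⟩, h.symm⟩
  let f : C(Y, range (fun x : Sp => op x.1)) := ⟨fun y => ⟨Pm y.1, hmem y⟩, by
    refine Continuous.subtype_mk ?_ _
    exact continuousOn_iff_continuous_domRestrict.1 hc⟩
  obtain ⟨e0, he0⟩ := hmem ⟨v, hv⟩
  obtain ⟨F, ⟨-, hF⟩, -⟩ := prj_cov.existsUnique_continuousMap_lifts f ⟨v, hv⟩ e0 (Subtype.ext he0)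
  classical
  refine ⟨fun y => if h : y ∈ Y then (F ⟨y, h⟩).1 else 0, ?_, ?_⟩
  · rw [continuousOn_iff_continuous_domRestrict]
    have : Y.domRestrict (fun y => if h : y ∈ Y then (F ⟨y, h⟩).1 else 0) = fun y => (F y).1 := by
      ext1 y
      simp [domRestrict_apply]
    rw [this]
    exact continuous_subtype_val.comp F.continuous
  · intro y hy
    simp only [hy, dif_pos]
    refine ⟨norm_eq_of_mem_sphere _, ?_⟩
    have := congrArg Subtype.val (congrFun hF ⟨y, hy⟩)
    exact this.symm

/-- complement of a ray -/
def Ray (v : E3) : Set E3 := {y | ∀ c : ℝ, 0 ≤ c → y ≠ -(c • v)}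

lemma Ray_star {v : E3} (hv : ‖v‖ = 1) : StarConvex ℝ v (Ray v) := by
  rw [starConvex_iff_segment_subset]
  intro y hy z hz c hc hzc
  obtain ⟨p, q, hp, hq, hpq, rfl⟩ := hz
  rcases hq.eq_or_lt with h0 | h0
  · rw [← h0] at hzc hpq
    have hp1 : p = 1 := by linarith
    rw [hp1] at hzc
    have h2 : (1 + c) • v = 0 := by
      rw [add_smul]; 
      simp only [one_smul, zero_smul, add_zero] at hzc ⊢
      nth_rewrite 1 [hzc]; simp
    rcases smul_eq_zero.1 h2 with h | h
    · linarith
    · rw [h] at hv; simp at hv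
  · refine hy ((c + p) / q) (by positivity) ?_
    have : q • y = -((c + p) • v) := by
      have : q • y = (p • v + q • y) - p • v := by abel
      rw [this, hzc, add_smul]; abel
    have h3 : y = q⁻¹ • (q • y) := by rw [smul_smul, inv_mul_cancel₀ h0.ne', one_smul]
    rw [h3, this, smul_neg, smul_smul]; congr 2; field_simp

lemma Ray_open {v : E3} (hv : ‖v‖ = 1) : IsOpen (Ray v) := by
  have : (Ray v)ᶜ = (fun c : ℝ => -(c • v)) '' Ici 0 := by
    ext y
    simp only [Ray, mem_compl_iff, mem_ofPred_eq, mem_image, mem_Ici]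
    push Not
    constructor
    · rintro ⟨c, hc, h⟩; exact ⟨c, hc, h.symm⟩
    · rintro ⟨c, hc, h⟩; exact ⟨c, hc, h.symm⟩
  rw [← isClosed_compl_iff, this]
  have hi : Topology.IsClosedEmbedding (fun c : ℝ => -(c • v)) := by
    have : Isometry (fun c : ℝ => -(c • v)) := by
      refine Isometry.of_dist_eq fun x y => ?_
      rw [dist_neg_neg, dist_eq_norm, ← sub_smul, norm_smul, hv, mul_one, dist_eq_norm]
    exact this.isClosedEmbedding
  exact hi.isClosedMap _ isClosed_Ici

lemma lift_top {Pm : E3 → M3} (hc : ContinuousOn Pm {0}ᶜ)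
    (hr : ∀ y, y ≠ 0 → ∃ n : E3, ‖n‖ = 1 ∧ Pm y = op n) :
    ∃ n : E3 → E3, ContinuousOn n {0}ᶜ ∧ ∀ y, y ≠ 0 → ‖n y‖ = 1 ∧ Pm y = op (n y) := by
  set v : E3 := EuclideanSpace.single 0 1 with hv
  have hv1 : ‖v‖ = 1 := by simp [hv]
  have hv1' : ‖-v‖ = 1 := by simp [hv]
  have key : ∀ v : E3, ‖v‖ = 1 → ∃ n : E3 → E3, ContinuousOn n (Ray v) ∧ ∀ y ∈ Ray v, ‖n y‖ = 1 ∧ Pm y = op (n y) := by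
    intro v hv
    have h0 : ∀ y ∈ Ray v, y ≠ 0 := fun y hy => by simpa using hy 0 le_rfl
    refine lift_star (Ray_open hv) (v := v) ?_ (Ray_star hv) (hc.mono fun y hy => h0 y hy) fun y hy => hr y (h0 y hy)
    intro c hc h
    have h2 : (1 + c) • v = 0 := by
      rw [add_smul, one_smul]; nth_rewrite 1 [h]; simp
    rcases smul_eq_zero.1 h2 with h | h
    · linarith
    · rw [h] at hv; simp at hv
  obtain ⟨n1, c1, p1⟩ := key v hv1
  obtain ⟨n2, c2, p2⟩ := key (-v) hv1'
  have hconn : IsPreconnected ((Submodule.span ℝ {v} : Submodule ℝ E3) : Set E3)ᶜ := by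
    refine (isConnected_compl_of_one_lt_codim ?_).isPreconnected
    have h1 := Submodule.finrank_quotient_add_finrank (Submodule.span ℝ {v} : Submodule ℝ E3)
    rw [finrank_span_singleton (by rw [← norm_pos_iff, hv1]; norm_num)] at h1
    simp only [finrank_euclideanSpace, Fintype.card_fin] at h1
    rw [← Module.finrank_eq_rank]
    exact_mod_cast (show 1 < Module.finrank ℝ (E3 ⧸ Submodule.span ℝ {v}) by omega)
  have hsub : ((Submodule.span ℝ {v} : Submodule ℝ E3) : Set E3)ᶜ ⊆ Ray v ∩ Ray (-v) := by
    intro y hy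
    constructor
    · intro c _ h; exact hy (by rw [h]; exact Submodule.neg_mem _ (Submodule.smul_mem _ _ (Submodule.mem_span_singleton_self v)))
    · intro c _ h; exact hy (by rw [h]; exact Submodule.neg_mem _ (Submodule.smul_mem _ _ (Submodule.neg_mem _ (Submodule.mem_span_singleton_self v))))
  have hsign : ∃ σ : ℝ, (σ = 1 ∨ σ = -1) ∧ ∀ y ∈ ((Submodule.span ℝ {v} : Submodule ℝ E3) : Set E3)ᶜ, n1 y = σ • n2 y := by
    have hci : ContinuousOn (fun y => (inner ℝ (n1 y) (n2 y) : ℝ)) ((Submodule.span ℝ {v} : Submodule ℝ E3) : Set E3)ᶜ :=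
      (c1.mono fun y hy => (hsub hy).1).inner (𝕜 := ℝ) (c2.mono fun y hy => (hsub hy).2)
    have hval : ∀ y ∈ ((Submodule.span ℝ {v} : Submodule ℝ E3) : Set E3)ᶜ, n1 y = n2 y ∨ n1 y = - n2 y := fun y hy =>
      op_eq (p1 y (hsub hy).1).1 (p2 y (hsub hy).2).1 ((p1 y (hsub hy).1).2.symm.trans (p2 y (hsub hy).2).2)
    by_cases hall : ∀ y ∈ ((Submodule.span ℝ {v} : Submodule ℝ E3) : Set E3)ᶜ, n1 y = n2 y
    · exact ⟨1, Or.inl rfl, fun y hy => by rw [one_smul]; exact hall y hy⟩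
    · push Not at hall
      obtain ⟨y0, hy0, hne⟩ := hall
      refine ⟨-1, Or.inr rfl, fun y hy => ?_⟩
      rcases hval y hy with h | h
      · exfalso
        have h0 := (hval y0 hy0).resolve_left hne
        have i0 : (inner ℝ (n1 y0) (n2 y0) : ℝ) = -1 := by
          rw [h0, inner_neg_left, real_inner_self_eq_norm_sq, (p2 y0 (hsub hy0).2).1]; norm_num
        have i1 : (inner ℝ (n1 y) (n2 y) : ℝ) = 1 := by
          rw [h, real_inner_self_eq_norm_sq, (p2 y (hsub hy).2).1]; norm_num
        have := hconn.intermediate_value hy0 hy hci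
        rw [i0, i1] at this
        obtain ⟨z, hz, hz0⟩ := this (show (0:ℝ) ∈ Icc (-1) 1 by norm_num)
        simp only at hz0
        rcases hval z hz with h | h
        · rw [h, real_inner_self_eq_norm_sq, (p2 z (hsub hz).2).1] at hz0; norm_num at hz0
        · rw [h, inner_neg_left, real_inner_self_eq_norm_sq, (p2 z (hsub hz).2).1] at hz0; norm_num at hz0
      · simpa using h
  obtain ⟨σ, hσ, hs⟩ := hsign
  have hcover : ∀ y, y ≠ 0 → y ∉ Ray v → y ∈ Ray (-v) := by
    intro y hy h1
    simp only [Ray, mem_ofPred_eq] at h1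
    push Not at h1
    obtain ⟨c, hc, rfl⟩ := h1
    intro d hd h
    have h2 : (c + d) • v = 0 := by
      rw [add_smul]
      have : c • v = -(d • v) := by
        rw [smul_neg, neg_neg] at h
        rw [← h, neg_neg]
      rw [this]; simp
    rcases smul_eq_zero.1 h2 with h | h
    · apply hy
      have : c = 0 := by linarith
      rw [this]; simp
    · rw [h] at hv1; simp at hv1
  classical
  have hagree : ∀ y ∈ Ray (-v), (if y ∈ Ray v then n1 y else σ • n2 y) = σ • n2 y := by
    intro y hy
    by_cases h : y ∈ Ray v
    · rw [if_pos h]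
      apply hs
      intro hm
      obtain ⟨c, rfl⟩ := Submodule.mem_span_singleton.1 hm
      rcases le_total 0 c with hc | hc
      · exact hy c hc (by simp)
      · exact h (-c) (by linarith) (by simp)
    · rw [if_neg h]
  refine ⟨fun y => if y ∈ Ray v then n1 y else σ • n2 y, ?_, ?_⟩
  · intro y hy
    by_cases h : y ∈ Ray v
    · have : ContinuousAt n1 y := c1.continuousAt ((Ray_open hv1).mem_nhds h)
      refine (this.congr ?_).continuousWithinAt
      filter_upwards [(Ray_open hv1).mem_nhds h] with z hz
      rw [if_pos hz]
    · have h2 := hcover y hy h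
      have : ContinuousAt (fun y => σ • n2 y) y := (c2.continuousAt ((Ray_open hv1').mem_nhds h2)).const_smul σ
      refine (this.congr ?_).continuousWithinAt
      filter_upwards [(Ray_open hv1').mem_nhds h2] with z hz
      rw [hagree z hz]
  · intro y hy
    simp only
    by_cases h : y ∈ Ray v
    · rw [if_pos h]; exact p1 y h
    · rw [if_neg h]
      have h2 := p2 y (hcover y hy h)
      rcases hσ with h | h <;> simp [h, h2, op_neg]

end Part14

section Part15

/-! ### P15: the spectral projector near the vacuum manifold -/

open scoped Topology

/-- the uniaxial matrix -/
def Nn (s : ℝ) (n : E3) : M3 := s • (op n - (1/3:ℝ) • (1 : M3))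

lemma proj_op {P : M3} (hs : P.IsSymm) (hi : P * P = P) (ht : P.trace = 1) : ∃ n : E3, ‖n‖ = 1 ∧ P = op n := by
  have hsym : ∀ i j, P i j = P j i := fun i j => hs.apply j i
  have hid : ∀ i j, ∑ k, P i k * P k j = P i j := fun i j => by
    rw [← Matrix.mul_apply, hi]
  have hex : ∃ i, 0 < P i i := by
    by_contra! h
    have : P.trace ≤ 0 := by
      rw [Matrix.trace]; exact Finset.sum_nonpos fun i _ => h i
    rw [ht] at this; linarith
  obtain ⟨i, hpi⟩ := hex
  set q := Real.sqrt (P i i) with hq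
  have hq0 : 0 < q := Real.sqrt_pos.2 hpi
  have hq2 : q ^ 2 = P i i := Real.sq_sqrt hpi.le
  set n : E3 := WithLp.toLp 2 (fun k => P k i / q) with hn
  have hnk : ∀ k, n k = P k i / q := fun k => rfl
  have hn1 : ‖n‖ ^ 2 = 1 := by
    rw [EuclideanSpace.norm_sq_eq]
    have : ∀ k, ‖n k‖ ^ 2 = (P i k * P k i) / P i i := fun k => by
      rw [hnk, Real.norm_eq_abs, sq_abs, div_pow, hq2, hsym i k]; ring
    simp only [this]
    rw [← Finset.sum_div, hid i i, div_self hpi.ne']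
  have hPn : ∀ k, ∑ l, P k l * n l = n k := fun k => by
    simp only [hnk, mul_div_assoc', ← Finset.sum_div, hid k i]
  have hPn' : ∀ k, ∑ l, n l * P l k = n k := fun k => by
    rw [← hPn k]
    exact Finset.sum_congr rfl fun l _ => by rw [hsym l k, mul_comm]
  have hnn : ∑ k, n k * n k = 1 := by
    rw [← hn1, EuclideanSpace.norm_sq_eq]
    exact Finset.sum_congr rfl fun l _ => by rw [Real.norm_eq_abs, sq_abs, sq]
  refine ⟨n, ?_, ?_⟩
  · have := norm_nonneg n
    nlinarith
  · have h0 : frobSq (P - op n) = 0 := by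
      unfold frobSq
      have : ∀ k l, (P - op n) k l ^ 2 = P k l * P l k - n k * (n l * P l k) - (P k l * n l) * n k + (n k * n k) * (n l * n l) := fun k l => by
        rw [Matrix.sub_apply, op_apply, hsym l k]; ring
      simp only [this, Finset.sum_add_distrib, Finset.sum_sub_distrib, ← Finset.mul_sum, ← Finset.sum_mul, hid, hPn, hPn', hnn]
      have : ∑ k, P k k = 1 := ht
      rw [this]; ring
    exact sub_eq_zero.1 (dot_zero_of_S0 h0)

lemma cayley {Q : M3} (h : Q ∈ S0) : Q * Q * Q = (frobSq Q / 2) • Q + Q.det • (1 : M3) := by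
  obtain ⟨x1, x2, x3, x4, x5, rfl⟩ := S0_form h
  rw [Matrix.det_fin_three]
  ext i j
  fin_cases i <;> fin_cases j <;>
    simp [Matrix.mul_apply, Fin.sum_univ_three, frobSq] <;> ring

/-- unnormalised projector -/
def PA (l : ℝ) (Q : M3) : M3 := Q * Q + l • Q + (l ^ 2 - frobSq Q / 2) • (1 : M3)

lemma PA_proj {Q : M3} (h : Q ∈ S0) {l : ℝ} (hl : l ^ 3 = frobSq Q / 2 * l + Q.det) (hd : 3 * l ^ 2 - frobSq Q / 2 ≠ 0) :
    ∃ n : E3, ‖n‖ = 1 ∧ (3 * l ^ 2 - frobSq Q / 2)⁻¹ • PA l Q = op n := by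
  have hQA : Q * PA l Q = l • PA l Q := by
    have hc := cayley h
    unfold PA
    have e : Q * (Q * Q + l • Q + (l ^ 2 - frobSq Q / 2) • (1:M3)) = Q * Q * Q + l • (Q * Q) + (l ^ 2 - frobSq Q / 2) • Q := by
      rw [mul_add, mul_add, ← mul_assoc, Matrix.mul_smul, Matrix.mul_smul, mul_one]
    rw [e, hc]
    ext i j
    simp only [Matrix.add_apply, Matrix.smul_apply, smul_eq_mul]
    linear_combination (- (1:M3) i j) * hl
  have hAA : PA l Q * PA l Q = (3 * l ^ 2 - frobSq Q / 2) • PA l Q := by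
    have e : PA l Q * PA l Q = Q * (Q * PA l Q) + l • (Q * PA l Q) + (l ^ 2 - frobSq Q / 2) • PA l Q := by
      conv_lhs => rw [show PA l Q * PA l Q = (Q * Q + l • Q + (l ^ 2 - frobSq Q / 2) • (1 : M3)) * PA l Q from rfl]
      rw [add_mul, add_mul, mul_assoc, Matrix.smul_mul, Matrix.smul_mul, one_mul]
    rw [e, hQA, Matrix.mul_smul, hQA]
    module
  apply proj_op
  · have hs : Q.IsSymm := h.1
    have : (PA l Q).IsSymm := by
      unfold PA Matrix.IsSymm
      rw [Matrix.transpose_add, Matrix.transpose_add, Matrix.transpose_mul, Matrix.transpose_smul, Matrix.transpose_smul, hs, Matrix.transpose_one]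
    exact this.smul _
  · rw [Matrix.smul_mul, Matrix.mul_smul, hAA, smul_smul (3 * l ^ 2 - frobSq Q / 2)⁻¹ (3 * l ^ 2 - frobSq Q / 2), inv_mul_cancel₀ hd, one_smul]
  · unfold PA
    rw [Matrix.trace_smul, Matrix.trace_add, Matrix.trace_add, trace_sq_S0 h, Matrix.trace_smul, h.2, Matrix.trace_smul, Matrix.trace_one]
    simp only [Fintype.card_fin, smul_eq_mul]
    rw [inv_mul_eq_one₀ hd]
    push_cast
    ring

lemma psi_exists : ∃ (W : Set ℝ) (ψ : ℝ → ℝ), IsOpen W ∧ 1 ∈ W ∧ ContDiffOn ℝ ∞ ψ W ∧ ψ 1 = 1 ∧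
    ∀ x ∈ W, 4 * ψ x ^ 3 - 3 * ψ x = x := by
  have hT : ContDiffAt ℝ ω (fun μ : ℝ => 4 * μ ^ 3 - 3 * μ) 1 := by fun_prop
  have hd0 : HasDerivAt (fun μ : ℝ => 4 * μ ^ 3 - 3 * μ) 9 1 := by
    refine (((hasDerivAt_pow 3 (1:ℝ)).const_mul 4).sub ((hasDerivAt_id (1:ℝ)).const_mul 3)).congr_deriv ?_
    norm_num
  have hd : HasFDerivAt (fun μ : ℝ => 4 * μ ^ 3 - 3 * μ)
      ((ContinuousLinearEquiv.unitsEquivAut ℝ (Units.mk0 (9:ℝ) (by norm_num)) : ℝ ≃L[ℝ] ℝ) : ℝ →L[ℝ] ℝ) 1 := by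
    refine hd0.hasFDerivAt.congr_fderiv ?_
    ext; simp
  have hω : (ω : WithTop ℕ∞) ≠ 0 := by simp
  set ψ := hT.localInverse hd hω with hψ
  have e1 : (4 * (1:ℝ) ^ 3 - 3 * 1) = 1 := by norm_num
  have h1 : ContDiffAt ℝ ω ψ 1 := by
    have := hT.to_localInverse hd hω
    simp only [e1] at this; exact this
  have h2 : ∀ᶠ x in 𝓝 (1:ℝ), 4 * ψ x ^ 3 - 3 * ψ x = x := by
    have := (hT.hasStrictFDerivAt' hd hω).eventually_right_inverse
    simp only [e1] at this; exact this
  have h3 := h1.eventually (by simp)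
  obtain ⟨W, hW, hWo, hW1⟩ := _root_.eventually_nhds_iff.1 (h2.and h3)
  refine ⟨W, ψ, hWo, hW1, fun x hx => ((hW x hx).2.of_le (by simp)).contDiffWithinAt, ?_, fun x hx => (hW x hx).1⟩
  have := hT.localInverse_apply_image hd hω
  simp only [e1] at this; exact this

lemma frobSq_Nn (s : ℝ) {n : E3} (hn : ‖n‖ = 1) : frobSq (Nn s n) = 2 / 3 * s ^ 2 := by
  have h1 : n 0 ^ 2 + n 1 ^ 2 + n 2 ^ 2 = 1 := by rw [← norm_sq_E3, hn]; norm_num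
  simp [Nn, frobSq, Fin.sum_univ_three, op_apply, Matrix.one_apply]
  linear_combination (s ^ 2 * (n 0 ^ 2 + n 1 ^ 2 + n 2 ^ 2 + 1) - 2 / 3 * s ^ 2) * h1

lemma det_Nn (s : ℝ) {n : E3} (hn : ‖n‖ = 1) : (Nn s n).det = 2 / 27 * s ^ 3 := by
  have h1 : n 0 ^ 2 + n 1 ^ 2 + n 2 ^ 2 = 1 := by rw [← norm_sq_E3, hn]; norm_num
  rw [Matrix.det_fin_three]
  simp [Nn, op_apply, Matrix.one_apply]
  linear_combination (s ^ 3 / 9) * h1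

lemma Nn_S0 (s : ℝ) {n : E3} (hn : ‖n‖ = 1) : Nn s n ∈ S0 := by
  have h1 : n 0 ^ 2 + n 1 ^ 2 + n 2 ^ 2 = 1 := by rw [← norm_sq_E3, hn]; norm_num
  constructor
  · ext i j
    simp [Nn, op_apply, Matrix.one_apply, eq_comm, mul_comm]
  · simp [Nn, Matrix.trace, Fin.sum_univ_three, op_apply, Matrix.one_apply]
    linear_combination s * h1

lemma Nn_mem {a b c : ℝ} {n : E3} (hn : ‖n‖ = 1) : Nn (sstar a b c) n ∈ Nman a b c := by
  refine ⟨fun i => n i, ?_, ?_⟩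
  · rw [Fin.sum_univ_three, ← norm_sq_E3, hn]; norm_num
  · rfl

lemma Nman_Nn {a b c : ℝ} {p : M3} (hp : p ∈ Nman a b c) : ∃ n : E3, ‖n‖ = 1 ∧ p = Nn (sstar a b c) n := by
  obtain ⟨n, hn, rfl⟩ := hp
  refine ⟨WithLp.toLp 2 n, ?_, rfl⟩
  have h : ‖(WithLp.toLp 2 n : E3)‖ ^ 2 = 1 := by
    rw [norm_sq_E3]; rw [Fin.sum_univ_three] at hn; exact hn
  have := norm_nonneg (WithLp.toLp 2 n : E3)
  nlinarith

lemma cd_entry (i j : Fin 3) : ContDiff ℝ ∞ (fun Q : M3 => Q i j) :=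
  (contDiff_apply_apply ℝ ℝ i j : ContDiff ℝ ∞ (fun f : Fin 3 → Fin 3 → ℝ => f i j))

lemma cdOnM {E : Type*} [NormedAddCommGroup E] [NormedSpace ℝ E] {F : E → M3} {S : Set E}
    (h : ∀ i j, ContDiffOn ℝ ∞ (fun x => F x i j) S) : ContDiffOn ℝ ∞ F S :=
  contDiffOn_pi.2 fun i => contDiffOn_pi.2 (h i)

lemma proj_exists (s : ℝ) (hs : 0 < s) : ∃ (O : Set M3) (Ph : M3 → M3), IsOpen O ∧
    (∀ n : E3, ‖n‖ = 1 → Nn s n ∈ O ∧ Ph (Nn s n) = op n) ∧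
    ContDiffOn ℝ ∞ Ph O ∧ ∀ Q ∈ O, Q ∈ S0 → ∃ n : E3, ‖n‖ = 1 ∧ Ph Q = op n := by
  obtain ⟨W, ψ, hW, hW1, hψ, hψ1, hT⟩ := psi_exists
  set σ : M3 → ℝ := fun Q => Real.sqrt (frobSq Q / 6) with hσ
  set X : M3 → ℝ := fun Q => Q.det / (2 * σ Q ^ 3) with hX
  set l : M3 → ℝ := fun Q => 2 * σ Q * ψ (X Q) with hl
  have cF : ContDiff ℝ ∞ (frobSq : M3 → ℝ) := by
    unfold frobSq
    exact ContDiff.sum fun i _ => ContDiff.sum fun j _ => (cd_entry i j).pow 2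
  have cdet : ContDiff ℝ ∞ (fun Q : M3 => Q.det) := by
    simp only [Matrix.det_fin_three]
    have := cd_entry
    fun_prop (disch := assumption)
  set O1 : Set M3 := {Q | 0 < frobSq Q} with hO1
  have oO1 : IsOpen O1 := isOpen_lt continuous_const cF.continuous
  have cσ : ContDiffOn ℝ ∞ σ O1 := by
    intro Q hQ
    have : frobSq Q / 6 ≠ 0 := by
      have : 0 < frobSq Q := hQ
      positivity
    exact ((cF.div_const 6).contDiffAt.sqrt this).contDiffWithinAt
  have σpos : ∀ Q ∈ O1, 0 < σ Q := fun Q hQ => Real.sqrt_pos.2 (by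
      have : 0 < frobSq Q := hQ
      positivity)
  have cX : ContDiffOn ℝ ∞ X O1 := cdet.contDiffOn.div (contDiffOn_const.mul (cσ.pow 3)) fun Q hQ => by
    have := σpos Q hQ
    positivity
  set O2 := O1 ∩ X ⁻¹' W with hO2
  have oO2 : IsOpen O2 := cX.continuousOn.isOpen_inter_preimage oO1 hW
  have cl : ContDiffOn ℝ ∞ l O2 :=
    (contDiffOn_const.mul (cσ.mono inter_subset_left)).mul (hψ.comp (cX.mono inter_subset_left) fun Q hQ => hQ.2)
  set d : M3 → ℝ := fun Q => 3 * l Q ^ 2 - frobSq Q / 2 with hd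
  have cd : ContDiffOn ℝ ∞ d O2 := (contDiffOn_const.mul (cl.pow 2)).sub (cF.contDiffOn.div_const 2)
  set O3 := O2 ∩ d ⁻¹' {0}ᶜ with hO3
  have oO3 : IsOpen O3 := cd.continuousOn.isOpen_inter_preimage oO2 isOpen_compl_singleton
  have lN : ∀ n : E3, ‖n‖ = 1 → σ (Nn s n) = s / 3 ∧ X (Nn s n) = 1 ∧ l (Nn s n) = 2 * s / 3 := by
    intro n hn
    have h1 : σ (Nn s n) = s / 3 := by
      simp only [hσ]
      rw [frobSq_Nn s hn, show 2 / 3 * s ^ 2 / 6 = (s/3) ^ 2 by ring, Real.sqrt_sq (by positivity)]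
    have h2 : X (Nn s n) = 1 := by
      simp only [hX]; rw [h1, det_Nn s hn]; field_simp; norm_num
    refine ⟨h1, h2, ?_⟩
    simp only [hl]; rw [h1, h2, hψ1]; ring
  refine ⟨O3, fun Q => (d Q)⁻¹ • PA (l Q) Q, oO3, ?_, ?_, ?_⟩
  · intro n hn
    obtain ⟨h1, h2, h3⟩ := lN n hn
    have hdN : d (Nn s n) = s ^ 2 := by
      simp only [hd]; rw [h3, frobSq_Nn s hn]; ring
    refine ⟨⟨⟨?_, ?_⟩, ?_⟩, ?_⟩
    · simp only [hO1, mem_ofPred_eq]; rw [frobSq_Nn s hn]; positivity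
    · simp only [mem_preimage]; rw [h2]; exact hW1
    · simp only [mem_preimage, hdN]; simp; positivity
    · simp only
      rw [hdN, h3]
      unfold PA
      rw [frobSq_Nn s hn]
      have h1 : n 0 ^ 2 + n 1 ^ 2 + n 2 ^ 2 = 1 := by rw [← norm_sq_E3, hn]; norm_num
      ext i j
      have hmul : (Nn s n * Nn s n) i j = s ^ 2 * (1/3 * op n i j + 1/9 * (1:M3) i j) := by
        rw [Matrix.mul_apply, Fin.sum_univ_three]
        fin_cases i <;> fin_cases j <;> simp [Nn, op_apply, Matrix.one_apply]
        · linear_combination s ^ 2 * (n 0 * n 0) * h1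
        · linear_combination s ^ 2 * (n 0 * n 1) * h1
        · linear_combination s ^ 2 * (n 0 * n 2) * h1
        · linear_combination s ^ 2 * (n 1 * n 0) * h1
        · linear_combination s ^ 2 * (n 1 * n 1) * h1
        · linear_combination s ^ 2 * (n 1 * n 2) * h1
        · linear_combination s ^ 2 * (n 2 * n 0) * h1
        · linear_combination s ^ 2 * (n 2 * n 1) * h1
        · linear_combination s ^ 2 * (n 2 * n 2) * h1
      simp only [Matrix.smul_apply, Matrix.add_apply, smul_eq_mul, hmul]
      have : Nn s n i j = s * (op n i j - 1/3 * (1:M3) i j) := by simp [Nn]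
      rw [this]; field_simp; ring
  · refine ContDiffOn.smul (ContDiffOn.inv (cd.mono inter_subset_left) fun Q hQ => hQ.2) ?_
    change ContDiffOn ℝ ∞ (fun Q => PA (l Q) Q) O3
    have cl' := cl.mono (inter_subset_left : O3 ⊆ O2)
    refine cdOnM fun i j => ?_
    have e : (fun Q : M3 => PA (l Q) Q i j) = fun Q => (∑ k, Q i k * Q k j) + l Q * Q i j + (l Q ^ 2 - frobSq Q / 2) * (1:M3) i j := by
      ext Q
      simp [PA, Matrix.mul_apply]
    rw [e]
    refine ContDiffOn.add (ContDiffOn.add ?_ (cl'.mul (cd_entry i j).contDiffOn)) (((cl'.pow 2).sub (cF.contDiffOn.div_const 2)).mul contDiffOn_const)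
    exact (ContDiff.sum fun k _ => (cd_entry i k).mul (cd_entry k j)).contDiffOn
  · rintro Q ⟨⟨hQ1, hQ2⟩, hQ3⟩ hQS
    refine PA_proj hQS ?_ hQ3
    have hp := σpos Q hQ1
    have h6 : σ Q ^ 2 = frobSq Q / 6 := Real.sq_sqrt (by
      have : 0 < frobSq Q := hQ1
      positivity)
    have h7 : X Q * (2 * σ Q ^ 3) = Q.det := by
      simp only [hX]; field_simp
    have h8 := hT (X Q) hQ2
    have h9 : l Q = 2 * σ Q * ψ (X Q) := rfl
    rw [h9]
    rw [← h7, show frobSq Q / 2 = 3 * σ Q ^ 2 by rw [h6]; ring]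
    linear_combination (2 * σ Q ^ 3) * h8

end Part15

section Part16

/-! ### P16: lifting the minimizer on a sphere -/

open scoped Topology

lemma entry_le (A : M3) (i j : Fin 3) : |A i j| ≤ ‖A‖ := by
  rw [← Real.norm_eq_abs]; exact Matrix.norm_entry_le_entrywise_sup_norm A

lemma frobSq_le_norm (A : M3) : frobSq A ≤ 9 * ‖A‖ ^ 2 := by
  have h : ∀ i j, A i j ^ 2 ≤ ‖A‖ ^ 2 := fun i j => by
    rw [← sq_abs]; exact pow_le_pow_left₀ (abs_nonneg _) (entry_le A i j) 2
  unfold frobSq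
  simp only [Fin.sum_univ_three]
  linarith [h 0 0, h 0 1, h 0 2, h 1 0, h 1 1, h 1 2, h 2 0, h 2 1, h 2 2]

lemma norm_le_frob (A : M3) : ‖A‖ ≤ frobNorm A := by
  rw [Matrix.norm_le_iff (frobNorm_nonneg A)]
  intro i j
  rw [Real.norm_eq_abs]
  apply Real.abs_le_sqrt
  unfold frobSq
  calc A i j ^ 2 ≤ ∑ j, A i j ^ 2 := Finset.single_le_sum (f := fun j => A i j ^ 2) (fun _ _ => sq_nonneg _) (Finset.mem_univ j)
    _ ≤ _ := Finset.single_le_sum (f := fun i => ∑ j, A i j ^ 2) (fun _ _ => Finset.sum_nonneg fun _ _ => sq_nonneg _) (Finset.mem_univ i)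

lemma norm_sq_le_frob (A : M3) : ‖A‖ ^ 2 ≤ frobSq A := by
  rw [← frobNorm_sq]; exact pow_le_pow_left₀ (norm_nonneg _) (norm_le_frob A) 2

lemma hasFDerivAt_norm' {y : E3} (hy : y ≠ 0) : HasFDerivAt (fun y : E3 => ‖y‖) (‖y‖⁻¹ • innerSL ℝ y) y := by
  have h := (hasStrictFDerivAt_norm_sq y).hasFDerivAt.sqrt (by simpa using hy)
  have hn := norm_pos_iff.2 hy
  refine (h.congr_of_eventuallyEq (Filter.Eventually.of_forall fun z => ?_)).congr_fderiv ?_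
  · simp [Real.sqrt_sq]
  · rw [Real.sqrt_sq hn.le, ← Nat.cast_smul_eq_nsmul ℝ 2, smul_smul]
    congr 1; field_simp; norm_num

/-- radial projection to the unit sphere -/
def hat (y : E3) : E3 := ‖y‖⁻¹ • y

lemma norm_hat {y : E3} (hy : y ≠ 0) : ‖hat y‖ = 1 := by
  have := norm_pos_iff.2 hy
  rw [hat, norm_smul, norm_inv, norm_norm, inv_mul_cancel₀ this.ne']

lemma hat_smul {t : ℝ} (ht : 0 < t) (y : E3) : hat (t • y) = hat y := by
  rw [hat, hat, norm_smul, Real.norm_of_nonneg ht.le, smul_smul, mul_inv, mul_right_comm, inv_mul_cancel₀ ht.ne', one_mul]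

lemma hat_unit {y : E3} (hy : ‖y‖ = 1) : hat y = y := by simp [hat, hy]

lemma ne_of_unit {y : E3} (hy : ‖y‖ = 1) : y ≠ 0 := by rintro rfl; simp at hy

lemma hat_ne {y : E3} (hy : y ≠ 0) : hat y ≠ 0 := ne_of_unit (norm_hat hy)

lemma hat_hat {y : E3} (hy : y ≠ 0) : hat (hat y) = hat y := hat_unit (norm_hat hy)

lemma cd_norm : ContDiffOn ℝ ∞ (fun y : E3 => ‖y‖) {0}ᶜ := contDiffOn_id.norm ℝ fun y hy => hy

lemma cd_hat : ContDiffOn ℝ ∞ hat {0}ᶜ := (cd_norm.inv fun y hy => norm_ne_zero_iff.2 hy).smul contDiffOn_id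

lemma hasFDerivAt_hat {y : E3} (hy : y ≠ 0) :
    HasFDerivAt hat (‖y‖⁻¹ • ContinuousLinearMap.id ℝ E3 - ((‖y‖⁻¹) ^ 3 • innerSL ℝ y).smulRight y) y := by
  have hn := norm_pos_iff.2 hy
  have h1 := (hasDerivAt_inv hn.ne').comp_hasFDerivAt y (hasFDerivAt_norm' hy)
  refine (h1.smul (hasFDerivAt_id y)).congr_fderiv ?_
  ext ξ
  simp [smul_smul]
  field_simp
  ring

/-- radial derivative removed -/
lemma fderiv_comp_hat {F : Type*} [NormedAddCommGroup F] [NormedSpace ℝ F] {u : E3 → F} {s : ℝ} {y : E3} (hy : y ≠ 0)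
    (hu : DifferentiableAt ℝ u (s • hat y)) (ξ : E3) :
    fderiv ℝ (fun y => u (s • hat y)) y ξ = (s * ‖y‖⁻¹) • fderiv ℝ u (s • hat y) (ξ - (inner ℝ (hat y) ξ) • hat y) := by
  have h := hu.hasFDerivAt.comp y ((hasFDerivAt_hat hy).const_smul s)
  have e : (fun y => u (s • hat y)) = u ∘ (fun y => s • hat y) := rfl
  rw [e]
  have h2 := h.fderiv
  have h3 : (u ∘ (s • hat)) = u ∘ (fun y => s • hat y) := rfl
  rw [h3] at h2
  rw [h2, ← map_smul]
  simp only [ContinuousLinearMap.comp_apply]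
  simp only [hat, _root_.smul_apply, _root_.sub_apply, ContinuousLinearMap.smulRight_apply, ContinuousLinearMap.id_apply, innerSL_apply_apply, inner_smul_left, smul_sub, smul_smul]
  simp
  ring_nf
  module

structure Lift (a b c C s : ℝ) (u : E3 → M3) (n : E3 → E3) : Prop where
  sm : ContDiffOn ℝ ∞ n {0}ᶜ
  hom : ∀ t : ℝ, 0 < t → ∀ y, n (t • y) = n y
  unit : ∀ y, y ≠ 0 → ‖n y‖ = 1
  close : ∀ w, ‖w‖ = 1 → frobSq (u (s • w) - Nn (sstar a b c) (n w)) ≤ C * fbulk a b c (u (s • w))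
  der : ∀ w, ‖w‖ = 1 → ∀ ξ, ‖fderiv ℝ n w ξ‖ ≤ C * ‖fderiv ℝ u (s • w) (ξ - (inner ℝ w ξ) • w)‖

lemma sum_op (n m : E3) (i : Fin 3) : ∑ j, op n i j * m j = inner ℝ n m * n i := by
  simp only [Fin.sum_univ_three, op_apply, inner_E3]; ring

lemma lift_smooth {Pm : E3 → M3} {n : E3 → E3} (hP : ContDiffOn ℝ ∞ Pm {0}ᶜ) (hn : ContinuousOn n {0}ᶜ)
    (h : ∀ y, y ≠ 0 → ‖n y‖ = 1 ∧ Pm y = op (n y)) : ContDiffOn ℝ ∞ n {0}ᶜ := by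
  intro y0 hy0
  have ho : ({0}ᶜ : Set E3) ∈ 𝓝 y0 := isOpen_compl_singleton.mem_nhds hy0
  set m := n y0 with hm
  have hPij : ∀ i j, ContDiffAt ℝ ∞ (fun y => Pm y i j) y0 := fun i j =>
    (cd_entry i j).contDiffAt.comp y0 (hP.contDiffAt ho)
  set q : E3 → ℝ := fun y => ∑ i, ∑ j, m i * (Pm y i j * m j) with hq
  have hq' : ∀ y, y ≠ 0 → q y = (inner ℝ (n y) m) ^ 2 := by
    intro y hy
    simp only [hq, (h y hy).2, ← Finset.mul_sum, sum_op]
    rw [inner_E3, Fin.sum_univ_three]; ring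
  have hinn0 : (inner ℝ (n y0) m : ℝ) = 1 := by
    rw [← hm, real_inner_self_eq_norm_sq, hm, (h y0 hy0).1]; norm_num
  have cq : ContDiffAt ℝ ∞ q y0 := ContDiffAt.sum fun i _ => ContDiffAt.sum fun j _ => contDiffAt_const.mul ((hPij i j).mul contDiffAt_const)
  have cin : ContDiffAt ℝ ∞ (fun y => (Real.sqrt (q y))⁻¹) y0 := by
    refine (cq.sqrt ?_).inv ?_
    · rw [hq' y0 hy0, hinn0]; norm_num
    · rw [hq' y0 hy0, hinn0]; norm_num
  have hpos : ∀ᶠ y in 𝓝 y0, 0 < (inner ℝ (n y) m : ℝ) := by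
    have : ContinuousAt (fun y => (inner ℝ (n y) m : ℝ)) y0 := (hn.continuousAt ho).inner continuousAt_const
    exact this.eventually_const_lt (by show (0:ℝ) < inner ℝ (n y0) m; rw [hinn0]; norm_num)
  refine ContDiffAt.contDiffWithinAt ?_
  rw [contDiffAt_piLp]
  intro i
  have : ContDiffAt ℝ ∞ (fun y => (Real.sqrt (q y))⁻¹ * ∑ j, Pm y i j * m j) y0 :=
    cin.mul (ContDiffAt.sum fun j _ => (hPij i j).mul contDiffAt_const)
  refine this.congr_of_eventuallyEq ?_
  filter_upwards [hpos, ho] with y hy hy0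
  rw [hq' y hy0, Real.sqrt_sq hy.le, (h y hy0).2, sum_op, ← mul_assoc, inv_mul_cancel₀ hy.ne', one_mul]

lemma lift_deriv {Pm : E3 → M3} {n : E3 → E3} (hP : ContDiffOn ℝ ∞ Pm {0}ᶜ) (hn : ContDiffOn ℝ ∞ n {0}ᶜ)
    (h : ∀ y, y ≠ 0 → ‖n y‖ = 1 ∧ Pm y = op (n y)) {y : E3} (hy : y ≠ 0) (ξ : E3) :
    ‖fderiv ℝ n y ξ‖ ≤ 6 * ‖fderiv ℝ Pm y ξ‖ := by
  have ho : ({0}ᶜ : Set E3) ∈ 𝓝 y := isOpen_compl_singleton.mem_nhds hy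
  have dn : HasFDerivAt n (fderiv ℝ n y) y := ((hn.contDiffAt ho).differentiableAt (by simp)).hasFDerivAt
  have dP : HasFDerivAt Pm (fderiv ℝ Pm y) y := ((hP.contDiffAt ho).differentiableAt (by simp)).hasFDerivAt
  set d := fderiv ℝ n y ξ with hd
  set A := fderiv ℝ Pm y ξ with hA
  have dni : ∀ i, HasFDerivAt (fun z => n z i) ((EuclideanSpace.proj i : E3 →L[ℝ] ℝ).comp (fderiv ℝ n y)) y := fun i =>
    ((EuclideanSpace.proj i : E3 →L[ℝ] ℝ).hasFDerivAt (x := n y)).comp y dn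
  have hPe : ∀ᶠ z in 𝓝 y, Pm z = op (n z) := by
    filter_upwards [ho] with z hz using (h z hz).2
  have hAij : ∀ i j, A i j = d i * n y j + n y i * d j := by
    intro i j
    have e1 : HasFDerivAt (fun z => Pm z i j) _ y := (hasFDerivAt_pi'.1 ((hasFDerivAt_pi'.1 dP) i)) j
    have e2 := (dni i).mul (dni j)
    have e3 : (fun z => Pm z i j) =ᶠ[𝓝 y] (fun z => n z i * n z j) := by
      filter_upwards [hPe] with z hz
      rw [hz, op_apply]
    have e4 := e1.unique (e2.congr_of_eventuallyEq e3)
    have e5 := DFunLike.congr_fun e4 ξ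
    have e6 : A i j = n y i * d j + n y j * d i := by
      refine Eq.trans (Eq.trans ?_ e5) ?_
      · rfl
      · simp [hd]
    rw [e6]; ring
  have hnd : n y 0 * d 0 + n y 1 * d 1 + n y 2 * d 2 = 0 := by
    have e2 := (((dni 0).mul (dni 0)).add ((dni 1).mul (dni 1))).add ((dni 2).mul (dni 2))
    have e3 : (fun z => n z 0 * n z 0 + n z 1 * n z 1 + n z 2 * n z 2) =ᶠ[𝓝 y] (fun z => (1:ℝ)) := by
      filter_upwards [ho] with z hz
      have h1 := norm_sq_E3 (n z)
      rw [(h z hz).1] at h1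
      linarith
    have e4 := HasFDerivAt.unique (e2.congr_of_eventuallyEq e3.symm) (hasFDerivAt_const (1:ℝ) y)
    have e5 := DFunLike.congr_fun e4 ξ
    have e6 : n y 0 * d 0 + n y 0 * d 0 + (n y 1 * d 1 + n y 1 * d 1) + (n y 2 * d 2 + n y 2 * d 2) = 0 := by simpa using e5
    linarith
  have hn1 : n y 0 ^ 2 + n y 1 ^ 2 + n y 2 ^ 2 = 1 := by rw [← norm_sq_E3, (h y hy).1]; norm_num
  have hdi : ∀ i, d i = A i 0 * n y 0 + A i 1 * n y 1 + A i 2 * n y 2 := by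
    intro i
    rw [hAij, hAij, hAij]
    linear_combination (- d i) * hn1 - n y i * hnd
  have hni : ∀ j, |n y j| ≤ 1 := by
    intro j
    apply abs_le_one_iff_mul_self_le_one.2
    fin_cases j <;> simp <;> nlinarith [sq_nonneg (n y 0), sq_nonneg (n y 1), sq_nonneg (n y 2)]
  have hdb : ∀ i, |d i| ≤ 3 * ‖A‖ := by
    intro i
    rw [hdi]
    have hh : ∀ j, |A i j * n y j| ≤ ‖A‖ := fun j => by
      rw [abs_mul]
      calc |A i j| * |n y j| ≤ ‖A‖ * 1 := mul_le_mul (entry_le A i j) (hni j) (abs_nonneg _) (norm_nonneg _)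
        _ = ‖A‖ := mul_one _
    calc _ ≤ |A i 0 * n y 0| + |A i 1 * n y 1| + |A i 2 * n y 2| := abs_add_three _ _ _
      _ ≤ _ := by linarith [hh 0, hh 1, hh 2]
  apply le_of_sq_le_sq _ (by positivity)
  rw [norm_sq_E3]
  have hh : ∀ i, d i ^ 2 ≤ 9 * ‖A‖ ^ 2 := fun i => by
    rw [← sq_abs]
    calc |d i| ^ 2 ≤ (3 * ‖A‖) ^ 2 := pow_le_pow_left₀ (abs_nonneg _) (hdb i) 2
      _ = _ := by ring
  nlinarith [hh 0, hh 1, hh 2, sq_nonneg ‖A‖]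

lemma cd_compact_bound {E F : Type*} [NormedAddCommGroup E] [NormedSpace ℝ E] [NormedAddCommGroup F] [NormedSpace ℝ F]
    {f : E → F} {O K : Set E} (oO : IsOpen O) (cf : ContDiffOn ℝ ∞ f O) (hK : IsCompact K) (hKO : K ⊆ O) :
    ∃ C : ℝ, 0 ≤ C ∧ (∀ Q ∈ K, ∀ ξ, ‖fderiv ℝ f Q ξ‖ ≤ C * ‖ξ‖) ∧
      (∀ p r, 0 < r → ball p r ⊆ K → ∀ x ∈ ball p r, ‖f x - f p‖ ≤ C * ‖x - p‖) := by
  have hcf : ContinuousOn (fderiv ℝ f) K := (cf.continuousOn_fderiv_of_isOpen oO (by simp)).mono hKO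
  obtain ⟨C0', hC0'⟩ := hK.exists_bound_of_continuousOn hcf
  have hC0 : ∀ Q ∈ K, ‖fderiv ℝ f Q‖ ≤ max C0' 0 := fun Q hQ => (hC0' Q hQ).trans (le_max_left _ _)
  refine ⟨max C0' 0, le_max_right _ _, fun Q hQ ξ => ?_, fun p r hr hb x hx => ?_⟩
  · refine (ContinuousLinearMap.le_opNorm _ _).trans ?_
    gcongr
    exact hC0 Q hQ
  · refine Convex.norm_image_sub_le_of_norm_fderiv_le (𝕜 := ℝ) (s := ball p r) ?_ ?_ (convex_ball p r) (mem_ball_self hr) hx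
    · intro x hx
      exact (cf.contDiffAt (oO.mem_nhds (hKO (hb hx)))).differentiableAt (by simp)
    · intro x hx
      exact hC0 x (hb hx)

lemma Nman_compact (a b c : ℝ) : IsCompact (Nman a b c) := by
  have : Nman a b c = Nn (sstar a b c) '' sphere (0:E3) 1 := by
    ext p
    constructor
    · intro hp
      obtain ⟨n, hn, rfl⟩ := Nman_Nn hp
      exact ⟨n, by simpa using hn, rfl⟩
    · rintro ⟨n, hn, rfl⟩
      exact Nn_mem (by simpa using hn)
  rw [this]
  refine (isCompact_sphere _ _).image ?_
  refine continuous_matrix fun i j => ?_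
  have h1 : Continuous fun n : E3 => op n i j := op_cont.matrix_elem i j
  simp only [Nn, Matrix.smul_apply, Matrix.sub_apply]
  exact continuous_const.mul (h1.sub continuous_const)

lemma lift_exists {a b c : ℝ} (ha : 0 ≤ a) (hb : 0 < b) (hc : 0 < c) :
    ∃ δ₁ > 0, ∃ C > 0, ∀ u : E3 → M3, ContDiff ℝ ∞ u → (∀ y, u y ∈ S0) → ∀ s : ℝ, 0 < s → s ≤ 2 →
      (∀ w : E3, ‖w‖ = 1 → fbulk a b c (u (s • w)) ≤ δ₁) → ∃ n, Lift a b c C s u n := by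
  have hs := sstar_pos ha hb hc
  set st := sstar a b c with hst
  obtain ⟨O, Ph, oO, hON, cPh, hproj⟩ := proj_exists st hs
  have hNO : Nman a b c ⊆ O := by
    intro p hp
    obtain ⟨n, hn, rfl⟩ := Nman_Nn hp
    exact (hON n hn).1
  have : ProperSpace M3 := FiniteDimensional.proper_real M3
  obtain ⟨r0, hr0, hthick⟩ := (Nman_compact a b c).exists_cthickening_subset_open oO hNO
  have hK : IsCompact (cthickening r0 (Nman a b c)) := (Nman_compact a b c).cthickening
  obtain ⟨C0, hC00, hC0, hLip⟩ := cd_compact_bound oO cPh hK hthick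
  have hC2 : 0 < C2 a b c := C2_pos ha hb hc
  refine ⟨r0 ^ 2 / (2 * C2 a b c), by positivity, 9 * (1 + st * C0) ^ 2 * C2 a b c + 6 * C0 * 2 + 1, by positivity, ?_⟩
  intro u hu hS s hs0 hs2 hf
  have near : ∀ w : E3, ‖w‖ = 1 → ∃ p ∈ Nman a b c, frobSq (u (s • w) - p) ≤ C2 a b c * fbulk a b c (u (s • w)) ∧ ‖u (s • w) - p‖ < r0 := by
    intro w hw
    obtain ⟨p, hp, h1⟩ := exists_near_N ha hb hc (hS (s • w))
    refine ⟨p, hp, h1, ?_⟩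
    have h2 : frobSq (u (s • w) - p) ≤ r0 ^ 2 / 2 := h1.trans (by
      have := mul_le_mul_of_nonneg_left (hf w hw) hC2.le
      have e : C2 a b c * (r0 ^ 2 / (2 * C2 a b c)) = r0 ^ 2 / 2 := by field_simp
      rwa [e] at this)
    have h3 := norm_sq_le_frob (u (s • w) - p)
    apply lt_of_pow_lt_pow_left₀ 2 hr0.le
    have : 0 < r0 ^ 2 := by positivity
    linarith
  have ballK : ∀ p ∈ Nman a b c, ball p r0 ⊆ cthickening r0 (Nman a b c) := fun p hp =>
    ball_subset_closedBall.trans (closedBall_subset_cthickening hp r0)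
  have hUK : ∀ w : E3, ‖w‖ = 1 → u (s • w) ∈ cthickening r0 (Nman a b c) := by
    intro w hw
    obtain ⟨p, hp, -, h2⟩ := near w hw
    exact ballK p hp (by rwa [mem_ball, dist_eq_norm])
  set U : E3 → M3 := fun y => u (s • hat y) with hU
  have cU : ContDiffOn ℝ ∞ U {0}ᶜ := hu.comp_contDiffOn (cd_hat.const_smul s)
  have hUO : MapsTo U {0}ᶜ O := fun y hy => hthick (hUK _ (norm_hat hy))
  set Pm : E3 → M3 := fun y => Ph (U y) with hPm
  have cPm : ContDiffOn ℝ ∞ Pm {0}ᶜ := cPh.comp cU hUO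
  obtain ⟨n0, cn0, hn0⟩ := lift_top cPm.continuousOn fun y hy => hproj (U y) (hUO hy) (hS _)
  set n : E3 → E3 := fun y => n0 (hat y) with hn
  have hPn : ∀ y, y ≠ 0 → ‖n y‖ = 1 ∧ Pm y = op (n y) := by
    intro y hy
    have h1 := hn0 (hat y) (hat_ne hy)
    refine ⟨h1.1, ?_⟩
    rw [← h1.2]
    simp only [hPm, hU, hat_hat hy]
  have cn : ContinuousOn n {0}ᶜ := cn0.comp cd_hat.continuousOn fun y hy => hat_ne hy
  have sn := lift_smooth cPm cn hPn
  refine ⟨n, sn, ?_, fun y hy => (hPn y hy).1, ?_, ?_⟩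
  · intro t ht y
    simp only [hn, hat_smul ht]
  · intro w hw
    have hw0 := ne_of_unit hw
    obtain ⟨p, hp, h1, h2⟩ := near w hw
    obtain ⟨m, hm, hpm⟩ := Nman_Nn hp
    have hUw : U w = u (s • w) := by simp only [hU, hat_unit hw]
    have hlip : ‖Ph (u (s • w)) - Ph p‖ ≤ C0 * ‖u (s • w) - p‖ := by
      exact hLip p r0 hr0 (ballK p hp) _ (by rwa [mem_ball, dist_eq_norm])
    have e1 : Ph p = op m := by rw [hpm]; exact (hON m hm).2
    have e2 : Ph (u (s • w)) = op (n w) := by rw [← hUw]; exact (hPn w hw0).2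
    have e3 : u (s • w) - Nn st (n w) = (u (s • w) - p) - st • (Ph (u (s • w)) - Ph p) := by
      rw [e1, e2, hpm]; unfold Nn; rw [smul_sub, smul_sub, smul_sub]; abel
    have e4 : ‖u (s • w) - Nn st (n w)‖ ≤ (1 + st * C0) * ‖u (s • w) - p‖ := by
      rw [e3]
      refine (norm_sub_le _ _).trans ?_
      rw [norm_smul, Real.norm_of_nonneg hs.le]
      nlinarith
    have hfn := fbulk_nonneg ha hb hc (hS (s • w))
    calc frobSq (u (s • w) - Nn st (n w)) ≤ 9 * ‖u (s • w) - Nn st (n w)‖ ^ 2 := frobSq_le_norm _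
      _ ≤ 9 * ((1 + st * C0) * ‖u (s • w) - p‖) ^ 2 := by gcongr
      _ = 9 * (1 + st * C0) ^ 2 * ‖u (s • w) - p‖ ^ 2 := by ring
      _ ≤ 9 * (1 + st * C0) ^ 2 * (C2 a b c * fbulk a b c (u (s • w))) := by
          gcongr; exact (norm_sq_le_frob _).trans h1
      _ ≤ _ := by nlinarith [mul_nonneg hC00 hfn]
  · intro w hw ξ
    have hw0 := ne_of_unit hw
    have ho : ({0}ᶜ : Set E3) ∈ 𝓝 w := isOpen_compl_singleton.mem_nhds hw0
    have h1 := lift_deriv cPm sn hPn hw0 ξ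
    have h2 : fderiv ℝ Pm w ξ = fderiv ℝ Ph (U w) (fderiv ℝ U w ξ) := by
      have dPh : DifferentiableAt ℝ Ph (U w) := (cPh.contDiffAt (oO.mem_nhds (hUO hw0))).differentiableAt (by simp)
      have dU : DifferentiableAt ℝ U w := (cU.contDiffAt ho).differentiableAt (by simp)
      have := (dPh.hasFDerivAt.comp w dU.hasFDerivAt).fderiv
      have e : Ph ∘ U = Pm := rfl
      rw [e] at this
      exact DFunLike.congr_fun this ξ
    have h3 : ‖fderiv ℝ Pm w ξ‖ ≤ C0 * ‖fderiv ℝ U w ξ‖ := by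
      rw [h2]
      refine hC0 _ ?_ _
      simp only [hU]; exact hUK _ (norm_hat hw0)
    have h4' := fderiv_comp_hat (u := u) (s := s) hw0 (hu.differentiable (by simp) _) ξ
    rw [hat_unit hw, hw] at h4'
    have h4 : fderiv ℝ U w ξ = (s * 1⁻¹) • (fderiv ℝ u (s • w)) (ξ - inner ℝ w ξ • w) := h4'
    have h5 : ‖fderiv ℝ U w ξ‖ ≤ 2 * ‖fderiv ℝ u (s • w) (ξ - (inner ℝ w ξ) • w)‖ := by
      rw [h4, norm_smul]
      gcongr
      rw [inv_one, mul_one, Real.norm_of_nonneg hs0.le]; exact hs2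
    calc _ ≤ 6 * ‖fderiv ℝ Pm w ξ‖ := h1
      _ ≤ 6 * (C0 * (2 * ‖fderiv ℝ u (s • w) (ξ - (inner ℝ w ξ) • w)‖)) := by
          gcongr; exact h3.trans (by gcongr)
      _ = (6 * C0 * 2) * ‖fderiv ℝ u (s • w) (ξ - (inner ℝ w ξ) • w)‖ := by ring
      _ ≤ _ := by
          gcongr
          have : 0 ≤ 9 * (1 + st * C0) ^ 2 * C2 a b c := by positivity
          linarith

end Part16

section Part17

/-! ### P17: polar coordinates -/

open scoped Topology ENNReal

abbrev Sph := sphere (0:E3) 1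

def sig : Measure Sph := (volume : Measure E3).toSphere

instance sig_fin : IsFiniteMeasure sig := by unfold sig; infer_instance

lemma Sph_norm (w : Sph) : ‖(w:E3)‖ = 1 := by simp

instance Sph_compact : CompactSpace Sph := isCompact_iff_compactSpace.1 (isCompact_sphere _ _)

lemma sph_int {g : Sph → ℝ} (hg : Continuous g) : Integrable g sig := by
  rw [← integrableOn_univ]
  exact hg.continuousOn.integrableOn_compact isCompact_univ

lemma sph_cont {g : E3 → ℝ} (hg : Continuous g) : Continuous fun r : ℝ => ∫ w : Sph, g (r • (w:E3)) ∂sig := by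
  have := continuous_parametric_integral_of_continuous (μ := sig) (f := fun (r:ℝ) (w:Sph) => g (r • (w:E3))) (by fun_prop) (s := univ) isCompact_univ
  simpa using this

lemma polar {F : E3 → ℝ≥0∞} (hF : Measurable F) :
    ∫⁻ y, F y = ∫⁻ w : Sph, ∫⁻ r in Ioi (0:ℝ), ENNReal.ofReal (r^2) * F (r • (w:E3)) ∂volume ∂sig := by
  have hmp := (volume : Measure E3).measurePreserving_homeomorphUnitSphereProd
  have hd : Module.finrank ℝ E3 - 1 = 2 := by simp
  rw [hd] at hmp
  change MeasurePreserving _ _ (sig.prod _) at hmp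
  have e0 : ∫⁻ y, F y = ∫⁻ x : ({(0:E3)}ᶜ : Set E3), F x.1 ∂(volume.comap Subtype.val) := by
    rw [lintegral_subtype_comap (measurableSet_singleton _).compl, restrict_compl_singleton]
  have e1 : ∫⁻ x : ({(0:E3)}ᶜ : Set E3), F x.1 ∂(volume.comap Subtype.val) =
      ∫⁻ p : Sph × Ioi (0:ℝ), F (p.2.1 • (p.1:E3)) ∂(sig.prod (.volumeIoiPow 2)) := by
    rw [← hmp.lintegral_comp_emb (Homeomorph.measurableEmbedding _)]
    refine lintegral_congr fun x => ?_
    congr 1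
    have := congrArg Subtype.val ((homeomorphUnitSphereProd E3).symm_apply_apply x)
    rw [← this]
    have hx : ‖x.1‖ ≠ 0 := norm_ne_zero_iff.2 x.2
    simp [smul_smul, hx]
  rw [e0, e1, lintegral_prod]
  · refine lintegral_congr fun w => ?_
    simp only
    rw [Measure.volumeIoiPow, lintegral_withDensity_eq_lintegral_mul]
    · simp only [Pi.mul_apply]
      exact lintegral_subtype_comap measurableSet_Ioi (fun r : ℝ => ENNReal.ofReal (r^2) * F (r • (w:E3)))
    · fun_prop
    · exact hF.comp (by fun_prop)
  · exact (hF.comp (by fun_prop)).aemeasurable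

lemma polar_ball {g : E3 → ℝ} (hg : Continuous g) (h0 : ∀ y, 0 ≤ g y) {R : ℝ} (hR : 0 ≤ R) :
    ∫ y in ball (0:E3) R, g y = ∫ r in (0:ℝ)..R, r^2 * ∫ w : Sph, g (r • (w:E3)) ∂sig := by
  have hc := sph_cont hg
  have hJ0 : ∀ r : ℝ, 0 ≤ ∫ w : Sph, g (r • (w:E3)) ∂sig := fun r => integral_nonneg fun w => h0 _
  have hin : ∀ r : ℝ, Integrable (fun w : Sph => g (r • (w:E3))) sig := fun r =>
    sph_int (by fun_prop)
  rw [intervalIntegral.integral_of_le hR, integral_Ioc_eq_integral_Ioo]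
  have i1 : IntegrableOn g (ball 0 R) := intOn_ball hg 0 R
  have i2 : IntegrableOn (fun r : ℝ => r^2 * ∫ w : Sph, g (r • (w:E3)) ∂sig) (Ioo 0 R) :=
    ((by fun_prop : Continuous fun r : ℝ => r^2 * ∫ w : Sph, g (r • (w:E3)) ∂sig).integrableOn_Icc).mono_set Ioo_subset_Icc_self
  have n2 : ∀ r : ℝ, 0 ≤ r^2 * ∫ w : Sph, g (r • (w:E3)) ∂sig := fun r => mul_nonneg (sq_nonneg _) (hJ0 r)
  apply (ENNReal.ofReal_eq_ofReal_iff (integral_nonneg h0) (integral_nonneg n2)).1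
  rw [ofReal_integral_eq_lintegral_ofReal i1 (Filter.Eventually.of_forall h0), ofReal_integral_eq_lintegral_ofReal i2 (Filter.Eventually.of_forall n2)]
  have mg : Measurable fun y => ENNReal.ofReal (g y) := hg.measurable.ennreal_ofReal
  rw [← lintegral_indicator measurableSet_ball, polar (mg.indicator measurableSet_ball)]
  rw [lintegral_lintegral_swap]
  · have e : ∀ r ∈ Ioi (0:ℝ), (∫⁻ w : Sph, ENNReal.ofReal (r^2) * (ball (0:E3) R).indicator (fun y => ENNReal.ofReal (g y)) (r • (w:E3)) ∂sig)
        = (Iio R).indicator (fun r => ENNReal.ofReal (r^2 * ∫ w : Sph, g (r • (w:E3)) ∂sig)) r := by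
      intro r hr
      have hr' : (0:ℝ) < r := hr
      by_cases h : r < R
      · rw [indicator_of_mem (by exact h), ENNReal.ofReal_mul (sq_nonneg r), lintegral_const_mul' _ _ ENNReal.ofReal_ne_top,
          ofReal_integral_eq_lintegral_ofReal (hin r) (Filter.Eventually.of_forall fun w => h0 _)]
        congr 1
        refine lintegral_congr fun w => ?_
        rw [indicator_of_mem]
        rw [mem_ball_zero_iff, norm_smul, Sph_norm, mul_one, Real.norm_of_nonneg hr'.le]; exact h
      · rw [indicator_of_notMem (by exact h)]
        rw [← lintegral_zero (μ := sig)]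
        refine lintegral_congr fun w => ?_
        rw [indicator_of_notMem, mul_zero]
        rw [mem_ball_zero_iff, norm_smul, Sph_norm, mul_one, Real.norm_of_nonneg hr'.le]; exact h
    rw [setLIntegral_congr_fun measurableSet_Ioi e, setLIntegral_indicator measurableSet_Iio]
    rw [inter_comm]; rfl
  · refine Measurable.aemeasurable ?_
    refine Measurable.mul (by fun_prop) ((mg.indicator measurableSet_ball).comp (by fun_prop))

end Part17

section Part18

/-! ### P18: caps, shells and derivatives -/

open scoped Topology ENNReal

lemma cap_lb {w0 : Sph} {ρ : ℝ} (h0 : 0 < ρ) (h1 : ρ ≤ 1) :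
    VB / 18 * ρ ^ 2 ≤ sig.real {w : Sph | ‖(w:E3) - w0‖ < ρ} := by
  set S := {w : Sph | ‖(w:E3) - w0‖ < ρ} with hS
  have mS : MeasurableSet S := by
    refine (isOpen_lt (by fun_prop) continuous_const).measurableSet
  have hvol : volume (ball (w0:E3) (ρ/2)) = ENNReal.ofReal (VB * (ρ/2)^3) := by
    rw [Measure.addHaar_ball _ _ (by positivity), finrank_euclideanSpace, Fintype.card_fin, mul_comm VB,
      ENNReal.ofReal_mul (by positivity), VB, ENNReal.ofReal_toReal measure_ball_lt_top.ne]
  have h2 : volume (ball (w0:E3) (ρ/2)) ≤ sig S * ENNReal.ofReal (ρ * (9/4)) := by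
    rw [← lintegral_indicator_one measurableSet_ball, polar (measurable_one.indicator measurableSet_ball), mul_comm]
    rw [← lintegral_indicator_const mS]
    refine lintegral_mono fun w => ?_
    have hr : ∀ r : ℝ, 0 < r → r • (w:E3) ∈ ball (w0:E3) (ρ/2) → |r - 1| < ρ/2 := by
      intro r hr hm
      rw [mem_ball, dist_eq_norm] at hm
      have := abs_norm_sub_norm_le (r • (w:E3)) w0
      rw [norm_smul, Sph_norm, Sph_norm, Real.norm_of_nonneg hr.le, mul_one] at this
      linarith
    by_cases hw : w ∈ S
    · rw [indicator_of_mem hw]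
      calc ∫⁻ r in Ioi (0:ℝ), ENNReal.ofReal (r^2) * (ball (w0:E3) (ρ/2)).indicator 1 (r • (w:E3))
          ≤ ∫⁻ r in Ioi (0:ℝ), (Ioo (1-ρ/2) (1+ρ/2)).indicator (fun _ => ENNReal.ofReal (9/4)) r := by
            refine setLIntegral_mono' measurableSet_Ioi fun r hr' => ?_
            by_cases hm : r • (w:E3) ∈ ball (w0:E3) (ρ/2)
            · have := abs_lt.1 (hr r hr' hm)
              rw [indicator_of_mem hm, indicator_of_mem (by constructor <;> linarith)]
              simp only [Pi.one_apply, mul_one]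
              apply ENNReal.ofReal_le_ofReal
              have : (0:ℝ) < r := hr'
              nlinarith
            · rw [indicator_of_notMem hm, mul_zero]; exact zero_le
        _ ≤ ∫⁻ r, (Ioo (1-ρ/2) (1+ρ/2)).indicator (fun _ => ENNReal.ofReal (9/4)) r := setLIntegral_le_lintegral _ _
        _ = ENNReal.ofReal (ρ * (9/4)) := by
            rw [lintegral_indicator_const measurableSet_Ioo, Real.volume_Ioo, ← ENNReal.ofReal_mul (by norm_num)]
            congr 1; ring
    · rw [indicator_of_notMem hw, nonpos_iff_eq_zero]
      rw [setLIntegral_congr_fun (g := fun _ => 0) measurableSet_Ioi]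
      · simp
      intro r hr'
      simp only
      rw [indicator_of_notMem, mul_zero]
      intro hm
      apply hw
      have h3 := hr r hr' hm
      rw [mem_ball, dist_eq_norm] at hm
      rw [hS, mem_ofPred_eq]
      have h4 : ‖(w:E3) - r • (w:E3)‖ = |r - 1| := by
        rw [show (w:E3) - r • (w:E3) = (1 - r) • (w:E3) by rw [sub_smul, one_smul], norm_smul, Sph_norm, mul_one, Real.norm_eq_abs, abs_sub_comm]
      calc ‖(w:E3) - w0‖ = ‖((w:E3) - r • (w:E3)) + (r • (w:E3) - w0)‖ := by congr 1; abel
        _ ≤ _ := norm_add_le _ _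
        _ < ρ := by linarith
  rw [hvol] at h2
  have h3 : sig S * ENNReal.ofReal (ρ * (9/4)) = ENNReal.ofReal (sig.real S * (ρ * (9/4))) := by
    rw [ENNReal.ofReal_mul measureReal_nonneg, Measure.real, ENNReal.ofReal_toReal (measure_ne_top _ _)]
  rw [h3, ENNReal.ofReal_le_ofReal_iff (mul_nonneg measureReal_nonneg (by positivity))] at h2
  have h4 : ρ * (VB * ρ ^ 2 / 8) ≤ ρ * (sig.real S * (9/4)) := by nlinarith
  have := le_of_mul_le_mul_left h4 h0
  linarith

/-- Chebyshev on caps. -/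
lemma cap_cheb {g : Sph → ℝ} (hg : Continuous g) (h0 : ∀ w, 0 ≤ g w) {w0 : Sph} {ρ δ : ℝ} (hρ : 0 < ρ) (h1 : ρ ≤ 1) (hδ : 0 ≤ δ)
    (h : ∀ w : Sph, ‖(w:E3) - w0‖ < ρ → δ ≤ g w) : δ * (VB / 18 * ρ ^ 2) ≤ ∫ w, g w ∂sig := by
  set S := {w : Sph | ‖(w:E3) - w0‖ < ρ} with hS
  have mS : MeasurableSet S := by
    refine (isOpen_lt (by fun_prop) continuous_const).measurableSet
  calc δ * (VB / 18 * ρ ^ 2) ≤ δ * sig.real S := by gcongr; exact cap_lb hρ h1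
    _ = ∫ w in S, δ ∂sig := by simp [mul_comm]
    _ ≤ ∫ w in S, g w ∂sig := setIntegral_mono_on (integrable_const _) (sph_int hg).integrableOn mS h
    _ ≤ _ := setIntegral_le_integral (sph_int hg) (Filter.Eventually.of_forall h0)

/-- integrating a `0`-homogeneous function over a shell -/
lemma shell_lint {H : E3 → ℝ≥0∞} (hH : Measurable H) (hom : ∀ t : ℝ, 0 < t → ∀ y, H (t • y) = H y) {s lam : ℝ} (hs : 0 ≤ s) (hl : 0 ≤ lam)
    (hl1 : lam ≤ 1) :
    ∫⁻ y in {y : E3 | (1 - lam) * s < ‖y‖ ∧ ‖y‖ < s}, H y ≤ ENNReal.ofReal (lam * s ^ 3) * ∫⁻ w : Sph, H w ∂sig := by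
  have mS : MeasurableSet {y : E3 | (1 - lam) * s < ‖y‖ ∧ ‖y‖ < s} :=
    ((isOpen_lt continuous_const continuous_norm).inter (isOpen_lt continuous_norm continuous_const)).measurableSet
  rw [← lintegral_indicator mS, polar (hH.indicator mS), ← lintegral_const_mul' _ _ ENNReal.ofReal_ne_top]
  refine lintegral_mono fun w => ?_
  calc ∫⁻ r in Ioi (0:ℝ), ENNReal.ofReal (r^2) * ({y : E3 | (1 - lam) * s < ‖y‖ ∧ ‖y‖ < s}).indicator H (r • (w:E3))
      ≤ ∫⁻ r in Ioi (0:ℝ), (Ioo ((1-lam)*s) s).indicator (fun _ => ENNReal.ofReal (s^2) * H w) r := by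
        refine setLIntegral_mono' measurableSet_Ioi fun r hr' => ?_
        have hr0 : (0:ℝ) < r := hr'
        have hn : ‖r • (w:E3)‖ = r := by rw [norm_smul, Sph_norm, Real.norm_of_nonneg hr0.le, mul_one]
        by_cases hm : r • (w:E3) ∈ {y : E3 | (1 - lam) * s < ‖y‖ ∧ ‖y‖ < s}
        · rw [indicator_of_mem hm]
          rw [mem_ofPred_eq, hn] at hm
          rw [indicator_of_mem (by exact hm), hom r hr0]
          gcongr
          exact hm.2.le
        · rw [indicator_of_notMem hm, mul_zero]; exact zero_le
    _ ≤ ∫⁻ r, (Ioo ((1-lam)*s) s).indicator (fun _ => ENNReal.ofReal (s^2) * H w) r := setLIntegral_le_lintegral _ _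
    _ = ENNReal.ofReal (lam * s ^ 3) * H w := by
        rw [lintegral_indicator_const measurableSet_Ioo, Real.volume_Ioo, mul_right_comm, ← ENNReal.ofReal_mul (by positivity)]
        congr 2; ring

lemma dirD_eq {u : E3 → M3} (hu : ContDiff ℝ ∞ u) (v x : E3) : dirD u v x = fderiv ℝ u x v := by
  have dP : HasFDerivAt u (fderiv ℝ u x) x := (hu.differentiable (by simp) x).hasFDerivAt
  ext i j
  have e1 : HasFDerivAt (fun z => u z i j) _ x := (hasFDerivAt_pi'.1 ((hasFDerivAt_pi'.1 dP) i)) j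
  have e2 : fderiv ℝ (fun z => u z i j) x v = fderiv ℝ u x v i j := by rw [e1.fderiv]; rfl
  rw [← e2, fderiv_sum]
  simp only [dirD, Matrix.sum_apply, Matrix.smul_apply, pd_apply, smul_eq_mul]

lemma pd_eq {u : E3 → M3} (hu : ContDiff ℝ ∞ u) (k : Fin 3) (x : E3) : pd u k x = fderiv ℝ u x (ee k) := by
  rw [← dirD_eq hu]
  fin_cases k <;> simp [dirD, Fin.sum_univ_three, ee]

lemma norm_fd_sq_le {u : E3 → M3} (hu : ContDiff ℝ ∞ u) (v x : E3) : ‖fderiv ℝ u x v‖ ^ 2 ≤ gradSq u x * ‖v‖ ^ 2 := by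
  rw [← dirD_eq hu]
  have h : ‖dirD u v x‖ ≤ |v 0| * ‖pd u 0 x‖ + |v 1| * ‖pd u 1 x‖ + |v 2| * ‖pd u 2 x‖ := by
    simp only [dirD, Fin.sum_univ_three]
    refine (norm_add₃_le).trans ?_
    simp only [norm_smul, Real.norm_eq_abs]; rfl
  have h2 : gradSq u x ≥ ‖pd u 0 x‖^2 + ‖pd u 1 x‖^2 + ‖pd u 2 x‖^2 := by
    simp only [gradSq, Fin.sum_univ_three]
    linarith [norm_sq_le_frob (pd u 0 x), norm_sq_le_frob (pd u 1 x), norm_sq_le_frob (pd u 2 x)]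
  have h3 := norm_sq_E3 v
  rw [← sq_abs (v 0), ← sq_abs (v 1), ← sq_abs (v 2)] at h3
  set A := ‖pd u 0 x‖; set B := ‖pd u 1 x‖; set C := ‖pd u 2 x‖
  have hh : ‖dirD u v x‖ ^ 2 ≤ (|v 0| * A + |v 1| * B + |v 2| * C) ^ 2 := pow_le_pow_left₀ (norm_nonneg _) h 2
  rw [h3]
  calc _ ≤ _ := hh
    _ ≤ (A^2+B^2+C^2) * (|v 0| ^ 2 + |v 1| ^ 2 + |v 2| ^ 2) := by
        nlinarith [sq_nonneg (|v 0| * B - |v 1| * A), sq_nonneg (|v 0| * C - |v 2| * A), sq_nonneg (|v 1| * C - |v 2| * B)]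
    _ ≤ _ := by gcongr

lemma norm_ee (k : Fin 3) : ‖ee k‖ = 1 := by simp [ee]

/-- gradient bound from a bound on all directional derivatives -/
lemma gradSq_le_of {u : E3 → M3} (hu : ContDiff ℝ ∞ u) {x : E3} {B : ℝ} (h : ∀ ξ : E3, ‖ξ‖ = 1 → ‖fderiv ℝ u x ξ‖ ^ 2 ≤ B) :
    gradSq u x ≤ 27 * B := by
  have : ∀ k, frobSq (pd u k x) ≤ 9 * B := fun k => by
    rw [pd_eq hu]
    exact (frobSq_le_norm _).trans (by have := h _ (norm_ee k); linarith)
  simp only [gradSq, Fin.sum_univ_three]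
  linarith [this 0, this 1, this 2]

end Part18

section Part19

/-! ### P19: averaged retraction of the ball -/

open scoped Topology ENNReal

def Gm (α p : E3) : E3 := p - (1 - ‖p‖ ^ 2) • α

def Hm (st k2 : ℝ) (α p : E3) : M3 :=
  (st * (1 + k2) / (‖Gm α p‖ ^ 2 + k2)) • (op (Gm α p) - (‖Gm α p‖ ^ 2 / 3) • (1 : M3))

def kn (k2 : ℝ) (α p : E3) : ℝ := 1 / (‖Gm α p‖ ^ 2 + k2)

lemma Gm_apply (α p : E3) (i : Fin 3) : Gm α p i = p i - (1 - (p 0 ^ 2 + p 1 ^ 2 + p 2 ^ 2)) * α i := by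
  simp [Gm, norm_sq_E3]

lemma Gm_cont : Continuous fun x : E3 × E3 => Gm x.1 x.2 := by unfold Gm; fun_prop

lemma kn_cont {k2 : ℝ} (hk : 0 < k2) : Continuous fun x : E3 × E3 => kn k2 x.1 x.2 := by
  unfold kn
  refine continuous_const.div ((Gm_cont.norm.pow 2).add continuous_const) fun x => ?_
  positivity

lemma kn_pos {k2 : ℝ} (hk : 0 < k2) (α p : E3) : 0 < kn k2 α p := by unfold kn; positivity

lemma Hm_cd {k2 : ℝ} (hk : 0 < k2) (st : ℝ) (α : E3) : ContDiff ℝ ∞ (Hm st k2 α) := by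
  have hG : ContDiff ℝ ∞ (Gm α) := by
    unfold Gm
    exact contDiff_id.sub ((contDiff_const.sub (contDiff_norm_sq ℝ)).smul contDiff_const)
  have hGi : ∀ i, ContDiff ℝ ∞ fun p => Gm α p i := fun i => (contDiff_piLp 2).1 hG i
  have hn : ContDiff ℝ ∞ fun p => ‖Gm α p‖ ^ 2 := hG.norm_sq ℝ
  have hq : ContDiff ℝ ∞ fun p => st * (1 + k2) / (‖Gm α p‖ ^ 2 + k2) :=
    contDiff_const.div (hn.add contDiff_const) fun p => by positivity
  rw [smM]
  intro i j
  simp only [Hm, Matrix.smul_apply, Matrix.sub_apply, op_apply, smul_eq_mul]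
  exact hq.mul (((hGi i).mul (hGi j)).sub ((hn.div_const 3).mul contDiff_const))

lemma Hm_S0 (st k2 : ℝ) (α p : E3) : Hm st k2 α p ∈ S0 := by
  unfold Hm
  refine S0_smul _ ⟨?_, ?_⟩
  · ext i j
    simp [op_apply, Matrix.one_apply, eq_comm, mul_comm]
  · simp [Matrix.trace, Fin.sum_univ_three, op_apply, norm_sq_E3]; ring

lemma Gm_unit {α p : E3} (hp : ‖p‖ = 1) : Gm α p = p := by simp [Gm, hp]

lemma Hm_unit {k2 : ℝ} (hk : 0 < k2) (st : ℝ) {α p : E3} (hp : ‖p‖ = 1) : Hm st k2 α p = Nn st p := by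
  unfold Hm Nn
  rw [Gm_unit hp, hp]
  have : st * (1 + k2) / (1 ^ 2 + k2) = st := by field_simp
  rw [this]; norm_num

lemma Gm_norm_le {α p : E3} (ha : ‖α‖ ≤ 1/2) (hp : ‖p‖ ≤ 1) : ‖Gm α p‖ ≤ 3/2 := by
  have h0 := norm_nonneg p
  have h1 : 0 ≤ 1 - ‖p‖ ^ 2 := by nlinarith
  calc ‖Gm α p‖ ≤ ‖p‖ + ‖(1 - ‖p‖ ^ 2) • α‖ := norm_sub_le _ _
    _ = ‖p‖ + (1 - ‖p‖ ^ 2) * ‖α‖ := by rw [norm_smul, Real.norm_of_nonneg h1]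
    _ ≤ ‖p‖ + (1 - ‖p‖ ^ 2) * (1/2) := by gcongr
    _ ≤ 3/2 := by nlinarith

/-- closeness of the regularised retraction to the vacuum manifold -/
lemma Hm_close {k2 : ℝ} (hk : 0 < k2) (st : ℝ) {α p : E3} (ha : ‖α‖ ≤ 1/2) (hp : ‖p‖ ≤ 1) :
    ∃ m : E3, ‖m‖ = 1 ∧ frobSq (Hm st k2 α p - Nn st m) ≤ 2 * st ^ 2 * (k2 * kn k2 α p) := by
  have hm : ∃ m : E3, ‖m‖ = 1 ∧ Gm α p = ‖Gm α p‖ • m := by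
    by_cases h : Gm α p = 0
    · exact ⟨ee 0, norm_ee 0, by simp [h]⟩
    · exact ⟨hat (Gm α p), norm_hat h, by rw [hat, smul_smul, mul_inv_cancel₀ (norm_ne_zero_iff.2 h), one_smul]⟩
  obtain ⟨m, hm1, hm2⟩ := hm
  refine ⟨m, hm1, ?_⟩
  have hg := Gm_norm_le ha hp
  have hg0 := norm_nonneg (Gm α p)
  unfold kn Hm
  set g := ‖Gm α p‖ with hgd
  have e1 : op (Gm α p) = g ^ 2 • op m := by
    rw [hm2]; ext i j; simp [op_apply]; ring
  have hN : 0 < g ^ 2 + k2 := by positivity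
  have e2 : (st * (1 + k2) / (g ^ 2 + k2)) • (op (Gm α p) - (g ^ 2 / 3) • (1 : M3)) - Nn st m
      = (k2 * (g ^ 2 - 1) / (g ^ 2 + k2)) • Nn st m := by
    rw [e1]; unfold Nn
    ext i j
    simp only [Matrix.smul_apply, Matrix.sub_apply, smul_eq_mul]
    field_simp
    ring
  rw [e2, frobSq_smul, frobSq_Nn st hm1]
  set x := k2 * (1 / (g ^ 2 + k2)) with hx
  have hx0 : 0 ≤ x := by positivity
  have hx1 : x ≤ 1 := by rw [hx, mul_one_div, div_le_one hN]; nlinarith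
  have e3 : k2 * (g ^ 2 - 1) / (g ^ 2 + k2) = x * (g ^ 2 - 1) := by rw [hx]; field_simp
  rw [e3]
  have h5 : (g ^ 2 - 1) ^ 2 ≤ 25/16 := by
    have : g ^ 2 ≤ 9/4 := by nlinarith
    nlinarith [sq_nonneg g]
  have h6 : x ^ 2 ≤ x := by nlinarith
  calc (x * (g ^ 2 - 1)) ^ 2 * (2 / 3 * st ^ 2) = x ^ 2 * (g ^ 2 - 1) ^ 2 * (2 / 3 * st ^ 2) := by ring
    _ ≤ x * (25/16) * (2 / 3 * st ^ 2) := by gcongr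
    _ ≤ 2 * st ^ 2 * x := by nlinarith [mul_nonneg hx0 (sq_nonneg st)]

lemma fderiv_entry {f : E3 → M3} {p ζ : E3} (hf : DifferentiableAt ℝ f p) {i j : Fin 3} {d : ℝ}
    (h : HasDerivAt (fun t : ℝ => f (p + t • ζ) i j) d 0) : fderiv ℝ f p ζ i j = d := by
  have dP : HasFDerivAt f (fderiv ℝ f p) p := hf.hasFDerivAt
  have e1 : HasFDerivAt (fun z => f z i j) _ p := (hasFDerivAt_pi'.1 ((hasFDerivAt_pi'.1 dP) i)) j
  have e2 := e1.hasLineDerivAt ζ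
  have e2' : HasDerivAt (fun t : ℝ => f (p + t • ζ) i j) _ 0 := e2
  have e3 := e2'.unique h
  rw [← e3]; rfl

lemma Hm_der {k2 : ℝ} (hk : 0 < k2) (hk1 : k2 ≤ 1) {st : ℝ} (hst : 0 < st) {α p : E3} (ha : ‖α‖ ≤ 1/2) (hp : ‖p‖ ≤ 1) (ζ : E3) :
    ‖fderiv ℝ (Hm st k2 α) p ζ‖ ^ 2 ≤ 576 * st ^ 2 * kn k2 α p * ‖ζ‖ ^ 2 := by
  set z : E3 := ζ + (2 * inner ℝ p ζ) • α with hz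
  have hzn : ‖z‖ ≤ 2 * ‖ζ‖ := by
    have h1 := abs_real_inner_le_norm p ζ
    have h2 := norm_nonneg ζ
    have h4 : ‖p‖ * ‖ζ‖ ≤ ‖ζ‖ := by nlinarith
    calc ‖z‖ ≤ ‖ζ‖ + ‖(2 * inner ℝ p ζ) • α‖ := norm_add_le _ _
      _ = ‖ζ‖ + 2 * |inner ℝ p ζ| * ‖α‖ := by rw [norm_smul, Real.norm_eq_abs, abs_mul, abs_two]
      _ ≤ ‖ζ‖ + 2 * ‖ζ‖ * (1/2) := by gcongr; exact h1.trans h4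
      _ = _ := by ring
  set q := Gm α p with hq
  set N := ‖q‖ ^ 2 + k2 with hN
  have hN0 : 0 < N := by positivity
  set c0 := st * (1 + k2) with hc0
  have hc00 : 0 < c0 := by positivity
  have hc02 : c0 ≤ 2 * st := by rw [hc0]; nlinarith
  have hline : ∀ i (t : ℝ), (p + t • ζ) i = p i + t * ζ i := fun i t => by simp
  have hd : ∀ i, HasDerivAt (fun t : ℝ => (p + t • ζ) i) (ζ i) 0 := fun i => by
    simp only [hline]
    simpa using ((hasDerivAt_id (0:ℝ)).mul_const (ζ i)).const_add (p i)
  have hG : ∀ i, HasDerivAt (fun t : ℝ => Gm α (p + t • ζ) i) (z i) 0 := fun i => by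
    simp only [Gm_apply]
    have h := (hd i).sub ((((((hd 0).pow 2).add ((hd 1).pow 2)).add ((hd 2).pow 2)).const_sub 1).mul_const (α i))
    refine h.congr_deriv ?_
    simp [hz, inner_E3]; ring
  have hNt : HasDerivAt (fun t : ℝ => ‖Gm α (p + t • ζ)‖ ^ 2) (2 * inner ℝ q z) 0 := by
    simp only [norm_sq_E3]
    have h := (((hG 0).pow 2).add ((hG 1).pow 2)).add ((hG 2).pow 2)
    refine h.congr_deriv ?_
    simp [inner_E3, hq]; ring
  have hent : ∀ i j, fderiv ℝ (Hm st k2 α) p ζ i j =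
      c0 * ((z i * q j + q i * z j - 2/3 * inner ℝ q z * (1:M3) i j) / N - (q i * q j - ‖q‖ ^ 2 / 3 * (1:M3) i j) * (2 * inner ℝ q z) / N ^ 2) := by
    intro i j
    apply fderiv_entry ((Hm_cd hk st α).differentiable (by simp) p)
    simp only [Hm, Matrix.smul_apply, Matrix.sub_apply, op_apply, smul_eq_mul]
    have h1 : HasDerivAt (fun t : ℝ => st * (1 + k2) / (‖Gm α (p + t • ζ)‖ ^ 2 + k2)) _ 0 :=
      (hasDerivAt_const (0:ℝ) (st * (1+k2))).div (hNt.add_const k2) (by positivity)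
    have h2 := ((hG i).mul (hG j)).sub ((hNt.div_const 3).mul_const ((1:M3) i j))
    have h3 := h1.mul h2
    refine h3.congr_deriv ?_
    simp only [Pi.mul_apply, Pi.sub_apply, zero_smul, add_zero]
    rw [← hq, ← hN, ← hc0]
    field_simp
    ring
  have hqi : ∀ i, |q i| ≤ ‖q‖ := fun i => by
    rw [← Real.norm_eq_abs]; exact PiLp.norm_apply_le q i
  have hzi : ∀ i, |z i| ≤ ‖z‖ := fun i => by
    rw [← Real.norm_eq_abs]; exact PiLp.norm_apply_le z i
  have hin : |inner ℝ q z| ≤ ‖q‖ * ‖z‖ := abs_real_inner_le_norm q z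
  have h1ij : ∀ i j, |(1:M3) i j| ≤ 1 := fun i j => by
    rw [Matrix.one_apply]; split_ifs <;> simp
  have hb : ‖fderiv ℝ (Hm st k2 α) p ζ‖ ≤ c0 * (6 * (‖q‖ * ‖z‖) / N) := by
    rw [Matrix.norm_le_iff (by positivity)]
    intro i j
    rw [hent, Real.norm_eq_abs, abs_mul, abs_of_pos hc00]
    gcongr
    have b1 : |z i * q j + q i * z j - 2/3 * inner ℝ q z * (1:M3) i j| ≤ 8/3 * (‖q‖ * ‖z‖) := by
      have t1 : |z i * q j| ≤ ‖q‖ * ‖z‖ := by rw [abs_mul, mul_comm]; gcongr <;> simp [hqi, hzi]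
      have t2 : |q i * z j| ≤ ‖q‖ * ‖z‖ := by rw [abs_mul]; gcongr <;> simp [hqi, hzi]
      have t3 : |2/3 * inner ℝ q z * (1:M3) i j| ≤ 2/3 * (‖q‖ * ‖z‖) := by
        rw [abs_mul, abs_mul]
        calc |(2/3:ℝ)| * |inner ℝ q z| * |(1:M3) i j| ≤ 2/3 * (‖q‖ * ‖z‖) * 1 := by
              gcongr
              · exact (abs_of_pos (by norm_num)).le
              · exact h1ij i j
          _ = _ := mul_one _
      calc _ ≤ |z i * q j + q i * z j| + _ := abs_sub _ _
        _ ≤ |z i * q j| + |q i * z j| + _ := by gcongr; exact abs_add_le _ _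
        _ ≤ _ := by linarith
    have b2 : |(q i * q j - ‖q‖ ^ 2 / 3 * (1:M3) i j) * (2 * inner ℝ q z)| ≤ 8/3 * (‖q‖ * ‖z‖) * ‖q‖ ^ 2 := by
      have t1 : |q i * q j| ≤ ‖q‖ * ‖q‖ := by rw [abs_mul]; gcongr <;> simp [hqi]
      have t3 : |‖q‖ ^ 2 / 3 * (1:M3) i j| ≤ ‖q‖ ^ 2 / 3 := by
        rw [abs_mul, abs_of_nonneg (by positivity)]
        exact mul_le_of_le_one_right (by positivity) (h1ij i j)
      have t4 : |q i * q j - ‖q‖ ^ 2 / 3 * (1:M3) i j| ≤ 4/3 * ‖q‖ ^ 2 := (abs_sub _ _).trans (by nlinarith)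
      rw [abs_mul, abs_mul 2, abs_two]
      calc _ ≤ (4/3 * ‖q‖ ^ 2) * (2 * (‖q‖ * ‖z‖)) := by gcongr
        _ = _ := by ring
    have hqN : ‖q‖ ^ 2 ≤ N := by rw [hN]; linarith
    calc _ ≤ _ := abs_sub _ _
      _ = |z i * q j + q i * z j - 2/3 * inner ℝ q z * (1:M3) i j| / N + |(q i * q j - ‖q‖ ^ 2 / 3 * (1:M3) i j) * (2 * inner ℝ q z)| / N ^ 2 := by
          rw [abs_div, abs_div, abs_of_pos hN0, abs_of_pos (by positivity : 0 < N ^ 2)]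
      _ ≤ (8/3 * (‖q‖ * ‖z‖)) / N + (8/3 * (‖q‖ * ‖z‖) * N) / N ^ 2 := by
          gcongr
          exact b2.trans (by gcongr)
      _ = (16/3 * (‖q‖ * ‖z‖)) / N := by field_simp; ring
      _ ≤ _ := by gcongr; norm_num
  have hkn : kn k2 α p = 1 / N := rfl
  have hqN : ‖q‖ ^ 2 ≤ N := by rw [hN]; linarith
  calc _ ≤ (c0 * (6 * (‖q‖ * ‖z‖) / N)) ^ 2 := by gcongr
    _ = c0 ^ 2 * 36 * ‖q‖ ^ 2 * ‖z‖ ^ 2 / N ^ 2 := by ring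
    _ ≤ (2 * st) ^ 2 * 36 * N * (2 * ‖ζ‖) ^ 2 / N ^ 2 := by gcongr
    _ = _ := by rw [hkn]; field_simp; ring

lemma lint_inv_sq : ∫⁻ y in ball (0:E3) 3, ENNReal.ofReal (1 / ‖y‖ ^ 2) ≤ ENNReal.ofReal (3 * sig.real univ) := by
  have hm : Measurable fun y : E3 => ENNReal.ofReal (1 / ‖y‖ ^ 2) := by fun_prop
  rw [← lintegral_indicator measurableSet_ball, polar (hm.indicator measurableSet_ball)]
  calc _ ≤ ∫⁻ w : Sph, ENNReal.ofReal 3 ∂sig := by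
        refine lintegral_mono fun w => ?_
        calc ∫⁻ r in Ioi (0:ℝ), ENNReal.ofReal (r^2) * (ball (0:E3) 3).indicator (fun y : E3 => ENNReal.ofReal (1 / ‖y‖ ^ 2)) (r • (w:E3))
            ≤ ∫⁻ r in Ioi (0:ℝ), (Iio (3:ℝ)).indicator 1 r := by
              refine setLIntegral_mono' measurableSet_Ioi fun r hr' => ?_
              have hr0 : (0:ℝ) < r := hr'
              have hn : ‖r • (w:E3)‖ = r := by rw [norm_smul, Sph_norm, Real.norm_of_nonneg hr0.le, mul_one]
              by_cases hm : r < 3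
              · rw [indicator_of_mem (by rw [mem_ball_zero_iff, hn]; exact hm), indicator_of_mem (by exact hm), hn,
                  ← ENNReal.ofReal_mul (by positivity)]
                have : r ^ 2 * (1 / r ^ 2) = 1 := by field_simp
                rw [this]; simp
              · rw [indicator_of_notMem (by rw [mem_ball_zero_iff, hn]; exact hm), mul_zero]; exact zero_le
          _ = ENNReal.ofReal 3 := by
              rw [lintegral_indicator_one measurableSet_Iio, Measure.restrict_apply measurableSet_Iio, inter_comm, Ioi_inter_Iio, Real.volume_Ioo]; norm_num
    _ = _ := by
        rw [lintegral_const, ENNReal.ofReal_mul (by norm_num), Measure.real, ENNReal.ofReal_toReal (measure_ne_top _ _)]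

lemma kn_avg : ∃ C > 0, ∀ k2 : ℝ, 0 < k2 → ∀ p : E3, ‖p‖ ≤ 1 →
    ∫⁻ α in ball (0:E3) (1/2), ENNReal.ofReal (kn k2 α p) ≤ ENNReal.ofReal C := by
  have hV := VB_pos
  have hs : 0 ≤ sig.real univ := measureReal_nonneg
  refine ⟨4 * VB + 6 * (3 * sig.real univ), by positivity, fun k2 hk p hp => ?_⟩
  have hp0 := norm_nonneg p
  by_cases h : 3/4 ≤ ‖p‖
  · calc ∫⁻ α in ball (0:E3) (1/2), ENNReal.ofReal (kn k2 α p) ≤ ∫⁻ α in ball (0:E3) (1/2), ENNReal.ofReal 4 := by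
          refine setLIntegral_mono' measurableSet_ball fun α hα => ?_
          apply ENNReal.ofReal_le_ofReal
          rw [mem_ball_zero_iff] at hα
          have h1 : 0 ≤ 1 - ‖p‖ ^ 2 := by nlinarith
          have h2 : 1/2 ≤ ‖Gm α p‖ := by
            have := norm_sub_norm_le p ((1 - ‖p‖ ^ 2) • α)
            rw [norm_smul, Real.norm_of_nonneg h1] at this
            have h3 : (1 - ‖p‖ ^ 2) * ‖α‖ ≤ (1 - ‖p‖ ^ 2) * (1/2) := by gcongr
            unfold Gm
            nlinarith
          unfold kn
          rw [div_le_iff₀ (by positivity)]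
          nlinarith
      _ = ENNReal.ofReal 4 * volume (ball (0:E3) (1/2)) := setLIntegral_const _ _
      _ ≤ ENNReal.ofReal 4 * volume (ball (0:E3) 1) := by gcongr; norm_num
      _ = ENNReal.ofReal (4 * VB) := by rw [ENNReal.ofReal_mul (by norm_num), VB, ENNReal.ofReal_toReal measure_ball_lt_top.ne]
      _ ≤ _ := by apply ENNReal.ofReal_le_ofReal; linarith
  · push Not at h
    set d := 1 - ‖p‖ ^ 2 with hd
    have hd1 : 7/16 ≤ d := by rw [hd]; nlinarith
    have hd0 : 0 < d := by linarith
    set x0 := d⁻¹ • p with hx0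
    have hx0n : ‖x0‖ ≤ 12/7 := by
      rw [hx0, norm_smul, norm_inv, Real.norm_of_nonneg hd0.le, inv_mul_le_iff₀ hd0]; nlinarith
    calc ∫⁻ α in ball (0:E3) (1/2), ENNReal.ofReal (kn k2 α p)
        ≤ ∫⁻ α in ball (0:E3) (1/2), ENNReal.ofReal 6 * (ball (0:E3) 3).indicator (fun y => ENNReal.ofReal (1 / ‖y‖ ^ 2)) (α + -x0) := by
          have hne : ∀ᵐ α : E3, α ≠ x0 := by
            have : volume ({x0} : Set E3) = 0 := measure_singleton _
            rw [ae_iff]; simp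
          refine lintegral_mono_ae ?_
          rw [ae_restrict_iff' measurableSet_ball]
          filter_upwards [hne] with α hα1 hα
          rw [mem_ball_zero_iff] at hα
          have hsub : α + -x0 ∈ ball (0:E3) 3 := by
            rw [mem_ball_zero_iff]
            calc _ ≤ ‖α‖ + ‖-x0‖ := norm_add_le _ _
              _ < 3 := by rw [norm_neg]; linarith
          rw [indicator_of_mem hsub, ← ENNReal.ofReal_mul (by norm_num)]
          apply ENNReal.ofReal_le_ofReal
          have hG : ‖Gm α p‖ = d * ‖α + -x0‖ := by
            have : Gm α p = (-d) • (α + -x0) := by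
              rw [hx0, smul_add, smul_neg, smul_smul, neg_mul, mul_inv_cancel₀ hd0.ne', Gm]
              module
            rw [this, norm_smul, norm_neg, Real.norm_of_nonneg hd0.le]
          have hy : 0 < ‖α + -x0‖ := by
            rw [norm_pos_iff, ← sub_eq_add_neg]; exact sub_ne_zero.2 hα1
          unfold kn
          rw [hG]
          have : (1/6) * ‖α + -x0‖ ^ 2 ≤ (d * ‖α + -x0‖) ^ 2 + k2 := by
            have : 1/6 ≤ d ^ 2 := by nlinarith
            rw [mul_pow]; nlinarith [sq_nonneg ‖α + -x0‖]
          calc 1 / ((d * ‖α + -x0‖) ^ 2 + k2) ≤ 1 / ((1/6) * ‖α + -x0‖ ^ 2) := by gcongr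
            _ = _ := by field_simp
      _ ≤ ∫⁻ α, ENNReal.ofReal 6 * (ball (0:E3) 3).indicator (fun y => ENNReal.ofReal (1 / ‖y‖ ^ 2)) (α + -x0) := setLIntegral_le_lintegral _ _
      _ = ENNReal.ofReal 6 * ∫⁻ y in ball (0:E3) 3, ENNReal.ofReal (1 / ‖y‖ ^ 2) := by
          rw [lintegral_const_mul' _ _ ENNReal.ofReal_ne_top, lintegral_add_right_eq_self (fun y => (ball (0:E3) 3).indicator (fun y => ENNReal.ofReal (1 / ‖y‖ ^ 2)) y),
            lintegral_indicator measurableSet_ball]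
      _ ≤ ENNReal.ofReal 6 * ENNReal.ofReal (3 * sig.real univ) := by gcongr; exact lint_inv_sq
      _ = ENNReal.ofReal (6 * (3 * sig.real univ)) := (ENNReal.ofReal_mul (by norm_num)).symm
      _ ≤ _ := by apply ENNReal.ofReal_le_ofReal; linarith

lemma exists_le_avg {F : E3 → ℝ≥0∞} (mF : Measurable F) :
    ∃ α : E3, ‖α‖ ≤ 1/2 ∧ F α ≤ (∫⁻ α in ball (0:E3) (1/2), F α) / volume (ball (0:E3) (1/2)) := by
  obtain ⟨α, hα, h⟩ := exists_le_setLAverage (μ := volume) (s := ball (0:E3) (1/2)) (measure_ball_pos _ _ (by norm_num)).ne' measure_ball_lt_top.ne mF.aemeasurable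
  refine ⟨α, by rw [mem_ball_zero_iff] at hα; exact hα.le, h.trans ?_⟩
  rw [setLAverage_eq]

lemma choose_alpha : ∃ C > 0, ∀ k2 : ℝ, 0 < k2 → ∀ (U : Set E3) (p : E3 → E3) (Ψ : E3 → ℝ≥0∞), MeasurableSet U → Measurable p → Measurable Ψ →
    (∀ y, ‖p y‖ ≤ 1) → ∃ α : E3, ‖α‖ ≤ 1/2 ∧
      ∫⁻ y in U, ENNReal.ofReal (1 + kn k2 α (p y)) * Ψ y ≤ ENNReal.ofReal C * ∫⁻ y in U, Ψ y := by
  obtain ⟨C, hC, hCk⟩ := kn_avg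
  set V := (volume (ball (0:E3) (1/2))).toReal with hV
  have hV0 : 0 < V := ENNReal.toReal_pos (measure_ball_pos _ _ (by norm_num)).ne' measure_ball_lt_top.ne
  have hVe : volume (ball (0:E3) (1/2)) = ENNReal.ofReal V := (ENNReal.ofReal_toReal measure_ball_lt_top.ne).symm
  refine ⟨(V + C) / V, by positivity, fun k2 hk U p Ψ mU mp mΨ hp => ?_⟩
  have mkn : Measurable fun x : E3 × E3 => kn k2 x.1 x.2 := (kn_cont hk).measurable
  have mk : Measurable fun x : E3 × E3 => ENNReal.ofReal (1 + kn k2 x.1 (p x.2)) * Ψ x.2 := by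
    refine Measurable.mul ?_ (mΨ.comp measurable_snd)
    refine Measurable.ennreal_ofReal (measurable_const.add ?_)
    have hh : Measurable fun x : E3 × E3 => (x.1, p x.2) := measurable_fst.prodMk (mp.comp measurable_snd)
    have h2 : Measurable ((fun x : E3 × E3 => kn k2 x.1 x.2) ∘ fun x : E3 × E3 => (x.1, p x.2)) := mkn.comp hh
    exact h2
  have mF : Measurable fun α => ∫⁻ y in U, ENNReal.ofReal (1 + kn k2 α (p y)) * Ψ y := mk.lintegral_prod_right'
  obtain ⟨α, hα, h⟩ := exists_le_avg mF
  refine ⟨α, hα, h.trans ?_⟩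
  rw [hVe]
  have hT : ∫⁻ α in ball (0:E3) (1/2), ∫⁻ y in U, ENNReal.ofReal (1 + kn k2 α (p y)) * Ψ y ≤ ENNReal.ofReal (V + C) * ∫⁻ y in U, Ψ y := by
    rw [lintegral_lintegral_swap mk.aemeasurable, ← lintegral_const_mul' _ _ ENNReal.ofReal_ne_top]
    refine lintegral_mono fun y => ?_
    have m1 : Measurable fun α => ENNReal.ofReal (1 + kn k2 α (p y)) :=
      (measurable_const.add (mkn.of_uncurry_right (y := p y))).ennreal_ofReal
    simp only
    rw [lintegral_mul_const _ m1]
    gcongr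
    have : ∀ α, ENNReal.ofReal (1 + kn k2 α (p y)) = ENNReal.ofReal 1 + ENNReal.ofReal (kn k2 α (p y)) := fun α =>
      ENNReal.ofReal_add (by norm_num) (kn_pos hk _ _).le
    simp only [this]
    rw [lintegral_add_left measurable_const, setLIntegral_const, hVe, ENNReal.ofReal_add hV0.le hC.le, ENNReal.ofReal_one, one_mul]
    gcongr
    exact hCk k2 hk (p y) (hp y)
  calc _ ≤ (ENNReal.ofReal (V + C) * ∫⁻ y in U, Ψ y) / ENNReal.ofReal V := by gcongr
    _ = _ := by
      rw [ENNReal.ofReal_div_of_pos hV0, div_eq_mul_inv, div_eq_mul_inv, mul_right_comm]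

end Part19

section Part20

/-! ### P20: the competitor -/

open scoped Topology ENNReal

def Xc (lam s : ℝ) (y : E3) : ℝ := Real.smoothTransition ((‖y‖ / s - (1 - lam)) / lam)

def gc (s τ r : ℝ) : ℝ := s + (r - s) * Real.smoothTransition ((r - s) / τ)

def pc (nb : E3) (lam s : ℝ) (n : E3 → E3) (y : E3) : E3 := nb + Xc lam s y • (n y - nb)

def Pc (st k2 : ℝ) (α nb : E3) (lam s τ : ℝ) (u : E3 → M3) (n : E3 → E3) (y : E3) : M3 :=
  Hm st k2 α (pc nb lam s n y) + Xc lam s y • (u (gc s τ ‖y‖ • hat y) - Hm st k2 α (n y))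

lemma sT_deriv : ∃ K > 0, ∀ t, |deriv Real.smoothTransition t| ≤ K := by
  have hc : Continuous (deriv Real.smoothTransition) :=
    (contDiff_infty_iff_deriv.1 (Real.smoothTransition.contDiff (n := ⊤))).2.continuous
  obtain ⟨K, hK⟩ := (isCompact_Icc (a := (0:ℝ)) (b := 1)).exists_bound_of_continuousOn hc.continuousOn
  refine ⟨max K 1, by positivity, fun t => ?_⟩
  rcases lt_or_ge t 0 with h | h
  · have : Real.smoothTransition =ᶠ[𝓝 t] fun _ => 0 := by
      filter_upwards [Iio_mem_nhds h] with z hz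
      exact Real.smoothTransition.zero_of_nonpos (le_of_lt hz)
    rw [this.deriv_eq]; simp
  rcases lt_or_ge 1 t with h1 | h1
  · have : Real.smoothTransition =ᶠ[𝓝 t] fun _ => 1 := by
      filter_upwards [Ioi_mem_nhds h1] with z hz
      exact Real.smoothTransition.one_of_one_le (le_of_lt hz)
    rw [this.deriv_eq]; simp
  · exact (hK t ⟨h, h1⟩).trans (le_max_left _ _)

lemma Xc_mem (lam s : ℝ) (y : E3) : 0 ≤ Xc lam s y ∧ Xc lam s y ≤ 1 :=
  ⟨Real.smoothTransition.nonneg _, Real.smoothTransition.le_one _⟩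

lemma Xc_zero {lam s : ℝ} (hl : 0 < lam) (hs : 0 < s) {y : E3} (hy : ‖y‖ ≤ (1 - lam) * s) : Xc lam s y = 0 := by
  apply Real.smoothTransition.zero_of_nonpos
  apply div_nonpos_of_nonpos_of_nonneg _ hl.le
  rw [sub_nonpos, div_le_iff₀ hs]; exact hy

lemma Xc_one {lam s : ℝ} (hl : 0 < lam) (hs : 0 < s) {y : E3} (hy : s ≤ ‖y‖) : Xc lam s y = 1 := by
  apply Real.smoothTransition.one_of_one_le
  rw [le_div_iff₀ hl]
  have : 1 ≤ ‖y‖ / s := by rwa [le_div_iff₀ hs, one_mul]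
  linarith

lemma Xc_cd (lam s : ℝ) : ContDiffOn ℝ ∞ (Xc lam s) {0}ᶜ :=
  (Real.smoothTransition.contDiff (n := ⊤)).comp_contDiffOn (((cd_norm.div_const s).sub contDiffOn_const).div_const lam)

lemma cd_of {F : Type*} [NormedAddCommGroup F] [NormedSpace ℝ F] {G : E3 → F} {k : F} {ρ : ℝ} (hρ : 0 < ρ)
    (h : ContDiffOn ℝ ∞ G {0}ᶜ) (hc : ∀ y : E3, ‖y‖ < ρ → G y = k) : ContDiff ℝ ∞ G := by
  rw [contDiff_iff_contDiffAt]
  intro y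
  by_cases hy : y = 0
  · subst hy
    have : G =ᶠ[𝓝 0] fun _ => k := by
      filter_upwards [ball_mem_nhds (0:E3) hρ] with z hz
      exact hc z (by simpa using hz)
    exact contDiffAt_const.congr_of_eventuallyEq this
  · exact h.contDiffAt (isOpen_compl_singleton.mem_nhds hy)

lemma pc_cd {nb : E3} {lam s : ℝ} {n : E3 → E3} (hl : 0 < lam) (hl1 : lam < 1) (hs : 0 < s) (hn : ContDiffOn ℝ ∞ n {0}ᶜ) :
    ContDiff ℝ ∞ (pc nb lam s n) := by
  refine cd_of (ρ := (1 - lam) * s) (k := nb) (by nlinarith) ?_ fun y hy => ?_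
  · exact contDiffOn_const.add ((Xc_cd lam s).smul (hn.sub contDiffOn_const))
  · simp [pc, Xc_zero hl hs hy.le]

lemma pc_norm {nb : E3} {lam s : ℝ} {n : E3 → E3} (hl : 0 < lam) (hl1 : lam < 1) (hs : 0 < s) (hn : ∀ y, y ≠ 0 → ‖n y‖ = 1)
    (hnb : ‖nb‖ ≤ 1) (y : E3) : ‖pc nb lam s n y‖ ≤ 1 := by
  by_cases hy : y = 0
  · have : Xc lam s y = 0 := Xc_zero hl hs (by subst hy; simp; nlinarith)
    simpa [pc, this] using hnb
  · have e : pc nb lam s n y = (1 - Xc lam s y) • nb + Xc lam s y • n y := by unfold pc; module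
    obtain ⟨h0, h1⟩ := Xc_mem lam s y
    rw [e]
    calc _ ≤ ‖(1 - Xc lam s y) • nb‖ + ‖Xc lam s y • n y‖ := norm_add_le _ _
      _ = (1 - Xc lam s y) * ‖nb‖ + Xc lam s y * 1 := by
        rw [norm_smul, norm_smul, hn y hy, Real.norm_of_nonneg h0, Real.norm_of_nonneg (by linarith)]
      _ ≤ (1 - Xc lam s y) * 1 + Xc lam s y * 1 := by gcongr
      _ = 1 := by ring

lemma gc_in {s τ r : ℝ} (hτ : 0 < τ) (hr : r ≤ s) : gc s τ r = s := by
  unfold gc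
  rw [Real.smoothTransition.zero_of_nonpos (div_nonpos_of_nonpos_of_nonneg (by linarith) hτ.le)]; ring

lemma gc_out {s τ r : ℝ} (hτ : 0 < τ) (hr : s + τ ≤ r) : gc s τ r = r := by
  unfold gc
  rw [Real.smoothTransition.one_of_one_le (by rw [le_div_iff₀ hτ]; linarith)]; ring

lemma gc_cd (s τ : ℝ) : ContDiff ℝ ∞ (gc s τ) := by
  unfold gc
  exact contDiff_const.add ((contDiff_id.sub contDiff_const).mul
    ((Real.smoothTransition.contDiff (n := ⊤)).comp ((contDiff_id.sub contDiff_const).div_const τ)))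

lemma Pc_cd {st k2 : ℝ} {α nb : E3} {lam s τ : ℝ} {u : E3 → M3} {n : E3 → E3} (hk : 0 < k2) (hl : 0 < lam) (hl1 : lam < 1) (hs : 0 < s)
    (hu : ContDiff ℝ ∞ u) (hn : ContDiffOn ℝ ∞ n {0}ᶜ) : ContDiff ℝ ∞ (Pc st k2 α nb lam s τ u n) := by
  refine cd_of (ρ := (1 - lam) * s) (k := Hm st k2 α nb) (by nlinarith) ?_ fun y hy => ?_
  · refine ((Hm_cd hk st α).comp_contDiffOn (pc_cd hl hl1 hs hn).contDiffOn).add ((Xc_cd lam s).smul (ContDiffOn.sub ?_ ((Hm_cd hk st α).comp_contDiffOn hn)))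
    exact hu.comp_contDiffOn (((gc_cd s τ).comp_contDiffOn cd_norm).smul cd_hat)
  · simp [Pc, pc, Xc_zero hl hs hy.le]

lemma Pc_S0 {st k2 : ℝ} {α nb : E3} {lam s τ : ℝ} {u : E3 → M3} {n : E3 → E3} (hS : ∀ y, u y ∈ S0) (y : E3) :
    Pc st k2 α nb lam s τ u n y ∈ S0 := by
  unfold Pc
  refine S0_add (Hm_S0 _ _ _ _) (S0_smul _ ?_)
  have := S0_add (hS (gc s τ ‖y‖ • hat y)) (S0_smul (-1) (Hm_S0 st k2 α (n y)))
  rwa [neg_one_smul, ← sub_eq_add_neg] at this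

lemma Pc_out {st k2 : ℝ} {α nb : E3} {lam s τ : ℝ} {u : E3 → M3} {n : E3 → E3} (hl : 0 < lam) (hs : 0 < s) {y : E3} (hy : s ≤ ‖y‖) :
    Pc st k2 α nb lam s τ u n y = u (gc s τ ‖y‖ • hat y) := by
  simp [Pc, pc, Xc_one hl hs hy]

lemma norm_smul_hat {y : E3} (hy : y ≠ 0) : ‖y‖ • hat y = y := by
  rw [hat, smul_smul, mul_inv_cancel₀ (norm_ne_zero_iff.2 hy), one_smul]

lemma Pc_far {st k2 : ℝ} {α nb : E3} {lam s τ : ℝ} {u : E3 → M3} {n : E3 → E3} (hl : 0 < lam) (hs : 0 < s) (hτ : 0 < τ) {y : E3} (hy : s + τ ≤ ‖y‖) :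
    Pc st k2 α nb lam s τ u n y = u y := by
  have : y ≠ 0 := norm_pos_iff.1 (by linarith)
  rw [Pc_out hl hs (by linarith), gc_out hτ hy, norm_smul_hat this]

lemma perp_le {w ξ : E3} (hw : ‖w‖ = 1) : ‖ξ - (inner ℝ w ξ : ℝ) • w‖ ≤ ‖ξ‖ := by
  have h : ‖ξ - (inner ℝ w ξ : ℝ) • w‖ ^ 2 = ‖ξ‖ ^ 2 - (inner ℝ w ξ : ℝ) ^ 2 := by
    rw [norm_sub_sq_real, norm_smul, hw, inner_smul_right, real_inner_comm, Real.norm_eq_abs, mul_one, sq_abs]; ring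
  exact le_of_sq_le_sq (by nlinarith [sq_nonneg (inner ℝ w ξ : ℝ)]) (norm_nonneg _) 

lemma fd_bound {F : Type*} [NormedAddCommGroup F] [NormedSpace ℝ F] {A : E3 → F} {p : E3 → E3} {X : E3 → ℝ} {v : E3 → F} {y : E3}
    (hA : DifferentiableAt ℝ A (p y)) (hp : DifferentiableAt ℝ p y) (hX : DifferentiableAt ℝ X y) (hv : DifferentiableAt ℝ v y) (ξ : E3) :
    ‖fderiv ℝ (fun z => A (p z) + X z • v z) y ξ‖ ≤ ‖fderiv ℝ A (p y) (fderiv ℝ p y ξ)‖ + |fderiv ℝ X y ξ| * ‖v y‖ + |X y| * ‖fderiv ℝ v y ξ‖ := by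
  have h := ((hA.hasFDerivAt.comp y hp.hasFDerivAt).add (hX.hasFDerivAt.smul hv.hasFDerivAt)).fderiv
  have e : fderiv ℝ (fun z => A (p z) + X z • v z) y ξ = fderiv ℝ A (p y) (fderiv ℝ p y ξ) + (X y • fderiv ℝ v y ξ + fderiv ℝ X y ξ • v y) := by
    have : fderiv ℝ (fun z => A (p z) + X z • v z) y = _ := h
    rw [this]; simp
  rw [e]
  refine (norm_add_le _ _).trans ?_
  have := norm_add_le (X y • fderiv ℝ v y ξ) (fderiv ℝ X y ξ • v y)
  rw [norm_smul, norm_smul, Real.norm_eq_abs, Real.norm_eq_abs] at this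
  linarith

lemma Xc_der {K : ℝ} (hK : ∀ t, |deriv Real.smoothTransition t| ≤ K) {lam s : ℝ} (hl : 0 < lam) (hs : 0 < s) {y : E3} (hy : y ≠ 0) {ξ : E3} (hξ : ‖ξ‖ = 1) :
    |fderiv ℝ (Xc lam s) y ξ| ≤ K / (lam * s) := by
  have h1 := (((hasFDerivAt_norm' hy).const_mul s⁻¹).sub_const (1 - lam)).const_mul lam⁻¹
  have h2 := ((Real.smoothTransition.contDiff (n := ⊤)).differentiable (by simp) (lam⁻¹ * (s⁻¹ * ‖y‖ - (1 - lam)))).hasDerivAt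
  have h3 := h2.comp_hasFDerivAt y h1
  have e : Xc lam s = Real.smoothTransition ∘ fun y : E3 => lam⁻¹ * (s⁻¹ * ‖y‖ - (1 - lam)) := by
    ext z; simp only [Xc, Function.comp]; congr 1; field_simp
  rw [e, h3.fderiv]
  simp only [_root_.smul_apply, innerSL_apply_apply, smul_eq_mul, abs_mul]
  have hy' := norm_pos_iff.2 hy
  have h4 : |inner ℝ y ξ| ≤ ‖y‖ := by have := abs_real_inner_le_norm y ξ; rwa [hξ, mul_one] at this
  calc _ ≤ K * (|lam⁻¹| * (|s⁻¹| * (|‖y‖⁻¹| * ‖y‖))) := by gcongr; exacts [(abs_nonneg _).trans (hK 0), hK _]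
    _ = K / (lam * s) := by
      rw [abs_of_pos (inv_pos.2 hl), abs_of_pos (inv_pos.2 hs), abs_of_pos (inv_pos.2 hy')]
      field_simp

lemma n_der {a b c C s : ℝ} {u : E3 → M3} {n : E3 → E3} (hu : ContDiff ℝ ∞ u) (h : Lift a b c C s u n) (hC : 0 < C) {y : E3} (hy : y ≠ 0) {ξ : E3} (hξ : ‖ξ‖ = 1) :
    ‖fderiv ℝ n y ξ‖ ^ 2 ≤ (C / ‖y‖) ^ 2 * gradSq u (s • hat y) := by
  have hd : DifferentiableAt ℝ n ((1:ℝ) • hat y) := by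
    rw [one_smul]
    exact (h.sm.contDiffAt (isOpen_compl_singleton.mem_nhds (hat_ne hy))).differentiableAt (by simp)
  have e : n =ᶠ[𝓝 y] fun z => n ((1:ℝ) • hat z) := by
    filter_upwards [isOpen_compl_singleton.mem_nhds hy] with z hz
    have : 0 < ‖z‖⁻¹ := inv_pos.2 (norm_pos_iff.2 hz)
    rw [one_smul, hat, h.hom _ this]
  rw [e.fderiv_eq, fderiv_comp_hat hy hd, norm_smul, one_smul, one_mul, norm_inv, norm_norm]
  have hw := norm_hat hy
  have h1 := h.der _ hw (ξ - (inner ℝ (hat y) ξ : ℝ) • hat y)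
  have h2 := norm_fd_sq_le hu (ξ - (inner ℝ (hat y) ξ : ℝ) • hat y - (inner ℝ (hat y) (ξ - (inner ℝ (hat y) ξ : ℝ) • hat y) : ℝ) • hat y) (s • hat y)
  have h3 : ‖ξ - (inner ℝ (hat y) ξ : ℝ) • hat y - (inner ℝ (hat y) (ξ - (inner ℝ (hat y) ξ : ℝ) • hat y) : ℝ) • hat y‖ ≤ 1 :=
    ((perp_le hw).trans (perp_le hw)).trans hξ.le
  have hG := gradSq_nonneg u (s • hat y)
  have h4 : ‖fderiv ℝ u (s • hat y) (ξ - (inner ℝ (hat y) ξ : ℝ) • hat y - (inner ℝ (hat y) (ξ - (inner ℝ (hat y) ξ : ℝ) • hat y) : ℝ) • hat y)‖ ^ 2 ≤ gradSq u (s • hat y) :=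
    h2.trans (mul_le_of_le_one_right hG (pow_le_one₀ (norm_nonneg _) h3))
  calc (‖y‖⁻¹ * ‖fderiv ℝ n (hat y) (ξ - (inner ℝ (hat y) ξ : ℝ) • hat y)‖) ^ 2 ≤ (‖y‖⁻¹ * (C * ‖fderiv ℝ u (s • hat y) (ξ - (inner ℝ (hat y) ξ : ℝ) • hat y - (inner ℝ (hat y) (ξ - (inner ℝ (hat y) ξ : ℝ) • hat y) : ℝ) • hat y)‖)) ^ 2 := by gcongr
    _ = (C / ‖y‖) ^ 2 * ‖fderiv ℝ u (s • hat y) (ξ - (inner ℝ (hat y) ξ : ℝ) • hat y - (inner ℝ (hat y) (ξ - (inner ℝ (hat y) ξ : ℝ) • hat y) : ℝ) • hat y)‖ ^ 2 := by field_simp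
    _ ≤ _ := by gcongr

end Part20

section Part21

/-! ### P21: pointwise estimates for the competitor -/

open scoped Topology ENNReal

lemma kn_unit {k2 : ℝ} (hk : 0 < k2) {α p : E3} (hp : ‖p‖ = 1) : kn k2 α p ≤ 1 := by
  unfold kn; rw [Gm_unit hp, hp, div_le_one (by positivity)]; linarith

lemma gradSq_congr {u v : E3 → M3} {y : E3} (h : u =ᶠ[𝓝 y] v) : gradSq u y = gradSq v y := by
  unfold gradSq pd
  have : ∀ i j, fderiv ℝ (fun y => u y i j) y = fderiv ℝ (fun y => v y i j) y := fun i j => by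
    apply Filter.EventuallyEq.fderiv_eq
    filter_upwards [h] with z hz; rw [hz]
  simp only [this]

lemma eDen_congr (a b c ε : ℝ) {u v : E3 → M3} {y : E3} (h : u =ᶠ[𝓝 y] v) : eDen a b c ε u y = eDen a b c ε v y := by
  unfold eDen; rw [gradSq_congr h, h.eq_of_nhds]

lemma frob_le_norm_sub {A B : M3} : ‖A - B‖ ^ 2 ≤ frobSq (A - B) := norm_sq_le_frob _

lemma sq3 (x y z : ℝ) : (x + y + z) ^ 2 ≤ 3 * (x ^ 2 + y ^ 2 + z ^ 2) := by
  nlinarith [sq_nonneg (x - y), sq_nonneg (y - z), sq_nonneg (x - z)]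

lemma sq2 (x y : ℝ) : (x + y) ^ 2 ≤ 2 * (x ^ 2 + y ^ 2) := by nlinarith [sq_nonneg (x - y)]

lemma fd_sub_apply {F : Type*} [NormedAddCommGroup F] [NormedSpace ℝ F] {A : E3 → F} {B : E3 → F} {n : E3 → E3} {y : E3} (hB : DifferentiableAt ℝ B y)
    (hA : DifferentiableAt ℝ A (n y)) (hn : DifferentiableAt ℝ n y) (ξ : E3) :
    ‖fderiv ℝ (fun z => B z - A (n z)) y ξ‖ ≤ ‖fderiv ℝ B y ξ‖ + ‖fderiv ℝ A (n y) (fderiv ℝ n y ξ)‖ := by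
  have h := (hB.hasFDerivAt.sub (hA.hasFDerivAt.comp y hn.hasFDerivAt)).fderiv
  have : fderiv ℝ (fun z => B z - A (n z)) y = _ := h
  rw [this]; exact norm_sub_le _ _

lemma Pc_arith {K C st κ G f N L : ℝ} (hC : 0 ≤ C) (hκ0 : 0 ≤ κ) (hG0 : 0 ≤ G) (hf0 : 0 ≤ f) (hN0 : 0 ≤ N) (hL0 : 0 ≤ L) :
    3 * (576 * st ^ 2 * κ * (2 * (4 * K ^ 2) * (L * N) + 2 * (16 * C ^ 2) * G) + 4 * K ^ 2 * L * (C * f) + (2 * 4 + 2 * (576 * st ^ 2 * (16 * C ^ 2))) * G) ≤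
    27 * (3 * (576 * st ^ 2 * (2 * (4 * K ^ 2) + 2 * (16 * C ^ 2))) + 3 * (4 * K ^ 2 * C) + 3 * (2 * 4 + 2 * (576 * st ^ 2 * (16 * C ^ 2)))) / 27 *
      ((1 + κ) * (L * N + G + L * f)) := by
  have q0 : 0 ≤ L * N := by positivity
  have q1 : 0 ≤ L * f := by positivity
  set A := L * N with hA
  set B := L * f with hB
  have r1 : 2 * (4 * K ^ 2) * A + 2 * (16 * C ^ 2) * G ≤ (2 * (4 * K ^ 2) + 2 * (16 * C ^ 2)) * (A + G + B) := by
    have : 0 ≤ 2 * (4 * K ^ 2) * (G + B) + 2 * (16 * C ^ 2) * (A + B) := by positivity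
    linarith
  have r2 : 4 * K ^ 2 * L * (C * f) ≤ 4 * K ^ 2 * C * (A + G + B) := by
    have e1 : 4 * K ^ 2 * L * (C * f) = 4 * K ^ 2 * C * B := by rw [hB]; ring
    rw [e1]; gcongr; linarith
  have r3 : (2 * 4 + 2 * (576 * st ^ 2 * (16 * C ^ 2))) * G ≤ (2 * 4 + 2 * (576 * st ^ 2 * (16 * C ^ 2))) * (A + G + B) := by gcongr; linarith
  set S := A + G + B with hS
  have hS0 : 0 ≤ S := by positivity
  calc _ ≤ 3 * (576 * st ^ 2 * κ * ((2 * (4 * K ^ 2) + 2 * (16 * C ^ 2)) * S) + 4 * K ^ 2 * C * S + (2 * 4 + 2 * (576 * st ^ 2 * (16 * C ^ 2))) * S) := by gcongr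
    _ ≤ 3 * (576 * st ^ 2 * (1 + κ) * ((2 * (4 * K ^ 2) + 2 * (16 * C ^ 2)) * S) + 4 * K ^ 2 * C * ((1 + κ) * S) + (2 * 4 + 2 * (576 * st ^ 2 * (16 * C ^ 2))) * ((1 + κ) * S)) := by
        have : S ≤ (1 + κ) * S := by nlinarith
        gcongr; linarith
    _ = _ := by ring

set_option maxHeartbeats 600000 in
lemma Pc_grad {K C : ℝ} (hK0 : 0 < K) (hC : 0 < C) {st : ℝ} (hst : 0 < st) (hK : ∀ t, |deriv Real.smoothTransition t| ≤ K) : ∃ C' > 0,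
    ∀ (a b c s lam k2 τ : ℝ) (α nb : E3) (u : E3 → M3) (n : E3 → E3), st = sstar a b c → ContDiff ℝ ∞ u → 
    Lift a b c C s u n → 1/2 ≤ s → s ≤ 2 → 0 < lam → lam ≤ 1/2 → 0 < k2 → k2 ≤ 1 → 0 < τ → ‖α‖ ≤ 1/2 → ‖nb‖ ≤ 1 →
    ∀ y : E3, s / 2 ≤ ‖y‖ → ‖y‖ < s →
    gradSq (Pc st k2 α nb lam s τ u n) y ≤ C' * ((1 + kn k2 α (pc nb lam s n y)) *
      (lam⁻¹ ^ 2 * ‖n y - nb‖ ^ 2 + gradSq u (s • hat y) + lam⁻¹ ^ 2 * |fbulk a b c (u (s • hat y))|)) := by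
  set C' := 27 * (3 * (576 * st ^ 2 * (2 * (4 * K ^ 2) + 2 * (16 * C ^ 2))) + 3 * (4 * K ^ 2 * C) + 3 * (2 * 4 + 2 * (576 * st ^ 2 * (16 * C ^ 2)))) with hC'
  refine ⟨C', by positivity, ?_⟩
  intro a b c s lam k2 τ α nb u n hsta hu h hs hs2 hl hl1 hk hk1 hτ ha hnb y hy1 hy2
  have hs0 : 0 < s := by linarith
  have hyp : 0 < ‖y‖ := by linarith
  have hy : y ≠ 0 := norm_pos_iff.1 hyp
  set G := gradSq u (s • hat y) with hG
  set f := |fbulk a b c (u (s • hat y))| with hf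
  set κ := kn k2 α (pc nb lam s n y) with hκ
  have hG0 : 0 ≤ G := gradSq_nonneg _ _
  have hf0 : 0 ≤ f := abs_nonneg _
  have hκ0 : 0 < κ := kn_pos hk _ _
  set N := ‖n y - nb‖ ^ 2 with hN
  have hN0 : 0 ≤ N := by positivity
  set L := lam⁻¹ ^ 2 with hL
  have hL0 : 0 < L := by positivity
  have hnd : DifferentiableAt ℝ n y := (h.sm.contDiffAt (isOpen_compl_singleton.mem_nhds hy)).differentiableAt (by simp)
  have hXd : DifferentiableAt ℝ (Xc lam s) y := ((Xc_cd lam s).contDiffAt (isOpen_compl_singleton.mem_nhds hy)).differentiableAt (by simp)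
  have hHd : ∀ q, DifferentiableAt ℝ (Hm st k2 α) q := fun q => (Hm_cd hk st α).differentiable (by simp) q
  have hhd : DifferentiableAt ℝ hat y := (cd_hat.contDiffAt (isOpen_compl_singleton.mem_nhds hy)).differentiableAt (by simp)
  have hud : DifferentiableAt ℝ (fun z => u (s • hat z)) y :=
    ((hu.differentiable (by simp) _).comp y (hhd.const_smul s) :)
  have hpd : DifferentiableAt ℝ (pc nb lam s n) y := (pc_cd hl (by linarith) hs0 h.sm).differentiable (by simp) y
  have e : Pc st k2 α nb lam s τ u n =ᶠ[𝓝 y] fun z => Hm st k2 α (pc nb lam s n z) + Xc lam s z • (u (s • hat z) - Hm st k2 α (n z)) := by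
    filter_upwards [(isOpen_lt continuous_norm continuous_const).mem_nhds hy2] with z hz
    have hz' : ‖z‖ ≤ s := le_of_lt hz
    unfold Pc; rw [gc_in hτ hz']
  have hnu : n y = n (hat y) := by rw [hat, h.hom _ (inv_pos.2 hyp)]
  have hw := norm_hat hy
  -- bounds on the pieces
  have hKs : K / (lam * s) ≤ 2 * K * lam⁻¹ := by
    rw [div_le_iff₀ (by positivity)]
    have : 2 * K * lam⁻¹ * (lam * s) = 2 * K * s := by field_simp
    rw [this]; nlinarith
  have hCy : C / ‖y‖ ≤ 4 * C := by rw [div_le_iff₀ hyp]; nlinarith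
  have hCy0 : 0 ≤ C / ‖y‖ := by positivity
  have hv : ‖u (s • hat y) - Hm st k2 α (n y)‖ ^ 2 ≤ C * f := by
    rw [Hm_unit hk st (h.unit y hy), hnu, hsta]
    refine (norm_sq_le_frob _).trans ((h.close _ hw).trans ?_)
    gcongr; exact le_abs_self _
  have key : ∀ ξ : E3, ‖ξ‖ = 1 → ‖fderiv ℝ (Pc st k2 α nb lam s τ u n) y ξ‖ ^ 2 ≤ C' / 27 * ((1 + κ) * (L * N + G + L * f)) := by
    intro ξ hξ
    have hX := Xc_der hK hl hs0 hy hξ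
    have hX' : |fderiv ℝ (Xc lam s) y ξ| ^ 2 ≤ 4 * K ^ 2 * L := by
      calc _ ≤ (2 * K * lam⁻¹) ^ 2 := by gcongr; exact hX.trans hKs
        _ = _ := by rw [hL]; ring
    have hnn : ‖fderiv ℝ n y ξ‖ ^ 2 ≤ 16 * C ^ 2 * G := by
      refine (n_der hu h hC hy hξ).trans ?_
      calc _ ≤ (4 * C) ^ 2 * G := by gcongr
        _ = _ := by ring
    have hp' : ‖fderiv ℝ (pc nb lam s n) y ξ‖ ^ 2 ≤ 2 * (4 * K ^ 2) * (L * N) + 2 * (16 * C ^ 2) * G := by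
      have h1 := ((hXd.hasFDerivAt.smul (hnd.hasFDerivAt.sub_const nb)).const_add nb).fderiv
      have h2 : fderiv ℝ (pc nb lam s n) y ξ = Xc lam s y • fderiv ℝ n y ξ + fderiv ℝ (Xc lam s) y ξ • (n y - nb) := by
        have : fderiv ℝ (pc nb lam s n) y = _ := h1
        rw [this]; simp
      rw [h2]
      obtain ⟨hX0, hX1⟩ := Xc_mem lam s y
      calc _ ≤ (‖fderiv ℝ n y ξ‖ + |fderiv ℝ (Xc lam s) y ξ| * ‖n y - nb‖) ^ 2 := by
            gcongr
            refine (norm_add_le _ _).trans ?_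
            rw [norm_smul, norm_smul, Real.norm_of_nonneg hX0, Real.norm_eq_abs]
            gcongr
            exact mul_le_of_le_one_left (norm_nonneg _) hX1
        _ ≤ 2 * (‖fderiv ℝ n y ξ‖ ^ 2 + (|fderiv ℝ (Xc lam s) y ξ| * ‖n y - nb‖) ^ 2) := sq2 _ _
        _ = 2 * (‖fderiv ℝ n y ξ‖ ^ 2 + |fderiv ℝ (Xc lam s) y ξ| ^ 2 * N) := by rw [hN]; ring
        _ ≤ 2 * (16 * C ^ 2 * G + 4 * K ^ 2 * L * N) := by gcongr
        _ = _ := by ring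
    have hT1 := Hm_der hk hk1 hst ha (pc_norm hl (by linarith) hs0 h.unit hnb y) (fderiv ℝ (pc nb lam s n) y ξ)
    have hT3 : ‖fderiv ℝ (fun z => u (s • hat z) - Hm st k2 α (n z)) y ξ‖ ^ 2 ≤ (2 * 4 + 2 * (576 * st ^ 2 * (16 * C ^ 2))) * G := by
      have h1 := fd_sub_apply hud (hHd (n y)) hnd ξ
      have h2 := Hm_der hk hk1 hst ha (h.unit y hy).le (fderiv ℝ n y ξ)
      have h3 : ‖fderiv ℝ (fun z => u (s • hat z)) y ξ‖ ^ 2 ≤ 4 * G := by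
        have h30 : fderiv ℝ (fun z => u (s • hat z)) y ξ = (s * ‖y‖⁻¹) • fderiv ℝ u (s • hat y) (ξ - (inner ℝ (hat y) ξ) • hat y) :=
          fderiv_comp_hat hy (hu.differentiable (by simp) _) ξ
        rw [h30, norm_smul, Real.norm_of_nonneg (by positivity), mul_pow]
        have h31 := norm_fd_sq_le hu (ξ - (inner ℝ (hat y) ξ : ℝ) • hat y) (s • hat y)
        have h32 : ‖ξ - (inner ℝ (hat y) ξ : ℝ) • hat y‖ ^ 2 ≤ 1 := pow_le_one₀ (norm_nonneg _) ((perp_le hw).trans hξ.le)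
        have h33 : s * ‖y‖⁻¹ ≤ 2 := by rw [← div_eq_mul_inv, div_le_iff₀ hyp]; linarith
        calc _ ≤ 2 ^ 2 * (G * 1) := by gcongr; exact h31.trans (by gcongr)
          _ = _ := by ring
      have h4 : kn k2 α (n y) ≤ 1 := kn_unit hk (h.unit y hy)
      calc _ ≤ (‖fderiv ℝ (fun z => u (s • hat z)) y ξ‖ + ‖fderiv ℝ (Hm st k2 α) (n y) (fderiv ℝ n y ξ)‖) ^ 2 := pow_le_pow_left₀ (norm_nonneg _) h1 2
        _ ≤ _ := sq2 _ _
        _ ≤ 2 * (4 * G + 576 * st ^ 2 * 1 * (16 * C ^ 2 * G)) := by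
            gcongr
            refine h2.trans ?_
            gcongr
        _ = _ := by ring
    have hmain := fd_bound (hHd (pc nb lam s n y)) hpd hXd (hud.sub ((hHd (n y)).comp y hnd)) ξ
    have e' : fderiv ℝ (Pc st k2 α nb lam s τ u n) y ξ = fderiv ℝ (fun z => Hm st k2 α (pc nb lam s n z) + Xc lam s z • (u (s • hat z) - Hm st k2 α (n z))) y ξ :=
      DFunLike.congr_fun e.fderiv_eq ξ
    rw [e']
    have hX1 : |Xc lam s y| ≤ 1 := by obtain ⟨hX0, hX1⟩ := Xc_mem lam s y; rwa [abs_of_nonneg hX0]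
    calc _ ≤ (‖fderiv ℝ (Hm st k2 α) (pc nb lam s n y) (fderiv ℝ (pc nb lam s n) y ξ)‖ + |fderiv ℝ (Xc lam s) y ξ| * ‖u (s • hat y) - Hm st k2 α (n y)‖
          + 1 * ‖fderiv ℝ (fun z => u (s • hat z) - Hm st k2 α (n z)) y ξ‖) ^ 2 := by
          refine pow_le_pow_left₀ (norm_nonneg _) (hmain.trans ?_) 2
          refine add_le_add le_rfl (mul_le_mul_of_nonneg_right hX1 (norm_nonneg _))
      _ ≤ _ := sq3 _ _ _
      _ = 3 * (‖fderiv ℝ (Hm st k2 α) (pc nb lam s n y) (fderiv ℝ (pc nb lam s n) y ξ)‖ ^ 2 + |fderiv ℝ (Xc lam s) y ξ| ^ 2 * ‖u (s • hat y) - Hm st k2 α (n y)‖ ^ 2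
          + ‖fderiv ℝ (fun z => u (s • hat z) - Hm st k2 α (n z)) y ξ‖ ^ 2) := by ring
      _ ≤ 3 * (576 * st ^ 2 * κ * (2 * (4 * K ^ 2) * (L * N) + 2 * (16 * C ^ 2) * G) + 4 * K ^ 2 * L * (C * f) + (2 * 4 + 2 * (576 * st ^ 2 * (16 * C ^ 2))) * G) := by
          gcongr
          refine hT1.trans ?_
          gcongr
      _ ≤ _ := by
          rw [hC']; exact Pc_arith hC.le hκ0.le hG0 hf0 hN0 hL0.le
  have := gradSq_le_of (Pc_cd (τ := τ) (α := α) (nb := nb) (st := st) hk hl (by linarith) hs0 hu h.sm) key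
  calc _ ≤ _ := this
    _ = _ := by ring

/-- the potential of the competitor -/
lemma Pc_pot {a b c : ℝ} (ha : 0 ≤ a) (hb : 0 < b) (hc : 0 < c) {C : ℝ} (hC : 0 < C) (Fb : ℝ) (hFb : 0 ≤ Fb) : ∃ C' > 0,
    ∀ (s lam k2 τ : ℝ) (α nb : E3) (u : E3 → M3) (n : E3 → E3), (∀ y, u y ∈ S0) →
    Lift a b c C s u n → 0 < s → 0 < lam → lam < 1 → 0 < k2 → 0 < τ → ‖α‖ ≤ 1/2 → ‖nb‖ ≤ 1 → (∀ w : E3, ‖w‖ = 1 → fbulk a b c (u (s • w)) ≤ Fb) →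
    ∀ y : E3, (‖y‖ < s → (y ≠ 0) → 
      fbulk a b c (Pc (sstar a b c) k2 α nb lam s τ u n y) ≤ C' * (k2 * kn k2 α (pc nb lam s n y) + fbulk a b c (u (s • hat y)))) ∧
      (‖y‖ < (1 - lam) * s → fbulk a b c (Pc (sstar a b c) k2 α nb lam s τ u n y) ≤ C' * (k2 * kn k2 α (pc nb lam s n y))) := by
  have hst := sstar_pos ha hb hc
  set st := sstar a b c with hstd
  obtain ⟨Cq, hCq, hq⟩ := fbulk_le_quad ha hb hc (Real.sqrt (2 * (2 * st ^ 2) + 2 * (C * Fb))) (Real.sqrt_nonneg _)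
  refine ⟨Cq * (4 * st ^ 2 + 2 * C), by positivity, ?_⟩
  intro s lam k2 τ α nb u n hS h hs hl hl1 hk hτ hα hnb hF y
  have hpn := pc_norm hl hl1 hs h.unit hnb y
  obtain ⟨m, hm, hcl⟩ := Hm_close hk st hα hpn
  set κ := kn k2 α (pc nb lam s n y) with hκ
  have hκ0 : 0 < κ := kn_pos hk _ _
  have hκ1 : k2 * κ ≤ 1 := by
    rw [hκ, kn, mul_one_div, div_le_one (by positivity)]; nlinarith [sq_nonneg ‖Gm α (pc nb lam s n y)‖]
  have hsub : ∀ {A B : M3}, A ∈ S0 → B ∈ S0 → A - B ∈ S0 := fun hA hB => by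
    have := S0_add hA (S0_smul (-1) hB)
    rwa [neg_one_smul, ← sub_eq_add_neg] at this
  have hPS := Pc_S0 (st := st) (k2 := k2) (α := α) (nb := nb) (lam := lam) (s := s) (τ := τ) (n := n) hS y
  have hw : Pc st k2 α nb lam s τ u n y - Nn st m ∈ S0 := hsub hPS (Nn_S0 st hm)
  have gen : ∀ B : ℝ, B ≤ 2 * (2 * st ^ 2) + 2 * (C * Fb) → frobSq (Pc st k2 α nb lam s τ u n y - Nn st m) ≤ B → fbulk a b c (Pc st k2 α nb lam s τ u n y) ≤ Cq * B := by
    intro B hB hle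
    have := hq (Nn st m) (Nn_mem hm) _ hw (by unfold frobNorm; exact Real.sqrt_le_sqrt (hle.trans hB))
    rw [add_sub_cancel] at this
    exact this.trans (by gcongr)
  have hk2 : 0 ≤ k2 * κ := by positivity
  have hst2 : 0 < st ^ 2 := by positivity
  have hCF : 0 ≤ C * Fb := by positivity
  constructor
  · intro hy1 hy0
    have hw1 := norm_hat hy0
    have hnu : n y = n (hat y) := by rw [hat, h.hom _ (inv_pos.2 (norm_pos_iff.2 hy0))]
    set f := fbulk a b c (u (s • hat y)) with hf
    have hf0 : 0 ≤ f := fbulk_nonneg ha hb hc (hS _)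
    have hfF : f ≤ Fb := hF _ hw1
    have hv : frobSq (u (s • hat y) - Hm st k2 α (n y)) ≤ C * f := by
      rw [Hm_unit hk st (h.unit y hy0), hnu]; exact h.close _ hw1
    have e : Pc st k2 α nb lam s τ u n y - Nn st m = (Hm st k2 α (pc nb lam s n y) - Nn st m) + Xc lam s y • (u (s • hat y) - Hm st k2 α (n y)) := by
      unfold Pc; rw [gc_in hτ hy1.le]; abel
    have hX : Xc lam s y ^ 2 ≤ 1 := pow_le_one₀ (Xc_mem _ _ _).1 (Xc_mem _ _ _).2
    have hle : frobSq (Pc st k2 α nb lam s τ u n y - Nn st m) ≤ 2 * (2 * st ^ 2 * (k2 * κ)) + 2 * (C * f) := by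
      rw [e]
      refine (frobSq_add_le _ _).trans ?_
      rw [frobSq_smul]
      have : Xc lam s y ^ 2 * frobSq (u (s • hat y) - Hm st k2 α (n y)) ≤ 1 * (C * f) := mul_le_mul hX hv (frobSq_nonneg _) zero_le_one
      rw [one_mul] at this
      linarith
    refine (gen _ ?_ hle).trans ?_
    · have : C * f ≤ C * Fb := by gcongr
      nlinarith
    · have : 0 ≤ st ^ 2 * f + C * (k2 * κ) := by positivity
      calc _ ≤ Cq * ((4 * st ^ 2 + 2 * C) * (k2 * κ + f)) := by gcongr; nlinarith
        _ = _ := by ring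
  · intro hy
    have hX := Xc_zero hl hs hy.le
    have e : Pc st k2 α nb lam s τ u n y = Hm st k2 α (pc nb lam s n y) := by unfold Pc; rw [hX]; simp
    rw [← e] at hcl
    refine (gen _ ?_ hcl).trans ?_
    · nlinarith
    · have : 0 ≤ C * (k2 * κ) := by positivity
      calc _ ≤ Cq * ((4 * st ^ 2 + 2 * C) * (k2 * κ)) := by gcongr; nlinarith
        _ = _ := by ring

end Part21

section Part22

/-! ### P22: energy comparison -/

open scoped Topology ENNReal

lemma min_cmp {a b c M ε : ℝ} {u P : E3 → M3} (h : Sol a b c M ε u) (hP : ContDiff ℝ ∞ P) (hPS : ∀ y, P y ∈ S0) {R R' : ℝ} (hR : R < R') (hR' : R' < 4)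
    (he : ∀ y, R ≤ ‖y‖ → P y = u y) :
    ∫ y in ball (0:E3) R', eDen a b c ε u y ≤ ∫ y in ball (0:E3) R', eDen a b c ε P y := by
  have h1 := h.min P hP hPS ⟨R, by linarith, he⟩
  unfold energy at h1
  have cu := (sm_eDen a b c ε h.sm h.s0).continuous
  have cP := (sm_eDen a b c ε hP hPS).continuous
  have hsub : ball (0:E3) R' ⊆ ball 0 4 := ball_subset_ball hR'.le
  have d1 := integral_diff measurableSet_ball (intOn_ball cu 0 4) hsub
  have d2 := integral_diff measurableSet_ball (intOn_ball cP 0 4) hsub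
  have e : ∫ y in ball (0:E3) 4 \ ball 0 R', eDen a b c ε u y = ∫ y in ball (0:E3) 4 \ ball 0 R', eDen a b c ε P y := by
    refine setIntegral_congr_fun (measurableSet_ball.diff measurableSet_ball) fun y hy => ?_
    apply eDen_congr
    have hy' : R < ‖y‖ := by
      have := hy.2; rw [mem_ball_zero_iff, not_lt] at this; linarith
    filter_upwards [(isOpen_lt continuous_const continuous_norm).mem_nhds hy'] with z hz
    exact (he z (le_of_lt hz)).symm
  linarith

lemma gc_bd {K : ℝ} (hK0 : 0 < K) (hK : ∀ t, |deriv Real.smoothTransition t| ≤ K) {s τ r : ℝ} (hτ : 0 < τ) (hs : s < r) (hr : r ≤ s + 2 * τ) :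
    s ≤ gc s τ r ∧ gc s τ r ≤ r ∧ |deriv (gc s τ) r| ≤ 1 + 2 * K := by
  have h0 := Real.smoothTransition.nonneg ((r - s) / τ)
  have h1 := Real.smoothTransition.le_one ((r - s) / τ)
  refine ⟨?_, ?_, ?_⟩
  · unfold gc; nlinarith
  · unfold gc; nlinarith
  · have d1 : HasDerivAt (fun r : ℝ => τ⁻¹ * (r - s)) (τ⁻¹ * 1) r := ((hasDerivAt_id r).sub_const s).const_mul τ⁻¹
    have d2 := ((Real.smoothTransition.contDiff (n := ⊤)).differentiable (by simp) (τ⁻¹ * (r - s))).hasDerivAt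
    have d3 := (((hasDerivAt_id r).sub_const s).mul (d2.comp r d1)).const_add s
    have e : gc s τ = fun r => s + (r - s) * (Real.smoothTransition (τ⁻¹ * (r - s))) := by
      ext r; unfold gc; rw [div_eq_inv_mul]
    have d4 : deriv (gc s τ) r = 1 * Real.smoothTransition (τ⁻¹ * (r - s)) + (r - s) * (deriv Real.smoothTransition (τ⁻¹ * (r - s)) * (τ⁻¹ * 1)) := by
      rw [e]; exact d3.deriv
    rw [d4]
    rw [div_eq_inv_mul] at h0 h1
    have b1 : |(r - s) * (deriv Real.smoothTransition (τ⁻¹ * (r - s)) * (τ⁻¹ * 1))| ≤ 2 * K := by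
      rw [abs_mul, abs_mul, mul_one, abs_of_pos (by linarith : 0 < r - s), abs_of_pos (inv_pos.2 hτ)]
      have : (r - s) * τ⁻¹ ≤ 2 := by rw [← div_eq_mul_inv, div_le_iff₀ hτ]; linarith
      calc _ = (r - s) * τ⁻¹ * |deriv Real.smoothTransition (τ⁻¹ * (r - s))| := by ring
        _ ≤ 2 * K := by gcongr; exact hK _
    refine (abs_add_le _ _).trans ?_
    refine add_le_add ?_ b1
    rw [one_mul, abs_of_nonneg h0]; exact h1

lemma W_der {K : ℝ} (hK0 : 0 < K) (hK : ∀ t, |deriv Real.smoothTransition t| ≤ K) {s τ : ℝ} (hs0 : 0 < s) (hτ : 0 < τ) {y : E3} (hs : s < ‖y‖) (hr : ‖y‖ ≤ s + 2 * τ)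
    {ξ : E3} (hξ : ‖ξ‖ = 1) : ‖fderiv ℝ (fun z : E3 => gc s τ ‖z‖ • hat z) y ξ‖ ≤ 2 + 2 * K := by
  have hyp : 0 < ‖y‖ := by linarith
  have hy : y ≠ 0 := norm_pos_iff.1 hyp
  obtain ⟨b1, b2, b3⟩ := gc_bd hK0 hK hτ hs hr
  have d1 := ((gc_cd s τ).differentiable (by simp) ‖y‖).hasDerivAt.comp_hasFDerivAt y (hasFDerivAt_norm' hy)
  have hhd : DifferentiableAt ℝ hat y := (cd_hat.contDiffAt (isOpen_compl_singleton.mem_nhds hy)).differentiableAt (by simp)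
  have d2 := (d1.smul hhd.hasFDerivAt).fderiv
  have d3 : fderiv ℝ (fun z : E3 => gc s τ ‖z‖ • hat z) y = _ := d2
  rw [d3]
  have hh : fderiv ℝ hat y ξ = ‖y‖⁻¹ • (ξ - (inner ℝ (hat y) ξ : ℝ) • hat y) := by
    have h1 : fderiv ℝ (fun y => id ((1:ℝ) • hat y)) y ξ = _ := fderiv_comp_hat hy differentiableAt_id ξ
    simpa using h1
  have hin : |‖y‖⁻¹ * inner ℝ y ξ| ≤ 1 := by
    rw [abs_mul, abs_of_pos (inv_pos.2 hyp), inv_mul_le_iff₀ hyp, mul_one]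
    have := abs_real_inner_le_norm y ξ; rwa [hξ, mul_one] at this
  simp only [_root_.add_apply, _root_.smul_apply, ContinuousLinearMap.smulRight_apply, innerSL_apply_apply, smul_eq_mul, hh, Function.comp]
  refine (norm_add_le _ _).trans ?_
  have hp := (perp_le (w := hat y) (ξ := ξ) (norm_hat hy)).trans hξ.le
  have t1 : ‖gc s τ ‖y‖ • ‖y‖⁻¹ • (ξ - (inner ℝ (hat y) ξ : ℝ) • hat y)‖ ≤ 1 := by
    rw [norm_smul, norm_smul, norm_inv, norm_norm, Real.norm_of_nonneg (by linarith)]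
    calc _ ≤ ‖y‖ * (‖y‖⁻¹ * 1) := by gcongr
      _ = 1 := by field_simp
  have t2 : ‖(deriv (gc s τ) ‖y‖ * (‖y‖⁻¹ * inner ℝ y ξ)) • hat y‖ ≤ 1 + 2 * K := by
    rw [norm_smul, norm_hat hy, mul_one, Real.norm_eq_abs, abs_mul]
    calc _ ≤ (1 + 2 * K) * 1 := by gcongr
      _ = _ := mul_one _
  linarith

lemma Pc_shell {K : ℝ} (hK0 : 0 < K) (hK : ∀ t, |deriv Real.smoothTransition t| ≤ K) (a b c ε : ℝ) {u : E3 → M3} (hu : ContDiff ℝ ∞ u) (hS : ∀ y, u y ∈ S0) :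
    ∃ B > 0, ∀ (st k2 lam s τ : ℝ) (α nb : E3) (n : E3 → E3), ContDiffOn ℝ ∞ n {0}ᶜ → 0 < k2 → 0 < lam → lam < 1 → 0 < s → s ≤ 2 → 0 < τ → τ ≤ 1/2 →
      ∀ y : E3, s < ‖y‖ → ‖y‖ ≤ s + 2 * τ → eDen a b c ε (Pc st k2 α nb lam s τ u n) y ≤ B := by
  obtain ⟨B1, hB1⟩ := (isCompact_closedBall (0:E3) 4).exists_bound_of_continuousOn (sm_gradSq hu).continuous.continuousOn
  obtain ⟨B2, hB2⟩ := (isCompact_closedBall (0:E3) 4).exists_bound_of_continuousOn (sm_fbulk a b c hu hS).continuous.continuousOn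
  refine ⟨1 / 2 * (27 * (|B1| * (2 + 2 * K) ^ 2)) + 1 / ε ^ 2 * |B2| + 1, by positivity, ?_⟩
  intro st k2 lam s τ α nb n hn hk hl hl1 hs hs2 hτ hτ2 y hy hy2
  have hyp : 0 < ‖y‖ := by linarith
  have hy0 : y ≠ 0 := norm_pos_iff.1 hyp
  obtain ⟨b1, b2, b3⟩ := gc_bd hK0 hK hτ hy hy2
  have hW : gc s τ ‖y‖ • hat y ∈ closedBall (0:E3) 4 := by
    rw [mem_closedBall_zero_iff, norm_smul, norm_hat hy0, Real.norm_of_nonneg (by linarith)]; linarith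
  have e : Pc st k2 α nb lam s τ u n =ᶠ[𝓝 y] fun z => u (gc s τ ‖z‖ • hat z) := by
    filter_upwards [(isOpen_lt continuous_const continuous_norm).mem_nhds hy] with z hz
    exact Pc_out hl hs (le_of_lt hz)
  have hWd : DifferentiableAt ℝ (fun z : E3 => gc s τ ‖z‖ • hat z) y :=
    ((((gc_cd s τ).comp_contDiffOn cd_norm).smul cd_hat).contDiffAt (isOpen_compl_singleton.mem_nhds hy0)).differentiableAt (by simp)
  have hg : gradSq (Pc st k2 α nb lam s τ u n) y ≤ 27 * (|B1| * (2 + 2 * K) ^ 2) := by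
    refine gradSq_le_of (Pc_cd hk hl hl1 hs hu hn) fun ξ hξ => ?_
    have e' : fderiv ℝ (Pc st k2 α nb lam s τ u n) y ξ = fderiv ℝ (fun z => u (gc s τ ‖z‖ • hat z)) y ξ :=
      DFunLike.congr_fun e.fderiv_eq ξ
    have e2 : fderiv ℝ (fun z => u (gc s τ ‖z‖ • hat z)) y ξ = fderiv ℝ u (gc s τ ‖y‖ • hat y) (fderiv ℝ (fun z : E3 => gc s τ ‖z‖ • hat z) y ξ) :=
      DFunLike.congr_fun (fderiv_comp y (hu.differentiable (by simp) _) hWd) ξ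
    rw [e', e2]
    refine (norm_fd_sq_le hu _ _).trans ?_
    have h1 := hB1 _ hW
    have h2 := W_der hK0 hK hs hτ hy hy2 hξ
    have h3 : gradSq u (gc s τ ‖y‖ • hat y) ≤ |B1| := (le_abs_self _).trans (h1.trans (le_abs_self _))
    gcongr
  have hf : fbulk a b c (Pc st k2 α nb lam s τ u n y) ≤ |B2| := by
    rw [e.eq_of_nhds]
    exact (le_abs_self _).trans ((hB2 _ hW).trans (le_abs_self _))
  unfold eDen
  have : 1 / ε ^ 2 * fbulk a b c (Pc st k2 α nb lam s τ u n y) ≤ 1 / ε ^ 2 * |B2| := by gcongr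
  linarith

lemma vol_ball (R : ℝ) (hR : 0 ≤ R) : (volume (ball (0:E3) R)).toReal = R ^ 3 * VB := by
  rw [Measure.addHaar_ball _ _ hR, ENNReal.toReal_mul, VB]
  simp [hR]

lemma ball_closed_int {g : E3 → ℝ} {s : ℝ} (hs : s ≠ 0) : ∫ y in closedBall (0:E3) s, g y = ∫ y in ball (0:E3) s, g y := by
  apply setIntegral_congr_set
  refine (ae_eq_of_subset_of_measure_ge ball_subset_closedBall ?_ measurableSet_ball.nullMeasurableSet measure_closedBall_lt_top.ne).symm
  rw [Measure.addHaar_closedBall_eq_addHaar_ball]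

/-- the competitor energy dominates, up to an arbitrarily small error -/
lemma cmp_out {a b c M ε : ℝ} {u : E3 → M3} (h : Sol a b c M ε u) {e0 : ℝ} (he0 : 0 < e0) (s : ℝ) (hs : 0 < s) (hs2 : s ≤ 2) (ha : 0 ≤ a) (hb : 0 < b) (hc : 0 < c) :
    ∃ τ > 0, ∀ (st k2 lam : ℝ) (α nb : E3) (n : E3 → E3), ContDiffOn ℝ ∞ n {0}ᶜ → 0 < k2 → 0 < lam → lam < 1 →
      ∫ y in ball (0:E3) s, eDen a b c ε u y ≤ (∫ y in ball (0:E3) s, eDen a b c ε (Pc st k2 α nb lam s τ u n) y) + e0 := by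
  obtain ⟨K, hK0, hK⟩ := sT_deriv
  obtain ⟨B, hB0, hB⟩ := Pc_shell hK0 hK a b c ε h.sm h.s0
  have hV := VB_pos
  set τ := min (1/2) (e0 / (54 * B * VB)) with hτd
  have hτ0 : 0 < τ := by positivity
  have hτ1 : τ ≤ 1/2 := min_le_left _ _
  have hτ2 : τ * (54 * B * VB) ≤ e0 := by rw [← le_div_iff₀ (by positivity)]; exact min_le_right _ _
  refine ⟨τ, hτ0, ?_⟩
  intro st k2 lam α nb n hn hk hl hl1
  set P := Pc st k2 α nb lam s τ u n with hPd
  have sP : ContDiff ℝ ∞ P := Pc_cd hk hl hl1 hs h.sm hn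
  have hPS : ∀ y, P y ∈ S0 := Pc_S0 h.s0
  have h1 := min_cmp h sP hPS (R := s + τ) (R' := s + 2 * τ) (by linarith) (by linarith) (fun y hy => Pc_far hl hs hτ0 hy)
  have cu := (sm_eDen a b c ε h.sm h.s0).continuous
  have cP := (sm_eDen a b c ε sP hPS).continuous
  have hsub : closedBall (0:E3) s ⊆ ball 0 (s + 2 * τ) := closedBall_subset_ball (by linarith)
  have d2 := integral_diff measurableSet_closedBall (intOn_ball cP 0 (s + 2 * τ)) hsub
  rw [ball_closed_int hs.ne'] at d2
  have d1 : ∫ y in ball (0:E3) s, eDen a b c ε u y ≤ ∫ y in ball (0:E3) (s + 2 * τ), eDen a b c ε u y :=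
    setIntegral_mono_set (intOn_ball cu _ _) (Filter.Eventually.of_forall fun y => eDen_nonneg ha hb hc ε (h.s0 y)) (ball_subset_ball (by linarith)).eventuallyLE
  have hfin : volume (ball (0:E3) (s + 2 * τ) \ closedBall 0 s) ≠ ⊤ := ((measure_mono diff_subset).trans_lt measure_ball_lt_top).ne
  have d3 : ∫ y in ball (0:E3) (s + 2 * τ) \ closedBall 0 s, eDen a b c ε P y ≤ ∫ y in ball (0:E3) (s + 2 * τ) \ closedBall 0 s, B := by
    refine setIntegral_mono_on ((intOn_ball cP _ _).mono_set diff_subset) (integrableOn_const hfin) (measurableSet_ball.diff measurableSet_closedBall) fun y hy => ?_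
    have h1 := hy.1; have h2 := hy.2
    rw [mem_ball_zero_iff] at h1; rw [mem_closedBall_zero_iff, not_le] at h2
    exact hB st k2 lam s τ α nb n hn hk hl hl1 hs hs2 hτ0 hτ1 y h2 h1.le
  have d4 : ∫ y in ball (0:E3) (s + 2 * τ) \ closedBall 0 s, B = ((s + 2 * τ) ^ 3 * VB - s ^ 3 * VB) * B := by
    rw [integral_diff measurableSet_closedBall (integrableOn_const measure_ball_lt_top.ne) hsub, ball_closed_int hs.ne']
    simp only [setIntegral_const, Measure.real, smul_eq_mul]
    rw [vol_ball _ (by linarith), vol_ball _ hs.le]; ring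
  have d5 : ((s + 2 * τ) ^ 3 * VB - s ^ 3 * VB) * B ≤ e0 := by
    refine le_trans ?_ hτ2
    have : (s + 2 * τ) ^ 3 - s ^ 3 ≤ 54 * τ := by
      have e1 : (s + 2 * τ) ^ 3 - s ^ 3 = 2 * τ * ((s + 2 * τ) ^ 2 + (s + 2 * τ) * s + s ^ 2) := by ring
      rw [e1]
      have : (s + 2 * τ) ^ 2 + (s + 2 * τ) * s + s ^ 2 ≤ 27 := by nlinarith
      nlinarith
    calc _ = ((s + 2 * τ) ^ 3 - s ^ 3) * (VB * B) := by ring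
      _ ≤ 54 * τ * (VB * B) := by gcongr
      _ = _ := by ring
  linarith

end Part22

section Part23

/-! ### P23: the comparison theorem -/

open scoped Topology ENNReal

lemma comp_arith {C1 C2 kn lam ε g fP h G0 F : ℝ} (hC1 : 0 < C1) (hC2 : 0 < C2) (hk : 0 < kn) (hl : 0 < lam) (hε : 0 < ε)
    (hG0 : 0 ≤ G0) (hF : 0 ≤ F) (hg : g ≤ C1 * ((1 + kn) * (G0 + lam⁻¹ ^ 2 * F))) (hf : fP ≤ C2 * (ε ^ 2 * lam * kn + F)) :
    1 / 2 * g + 1 / ε ^ 2 * fP ≤ (C1 + C2) * ((1 + kn) * ((G0 + (lam⁻¹ ^ 2 + 1 / ε ^ 2) * F) + lam)) := by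
  have e2 : 0 < ε ^ 2 := by positivity
  have h1 : 1 / ε ^ 2 * fP ≤ C2 * (lam * kn + 1 / ε ^ 2 * F) := by
    calc 1 / ε ^ 2 * fP ≤ 1 / ε ^ 2 * (C2 * (ε ^ 2 * lam * kn + F)) := by gcongr
      _ = C2 * (lam * kn + 1 / ε ^ 2 * F) := by field_simp
  set X := G0 + lam⁻¹ ^ 2 * F with hX
  have hX0 : 0 ≤ X := by positivity
  set Y := 1 / ε ^ 2 * F with hY
  have hY0 : 0 ≤ Y := by positivity
  have e : (G0 + (lam⁻¹ ^ 2 + 1 / ε ^ 2) * F) + lam = X + Y + lam := by rw [hX, hY]; ring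
  rw [e]
  have p1 : 0 ≤ C1 * ((1 + kn) * X) := by positivity
  have p2 : 0 ≤ C1 * ((1 + kn) * (Y + lam)) := by positivity
  have p3 : 0 ≤ C2 * ((1 + kn) * X) := by positivity
  have p4 : 0 ≤ C2 * (kn * Y) := by positivity
  have p5 : 0 ≤ C2 * lam := by positivity
  nlinarith

def Hd (a b c ε lam s : ℝ) (nb : E3) (u : E3 → M3) (n : E3 → E3) (y : E3) : ℝ :=
  lam⁻¹ ^ 2 * ‖n y - nb‖ ^ 2 + gradSq u (s • hat y) + (lam⁻¹ ^ 2 + 1 / ε ^ 2) * fbulk a b c (u (s • hat y))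

lemma comp_pt {a b c C1 M : ℝ} (ha : 0 ≤ a) (hb : 0 < b) (hc : 0 < c) (hC1 : 0 < C1) (hM : 0 < M) : ∃ C > 0, ∀ ε : ℝ, 0 < ε → ε ≤ 1 →
    ∀ (u : E3 → M3), Sol a b c M ε u → ∀ (s lam τ : ℝ) (α nb : E3) (n : E3 → E3), 1/2 ≤ s → s ≤ 2 → Lift a b c C1 s u n → ‖nb‖ ≤ 1 →
    0 < lam → lam ≤ 1/2 → 0 < τ → ‖α‖ ≤ 1/2 → ∀ y : E3, y ≠ 0 → ‖y‖ < s →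
    eDen a b c ε (Pc (sstar a b c) (ε ^ 2 * lam) α nb lam s τ u n) y ≤ C * ((1 + kn (ε ^ 2 * lam) α (pc nb lam s n y)) *
      ({y : E3 | (1 - 2 * lam) * s < ‖y‖ ∧ ‖y‖ < s}.indicator (Hd a b c ε lam s nb u n) y + lam)) := by
  obtain ⟨K, hK0, hK⟩ := sT_deriv
  obtain ⟨Fb, hFb, hFbd⟩ := f_bdd ha hb hc M hM.le
  obtain ⟨A1, hA1, hg⟩ := Pc_grad hK0 hC1 (sstar_pos ha hb hc) hK
  obtain ⟨A2, hA2, hf⟩ := Pc_pot ha hb hc hC1 Fb hFb.le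
  refine ⟨A1 + A2, by positivity, ?_⟩
  intro ε hε hε1 u hu s lam τ α nb n hs hs2 hL hnb hl hl1 hτ hα y hy0 hys
  have hk : 0 < ε ^ 2 * lam := by positivity
  have hk1 : ε ^ 2 * lam ≤ 1 := by
    have : ε ^ 2 ≤ 1 := pow_le_one₀ hε.le hε1
    nlinarith
  have hf' := hf s lam (ε ^ 2 * lam) τ α nb u n hu.s0 hL (by linarith) hl (by linarith) hk hτ hα hnb (fun w hw => hFbd _ (hu.s0 _) (hu.bdd _ (by
    rw [mem_ball_zero_iff, norm_smul, hw, Real.norm_of_nonneg (by linarith)]; linarith))) y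
  have hkn := kn_pos hk α (pc nb lam s n y)
  have hf0 := fbulk_nonneg ha hb hc (hu.s0 (s • hat y))
  unfold eDen
  rcases lt_or_ge ‖y‖ ((1 - lam) * s) with hlt | hge
  · have hev : Pc (sstar a b c) (ε ^ 2 * lam) α nb lam s τ u n =ᶠ[𝓝 y] fun _ => Hm (sstar a b c) (ε ^ 2 * lam) α nb := by
      filter_upwards [(isOpen_lt continuous_norm continuous_const).mem_nhds hlt] with z hz
      have : Xc lam s z = 0 := Xc_zero hl (by linarith) (le_of_lt hz)
      simp [Pc, pc, this]
    have g0 : gradSq (Pc (sstar a b c) (ε ^ 2 * lam) α nb lam s τ u n) y = 0 := by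
      rw [gradSq_congr hev]; simp [gradSq, pd, frobSq]
    rw [g0]
    have h2 := hf'.2 hlt
    have i0 : 0 ≤ {y : E3 | (1 - 2 * lam) * s < ‖y‖ ∧ ‖y‖ < s}.indicator (Hd a b c ε lam s nb u n) y := by
      apply indicator_nonneg
      intro z hz
      have := fbulk_nonneg ha hb hc (hu.s0 (s • hat z))
      have := gradSq_nonneg u (s • hat z)
      unfold Hd; positivity
    have e := comp_arith (C1 := A1) (C2 := A2) (g := 0) (G0 := 0) (F := 0) hA1 hA2 hkn hl hε le_rfl le_rfl (by simp) (by simpa using h2) (h := 0)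
    refine e.trans ?_
    gcongr
    simpa using i0
  · have hin : y ∈ {y : E3 | (1 - 2 * lam) * s < ‖y‖ ∧ ‖y‖ < s} := ⟨by nlinarith, hys⟩
    rw [indicator_of_mem hin]
    have hg' := hg a b c s lam (ε ^ 2 * lam) τ α nb u n rfl hu.sm hL hs hs2 hl hl1 hk hk1 hτ hα hnb y (by nlinarith) hys
    rw [abs_of_nonneg hf0] at hg'
    have := gradSq_nonneg u (s • hat y)
    exact comp_arith (h := 0) hA1 hA2 hkn hl hε (by positivity) hf0 hg' (hf'.1 hys hy0)

end Part23

section Part24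

/-! ### P24: comparison theorem, integrated -/

open scoped Topology ENNReal

lemma meas_hat : Measurable hat := by
  unfold hat; exact measurable_norm.inv.smul measurable_id

lemma Lift.meas {a b c C s : ℝ} {u : E3 → M3} {n : E3 → E3} (h : Lift a b c C s u n) : Measurable n :=
  measurable_of_continuousOn_compl_singleton 0 h.sm.continuousOn

lemma Hd_cont {a b c C s : ℝ} {u : E3 → M3} {n : E3 → E3} (h : Lift a b c C s u n) : Continuous fun w : Sph => n w := by
  exact h.sm.continuousOn.comp_continuous continuous_subtype_val fun w => ne_of_unit (Sph_norm w)

set_option maxHeartbeats 1000000 in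
lemma comp_energy {a b c C1 M : ℝ} (ha : 0 ≤ a) (hb : 0 < b) (hc : 0 < c) (hC1 : 0 < C1) (hM : 0 < M) : ∃ C > 0, ∀ ε : ℝ, 0 < ε → ε ≤ 1 →
    ∀ (u : E3 → M3), Sol a b c M ε u → ∀ (s lam : ℝ) (nb : E3) (n : E3 → E3), 1/2 ≤ s → s ≤ 2 → Lift a b c C1 s u n → ‖nb‖ ≤ 1 →
    0 < lam → lam ≤ 1/2 →
    ∫ y in ball (0:E3) s, eDen a b c ε u y ≤ C * (lam * (1 + ∫ w : Sph, gradSq u (s • (w:E3)) ∂sig) + lam⁻¹ * (∫ w : Sph, ‖n w - nb‖ ^ 2 ∂sig)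
      + (lam * (1 / ε ^ 2) + lam⁻¹) * ∫ w : Sph, fbulk a b c (u (s • (w:E3))) ∂sig) := by
  obtain ⟨C2, hC2, hpt⟩ := comp_pt ha hb hc hC1 hM
  obtain ⟨C3, hC3, hal⟩ := choose_alpha
  have hV := VB_pos
  refine ⟨C2 * C3 * (16 + 8 * VB) + 1, by positivity, ?_⟩
  intro ε hε hε1 u hu s lam nb n hs hs2 hL hnb hl hl1
  have hs0 : 0 < s := by linarith
  have hk : 0 < ε ^ 2 * lam := by positivity
  obtain ⟨τ, hτ, hout⟩ := cmp_out hu hl s hs0 hs2 ha hb hc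
  set S := {y : E3 | (1 - 2 * lam) * s < ‖y‖ ∧ ‖y‖ < s} with hS
  have mS : MeasurableSet S :=
    ((isOpen_lt continuous_const continuous_norm).inter (isOpen_lt continuous_norm continuous_const)).measurableSet
  set H := Hd a b c ε lam s nb u n with hH
  have cg := (sm_gradSq hu.sm).continuous
  have cf := (sm_fbulk a b c hu.sm hu.s0).continuous
  have H0 : ∀ y, 0 ≤ H y := fun y => by
    have := fbulk_nonneg ha hb hc (hu.s0 (s • hat y))
    have := gradSq_nonneg u (s • hat y)
    rw [hH]; unfold Hd; positivity
  have mH : Measurable H := by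
    rw [hH]; unfold Hd
    have mh : Measurable fun y => s • hat y := meas_hat.const_smul s
    exact (((((hL.meas.sub_const nb).norm.pow_const 2).const_mul _)).add (cg.measurable.comp mh)).add ((cf.measurable.comp mh).const_mul _)
  have homH : ∀ t : ℝ, 0 < t → ∀ y, H (t • y) = H y := fun t ht y => by
    rw [hH]; unfold Hd; rw [hL.hom t ht, hat_smul ht]
  set Ψ : E3 → ℝ≥0∞ := fun y => S.indicator (fun y => ENNReal.ofReal (H y)) y + ENNReal.ofReal lam with hΨ
  have mΨ : Measurable Ψ := (mH.ennreal_ofReal.indicator mS).add measurable_const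
  have cp := (pc_cd (nb := nb) hl (by linarith) hs0 hL.sm).continuous
  obtain ⟨α, hα, hα2⟩ := hal _ hk (ball (0:E3) s) (pc nb lam s n) Ψ measurableSet_ball cp.measurable mΨ
    (pc_norm hl (by linarith) hs0 hL.unit hnb)
  have hmain := hout (sstar a b c) (ε ^ 2 * lam) lam α nb n hL.sm hk hl (by linarith)
  set P := Pc (sstar a b c) (ε ^ 2 * lam) α nb lam s τ u n with hPd
  have sP : ContDiff ℝ ∞ P := Pc_cd hk hl (by linarith) hs0 hu.sm hL.sm
  have hPS : ∀ y, P y ∈ S0 := Pc_S0 hu.s0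
  have cP := (sm_eDen a b c ε sP hPS).continuous
  set A := ∫ w : Sph, gradSq u (s • (w:E3)) ∂sig with hA
  set B := ∫ w : Sph, ‖n w - nb‖ ^ 2 ∂sig with hB
  set F := ∫ w : Sph, fbulk a b c (u (s • (w:E3))) ∂sig with hF
  have hA0 : 0 ≤ A := integral_nonneg fun w => gradSq_nonneg _ _
  have hB0 : 0 ≤ B := integral_nonneg fun w => by positivity
  have hF0 : 0 ≤ F := integral_nonneg fun w => fbulk_nonneg ha hb hc (hu.s0 _)
  -- sphere integral
  have ic : Continuous fun w : Sph => n w := Hd_cont hL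
  have i1 : Integrable (fun w : Sph => ‖n w - nb‖ ^ 2) sig := sph_int ((ic.sub continuous_const).norm.pow 2)
  have i2 : Integrable (fun w : Sph => gradSq u (s • (w:E3))) sig := sph_int (cg.comp (continuous_subtype_val.const_smul s))
  have i3 : Integrable (fun w : Sph => fbulk a b c (u (s • (w:E3)))) sig := sph_int (cf.comp (continuous_subtype_val.const_smul s))
  have eH : (fun w : Sph => H w) = fun w : Sph => lam⁻¹ ^ 2 * ‖n w - nb‖ ^ 2 + gradSq u (s • (w:E3)) + (lam⁻¹ ^ 2 + 1 / ε ^ 2) * fbulk a b c (u (s • (w:E3))) := by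
    ext w; rw [hH]; unfold Hd; rw [hat_unit (Sph_norm w)]
  have hsph : ∫⁻ w : Sph, ENNReal.ofReal (H w) ∂sig = ENNReal.ofReal (lam⁻¹ ^ 2 * B + A + (lam⁻¹ ^ 2 + 1 / ε ^ 2) * F) := by
    have iH : Integrable (fun w : Sph => H w) sig := by
      rw [eH]; exact ((i1.const_mul _).add i2).add (i3.const_mul _)
    rw [← ofReal_integral_eq_lintegral_ofReal iH (Filter.Eventually.of_forall fun w => H0 w), eH]
    have j1 : Integrable (fun w : Sph => lam⁻¹ ^ 2 * ‖n w - nb‖ ^ 2 + gradSq u (s • (w:E3))) sig := (i1.const_mul _).add i2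
    rw [integral_add j1 (i3.const_mul _), integral_add (i1.const_mul _) i2, integral_const_mul, integral_const_mul]
  have hX0 : 0 ≤ lam⁻¹ ^ 2 * B + A + (lam⁻¹ ^ 2 + 1 / ε ^ 2) * F := by positivity
  have hΨint : ∫⁻ y in ball (0:E3) s, Ψ y ≤ ENNReal.ofReal ((2 * lam * s ^ 3) * (lam⁻¹ ^ 2 * B + A + (lam⁻¹ ^ 2 + 1 / ε ^ 2) * F) + lam * (s ^ 3 * VB)) := by
    have hv : volume (ball (0:E3) s) = ENNReal.ofReal (s ^ 3 * VB) := by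
      rw [← vol_ball s hs0.le, ENNReal.ofReal_toReal measure_ball_lt_top.ne]
    rw [hΨ, lintegral_add_right _ measurable_const, setLIntegral_const, hv, ENNReal.ofReal_add (by positivity) (by positivity),
      ENNReal.ofReal_mul hl.le]
    refine add_le_add ?_ le_rfl
    rw [ENNReal.ofReal_mul (by positivity), ← hsph]
    refine le_trans ?_ (shell_lint mH.ennreal_ofReal (fun t ht y => by rw [homH t ht]) hs0.le (by positivity : 0 ≤ 2 * lam) (by linarith))
    rw [setLIntegral_indicator mS]
    exact lintegral_mono_set inter_subset_left
  have hne : ∀ᵐ y : E3, y ≠ 0 := by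
    simp [ae_iff]
  have hP : ENNReal.ofReal (∫ y in ball (0:E3) s, eDen a b c ε P y) ≤ ENNReal.ofReal C2 * (ENNReal.ofReal C3 *
      ENNReal.ofReal ((2 * lam * s ^ 3) * (lam⁻¹ ^ 2 * B + A + (lam⁻¹ ^ 2 + 1 / ε ^ 2) * F) + lam * (s ^ 3 * VB))) := by
    rw [ofReal_integral_eq_lintegral_ofReal (intOn_ball cP 0 s) (Filter.Eventually.of_forall fun y => eDen_nonneg ha hb hc ε (hPS y))]
    calc ∫⁻ y in ball (0:E3) s, ENNReal.ofReal (eDen a b c ε P y)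
        ≤ ∫⁻ y in ball (0:E3) s, ENNReal.ofReal C2 * (ENNReal.ofReal (1 + kn (ε ^ 2 * lam) α (pc nb lam s n y)) * Ψ y) := by
          refine lintegral_mono_ae ?_
          filter_upwards [ae_restrict_mem measurableSet_ball, ae_restrict_of_ae hne] with y hy hy0
          have hkn := kn_pos hk α (pc nb lam s n y)
          have := hpt ε hε hε1 u hu s lam τ α nb n hs hs2 hL hnb hl hl1 hτ hα y hy0 (mem_ball_zero_iff.1 hy)
          have eΨ : Ψ y = ENNReal.ofReal (S.indicator H y + lam) := by
            rw [ENNReal.ofReal_add (indicator_nonneg (fun z _ => H0 z) y) hl.le, hΨ]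
            by_cases hyS : y ∈ S <;> simp [hyS]
          rw [eΨ, ← ENNReal.ofReal_mul (by positivity), ← ENNReal.ofReal_mul hC2.le]
          exact ENNReal.ofReal_le_ofReal this
      _ = ENNReal.ofReal C2 * ∫⁻ y in ball (0:E3) s, (ENNReal.ofReal (1 + kn (ε ^ 2 * lam) α (pc nb lam s n y)) * Ψ y) :=
          lintegral_const_mul' _ _ ENNReal.ofReal_ne_top
      _ ≤ ENNReal.ofReal C2 * (ENNReal.ofReal C3 * ∫⁻ y in ball (0:E3) s, Ψ y) := by gcongr
      _ ≤ _ := by gcongr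
  rw [← ENNReal.ofReal_mul hC3.le, ← ENNReal.ofReal_mul hC2.le, ENNReal.ofReal_le_ofReal_iff (by positivity)] at hP
  have hs3 : s ^ 3 ≤ 8 := by
    calc s ^ 3 ≤ 2 ^ 3 := by gcongr
      _ = 8 := by norm_num
  have hfin : (2 * lam * s ^ 3) * (lam⁻¹ ^ 2 * B + A + (lam⁻¹ ^ 2 + 1 / ε ^ 2) * F) + lam * (s ^ 3 * VB) ≤
      (16 + 8 * VB) * (lam * (1 + A) + lam⁻¹ * B + (lam * (1 / ε ^ 2) + lam⁻¹) * F) := by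
    have e1 : (2 * lam * s ^ 3) * (lam⁻¹ ^ 2 * B + A + (lam⁻¹ ^ 2 + 1 / ε ^ 2) * F) =
        2 * s ^ 3 * (lam * A + lam⁻¹ * B + (lam * (1 / ε ^ 2) + lam⁻¹) * F) := by
      have : lam * lam⁻¹ ^ 2 = lam⁻¹ := by field_simp
      calc _ = 2 * s ^ 3 * ((lam * lam⁻¹ ^ 2) * B + lam * A + (lam * lam⁻¹ ^ 2 + lam * (1 / ε ^ 2)) * F) := by ring
        _ = _ := by rw [this]; ring
    rw [e1]
    have q0 : 0 ≤ lam * A + lam⁻¹ * B + (lam * (1 / ε ^ 2) + lam⁻¹) * F := by positivity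
    have : 2 * s ^ 3 * (lam * A + lam⁻¹ * B + (lam * (1 / ε ^ 2) + lam⁻¹) * F) ≤ 2 * 8 * (lam * A + lam⁻¹ * B + (lam * (1 / ε ^ 2) + lam⁻¹) * F) := by gcongr
    have h2 : lam * (s ^ 3 * VB) ≤ lam * (8 * VB) := by gcongr
    have h3 : 0 ≤ VB * (lam * A + lam⁻¹ * B + (lam * (1 / ε ^ 2) + lam⁻¹) * F) := by positivity
    nlinarith
  have hY : lam ≤ lam * (1 + A) + lam⁻¹ * B + (lam * (1 / ε ^ 2) + lam⁻¹) * F := by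
    have : 0 ≤ lam * A := by positivity
    have : 0 ≤ lam⁻¹ * B := by positivity
    have : 0 ≤ (lam * (1 / ε ^ 2) + lam⁻¹) * F := by positivity
    linarith
  calc _ ≤ _ := hmain
    _ ≤ C2 * (C3 * ((16 + 8 * VB) * (lam * (1 + A) + lam⁻¹ * B + (lam * (1 / ε ^ 2) + lam⁻¹) * F))) + (lam * (1 + A) + lam⁻¹ * B + (lam * (1 / ε ^ 2) + lam⁻¹) * F) := by
        refine add_le_add (hP.trans ?_) hY
        gcongr
    _ = _ := by ring

end Part24

section Part25

/-! ### P25: energy bound -/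

open scoped Topology ENNReal

lemma lip_u {a b c M C ε : ℝ} (ha : 0 ≤ a) (hb : 0 < b) (hc : 0 < c) (hC : 0 < C) (hε : 0 < ε) {u : E3 → M3} (h : Sol a b c M ε u)
    (hg : ∀ x ∈ ball (0:E3) 3, eDen a b c ε u x ≤ C / ε ^ 2) {x y : E3} (hx : x ∈ ball (0:E3) 3) (hy : y ∈ ball (0:E3) 3) :
    ‖u y - u x‖ ≤ (2 * C + 1) / ε * ‖y - x‖ := by
  have hd : ∀ z ∈ ball (0:E3) 3, DifferentiableAt ℝ u z := fun z _ => (h.sm.differentiable (by simp)) z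
  refine (convex_ball (0:E3) 3).norm_image_sub_le_of_norm_fderiv_le hd (fun z hz => ?_) hx hy
  refine ContinuousLinearMap.opNorm_le_bound _ (by positivity) fun v => ?_
  refine (sq_le_sq₀ (norm_nonneg _) (by positivity)).1 ?_
  have h1 := norm_fd_sq_le h.sm v z
  have h2 := hg z hz
  have h3 := fbulk_nonneg ha hb hc (h.s0 z)
  have h4 : gradSq u z ≤ (2 * C + 1) ^ 2 / ε ^ 2 := by
    have : 1 / 2 * gradSq u z ≤ C / ε ^ 2 := by
      unfold eDen at h2
      have : 0 ≤ 1 / ε ^ 2 * fbulk a b c (u z) := by positivity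
      linarith
    have e : (2 * C) / ε ^ 2 ≤ (2 * C + 1) ^ 2 / ε ^ 2 := by gcongr; nlinarith
    have e2 : (2 * C) / ε ^ 2 = 2 * (C / ε ^ 2) := by ring
    linarith
  calc ‖fderiv ℝ u z v‖ ^ 2 ≤ _ := h1
    _ ≤ (2 * C + 1) ^ 2 / ε ^ 2 * ‖v‖ ^ 2 := by gcongr
    _ = _ := by ring

lemma sup_f {a b c : ℝ} (ha : 0 ≤ a) (hb : 0 < b) (hc : 0 < c) {φ : ℝ → ℝ} (hφ : AdmissibleCutoff φ) {M : ℝ} (hM : 0 < M) {δ : ℝ} (hδ : 0 < δ) :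
    ∃ thr > 0, ∀ ε, 0 < ε → ε ≤ 1 / 4 → ∀ u, Sol a b c M ε u → ∀ s : ℝ, 1 / 2 ≤ s → s ≤ 2 →
      ∫ w : Sph, fbulk a b c (u (s • (w:E3))) ∂sig ≤ thr * ε ^ 2 → ∀ w : E3, ‖w‖ = 1 → fbulk a b c (u (s • w)) ≤ δ := by
  obtain ⟨C, hC, hg⟩ := grad_bound ha hb hc hφ M hM.le
  obtain ⟨C3, hC3, hq⟩ := fbulk_le_quad ha hb hc 1 (by norm_num)
  have hC2 := C2_pos ha hb hc
  have hV := VB_pos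
  set K := 2 * C + 1 with hK
  have hK0 : 0 < K := by positivity
  set σ := min 1 (δ / (2 * C3)) with hσ
  have hσ0 : 0 < σ := by positivity
  have hσ1 : σ ≤ 1 := min_le_left _ _
  have hσ2 : C3 * σ ≤ δ / 2 := by
    have : σ ≤ δ / (2 * C3) := min_le_right _ _
    rw [le_div_iff₀ (by positivity)] at this; linarith
  set κ := min 1 (σ / (144 * K ^ 2)) with hκ
  have hκ0 : 0 < κ := by positivity
  have hκ1 : κ ≤ 1 := min_le_left _ _
  have hκ2 : 72 * K ^ 2 * κ ^ 2 ≤ σ / 2 := by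
    have : κ ≤ σ / (144 * K ^ 2) := min_le_right _ _
    rw [le_div_iff₀ (by positivity)] at this
    have : κ ^ 2 ≤ κ := by nlinarith
    have : 72 * K ^ 2 * κ ^ 2 ≤ 72 * K ^ 2 * κ := by gcongr
    linarith
  set δ' := σ / (4 * C2 a b c) with hδ'
  have hδ'0 : 0 < δ' := by positivity
  have hδ'2 : 2 * (C2 a b c * δ') = σ / 2 := by rw [hδ']; field_simp; ring
  refine ⟨δ' * (VB / 18 * κ ^ 2) / 2, by positivity, ?_⟩
  intro ε hε hε4 u hu s hs hs2 hF w hw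
  by_contra hcon
  push Not at hcon
  have cf := (sm_fbulk a b c hu.sm hu.s0).continuous
  let w0 : Sph := ⟨w, by simpa using hw⟩
  have hin : ∀ v : Sph, s • (v:E3) ∈ ball (0:E3) 3 := fun v => by
    rw [mem_ball_zero_iff, norm_smul, Sph_norm, Real.norm_of_nonneg (by linarith)]; linarith
  have key := cap_cheb (g := fun v : Sph => fbulk a b c (u (s • (v:E3)))) (cf.comp (continuous_subtype_val.const_smul s))
    (fun v => fbulk_nonneg ha hb hc (hu.s0 _)) (w0 := w0) (ρ := κ * ε) (δ := δ') (by positivity) (by nlinarith) hδ'0.le (fun v hv => ?_)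
  · have : δ' * (VB / 18 * (κ * ε) ^ 2) = (δ' * (VB / 18 * κ ^ 2)) * ε ^ 2 := by ring
    rw [this] at key
    have : 0 < (δ' * (VB / 18 * κ ^ 2)) * ε ^ 2 := by positivity
    linarith
  · by_contra hlt
    push Not at hlt
    obtain ⟨p, hp, hpn⟩ := exists_near_N ha hb hc (hu.s0 (s • (v:E3)))
    have hl := lip_u ha hb hc hC hε hu (hg ε hε hε4 u hu) (hin v) (hin w0)
    have hl2 : ‖u (s • (w0:E3)) - u (s • (v:E3))‖ ≤ 2 * K * κ := by
      refine hl.trans ?_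
      rw [← smul_sub, norm_smul, Real.norm_of_nonneg (by linarith), norm_sub_rev]
      calc K / ε * (s * ‖(v:E3) - w0‖) ≤ K / ε * (2 * (κ * ε)) := by gcongr
        _ = 2 * K * κ := by field_simp
    have h1 := frobSq_le_norm (u (s • (w0:E3)) - u (s • (v:E3)))
    have h2 : ‖u (s • (w0:E3)) - u (s • (v:E3))‖ ^ 2 ≤ (2 * K * κ) ^ 2 := pow_le_pow_left₀ (norm_nonneg _) hl2 2
    have h3 := frobSq_add_le (u (s • (w0:E3)) - u (s • (v:E3))) (u (s • (v:E3)) - p)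
    rw [sub_add_sub_cancel] at h3
    have h4 : C2 a b c * fbulk a b c (u (s • (v:E3))) ≤ C2 a b c * δ' := by gcongr
    have h5 : frobSq (u (s • (w0:E3)) - p) ≤ σ := by
      have : (2 * K * κ) ^ 2 = 4 * K ^ 2 * κ ^ 2 := by ring
      linarith
    have h6 := hq p hp (u (s • (w0:E3)) - p) (S0_sub (hu.s0 _) (Nman_S0 hp)) (frobNorm_le_of_sq (by norm_num) (by linarith))
    rw [add_sub_cancel] at h6
    have h7 : C3 * frobSq (u (s • (w0:E3)) - p) ≤ C3 * σ := by gcongr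
    have : δ < fbulk a b c (u (s • (w0:E3))) := hcon
    linarith

lemma good_lift {a b c : ℝ} (ha : 0 ≤ a) (hb : 0 < b) (hc : 0 < c) {φ : ℝ → ℝ} (hφ : AdmissibleCutoff φ) {M : ℝ} (hM : 0 < M) :
    ∃ thr > 0, thr ≤ 1 ∧ ∃ C1 > 0, ∀ ε, 0 < ε → ε ≤ 1 / 4 → ∀ u, Sol a b c M ε u → ∀ s : ℝ, 1 / 2 ≤ s → s ≤ 2 →
      ∫ w : Sph, fbulk a b c (u (s • (w:E3))) ∂sig ≤ thr * ε ^ 2 → ∃ n, Lift a b c C1 s u n := by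
  obtain ⟨δ, hδ, C1, hC1, h⟩ := lift_exists ha hb hc
  obtain ⟨thr, ht, h2⟩ := sup_f ha hb hc hφ hM hδ
  refine ⟨min thr 1, by positivity, min_le_right _ _, C1, hC1, fun ε hε hε4 u hu s hs hs2 hF => ?_⟩
  refine h u hu.sm hu.s0 s (by linarith) hs2 (h2 ε hε hε4 u hu s hs hs2 (hF.trans ?_))
  gcongr; exact min_le_left _ _

lemma ode_bound {K k F : ℝ → ℝ} {c q : ℝ} (hc : 0 < c) (hq : 0 < q) (hK : ∀ s ∈ Icc (1:ℝ) (7/5), HasDerivAt K (k s) s) (hF : Continuous F)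
    (hpos : ∀ s ∈ Icc (1:ℝ) (7/5), 0 < K s) (hk : ∀ s ∈ Icc (1:ℝ) (7/5), c * K s ^ 2 * (1 - F s / q) ≤ k s)
    (hInt0 : ∫ s in (1:ℝ)..(7/5), F s ≤ q / 5) : K 1 ≤ 5 / c := by
  set G : ℝ → ℝ := fun s => -(K s)⁻¹ - c * (s - q⁻¹ * ∫ r in (1:ℝ)..s, F r) with hG
  have hd : ∀ s ∈ Icc (1:ℝ) (7/5), HasDerivAt G (-(-(k s) / K s ^ 2) - c * (1 - q⁻¹ * F s)) s := fun s hs => by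
    have d1 := ((hK s hs).inv (hpos s hs).ne').neg
    have d2 : HasDerivAt (fun s => ∫ r in (1:ℝ)..s, F r) (F s) s := intervalIntegral.integral_hasDerivAt_right (hF.intervalIntegrable _ _)
      (hF.stronglyMeasurableAtFilter _ _) hF.continuousAt
    exact d1.sub (((hasDerivAt_id s).sub (d2.const_mul q⁻¹)).const_mul c)
  have hm : MonotoneOn G (Icc 1 (7/5)) := by
    refine monotoneOn_of_deriv_nonneg (convex_Icc _ _) (fun s hs => (hd s hs).continuousAt.continuousWithinAt)
      (fun s hs => (hd s (interior_subset hs)).differentiableAt.differentiableWithinAt) fun s hs => ?_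
    rw [(hd s (interior_subset hs)).deriv]
    have h1 := hk s (interior_subset hs)
    have h2 := hpos s (interior_subset hs)
    have : c * (1 - q⁻¹ * F s) ≤ k s / K s ^ 2 := by
      rw [le_div_iff₀ (by positivity)]
      calc _ = c * K s ^ 2 * (1 - F s / q) := by ring
        _ ≤ _ := h1
    have e : -(-(k s) / K s ^ 2) = k s / K s ^ 2 := by ring
    rw [e]; linarith
  have h := hm (left_mem_Icc.2 (by norm_num)) (right_mem_Icc.2 (by norm_num)) (by norm_num : (1:ℝ) ≤ 7/5)
  simp only [hG, intervalIntegral.integral_same, mul_zero, sub_zero, mul_one] at h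
  have p1 := hpos 1 (left_mem_Icc.2 (by norm_num))
  have p2 := hpos (7/5) (right_mem_Icc.2 (by norm_num))
  have p3 : 0 < (K (7/5))⁻¹ := by positivity
  have h3 : q⁻¹ * ∫ s in (1:ℝ)..(7/5), F s ≤ 1 / 5 := by
    rw [inv_mul_le_iff₀ hq]; linarith
  have h4 : c * (1 / 5) ≤ (K 1)⁻¹ := by nlinarith
  rw [le_div_iff₀ hc]
  have h5 := mul_le_mul_of_nonneg_left h4 p1.le
  rw [mul_inv_cancel₀ p1.ne'] at h5
  linarith

end Part25

section Part26

/-! ### P26: universal energy bound -/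

open scoped Topology ENNReal

lemma eb_arith {C σ K k : ℝ} (hC : 0 < C) (hσ : 0 ≤ σ) (hk : 0 ≤ k) (hK0 : 4 * C * (σ + 1) ≤ K) (hK1 : 16 * C ^ 2 * (σ + 1) ≤ K ^ 2)
    (h : ∀ lam : ℝ, 0 < lam → lam ≤ 1/2 → K ≤ C * (lam * (2 + 2 * k) + lam⁻¹ * (σ + 1))) :
    (16 * C ^ 2 * (σ + 1))⁻¹ * K ^ 2 ≤ k := by
  have hKp : 0 < K := lt_of_lt_of_le (by positivity) hK0
  have h1 := h (2 * C * (σ + 1) / K) (by positivity) (by rw [div_le_iff₀ hKp]; linarith)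
  have e1 : C * ((2 * C * (σ + 1) / K)⁻¹ * (σ + 1)) = K / 2 := by field_simp
  have h2 : K / 2 ≤ C * (2 * C * (σ + 1) / K) * (2 + 2 * k) := by
    have : C * (2 * C * (σ + 1) / K * (2 + 2 * k) + (2 * C * (σ + 1) / K)⁻¹ * (σ + 1)) = C * (2 * C * (σ + 1) / K) * (2 + 2 * k) + K / 2 := by
      rw [← e1]; ring
    linarith
  have e2 : C * (2 * C * (σ + 1) / K) * (2 + 2 * k) = (4 * C ^ 2 * (σ + 1) * (1 + k)) / K := by ring
  rw [e2, le_div_iff₀ hKp] at h2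
  rw [inv_mul_le_iff₀ (by positivity)]
  nlinarith

lemma K_deriv {g : E3 → ℝ} (hg : Continuous g) (h0 : ∀ y, 0 ≤ g y) {s : ℝ} (hs : 0 < s) :
    HasDerivAt (fun s => ∫ y in ball (0:E3) s, g y) (s ^ 2 * ∫ w : Sph, g (s • (w:E3)) ∂sig) s := by
  have hc : Continuous fun r : ℝ => r ^ 2 * ∫ w : Sph, g (r • (w:E3)) ∂sig := (continuous_id.pow 2).mul (sph_cont hg)
  have d2 : HasDerivAt (fun s => ∫ r in (0:ℝ)..s, r ^ 2 * ∫ w : Sph, g (r • (w:E3)) ∂sig) (s ^ 2 * ∫ w : Sph, g (s • (w:E3)) ∂sig) s :=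
    intervalIntegral.integral_hasDerivAt_right (hc.intervalIntegrable _ _) (hc.stronglyMeasurableAtFilter _ _) hc.continuousAt
  refine d2.congr_of_eventuallyEq ?_
  filter_upwards [lt_mem_nhds hs] with r hr
  exact polar_ball hg h0 hr.le

/-- radial averaging: the integral of sphere means over `[p,q]` is controlled by the ball integral. -/
lemma rad_int {g : E3 → ℝ} (hg : Continuous g) (h0 : ∀ y, 0 ≤ g y) {p q κ : ℝ} (hp : 0 < p) (hpq : p ≤ q) (hκ : 0 < κ) (hκp : 1 ≤ κ * p ^ 2) :
    ∫ s in p..q, (∫ w : Sph, g (s • (w:E3)) ∂sig) ≤ κ * ∫ y in ball (0:E3) q, g y := by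
  have hc := sph_cont hg
  have hc2 : Continuous fun r : ℝ => r ^ 2 * ∫ w : Sph, g (r • (w:E3)) ∂sig := (continuous_id.pow 2).mul hc
  have hJ0 : ∀ r : ℝ, 0 ≤ ∫ w : Sph, g (r • (w:E3)) ∂sig := fun r => integral_nonneg fun w => h0 _
  rw [polar_ball hg h0 (hp.le.trans hpq), ← intervalIntegral.integral_add_adjacent_intervals (b := p) (hc2.intervalIntegrable _ _) (hc2.intervalIntegrable _ _)]
  have h1 : 0 ≤ ∫ r in (0:ℝ)..p, r ^ 2 * ∫ w : Sph, g (r • (w:E3)) ∂sig :=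
    intervalIntegral.integral_nonneg hp.le fun r _ => mul_nonneg (sq_nonneg _) (hJ0 r)
  have h2 : ∫ s in p..q, (∫ w : Sph, g (s • (w:E3)) ∂sig) ≤ ∫ s in p..q, κ * (s ^ 2 * ∫ w : Sph, g (s • (w:E3)) ∂sig) := by
    refine intervalIntegral.integral_mono_on hpq (hc.intervalIntegrable _ _) ((continuous_const.mul hc2).intervalIntegrable _ _) fun s hs => ?_
    have : 1 ≤ κ * s ^ 2 := hκp.trans (by gcongr; exact hs.1)
    nlinarith [hJ0 s]
  rw [intervalIntegral.integral_const_mul] at h2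
  have : 0 ≤ κ * ∫ r in (0:ℝ)..p, r ^ 2 * ∫ w : Sph, g (r • (w:E3)) ∂sig := by positivity
  linarith

set_option maxHeartbeats 1000000 in
lemma energy_bound {a b c : ℝ} (ha : 0 ≤ a) (hb : 0 < b) (hc : 0 < c) {φ : ℝ → ℝ} (hφ : AdmissibleCutoff φ) {M : ℝ} (hM : 0 < M) :
    ∃ η > 0, ∃ M' > 0, ∀ ε, 0 < ε → ε ≤ 1 / 4 → ∀ u, Sol a b c M ε u →
      ∫ y in ball (0:E3) (7/5), fbulk a b c (u y) ≤ η * ε ^ 2 → ∫ y in ball (0:E3) 1, eDen a b c ε u y ≤ M' := by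
  obtain ⟨thr, ht, ht1, C1, hC1, hgood⟩ := good_lift ha hb hc hφ hM
  obtain ⟨C, hC, hcomp⟩ := comp_energy ha hb hc hC1 hM
  set σ := (sig univ).toReal with hσ
  have hσ0 : 0 ≤ σ := ENNReal.toReal_nonneg
  set K0 := 4 * C * (σ + 1) + 16 * C ^ 2 * (σ + 1) + 1 with hK0
  set cc := (16 * C ^ 2 * (σ + 1))⁻¹ with hcc
  have hcc0 : 0 < cc := by positivity
  refine ⟨thr / 5, by positivity, K0 + 5 / cc, by positivity, ?_⟩
  intro ε hε hε4 u hu hfb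
  have cf := (sm_fbulk a b c hu.sm hu.s0).continuous
  have cg := (sm_gradSq hu.sm).continuous
  have ce := (sm_eDen a b c ε hu.sm hu.s0).continuous
  have f0 : ∀ y, 0 ≤ fbulk a b c (u y) := fun y => fbulk_nonneg ha hb hc (hu.s0 y)
  have e0 : ∀ y, 0 ≤ eDen a b c ε u y := fun y => eDen_nonneg ha hb hc ε (hu.s0 y)
  set K : ℝ → ℝ := fun s => ∫ y in ball (0:E3) s, eDen a b c ε u y with hKd
  by_cases hbig : K 1 ≤ K0
  · have : 0 < 5 / cc := by positivity
    linarith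
  push Not at hbig
  have hmono : ∀ s, 1 ≤ s → K 1 ≤ K s := fun s hs =>
    setIntegral_mono_set (intOn_ball ce _ _) (Filter.Eventually.of_forall e0) (ball_subset_ball hs).eventuallyLE
  have hK0p : 0 < K0 := by positivity
  have key : K 1 ≤ 5 / cc := by
    refine ode_bound (K := K) (k := fun s => s ^ 2 * ∫ w : Sph, eDen a b c ε u (s • (w:E3)) ∂sig) (F := fun s => ∫ w : Sph, fbulk a b c (u (s • (w:E3))) ∂sig)
      (q := thr * ε ^ 2) hcc0 (by positivity) (fun s hs => K_deriv ce e0 (by linarith [hs.1])) (sph_cont cf) (fun s hs => ?_) (fun s hs => ?_) ?_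
    · have := hmono s hs.1; linarith
    · have hs1 := hs.1
      have hs2 := hs.2
      have hKs := hmono s hs.1
      have hk0 : 0 ≤ s ^ 2 * ∫ w : Sph, eDen a b c ε u (s • (w:E3)) ∂sig := mul_nonneg (sq_nonneg _) (integral_nonneg fun w => e0 _)
      set k := s ^ 2 * ∫ w : Sph, eDen a b c ε u (s • (w:E3)) ∂sig with hk
      set F := ∫ w : Sph, fbulk a b c (u (s • (w:E3))) ∂sig with hF
      have hF0 : 0 ≤ F := integral_nonneg fun w => f0 _
      have hq : 0 < thr * ε ^ 2 := by positivity
      rcases le_or_gt F (thr * ε ^ 2) with hFl | hFg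
      · obtain ⟨n, hL⟩ := hgood ε hε hε4 u hu s (by linarith) (by linarith) hFl
        have h1 : cc * K s ^ 2 ≤ k := by
          refine eb_arith hC hσ0 hk0 (by
            have : 0 ≤ 16 * C ^ 2 * (σ + 1) := by positivity
            linarith) ?_ fun lam hl hl1 => ?_
          · have : 1 ≤ K s := by
              have : 0 ≤ 4 * C * (σ + 1) + 16 * C ^ 2 * (σ + 1) := by positivity
              linarith
            have : K s ≤ K s ^ 2 := by nlinarith
            have : 0 ≤ 4 * C * (σ + 1) := by positivity
            linarith
          · refine (hcomp ε hε (by linarith) u hu s lam 0 n (by linarith) (by linarith) hL (by simp) hl hl1).trans ?_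
            have hB : ∫ w : Sph, ‖n w - 0‖ ^ 2 ∂sig = σ := by
              have : (fun w : Sph => ‖n w - 0‖ ^ 2) = fun _ => (1:ℝ) := by
                ext w; rw [sub_zero, hL.unit _ (ne_of_unit (Sph_norm w))]; norm_num
              rw [this]; simp [hσ, Measure.real]
            have hA : ∫ w : Sph, gradSq u (s • (w:E3)) ∂sig ≤ 2 * k := by
              have i1 : Integrable (fun w : Sph => gradSq u (s • (w:E3))) sig := sph_int (cg.comp (continuous_subtype_val.const_smul s))
              have i2 : Integrable (fun w : Sph => eDen a b c ε u (s • (w:E3))) sig := sph_int (ce.comp (continuous_subtype_val.const_smul s))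
              have h2 : ∫ w : Sph, gradSq u (s • (w:E3)) ∂sig ≤ ∫ w : Sph, 2 * eDen a b c ε u (s • (w:E3)) ∂sig := by
                refine integral_mono i1 (i2.const_mul 2) fun w => ?_
                have := f0 (s • (w:E3))
                have : 0 ≤ 1 / ε ^ 2 * fbulk a b c (u (s • (w:E3))) := by positivity
                simp only [eDen]; linarith
              rw [integral_const_mul] at h2
              refine h2.trans ?_
              have : 0 ≤ ∫ w : Sph, eDen a b c ε u (s • (w:E3)) ∂sig := integral_nonneg fun w => e0 _
              have h9 := le_mul_of_one_le_left this (one_le_pow₀ hs1 (n := 2))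
              linarith
            rw [hB]
            have hF1 : (1 / ε ^ 2) * F ≤ 1 := by
              rw [one_div, inv_mul_le_iff₀ (by positivity)]
              have : thr * ε ^ 2 ≤ 1 * ε ^ 2 := by gcongr
              linarith
            have hF2 : F ≤ 1 := by
              have : ε ^ 2 ≤ 1 := pow_le_one₀ hε.le (by linarith)
              have : thr * ε ^ 2 ≤ 1 * 1 := by gcongr
              linarith
            refine mul_le_mul_of_nonneg_left ?_ hC.le
            have h5 : lam * (1 / ε ^ 2 * F) ≤ lam * 1 := by gcongr
            have h6 : lam⁻¹ * F ≤ lam⁻¹ * 1 := by gcongr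
            have h7 : lam * (∫ w : Sph, gradSq u (s • (w:E3)) ∂sig) ≤ lam * (2 * k) := by gcongr
            calc _ = lam + lam * (∫ w : Sph, gradSq u (s • (w:E3)) ∂sig) + lam⁻¹ * σ + (lam * (1 / ε ^ 2 * F) + lam⁻¹ * F) := by ring
              _ ≤ lam + lam * (2 * k) + lam⁻¹ * σ + (lam * 1 + lam⁻¹ * 1) := by gcongr
              _ = _ := by ring
        have h2 : cc * K s ^ 2 * (1 - F / (thr * ε ^ 2)) ≤ cc * K s ^ 2 * 1 := by
          have : 0 ≤ F / (thr * ε ^ 2) := by positivity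
          gcongr; linarith
        show cc * K s ^ 2 * (1 - F / (thr * ε ^ 2)) ≤ k
        linarith
      · have : 1 < F / (thr * ε ^ 2) := by rw [lt_div_iff₀ hq]; linarith
        have h3 : 0 ≤ cc * K s ^ 2 := by positivity
        exact (mul_nonpos_of_nonneg_of_nonpos h3 (by linarith)).trans hk0
    · have := rad_int cf f0 (p := 1) (q := 7/5) (κ := 1) (by norm_num) (by norm_num) (by norm_num) (by norm_num)
      calc _ ≤ _ := this
        _ ≤ 1 * (thr / 5 * ε ^ 2) := by gcongr
        _ = _ := by ring
  show K 1 ≤ _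
  linarith

end Part26

section Part27

/-! ### P27: cylindrical coordinates on the sphere -/

open scoped Topology ENNReal

lemma exists_onb {v : E3} (hv : ‖v‖ = 1) : ∃ b : OrthonormalBasis (Fin 3) ℝ E3, b 2 = v := by
  have hh : Orthonormal ℝ (({2} : Set (Fin 3)).domRestrict (fun _ : Fin 3 => v)) := by
    constructor
    · intro i; simpa using hv
    · intro i j hij
      exact absurd (Subsingleton.elim i j) hij
  obtain ⟨b, hb⟩ := hh.exists_orthonormalBasis_extension_of_card_eq (by simp)
  exact ⟨b, hb 2 (by simp)⟩

lemma lint_onb (b : OrthonormalBasis (Fin 3) ℝ E3) {F : E3 → ℝ≥0∞} (hF : Measurable F) :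
    ∫⁻ y, F y = ∫⁻ z : ℝ, ∫⁻ p : ℝ × ℝ, F (p.1 • b 0 + p.2 • b 1 + z • b 2) := by
  have h1 := b.measurePreserving_repr_symm.comp (PiLp.volume_preserving_toLp (Fin 3))
  have h2 := (volume_preserving_piFinSuccAbove (fun _ : Fin 3 => ℝ) 2).symm
  have h3 := ((MeasurePreserving.id (volume : Measure ℝ)).prod (volume_preserving_finTwoArrow ℝ)).symm (e := (MeasurableEquiv.refl ℝ).prodCongr MeasurableEquiv.finTwoArrow)
  have h := (h1.comp h2).comp h3
  rw [← h.lintegral_comp hF, Measure.volume_eq_prod, lintegral_prod]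
  · refine lintegral_congr fun z => lintegral_congr fun p => ?_
    congr 1
    simp only [Function.comp]
    rw [← b.sum_repr_symm, Fin.sum_univ_three]
    rfl
  · exact (hF.comp h.measurable).aemeasurable

lemma lint_scale {r : ℝ} (hr : 0 < r) {G : ℝ → ℝ≥0∞} (hG : Measurable G) :
    ∫⁻ z, G z = ENNReal.ofReal r * ∫⁻ t, G (r * t) := by
  have h := Real.smul_map_volume_mul_left hr.ne'
  conv_lhs => rw [← h]
  rw [lintegral_smul_measure, lintegral_map hG (by fun_prop), abs_of_pos hr]
  rfl

def qq (b : OrthonormalBasis (Fin 3) ℝ E3) (θ t : ℝ) : E3 :=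
  Real.cos θ • b 0 + Real.sin θ • b 1 + t • b 2

lemma qq_cont (b : OrthonormalBasis (Fin 3) ℝ E3) : Continuous fun p : ℝ × ℝ => qq b p.1 p.2 := by
  unfold qq; fun_prop

lemma lint_cyl (b : OrthonormalBasis (Fin 3) ℝ E3) {F : E3 → ℝ≥0∞} (hF : Measurable F) :
    ∫⁻ y, F y = ∫⁻ θ in Ioo (-Real.pi) Real.pi, ∫⁻ t : ℝ, ∫⁻ r in Ioi (0:ℝ),
      ENNReal.ofReal (r^2) * F (r • qq b θ t) := by
  rw [lint_onb b hF]
  have e1 : ∀ z : ℝ, ∫⁻ p : ℝ × ℝ, F (p.1 • b 0 + p.2 • b 1 + z • b 2) =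
      ∫⁻ p in Ioi (0:ℝ) ×ˢ Ioo (-Real.pi) Real.pi, ENNReal.ofReal p.1 * F (p.1 • qq b p.2 0 + z • b 2) := by
    intro z
    rw [← lintegral_comp_polarCoord_symm, polarCoord_target]
    refine lintegral_congr fun p => ?_
    simp [qq, polarCoord_symm_apply, smul_add, smul_smul]
  simp_rw [e1]
  rw [lintegral_lintegral_swap]
  · have e2 : ∀ p ∈ Ioi (0:ℝ) ×ˢ Ioo (-Real.pi) Real.pi, (∫⁻ z : ℝ, ENNReal.ofReal p.1 * F (p.1 • qq b p.2 0 + z • b 2))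
        = ∫⁻ t : ℝ, ENNReal.ofReal (p.1^2) * F (p.1 • qq b p.2 t) := by
      intro p hp
      have hp1 : 0 < p.1 := hp.1
      rw [lint_scale hp1 (by fun_prop), ← lintegral_const_mul' _ _ ENNReal.ofReal_ne_top]
      refine lintegral_congr fun t => ?_
      rw [← mul_assoc, ← ENNReal.ofReal_mul hp1.le, sq]
      simp [qq, smul_add, smul_smul]
    rw [setLIntegral_congr_fun (measurableSet_Ioi.prod measurableSet_Ioo) e2]
    have hm : Measurable fun q : (ℝ × ℝ) × ℝ => ENNReal.ofReal (q.1.1^2) * F (q.1.1 • qq b q.1.2 q.2) := by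
      have : Measurable fun q : (ℝ × ℝ) × ℝ => q.1.1 • qq b q.1.2 q.2 := by unfold qq; fun_prop
      exact (by fun_prop : Measurable fun q : (ℝ × ℝ) × ℝ => ENNReal.ofReal (q.1.1^2)).mul (hF.comp this)
    rw [Measure.volume_eq_prod, ← Measure.prod_restrict, lintegral_prod_symm]
    · refine lintegral_congr fun θ => ?_
      rw [lintegral_lintegral_swap]
      exact (hm.comp (by fun_prop : Measurable fun q : ℝ × ℝ => ((q.1, θ), q.2))).aemeasurable
    · exact (hm.lintegral_prod_right' (ν := volume)).aemeasurable
  · have : Measurable fun q : ℝ × (ℝ × ℝ) => q.2.1 • qq b q.2.2 0 + q.1 • b 2 := by unfold qq; fun_prop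
    exact ((by fun_prop : Measurable fun q : ℝ × (ℝ × ℝ) => ENNReal.ofReal q.2.1).mul (hF.comp this)).aemeasurable

lemma lint_rad {h : E3 → ℝ≥0∞} (hom : ∀ t : ℝ, 0 < t → ∀ y, h (t • y) = h y) {q : E3} (hq : q ≠ 0) :
    ∫⁻ r in Ioi (0:ℝ), ENNReal.ofReal (r^2) * (ball (0:E3) 1).indicator h (r • q) =
      ENNReal.ofReal (‖q‖⁻¹^3/3) * h q := by
  have hn : 0 < ‖q‖ := norm_pos_iff.2 hq
  have e : ∀ r ∈ Ioi (0:ℝ), ENNReal.ofReal (r^2) * (ball (0:E3) 1).indicator h (r • q) =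
      (Iio ‖q‖⁻¹).indicator (fun r => ENNReal.ofReal (r^2) * h q) r := by
    intro r hr
    have hr' : (0:ℝ) < r := hr
    have hi : r • q ∈ ball (0:E3) 1 ↔ r ∈ Iio ‖q‖⁻¹ := by
      rw [mem_ball_zero_iff, norm_smul, Real.norm_of_nonneg hr'.le, mem_Iio, lt_inv_comm₀ hr' hn, ← one_div, lt_div_iff₀ hr', mul_comm]
    by_cases hh : r ∈ Iio ‖q‖⁻¹
    · rw [indicator_of_mem hh, indicator_of_mem (hi.2 hh), hom r hr']
    · rw [indicator_of_notMem hh, indicator_of_notMem (fun x => hh (hi.1 x)), mul_zero]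
  rw [setLIntegral_congr_fun measurableSet_Ioi e, lintegral_indicator measurableSet_Iio,
    Measure.restrict_restrict measurableSet_Iio, lintegral_mul_const _ (by fun_prop)]
  congr 1
  rw [inter_comm, Ioi_inter_Iio]
  rw [← ofReal_integral_eq_lintegral_ofReal]
  · congr 1
    rw [← integral_Ioc_eq_integral_Ioo, ← intervalIntegral.integral_of_le (by positivity), integral_pow]
    norm_num
  · exact ((by fun_prop : Continuous fun r : ℝ => r^2).integrableOn_Icc).mono_set Ioo_subset_Icc_self
  · exact Filter.Eventually.of_forall fun r => sq_nonneg r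

lemma qq_normsq (b : OrthonormalBasis (Fin 3) ℝ E3) (θ t : ℝ) : ‖qq b θ t‖^2 = 1 + t^2 := by
  have h := b.orthonormal
  have h00 : inner ℝ (b 0) (b 1) = 0 := h.2 (by decide)
  have h02 : inner ℝ (b 0) (b 2) = 0 := h.2 (by decide)
  have h12 : inner ℝ (b 1) (b 2) = 0 := h.2 (by decide)
  rw [qq, norm_add_sq_real, norm_add_sq_real]
  simp only [inner_add_left, inner_smul_left, inner_smul_right, h00, h02, h12, norm_smul, h.1, mul_pow]
  simp
  

lemma qq_ne (b : OrthonormalBasis (Fin 3) ℝ E3) (θ t : ℝ) : qq b θ t ≠ 0 := by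
  intro h
  have := qq_normsq b θ t
  rw [h] at this
  simp at this
  nlinarith [sq_nonneg t]

lemma sph_cyl (b : OrthonormalBasis (Fin 3) ℝ E3) {h : E3 → ℝ≥0∞} (hm : Measurable h) (hom : ∀ t : ℝ, 0 < t → ∀ y, h (t • y) = h y) :
    ∫⁻ w : Sph, h w ∂sig = ∫⁻ θ in Ioo (-Real.pi) Real.pi, ∫⁻ t : ℝ, ENNReal.ofReal (‖qq b θ t‖⁻¹^3) * h (qq b θ t) := by
  have hF : Measurable ((ball (0:E3) 1).indicator h) := hm.indicator measurableSet_ball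
  have h1 := polar hF
  rw [lint_cyl b hF] at h1
  have e1 : ∀ w : Sph, ∫⁻ r in Ioi (0:ℝ), ENNReal.ofReal (r^2) * (ball (0:E3) 1).indicator h (r • (w:E3)) = ENNReal.ofReal (1/3) * h w := by
    intro w
    rw [lint_rad hom (ne_of_unit (Sph_norm w)), Sph_norm]
    norm_num
  have e2 : ∀ θ t : ℝ, ∫⁻ r in Ioi (0:ℝ), ENNReal.ofReal (r^2) * (ball (0:E3) 1).indicator h (r • qq b θ t) = ENNReal.ofReal (1/3) * (ENNReal.ofReal (‖qq b θ t‖⁻¹^3) * h (qq b θ t)) := by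
    intro θ t
    rw [lint_rad hom (qq_ne b θ t), ← mul_assoc, ← ENNReal.ofReal_mul (by norm_num)]
    congr 2; ring
  simp_rw [e1, e2] at h1
  simp_rw [lintegral_const_mul' (ENNReal.ofReal (1/3)) _ ENNReal.ofReal_ne_top] at h1
  have := (ENNReal.mul_right_inj (by simp) ENNReal.ofReal_ne_top).1 h1
  exact this.symm

end Part27

section Part28

/-! ### P28: derivatives along the cylinder, Cauchy-Schwarz -/

open scoped Topology ENNReal

def G2 (u : E3 → M3) (v y : E3) : ℝ := frobSq (dirD u v y) + frobSq (dirD u y y)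

lemma G2_nonneg (u : E3 → M3) (v y : E3) : 0 ≤ G2 u v y := add_nonneg (frobSq_nonneg _) (frobSq_nonneg _)

lemma G2_cont {u : E3 → M3} (hu : ContDiff ℝ ∞ u) (v : E3) : Continuous (G2 u v) :=
  (cont_dirD hu continuous_const continuous_id).add (cont_dirD hu continuous_id continuous_id)

lemma two_sq {x y k : ℝ} (hx : 0 ≤ x) (hy : 0 ≤ y) (hk : |k| ≤ 1) : (x + |k| * y)^2 ≤ 2 * (x^2 + y^2) := by
  have h1 : |k| * y ≤ y := mul_le_of_le_one_left hy hk
  have h0 : 0 ≤ |k| * y := by positivity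
  nlinarith [sq_nonneg (x - y)]

lemma fd_perp {F : Type*} [NormedAddCommGroup F] [NormedSpace ℝ F] (L : E3 →L[ℝ] F) {v w : E3} {s k : ℝ} (hs : 1/2 ≤ s) (hk : |k| ≤ 1) :
    ‖L (v - k • w)‖^2 ≤ 8 * (‖L v‖^2 + ‖L (s • w)‖^2) := by
  have h1 : ‖L (v - k • w)‖ ≤ ‖L v‖ + |k| * ‖L w‖ := by
    rw [map_sub, map_smul]
    refine (norm_sub_le _ _).trans ?_
    rw [norm_smul, Real.norm_eq_abs]
  have h2 := two_sq (norm_nonneg (L v)) (norm_nonneg (L w)) hk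
  have h3 : ‖L (s • w)‖^2 = s^2 * ‖L w‖^2 := by
    rw [map_smul, norm_smul, mul_pow, Real.norm_eq_abs, sq_abs]
  have h4 := pow_le_pow_left₀ (norm_nonneg _) h1 2
  have h5 : 1/4 ≤ s^2 := by nlinarith
  rw [h3]
  nlinarith [mul_le_mul_of_nonneg_right h5 (sq_nonneg ‖L w‖), sq_nonneg ‖L v‖]

lemma perp_perp {w ξ : E3} (hw : ‖w‖ = 1) : (inner ℝ w (ξ - (inner ℝ w ξ : ℝ) • w) : ℝ) = 0 := by
  rw [inner_sub_right, inner_smul_right, real_inner_self_eq_norm_sq, hw]; ring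

lemma n_der2 {a b c C s : ℝ} {u : E3 → M3} {n : E3 → E3} (hu : ContDiff ℝ ∞ u) (h : Lift a b c C s u n) (hC : 0 < C) (hs : 1/2 ≤ s) {y : E3} (hy : y ≠ 0) {v : E3} (hv : ‖v‖ = 1) :
    ‖fderiv ℝ n y v‖ ^ 2 ≤ (C / ‖y‖) ^ 2 * (8 * G2 u v (s • hat y)) := by
  have hd : DifferentiableAt ℝ n ((1:ℝ) • hat y) := by
    rw [one_smul]
    exact (h.sm.contDiffAt (isOpen_compl_singleton.mem_nhds (hat_ne hy))).differentiableAt (by simp)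
  have e : n =ᶠ[𝓝 y] fun z => n ((1:ℝ) • hat z) := by
    filter_upwards [isOpen_compl_singleton.mem_nhds hy] with z hz
    have : 0 < ‖z‖⁻¹ := inv_pos.2 (norm_pos_iff.2 hz)
    rw [one_smul, hat, h.hom _ this]
  rw [e.fderiv_eq, fderiv_comp_hat hy hd, norm_smul, one_smul, one_mul, norm_inv, norm_norm]
  have hw := norm_hat hy
  have h1 := h.der _ hw (v - (inner ℝ (hat y) v : ℝ) • hat y)
  rw [perp_perp hw, zero_smul, sub_zero] at h1
  have hk : |(inner ℝ (hat y) v : ℝ)| ≤ 1 := by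
    have := abs_real_inner_le_norm (hat y) v
    rwa [hw, hv, one_mul] at this
  have h2 := fd_perp (fderiv ℝ u (s • hat y)) (v := v) (w := hat y) hs hk
  have h3 : ‖fderiv ℝ u (s • hat y) v‖^2 ≤ frobSq (dirD u v (s • hat y)) := by
    rw [← dirD_eq hu]; exact norm_sq_le_frob _
  have h4 : ‖fderiv ℝ u (s • hat y) (s • hat y)‖^2 ≤ frobSq (dirD u (s • hat y) (s • hat y)) := by
    rw [← dirD_eq hu]; exact norm_sq_le_frob _
  have h5 : ‖fderiv ℝ u (s • hat y) (v - (inner ℝ (hat y) v : ℝ) • hat y)‖^2 ≤ 8 * G2 u v (s • hat y) :=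
    h2.trans (mul_le_mul_of_nonneg_left (add_le_add h3 h4) (by norm_num))
  calc (‖y‖⁻¹ * ‖fderiv ℝ n (hat y) (v - (inner ℝ (hat y) v : ℝ) • hat y)‖) ^ 2 ≤ (‖y‖⁻¹ * (C * ‖fderiv ℝ u (s • hat y) (v - (inner ℝ (hat y) v : ℝ) • hat y)‖)) ^ 2 := by gcongr
    _ = (C / ‖y‖) ^ 2 * ‖fderiv ℝ u (s • hat y) (v - (inner ℝ (hat y) v : ℝ) • hat y)‖ ^ 2 := by field_simp
    _ ≤ _ := by gcongr

lemma cs_real {f : ℝ → ℝ} (hf : Continuous f) {a b : ℝ} (hab : a ≤ b) :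
    (∫ t in a..b, f t)^2 ≤ (b - a) * ∫ t in a..b, f t^2 := by
  rcases hab.eq_or_lt with rfl | hlt
  · simp
  have hpos : 0 < b - a := sub_pos.2 hlt
  set J := ∫ t in a..b, f t with hJ
  have h0 : 0 ≤ ∫ t in a..b, (f t - J / (b - a))^2 := intervalIntegral.integral_nonneg hab fun t _ => sq_nonneg _
  have e : ∫ t in a..b, (f t - J / (b - a))^2 = (∫ t in a..b, f t^2) - 2 * (J / (b-a)) * J + (b - a) * (J/(b-a))^2 := by
    have e1 : ∀ t, (f t - J / (b - a))^2 = f t^2 - 2 * (J / (b-a)) * f t + (J/(b-a))^2 := fun t => by ring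
    simp_rw [e1]
    rw [intervalIntegral.integral_add (Continuous.intervalIntegrable (by fun_prop) _ _) (Continuous.intervalIntegrable (by fun_prop) _ _),
      intervalIntegral.integral_sub (Continuous.intervalIntegrable (by fun_prop) _ _) (Continuous.intervalIntegrable (by fun_prop) _ _),
      intervalIntegral.integral_const_mul, ← hJ]
    simp
  rw [e] at h0
  have e2 : (∫ t in a..b, f t^2) - 2 * (J / (b-a)) * J + (b - a) * (J/(b-a))^2 = (∫ t in a..b, f t^2) - J^2 / (b-a) := by
    field_simp; ring
  rw [e2, sub_nonneg, div_le_iff₀ hpos] at h0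
  linarith

lemma cs1d {G G' : ℝ → E3} (hG : ∀ t, HasDerivAt G (G' t) t) (hc : Continuous G') {a b x y : ℝ} (hx : x ∈ Icc a b) (hy : y ∈ Icc a b) :
    ENNReal.ofReal (‖G x - G y‖^2) ≤ ENNReal.ofReal (b - a) * ∫⁻ t in Ioo a b, ENNReal.ofReal (‖G' t‖^2) := by
  have hab : a ≤ b := hx.1.trans hx.2
  have key : ∀ x y, x ∈ Icc a b → y ∈ Icc a b → y ≤ x → ‖G x - G y‖^2 ≤ (b - a) * ∫ t in a..b, ‖G' t‖^2 := by
    intro x y hx hy hxy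
    have h1 := intervalIntegral.integral_eq_sub_of_hasDerivAt (fun t _ => hG t) (hc.intervalIntegrable y x)
    have h2 : ‖G x - G y‖ ≤ ∫ t in y..x, ‖G' t‖ := by rw [← h1]; exact intervalIntegral.norm_integral_le_integral_norm hxy
    have h3 : ∫ t in y..x, ‖G' t‖ ≤ ∫ t in a..b, ‖G' t‖ :=
      intervalIntegral.integral_mono_interval hy.1 hxy hx.2 (Filter.Eventually.of_forall fun t => norm_nonneg _) (hc.norm.intervalIntegrable _ _)
    exact (pow_le_pow_left₀ (norm_nonneg _) (h2.trans h3) 2).trans (cs_real hc.norm hab)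
  have k2 : ‖G x - G y‖^2 ≤ (b - a) * ∫ t in a..b, ‖G' t‖^2 := by
    rcases le_total y x with h | h
    · exact key x y hx hy h
    · rw [norm_sub_rev]; exact key y x hy hx h
  refine (ENNReal.ofReal_le_ofReal k2).trans (le_of_eq ?_)
  rw [ENNReal.ofReal_mul (sub_nonneg.2 hab)]
  congr 1
  rw [intervalIntegral.integral_of_le hab, integral_Ioc_eq_integral_Ioo]
  refine ofReal_integral_eq_lintegral_ofReal ?_ (Filter.Eventually.of_forall fun t => sq_nonneg _)
  exact ((hc.norm.pow 2).integrableOn_Icc).mono_set Ioo_subset_Icc_self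

lemma qq_dt (b : OrthonormalBasis (Fin 3) ℝ E3) (θ t : ℝ) : HasDerivAt (fun t => qq b θ t) (b 2) t := by
  have := ((hasDerivAt_id t).smul_const (b 2)).const_add (Real.cos θ • b 0 + Real.sin θ • b 1)
  rw [one_smul] at this
  exact this

def qth (b : OrthonormalBasis (Fin 3) ℝ E3) (θ : ℝ) : E3 := (-Real.sin θ) • b 0 + Real.cos θ • b 1

lemma qq_dth (b : OrthonormalBasis (Fin 3) ℝ E3) (θ t : ℝ) : HasDerivAt (fun θ => qq b θ t) (qth b θ) θ :=
  (((Real.hasDerivAt_cos θ).smul_const (b 0)).add ((Real.hasDerivAt_sin θ).smul_const (b 1))).add_const (t • b 2)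

lemma qth_norm (b : OrthonormalBasis (Fin 3) ℝ E3) (θ : ℝ) : ‖qth b θ‖ = 1 := by
  have h := b.orthonormal
  have h00 : inner ℝ (b 0) (b 1) = 0 := h.2 (by decide)
  have : ‖qth b θ‖^2 = 1 := by
    rw [qth, norm_add_sq_real]
    simp only [inner_smul_left, inner_smul_right, h00, norm_smul, h.1, mul_pow]
    simp
  nlinarith [norm_nonneg (qth b θ)]

lemma n_comp_deriv {a b c C s : ℝ} {u : E3 → M3} {n : E3 → E3} (h : Lift a b c C s u n) {q : ℝ → E3} {q' : E3} {t : ℝ} (hq : HasDerivAt q q' t) (h0 : q t ≠ 0) :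
    HasDerivAt (fun t => n (q t)) (fderiv ℝ n (q t) q') t := by
  have hd : DifferentiableAt ℝ n (q t) :=
    (h.sm.contDiffAt (isOpen_compl_singleton.mem_nhds h0)).differentiableAt (by simp)
  exact hd.hasFDerivAt.comp_hasDerivAt t hq

lemma n_fd_cont {a b c C s : ℝ} {u : E3 → M3} {n : E3 → E3} (h : Lift a b c C s u n) {X : Type*} [TopologicalSpace X] {q v : X → E3} (hq : Continuous q) (hv : Continuous v)
    (h0 : ∀ x, q x ≠ 0) : Continuous fun x => fderiv ℝ n (q x) (v x) := by
  have h1 : ContinuousOn (fderiv ℝ n) {0}ᶜ := h.sm.continuousOn_fderiv_of_isOpen isOpen_compl_singleton (by simp)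
  exact (h1.comp_continuous hq h0).clm_apply hv

end Part28

section Part29

/-! ### P29: near-constancy of the lift -/

open scoped Topology ENNReal

lemma qq_one_le (b : OrthonormalBasis (Fin 3) ℝ E3) (θ t : ℝ) : 1 ≤ ‖qq b θ t‖ := by
  have := qq_normsq b θ t
  nlinarith [norm_nonneg (qq b θ t), sq_nonneg t]

lemma qq_le (b : OrthonormalBasis (Fin 3) ℝ E3) {θ t T : ℝ} (h : |t| ≤ T) : ‖qq b θ t‖ ≤ 1 + T := by
  have := qq_normsq b θ t
  have h2 : t^2 ≤ T^2 := sq_le_sq' (abs_le.1 h).1 (abs_le.1 h).2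
  have h3 : 0 ≤ T := (abs_nonneg t).trans h
  nlinarith [norm_nonneg (qq b θ t)]

lemma qq_ge (b : OrthonormalBasis (Fin 3) ℝ E3) (θ t : ℝ) : |t| ≤ ‖qq b θ t‖ := by
  have := qq_normsq b θ t
  exact abs_le_of_sq_le_sq (by linarith) (norm_nonneg _)

lemma div_arith {C R T G : ℝ} (hR : 1 ≤ R) (hRT : R ≤ 1 + T) (hG : 0 ≤ G) :
    (C / R)^2 * (8 * G) ≤ 8 * C^2 * (1 + T) * (R⁻¹^3 * G) := by
  have hR0 : 0 < R := by linarith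
  have e : (C / R)^2 * (8 * G) = 8 * C^2 * R * (R⁻¹^3 * G) := by field_simp
  rw [e]
  gcongr

lemma Ybound {a b c C s T : ℝ} {u : E3 → M3} {n : E3 → E3} (hu : ContDiff ℝ ∞ u) (h : Lift a b c C s u n) (hC : 0 < C) (hs : 1/2 ≤ s) (hT : 0 < T)
    (bs : OrthonormalBasis (Fin 3) ℝ E3) :
    ∫⁻ θ in Ioo (-Real.pi) Real.pi, ∫⁻ t in Ioo (-T) T, ENNReal.ofReal (‖fderiv ℝ n (qq bs θ t) (bs 2)‖^2) ≤
      ENNReal.ofReal (8 * C^2 * (1 + T)) * ∫⁻ w : Sph, ENNReal.ofReal (G2 u (bs 2) (s • (w:E3))) ∂sig := by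
  have hm : Measurable fun y : E3 => ENNReal.ofReal (G2 u (bs 2) (s • hat y)) :=
    ((G2_cont hu (bs 2)).measurable.comp (meas_hat.const_smul s)).ennreal_ofReal
  have e := sph_cyl bs hm (fun t ht y => by rw [hat_smul ht])
  have e1 : ∀ w : Sph, ENNReal.ofReal (G2 u (bs 2) (s • hat (w:E3))) = ENNReal.ofReal (G2 u (bs 2) (s • (w:E3))) := fun w => by
    rw [hat_unit (Sph_norm w)]
  simp_rw [e1] at e
  rw [e, ← lintegral_const_mul' _ _ ENNReal.ofReal_ne_top]
  refine lintegral_mono fun θ => ?_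
  rw [← lintegral_const_mul' _ _ ENNReal.ofReal_ne_top]
  refine le_trans ?_ (setLIntegral_le_lintegral (Ioo (-T) T) _)
  refine setLIntegral_mono' measurableSet_Ioo fun t ht => ?_
  have hR := qq_one_le bs θ t
  rw [← ENNReal.ofReal_mul (by positivity), ← ENNReal.ofReal_mul (by positivity)]
  refine ENNReal.ofReal_le_ofReal ((n_der2 hu h hC hs (qq_ne bs θ t) (bs.orthonormal.1 2)).trans ?_)
  exact div_arith hR (qq_le bs (abs_le.2 ⟨ht.1.le, ht.2.le⟩)) (G2_nonneg _ _ _)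

lemma log_int {T : ℝ} (hT : 0 < T) : ∫⁻ t in Ioo 0 T, ENNReal.ofReal ((1 + t)⁻¹) = ENNReal.ofReal (Real.log (1 + T)) := by
  have hc : ContinuousOn (fun t : ℝ => (1 + t)⁻¹) (Icc 0 T) :=
    (by fun_prop : ContinuousOn (fun t : ℝ => 1 + t) (Icc 0 T)).inv₀ fun t ht => by have := ht.1; positivity
  rw [← ofReal_integral_eq_lintegral_ofReal (hc.integrableOn_Icc.mono_set Ioo_subset_Icc_self)]
  · congr 1
    rw [← integral_Ioc_eq_integral_Ioo, ← intervalIntegral.integral_of_le hT.le]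
    have := intervalIntegral.integral_comp_add_left (a := 0) (b := T) (fun x : ℝ => x⁻¹) 1
    rw [this, integral_inv_of_pos (by norm_num) (by linarith)]
    congr 1; simp
  · filter_upwards [ae_restrict_mem measurableSet_Ioo] with t ht
    have := ht.1
    simp only [Pi.zero_apply]
    positivity

lemma div_arith2 {C R t G : ℝ} (hR : 1 ≤ R) (hRt : R ≤ 1 + t) (hG : 0 ≤ G) :
    (1 + t)⁻¹ * ((C / R)^2 * G) ≤ C^2 * (R⁻¹^3 * G) := by
  have hR0 : 0 < R := by linarith
  have e : C^2 * (R⁻¹^3 * G) = R⁻¹ * ((C / R)^2 * G) := by field_simp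
  rw [e]
  gcongr

lemma t0_exists {a b c C s T A : ℝ} {u : E3 → M3} {n : E3 → E3} (hu : ContDiff ℝ ∞ u) (h : Lift a b c C s u n) (hC : 0 < C) (hT : 0 < T)
    (bs : OrthonormalBasis (Fin 3) ℝ E3) (hA0 : 0 ≤ A) (hA : ∫⁻ w : Sph, ENNReal.ofReal (gradSq u (s • (w:E3))) ∂sig ≤ ENNReal.ofReal A) :
    ∃ t ∈ Ioo 0 T, ∫⁻ θ in Ioo (-Real.pi) Real.pi, ENNReal.ofReal (‖fderiv ℝ n (qq bs θ t) (qth bs θ)‖^2) ≤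
      ENNReal.ofReal ((C^2 * A + 1) / Real.log (1 + T)) := by
  by_contra! hcon
  have hL : 0 < Real.log (1 + T) := Real.log_pos (by linarith)
  have hm : Measurable fun y : E3 => ENNReal.ofReal (gradSq u (s • hat y)) :=
    ((sm_gradSq hu).continuous.measurable.comp (meas_hat.const_smul s)).ennreal_ofReal
  have e := sph_cyl bs hm (fun t ht y => by rw [hat_smul ht])
  have e1 : ∀ w : Sph, ENNReal.ofReal (gradSq u (s • hat (w:E3))) = ENNReal.ofReal (gradSq u (s • (w:E3))) := fun w => by
    rw [hat_unit (Sph_norm w)]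
  simp_rw [e1] at e
  have mq : Measurable fun p : ℝ × ℝ => qq bs p.1 p.2 := (qq_cont bs).measurable
  rw [lintegral_lintegral_swap] at e
  swap
  · exact ((mq.norm.inv.pow_const 3).ennreal_ofReal.mul (hm.comp mq)).aemeasurable
  have k : ENNReal.ofReal (C^2 * A + 1) ≤ ENNReal.ofReal (C^2) * ∫⁻ w : Sph, ENNReal.ofReal (gradSq u (s • (w:E3))) ∂sig := by
    rw [e, ← lintegral_const_mul' _ _ ENNReal.ofReal_ne_top]
    refine le_trans ?_ (setLIntegral_le_lintegral (Ioo 0 T) _)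
    have e3 : ENNReal.ofReal (C^2 * A + 1) = ∫⁻ t in Ioo 0 T, ENNReal.ofReal ((1 + t)⁻¹) * ENNReal.ofReal ((C^2 * A + 1) / Real.log (1 + T)) := by
      rw [lintegral_mul_const _ (by fun_prop), log_int hT, ← ENNReal.ofReal_mul hL.le]
      congr 1; field_simp
    rw [e3]
    refine setLIntegral_mono' measurableSet_Ioo fun t ht => ?_
    refine (mul_le_mul_right (hcon t ht).le _).trans ?_
    rw [← lintegral_const_mul' _ _ ENNReal.ofReal_ne_top, ← lintegral_const_mul' _ _ ENNReal.ofReal_ne_top]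
    refine lintegral_mono fun θ => ?_
    have hR := qq_one_le bs θ t
    have ht0 := ht.1
    rw [← ENNReal.ofReal_mul (by positivity), ← ENNReal.ofReal_mul (by positivity), ← ENNReal.ofReal_mul (by positivity)]
    refine ENNReal.ofReal_le_ofReal ?_
    refine le_trans (mul_le_mul_of_nonneg_left (n_der hu h hC (qq_ne bs θ t) (qth_norm bs θ)) (by positivity)) ?_
    exact div_arith2 hR (qq_le bs (by rw [abs_of_pos ht0])) (gradSq_nonneg _ _)
  have k2 := k.trans (mul_le_mul_right hA _)
  rw [← ENNReal.ofReal_mul (by positivity), ENNReal.ofReal_le_ofReal_iff (by positivity)] at k2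
  linarith

lemma psi_int : ∫⁻ t : ℝ, ENNReal.ofReal ((1 + t^2)⁻¹) = ENNReal.ofReal Real.pi := by
  rw [← ofReal_integral_eq_lintegral_ofReal integrable_inv_one_add_sq (Filter.Eventually.of_forall fun t => by positivity), integral_univ_inv_one_add_sq]

lemma sq_tri (x y z : E3) : ‖x - z‖^2 ≤ 2 * ‖x - y‖^2 + 2 * ‖y - z‖^2 := by
  have h : ‖x - z‖ ≤ ‖x - y‖ + ‖y - z‖ := norm_sub_le_norm_sub_add_norm_sub _ _ _
  nlinarith [norm_nonneg (x - z), sq_nonneg (‖x - y‖ - ‖y - z‖)]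

lemma four_sq {x y : E3} (hx : ‖x‖ = 1) (hy : ‖y‖ = 1) : ‖x - y‖^2 ≤ 4 := by
  have := norm_sub_le x y
  nlinarith [norm_nonneg (x - y)]

lemma R_arith1 {R t : ℝ} (hR : 1 ≤ R) (h : R^2 = 1 + t^2) : R⁻¹^3 ≤ (1 + t^2)⁻¹ := by
  have hR0 : 0 < R := by linarith
  rw [← h, ← inv_pow]
  exact pow_le_pow_of_le_one (by positivity) (inv_le_one_of_one_le₀ hR) (by norm_num)

lemma R_arith2 {R t T : ℝ} (hT : 0 < T) (hR : T ≤ R) (h : R^2 = 1 + t^2) : R⁻¹^3 * 4 ≤ 4 / T * (1 + t^2)⁻¹ := by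
  have hR0 : 0 < R := by linarith
  rw [← h]
  have e : R⁻¹^3 * 4 = 4 / R * (R^2)⁻¹ := by field_simp
  rw [e]; gcongr

def YY (n : E3 → E3) (bs : OrthonormalBasis (Fin 3) ℝ E3) (T θ : ℝ) : ℝ≥0∞ :=
  ∫⁻ t in Ioo (-T) T, ENNReal.ofReal (‖fderiv ℝ n (qq bs θ t) (bs 2)‖^2)

lemma near_p1 {a b c C s T κ t0 : ℝ} {u : E3 → M3} {n : E3 → E3} (h : Lift a b c C s u n)
    (bs : OrthonormalBasis (Fin 3) ℝ E3) (ht0 : t0 ∈ Ioo 0 T)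
    (hO : ∫⁻ θ in Ioo (-Real.pi) Real.pi, ENNReal.ofReal (‖fderiv ℝ n (qq bs θ t0) (qth bs θ)‖^2) ≤ ENNReal.ofReal κ)
    {θ : ℝ} (hθ : θ ∈ Ioo (-Real.pi) Real.pi) {t : ℝ} (ht : t ∈ Ioo (-T) T) :
    ENNReal.ofReal (‖n (qq bs θ t) - n (qq bs 0 t0)‖^2) ≤ ENNReal.ofReal (4 * T) * YY n bs T θ + ENNReal.ofReal (4 * Real.pi * κ) := by
  have hpi := Real.pi_pos
  have hcq : ∀ θ, Continuous fun t => qq bs θ t := fun θ => by unfold qq; fun_prop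
  have hcq2 : ∀ t, Continuous fun θ => qq bs θ t := fun t => by unfold qq; fun_prop
  have hcth : Continuous (qth bs) := by unfold qth; fun_prop
  have c1 : ENNReal.ofReal (‖n (qq bs θ t) - n (qq bs θ t0)‖^2) ≤ ENNReal.ofReal (T - -T) * YY n bs T θ :=
    cs1d (G := fun t => n (qq bs θ t)) (fun t => n_comp_deriv h (qq_dt bs θ t) (qq_ne bs θ t))
      (n_fd_cont h (hcq θ) continuous_const (fun t => qq_ne bs θ t)) (a := -T) (b := T) (x := t) (y := t0)
      ⟨ht.1.le, ht.2.le⟩ ⟨by linarith [ht0.1, ht0.2], ht0.2.le⟩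
  have c2 := cs1d (G := fun θ => n (qq bs θ t0)) (fun θ => n_comp_deriv h (qq_dth bs θ t0) (qq_ne bs θ t0))
      (n_fd_cont h (hcq2 t0) hcth (fun θ => qq_ne bs θ t0)) (a := -Real.pi) (b := Real.pi) (x := θ) (y := 0)
      ⟨hθ.1.le, hθ.2.le⟩ ⟨by linarith, by linarith⟩
  have c3 : ENNReal.ofReal (‖n (qq bs θ t0) - n (qq bs 0 t0)‖^2) ≤ ENNReal.ofReal (Real.pi - -Real.pi) * ENNReal.ofReal κ := c2.trans (mul_le_mul_right hO _)
  refine (ENNReal.ofReal_le_ofReal (sq_tri _ (n (qq bs θ t0)) _)).trans ?_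
  rw [ENNReal.ofReal_add (by positivity) (by positivity), ENNReal.ofReal_mul (by norm_num), ENNReal.ofReal_mul (by norm_num)]
  refine add_le_add ((mul_le_mul_right c1 _).trans (le_of_eq ?_)) ((mul_le_mul_right c3 _).trans (le_of_eq ?_))
  · rw [← mul_assoc, ← ENNReal.ofReal_mul (by norm_num)]
    congr 2; ring
  · rw [← mul_assoc, ← ENNReal.ofReal_mul (by norm_num), ← ENNReal.ofReal_mul (by linarith)]
    congr 1; ring

lemma near_p2 {a b c C s T t0 : ℝ} {u : E3 → M3} {n : E3 → E3} (h : Lift a b c C s u n)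
    (bs : OrthonormalBasis (Fin 3) ℝ E3) (hT : 0 < T) {X : ℝ≥0∞} {θ : ℝ}
    (p1 : ∀ t ∈ Ioo (-T) T, ENNReal.ofReal (‖n (qq bs θ t) - n (qq bs 0 t0)‖^2) ≤ X) (t : ℝ) :
    ENNReal.ofReal (‖qq bs θ t‖⁻¹^3) * ENNReal.ofReal (‖n (qq bs θ t) - n (qq bs 0 t0)‖^2) ≤
      ENNReal.ofReal ((1 + t^2)⁻¹) * (X + ENNReal.ofReal (4 / T)) := by
  by_cases ht : t ∈ Ioo (-T) T
  · exact mul_le_mul' (ENNReal.ofReal_le_ofReal (R_arith1 (qq_one_le bs θ t) (qq_normsq bs θ t))) ((p1 t ht).trans le_self_add)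
  · have ht' : T ≤ |t| := by
      by_contra! hh
      exact ht ⟨(abs_lt.1 hh).1, (abs_lt.1 hh).2⟩
    rw [mul_add]
    refine le_trans ?_ le_add_self
    refine (mul_le_mul_right (ENNReal.ofReal_le_ofReal (four_sq (h.unit _ (qq_ne bs θ t)) (h.unit _ (qq_ne bs 0 t0)))) _).trans ?_
    rw [← ENNReal.ofReal_mul (by positivity), ← ENNReal.ofReal_mul (by positivity), mul_comm (1 + t^2)⁻¹]
    exact ENNReal.ofReal_le_ofReal (R_arith2 hT (ht'.trans (qq_ge bs θ t)) (qq_normsq bs θ t))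

lemma near_int {T κ : ℝ} (hT : 0 < T) (hκ : 0 ≤ κ) (Y : ℝ → ℝ≥0∞) :
    (∫⁻ θ in Ioo (-Real.pi) Real.pi, ENNReal.ofReal Real.pi * (ENNReal.ofReal (4 * T) * Y θ + ENNReal.ofReal (4 * Real.pi * κ) + ENNReal.ofReal (4 / T))) =
      ENNReal.ofReal (Real.pi * (4 * T)) * (∫⁻ θ in Ioo (-Real.pi) Real.pi, Y θ) + ENNReal.ofReal (8 * Real.pi^3 * κ + 8 * Real.pi^2 / T) := by
  have hpi := Real.pi_pos
  rw [lintegral_const_mul' _ _ ENNReal.ofReal_ne_top]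
  simp only [add_assoc]
  rw [lintegral_add_right _ measurable_const, lintegral_const_mul' _ _ ENNReal.ofReal_ne_top, lintegral_const, mul_add, ← mul_assoc,
    ← ENNReal.ofReal_mul hpi.le, Measure.restrict_apply_univ, Real.volume_Ioo,
    ← ENNReal.ofReal_add (by positivity) (by positivity), ← ENNReal.ofReal_mul (by positivity), ← ENNReal.ofReal_mul hpi.le]
  congr 2; ring

lemma near_enn {a b c C s T A : ℝ} {u : E3 → M3} {n : E3 → E3} (hu : ContDiff ℝ ∞ u) (h : Lift a b c C s u n) (hC : 0 < C) (hs : 1/2 ≤ s) (hT : 0 < T)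
    (bs : OrthonormalBasis (Fin 3) ℝ E3) (hA0 : 0 ≤ A) (hA : ∫⁻ w : Sph, ENNReal.ofReal (gradSq u (s • (w:E3))) ∂sig ≤ ENNReal.ofReal A) :
    ∃ nb : E3, ‖nb‖ = 1 ∧ ∫⁻ w : Sph, ENNReal.ofReal (‖n w - nb‖^2) ∂sig ≤
      ENNReal.ofReal (Real.pi * (4 * T) * (8 * C^2 * (1 + T))) * (∫⁻ w : Sph, ENNReal.ofReal (G2 u (bs 2) (s • (w:E3))) ∂sig) +
      ENNReal.ofReal (8 * Real.pi^3 * ((C^2 * A + 1) / Real.log (1 + T)) + 8 * Real.pi^2 / T) := by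
  obtain ⟨t0, ht0, hO⟩ := t0_exists hu h hC hT bs hA0 hA
  have hpi := Real.pi_pos
  have hL : 0 < Real.log (1 + T) := Real.log_pos (by linarith)
  have hκ0 : 0 ≤ (C^2 * A + 1) / Real.log (1 + T) := by positivity
  refine ⟨n (qq bs 0 t0), h.unit _ (qq_ne _ _ _), ?_⟩
  have hm : Measurable fun y : E3 => ENNReal.ofReal (‖n y - n (qq bs 0 t0)‖^2) := ((h.meas.sub_const (n (qq bs 0 t0))).norm.pow_const 2).ennreal_ofReal
  rw [sph_cyl bs hm (fun t ht y => by rw [h.hom t ht])]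
  have hY : ∫⁻ θ in Ioo (-Real.pi) Real.pi, YY n bs T θ ≤ _ := Ybound hu h hC hs hT bs
  have hY2 := mul_le_mul_right hY (ENNReal.ofReal (Real.pi * (4 * T)))
  rw [← mul_assoc (ENNReal.ofReal (Real.pi * (4 * T))), ← ENNReal.ofReal_mul (by positivity)] at hY2
  refine le_trans ?_ (add_le_add hY2 le_rfl)
  rw [← near_int hT hκ0]
  refine setLIntegral_mono' measurableSet_Ioo fun θ hθ => ?_
  refine (lintegral_mono (near_p2 h bs hT (fun t ht => near_p1 h bs ht0 hO hθ ht))).trans (le_of_eq ?_)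
  rw [lintegral_mul_const _ (by fun_prop), psi_int]

lemma near_const {a b c C s T : ℝ} {u : E3 → M3} {n : E3 → E3} (hu : ContDiff ℝ ∞ u) (h : Lift a b c C s u n) (hC : 0 < C) (hs : 1/2 ≤ s) (hT : 0 < T)
    {v : E3} (hv : ‖v‖ = 1) :
    ∃ nb : E3, ‖nb‖ ≤ 1 ∧ ∫ w : Sph, ‖n w - nb‖^2 ∂sig ≤
      Real.pi * (4 * T) * (8 * C^2 * (1 + T)) * (∫ w : Sph, G2 u v (s • (w:E3)) ∂sig) +
      (8 * Real.pi^3 * ((C^2 * (∫ w : Sph, gradSq u (s • (w:E3)) ∂sig) + 1) / Real.log (1 + T)) + 8 * Real.pi^2 / T) := by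
  obtain ⟨bs, rfl⟩ := exists_onb hv
  have hpi := Real.pi_pos
  have hL : 0 < Real.log (1 + T) := Real.log_pos (by linarith)
  have iA : Integrable (fun w : Sph => gradSq u (s • (w:E3))) sig := sph_int ((sm_gradSq hu).continuous.comp (by fun_prop))
  have iD : Integrable (fun w : Sph => G2 u (bs 2) (s • (w:E3))) sig := sph_int ((G2_cont hu (bs 2)).comp (by fun_prop))
  have hA0 : 0 ≤ ∫ w : Sph, gradSq u (s • (w:E3)) ∂sig := integral_nonneg fun w => gradSq_nonneg _ _
  have hD0 : 0 ≤ ∫ w : Sph, G2 u (bs 2) (s • (w:E3)) ∂sig := integral_nonneg fun w => G2_nonneg _ _ _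
  obtain ⟨nb, hnb, hh⟩ := near_enn hu h hC hs hT bs hA0 (ofReal_integral_eq_lintegral_ofReal iA (Filter.Eventually.of_forall fun w => gradSq_nonneg _ _)).ge
  refine ⟨nb, hnb.le, ?_⟩
  have iB : Integrable (fun w : Sph => ‖n w - nb‖^2) sig := sph_int (((Hd_cont h).sub continuous_const).norm.pow 2)
  rw [← ofReal_integral_eq_lintegral_ofReal iB (Filter.Eventually.of_forall fun w => sq_nonneg _),
    ← ofReal_integral_eq_lintegral_ofReal iD (Filter.Eventually.of_forall fun w => G2_nonneg _ _ _),
    ← ENNReal.ofReal_mul (by positivity), ← ENNReal.ofReal_add (by positivity) (by positivity),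
    ENNReal.ofReal_le_ofReal_iff (by positivity)] at hh
  exact hh

end Part29

section Part30

/-! ### P30: assembling the small energy estimate -/

open scoped Topology ENNReal

lemma avg_exists {Φ : ℝ → ℝ} (hc : Continuous Φ) (h : ∫ s in (3/4:ℝ)..1, Φ s ≤ 3) : ∃ s ∈ Icc (3/4:ℝ) 1, Φ s ≤ 13 := by
  by_contra! hcon
  have h1 : ∫ s in (3/4:ℝ)..1, (13:ℝ) ≤ ∫ s in (3/4:ℝ)..1, Φ s :=
    intervalIntegral.integral_mono_on (by norm_num) (by simp) (hc.intervalIntegrable _ _) fun s hs => (hcon s hs).le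
  rw [intervalIntegral.integral_const, smul_eq_mul] at h1
  norm_num at h1
  linarith

lemma exists_T (K L κ : ℝ) (hκ : 0 < κ) : ∃ T : ℝ, 0 < T ∧ K / Real.log (1 + T) + L / T ≤ κ := by
  have h1 : Filter.Tendsto (fun T : ℝ => K / Real.log (1 + T)) Filter.atTop (𝓝 0) :=
    (Real.tendsto_log_atTop.comp (Filter.tendsto_atTop_add_const_left _ 1 Filter.tendsto_id)).const_div_atTop K
  have h2 : Filter.Tendsto (fun T : ℝ => L / T) Filter.atTop (𝓝 0) := Filter.tendsto_id.const_div_atTop L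
  have h3 := h1.add h2
  rw [add_zero] at h3
  obtain ⟨T, hT, hT0⟩ := ((h3.eventually (gt_mem_nhds hκ)).and (Filter.eventually_gt_atTop 0)).exists
  exact ⟨T, hT0, hT.le⟩

lemma good_radius {a b c ε M M' η : ℝ} (ha : 0 ≤ a) (hb : 0 < b) (hc : 0 < c) (hε : 0 < ε) (hM' : 0 < M') (hη : 0 < η) {u : E3 → M3} (h : Sol a b c M ε u) (v : E3)
    (hF : ∫ y in ball (0:E3) 1, fbulk a b c (u y) ≤ η * ε^2) (hE : ∫ y in ball (0:E3) 1, gradSq u y ≤ 2 * M')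
    (hD : ∫ y in ball (0:E3) 1, G2 u v y ≤ 2 * η) :
    ∃ s ∈ Icc (3/4:ℝ) 1, ∫ w : Sph, fbulk a b c (u (s • (w:E3))) ∂sig ≤ 26 * η * ε^2 ∧
      ∫ w : Sph, gradSq u (s • (w:E3)) ∂sig ≤ 52 * M' ∧ ∫ w : Sph, G2 u v (s • (w:E3)) ∂sig ≤ 52 * η := by
  have cF : Continuous fun y => fbulk a b c (u y) := (sm_fbulk a b c h.sm h.s0).continuous
  have cA : Continuous (gradSq u) := (sm_gradSq h.sm).continuous
  have cD := G2_cont h.sm v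
  have nF : ∀ y, 0 ≤ fbulk a b c (u y) := fun y => fbulk_nonneg ha hb hc (h.s0 y)
  have rF := rad_int cF nF (p := 3/4) (q := 1) (κ := 2) (by norm_num) (by norm_num) (by norm_num) (by norm_num)
  have rA := rad_int cA (gradSq_nonneg u) (p := 3/4) (q := 1) (κ := 2) (by norm_num) (by norm_num) (by norm_num) (by norm_num)
  have rD := rad_int cD (G2_nonneg u v) (p := 3/4) (q := 1) (κ := 2) (by norm_num) (by norm_num) (by norm_num) (by norm_num)
  have sF := sph_cont cF
  have sA := sph_cont cA
  have sD := sph_cont cD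
  have e2 : 0 < ε^2 := by positivity
  obtain ⟨s, hs, hΦ⟩ := avg_exists (Φ := fun s => (2 * η * ε^2)⁻¹ * (∫ w : Sph, fbulk a b c (u (s • (w:E3))) ∂sig) + (4 * M')⁻¹ * (∫ w : Sph, gradSq u (s • (w:E3)) ∂sig)
      + (4 * η)⁻¹ * (∫ w : Sph, G2 u v (s • (w:E3)) ∂sig)) (by fun_prop) (by
    rw [intervalIntegral.integral_add (Continuous.intervalIntegrable (by fun_prop) _ _) (Continuous.intervalIntegrable (by fun_prop) _ _),
      intervalIntegral.integral_add (Continuous.intervalIntegrable (by fun_prop) _ _) (Continuous.intervalIntegrable (by fun_prop) _ _),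
      intervalIntegral.integral_const_mul, intervalIntegral.integral_const_mul, intervalIntegral.integral_const_mul]
    have x1 : (2 * η * ε^2)⁻¹ * (∫ s in (3/4:ℝ)..1, ∫ w : Sph, fbulk a b c (u (s • (w:E3))) ∂sig) ≤ 1 := by
      rw [inv_mul_le_iff₀ (by positivity)]; linarith
    have x2 : (4 * M')⁻¹ * (∫ s in (3/4:ℝ)..1, ∫ w : Sph, gradSq u (s • (w:E3)) ∂sig) ≤ 1 := by
      rw [inv_mul_le_iff₀ (by positivity)]; linarith
    have x3 : (4 * η)⁻¹ * (∫ s in (3/4:ℝ)..1, ∫ w : Sph, G2 u v (s • (w:E3)) ∂sig) ≤ 1 := by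
      rw [inv_mul_le_iff₀ (by positivity)]; linarith
    linarith)
  have y1 : 0 ≤ (2 * η * ε^2)⁻¹ * (∫ w : Sph, fbulk a b c (u (s • (w:E3))) ∂sig) := mul_nonneg (by positivity) (integral_nonneg fun w => nF _)
  have y2 : 0 ≤ (4 * M')⁻¹ * (∫ w : Sph, gradSq u (s • (w:E3)) ∂sig) := mul_nonneg (by positivity) (integral_nonneg fun w => gradSq_nonneg _ _)
  have y3 : 0 ≤ (4 * η)⁻¹ * (∫ w : Sph, G2 u v (s • (w:E3)) ∂sig) := mul_nonneg (by positivity) (integral_nonneg fun w => G2_nonneg _ _ _)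
  have z1 : (2 * η * ε^2)⁻¹ * (∫ w : Sph, fbulk a b c (u (s • (w:E3))) ∂sig) ≤ 13 := by linarith
  have z2 : (4 * M')⁻¹ * (∫ w : Sph, gradSq u (s • (w:E3)) ∂sig) ≤ 13 := by linarith
  have z3 : (4 * η)⁻¹ * (∫ w : Sph, G2 u v (s • (w:E3)) ∂sig) ≤ 13 := by linarith
  rw [inv_mul_le_iff₀ (by positivity)] at z1 z2 z3
  exact ⟨s, hs, by linarith, by linarith, by linarith⟩

lemma core_arith {C lam A A0 B ε F η τ K L : ℝ} (hC : 0 < C) (hl : 0 < lam) (hε : 0 < ε) (hε1 : ε ≤ 1) (hη : 0 < η)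
    (hA : A ≤ A0) (hB : B ≤ K * (52 * η) + L) (hF0 : 0 ≤ F) (hF : F ≤ 26 * η * ε^2)
    (h1 : C * (lam * (1 + A0)) ≤ τ / 3) (h2 : C * (lam⁻¹ * L) ≤ τ / 3) (h3 : C * ((lam⁻¹ * K * 52 + (lam + lam⁻¹) * 26) * η) ≤ τ / 3) :
    C * (lam * (1 + A) + lam⁻¹ * B + (lam * (1/ε^2) + lam⁻¹) * F) ≤ τ := by
  have hli : 0 < lam⁻¹ := inv_pos.2 hl
  have e1 : lam * (1 + A) ≤ lam * (1 + A0) := by gcongr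
  have e2 : lam⁻¹ * B ≤ lam⁻¹ * (K * (52 * η) + L) := by gcongr
  have e3 : (lam * (1/ε^2) + lam⁻¹) * F ≤ (lam + lam⁻¹) * 26 * η := by
    have hx : ε^2 ≤ 1 := pow_le_one₀ hε.le hε1
    calc (lam * (1/ε^2) + lam⁻¹) * F ≤ (lam * (1/ε^2) + lam⁻¹) * (26 * η * ε^2) := by gcongr
      _ = (lam + lam⁻¹ * ε^2) * 26 * η := by field_simp
      _ ≤ (lam + lam⁻¹ * 1) * 26 * η := by gcongr
      _ = _ := by ring
  have e4 : C * (lam * (1 + A) + lam⁻¹ * B + (lam * (1/ε^2) + lam⁻¹) * F) ≤ C * (lam * (1 + A0) + lam⁻¹ * (K * (52 * η) + L) + (lam + lam⁻¹) * 26 * η) := by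
    gcongr
  refine e4.trans ?_
  nlinarith

set_option maxHeartbeats 600000 in
lemma core {a b c M : ℝ} {φ : ℝ → ℝ} (ha : 0 ≤ a) (hb : 0 < b) (hc : 0 < c) (hφ : AdmissibleCutoff φ) (hM : 0 < M) :
    ∃ η > 0, ∀ ε : ℝ, 0 < ε → ε ≤ 1/4 → ∀ u : E3 → M3, Sol a b c M ε u → ∀ v : E3, ‖v‖ = 1 →
      ∫ y in ball (0:E3) (7/5), (1 / ε^2 * fbulk a b c (u y) + frobSq (dirD u y y)) ≤ η →
      ∫ y in ball (0:E3) 1, frobSq (dirD u v y) ≤ η → ∀ x ∈ ball (0:E3) (1/2), eDen a b c ε u x ≤ 4 := by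
  obtain ⟨τ, hτ, hreg⟩ := eps_reg ha hb hc hφ M hM.le
  obtain ⟨thr, hthr, hthr1, C1, hC1, hlift⟩ := good_lift ha hb hc hφ hM
  obtain ⟨C, hC, hcomp⟩ := comp_energy (C1 := C1) (M := M) ha hb hc hC1 hM
  obtain ⟨η0, hη0, M', hM', hbound⟩ := energy_bound ha hb hc hφ hM
  obtain ⟨lam, hl, hl2, hl3⟩ : ∃ lam : ℝ, 0 < lam ∧ lam ≤ 1/2 ∧ C * (lam * (1 + 52 * M')) ≤ τ / 3 := by
    have hp : 0 < τ / 3 / (C * (1 + 52 * M')) := by positivity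
    refine ⟨min (1/2) (τ / 3 / (C * (1 + 52 * M'))), lt_min (by norm_num) hp, min_le_left _ _, ?_⟩
    have := min_le_right (1/2) (τ / 3 / (C * (1 + 52 * M')))
    rw [le_div_iff₀ (by positivity)] at this
    linarith
  have hli : 0 < lam⁻¹ := inv_pos.2 hl
  have hpi := Real.pi_pos
  obtain ⟨T, hT, hTL⟩ := exists_T (8 * Real.pi^3 * (C1^2 * (52 * M') + 1)) (8 * Real.pi^2) (τ / 3 / (C * lam⁻¹)) (by positivity)
  rw [le_div_iff₀ (by positivity)] at hTL
  have hL : 0 < Real.log (1 + T) := Real.log_pos (by linarith)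
  obtain ⟨K, hK⟩ : ∃ K, K = Real.pi * (4 * T) * (8 * C1^2 * (1 + T)) := ⟨_, rfl⟩
  have hK0 : 0 < K := by rw [hK]; positivity
  obtain ⟨η, hη, hη1, hη2, hη3⟩ : ∃ η : ℝ, 0 < η ∧ η ≤ η0 ∧ 26 * η ≤ thr ∧ C * ((lam⁻¹ * K * 52 + (lam + lam⁻¹) * 26) * η) ≤ τ / 3 := by
    have hp : 0 < τ / 3 / (C * (lam⁻¹ * K * 52 + (lam + lam⁻¹) * 26)) := by positivity
    refine ⟨min (min η0 (thr / 26)) (τ / 3 / (C * (lam⁻¹ * K * 52 + (lam + lam⁻¹) * 26))), lt_min (lt_min hη0 (by positivity)) hp, (min_le_left _ _).trans (min_le_left _ _), ?_, ?_⟩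
    · have := (min_le_left (min η0 (thr / 26)) (τ / 3 / (C * (lam⁻¹ * K * 52 + (lam + lam⁻¹) * 26)))).trans (min_le_right _ _)
      linarith
    · have := min_le_right (min η0 (thr / 26)) (τ / 3 / (C * (lam⁻¹ * K * 52 + (lam + lam⁻¹) * 26)))
      rw [le_div_iff₀ (by positivity)] at this
      linarith
  refine ⟨η, hη, fun ε hε hε4 u h v hv hP hV => ?_⟩
  have e2 : 0 < ε^2 := by positivity
  have cF : Continuous fun y => fbulk a b c (u y) := (sm_fbulk a b c h.sm h.s0).continuous
  have cA : Continuous (gradSq u) := (sm_gradSq h.sm).continuous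
  have cE : Continuous (eDen a b c ε u) := (sm_eDen a b c ε h.sm h.s0).continuous
  have cR : Continuous fun y => frobSq (dirD u y y) := cont_dirD h.sm continuous_id continuous_id
  have cV : Continuous fun y => frobSq (dirD u v y) := cont_dirD h.sm continuous_const continuous_id
  have nF : ∀ y, 0 ≤ fbulk a b c (u y) := fun y => fbulk_nonneg ha hb hc (h.s0 y)
  have nE : ∀ y, 0 ≤ eDen a b c ε u y := fun y => eDen_nonneg ha hb hc ε (h.s0 y)
  have cF' : Continuous fun y => 1 / ε^2 * fbulk a b c (u y) := continuous_const.mul cF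
  rw [integral_add (intOn_ball cF' 0 _) (intOn_ball cR 0 _), integral_const_mul] at hP
  have nR := integral_nonneg (μ := volume.restrict (ball (0:E3) (7/5))) (f := fun y => frobSq (dirD u y y)) (fun y => frobSq_nonneg _)
  have nF75 := integral_nonneg (μ := volume.restrict (ball (0:E3) (7/5))) (f := fun y => fbulk a b c (u y)) nF
  have hF75 : ∫ y in ball (0:E3) (7/5), fbulk a b c (u y) ≤ η * ε^2 := by
    have : 1 / ε^2 * ∫ y in ball (0:E3) (7/5), fbulk a b c (u y) ≤ η := by linarith
    rw [one_div, inv_mul_le_iff₀ e2] at this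
    linarith
  have hR75 : ∫ y in ball (0:E3) (7/5), frobSq (dirD u y y) ≤ η := by
    have : 0 ≤ 1 / ε^2 * ∫ y in ball (0:E3) (7/5), fbulk a b c (u y) := by positivity
    linarith
  have mono : ∀ {g : E3 → ℝ} {p q : ℝ}, Continuous g → (∀ y, 0 ≤ g y) → p ≤ q → ∫ y in ball (0:E3) p, g y ≤ ∫ y in ball (0:E3) q, g y := fun {g p q} hg h0 hpq =>
    setIntegral_mono_set (intOn_ball hg 0 _) (Filter.Eventually.of_forall h0) (ball_subset_ball hpq).eventuallyLE
  have hE1 := hbound ε hε hε4 u h (hF75.trans (by gcongr))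
  have hG1 : ∫ y in ball (0:E3) 1, gradSq u y ≤ 2 * M' := by
    have : ∫ y in ball (0:E3) 1, gradSq u y ≤ ∫ y in ball (0:E3) 1, 2 * eDen a b c ε u y := by
      refine integral_mono (intOn_ball cA 0 _) (intOn_ball (g := fun y => 2 * eDen a b c ε u y) (continuous_const.mul cE) 0 _) fun y => ?_
      have : 0 ≤ 1 / ε^2 * fbulk a b c (u y) := mul_nonneg (by positivity) (nF y)
      simp only [eDen]; linarith
    rw [integral_const_mul] at this
    linarith
  have hD1 : ∫ y in ball (0:E3) 1, G2 u v y ≤ 2 * η := by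
    have e : ∫ y in ball (0:E3) 1, G2 u v y = (∫ y in ball (0:E3) 1, frobSq (dirD u v y)) + ∫ y in ball (0:E3) 1, frobSq (dirD u y y) :=
      integral_add (intOn_ball cV 0 _) (intOn_ball cR 0 _)
    have := mono (p := 1) (q := 7/5) cR (fun y => frobSq_nonneg _) (by norm_num)
    rw [e]; linarith
  obtain ⟨s, hs, sF, sA, sD⟩ := good_radius ha hb hc hε hM' hη h v ((mono (p := 1) (q := 7/5) cF nF (by norm_num)).trans hF75) hG1 hD1
  have hs2 : 1/2 ≤ s := by linarith [hs.1]
  obtain ⟨n, hn⟩ := hlift ε hε hε4 u h s hs2 (by linarith [hs.2]) (sF.trans (by gcongr))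
  obtain ⟨nb, hnb, hB⟩ := near_const h.sm hn hC1 hs2 hT hv
  have hc1 := hcomp ε hε (by linarith) u h s lam nb n hs2 (by linarith [hs.2]) hn hnb hl hl2
  have hB2 : ∫ w : Sph, ‖n w - nb‖^2 ∂sig ≤ K * (52 * η) + (8 * Real.pi^3 * (C1^2 * (52 * M') + 1) / Real.log (1 + T) + 8 * Real.pi^2 / T) := by
    refine hB.trans ?_
    rw [← hK, mul_div_assoc (8 * Real.pi^3) (C1^2 * (52 * M') + 1)]
    gcongr
  have fin := hc1.trans (core_arith hC hl hε (by linarith) hη sA hB2 (integral_nonneg fun w => nF _) sF hl3 (by linarith) hη3)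
  exact hreg ε hε u h ((mono cE nE hs.1).trans fin)

end Part30

section Part31

/-! ### P31: rescaling to the unit scale -/

open scoped Topology ENNReal

lemma pd_rescale (Q : E3 → M3) (x : E3) (r : ℝ) (k : Fin 3) (y : E3) :
    pd (fun y => Q (x + r • y)) k y = r • pd Q k (x + r • y) := by
  ext i j
  have h1 := fderiv_comp_smul (𝕜 := ℝ) (f := fun z : E3 => Q (x + z) i j) (x := y) r
  have h2 := fderiv_comp_add_left (𝕜 := ℝ) (f := fun z : E3 => Q z i j) (x := r • y) x
  simp only [pd, Matrix.of_apply, Matrix.smul_apply]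
  rw [h1, h2]
  rfl

lemma dirD_rescale (Q : E3 → M3) (x : E3) (r : ℝ) (v y : E3) :
    dirD (fun y => Q (x + r • y)) v y = r • dirD Q v (x + r • y) := by
  simp only [dirD, pd_rescale, Finset.smul_sum, smul_comm r]

lemma dirD_congr {A B : E3 → M3} {x : E3} (h : A =ᶠ[nhds x] B) (v : E3) : dirD A v x = dirD B v x := by
  simp only [dirD, pd_congr h]

lemma eDen_rescale (a b c ε : ℝ) (Q : E3 → M3) (x : E3) {r : ℝ} (hr : 0 < r) (y : E3) :
    eDen a b c (ε / r) (fun y => Q (x + r • y)) y = r ^ 2 * eDen a b c ε Q (x + r • y) := by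
  have h : 1 / (ε / r) ^ 2 = r ^ 2 * (1 / ε ^ 2) := by rw [div_pow, one_div_div]; ring
  simp only [eDen, gradSq, pd_rescale, frobSq_smul, ← Finset.mul_sum, h]
  ring

/-- agreement with the rescaled map on an open ball -/
def Agr (u Q : E3 → M3) (x : E3) (r S : ℝ) : Prop := ∀ y : E3, ‖y‖ < S → u y = Q (x + r • y)

lemma Agr.ev {u Q : E3 → M3} {x : E3} {r S : ℝ} (h : Agr u Q x r S) {y : E3} (hy : ‖y‖ < S) :
    u =ᶠ[𝓝 y] fun y => Q (x + r • y) := by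
  filter_upwards [(continuous_norm.isOpen_preimage _ isOpen_Iio).mem_nhds (show y ∈ norm ⁻¹' Iio S from hy)] with z hz
  exact h z hz

lemma Agr.eDen {u Q : E3 → M3} {x : E3} {r S : ℝ} (h : Agr u Q x r S) (a b c ε : ℝ) (hr : 0 < r) {y : E3} (hy : ‖y‖ < S) :
    eDen a b c (ε / r) u y = r ^ 2 * eDen a b c ε Q (x + r • y) := by
  rw [eDen_congr a b c (ε / r) (h.ev hy), eDen_rescale a b c ε Q x hr]

lemma Agr.energy {u Q : E3 → M3} {x : E3} {r : ℝ} (h : Agr u Q x r 4) (a b c ε : ℝ) (hr : 0 < r) :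
    energy a b c (ε / r) u (ball 0 4) = r⁻¹ * energy a b c ε Q (ball x (r * 4)) := by
  unfold _root_.energy
  have h1 : ∫ y in ball (0:E3) 4, _root_.eDen a b c (ε / r) u y = ∫ y in ball (0:E3) 4, r ^ 2 * _root_.eDen a b c ε Q (x + r • y) :=
    setIntegral_congr_fun measurableSet_ball fun y hy => h.eDen a b c ε hr (by simpa using hy)
  rw [h1, integral_const_mul, int_scale (g := fun z => _root_.eDen a b c ε Q z) x hr 4]
  field_simp

lemma Agr.dirD {u Q : E3 → M3} {x : E3} {r : ℝ} (h : Agr u Q x r 4) (hr : 0 < r) (v : E3) :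
    ∫ y in ball (0:E3) 1, frobSq (dirD u v y) = r⁻¹ * ∫ y in ball x r, frobSq (dirD Q v y) := by
  have h1 : ∫ y in ball (0:E3) 1, frobSq (_root_.dirD u v y) = ∫ y in ball (0:E3) 1, r ^ 2 * frobSq (_root_.dirD Q v (x + r • y)) := by
    refine setIntegral_congr_fun measurableSet_ball fun y hy => ?_
    have hy' : ‖y‖ < 4 := by
      have : ‖y‖ < 1 := by simpa using hy
      linarith
    rw [dirD_congr (h.ev hy'), dirD_rescale, frobSq_smul]
  rw [h1, integral_const_mul, int_scale (g := fun z => frobSq (_root_.dirD Q v z)) x hr 1, mul_one]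
  field_simp

lemma Agr.theta {u Q : E3 → M3} {x : E3} {r : ℝ} (h : Agr u Q x r 4) (a b c ε : ℝ) (hr : 0 < r) {φ : ℝ → ℝ} (hφ : AdmissibleCutoff φ)
    {t : ℝ} (ht : 0 < t) (ht1 : t ≤ 1) :
    Fm a b c (ε / r) φ u 0 t = Theta a b c ε φ Q x (t * r) := by
  have hs : Real.sqrt 10 ^ 2 = 10 := Real.sq_sqrt (by norm_num)
  have hs0 := Real.sqrt_nonneg 10
  have htr : 0 < t * r := by positivity
  have h0 : ∫ y, _root_.eDen a b c (ε / r) u (0 + t • y) * φ (‖y‖ ^ 2)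
      = ∫ y in ball (0:E3) (Real.sqrt 10), _root_.eDen a b c (ε / r) u (0 + t • y) * φ (‖y‖ ^ 2) := by
    refine (setIntegral_eq_integral_of_forall_compl_eq_zero fun y hy => ?_).symm
    have hy' : Real.sqrt 10 ≤ ‖y‖ := by simpa using hy
    rw [hφ.2.2.1 _ (by nlinarith), mul_zero]
  have h1 : ∫ y in ball (0:E3) (Real.sqrt 10), _root_.eDen a b c (ε / r) u (0 + t • y) * φ (‖y‖ ^ 2)
      = ∫ y in ball (0:E3) (Real.sqrt 10), r ^ 2 * (_root_.eDen a b c ε Q (x + (t * r) • y) *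
        φ (‖(x + (t * r) • y) - x‖ ^ 2 / (t * r) ^ 2)) := by
    refine setIntegral_congr_fun measurableSet_ball fun y hy => ?_
    have hy' : ‖y‖ < Real.sqrt 10 := by simpa using hy
    have hy2 : ‖t • y‖ < 4 := by
      rw [norm_smul, Real.norm_of_nonneg ht.le]
      have hn := norm_nonneg y
      have h4 : ‖y‖ < 4 := by nlinarith
      nlinarith
    rw [zero_add, h.eDen a b c ε hr hy2, add_sub_cancel_left, norm_smul, Real.norm_of_nonneg htr.le, smul_smul, mul_comm r t, mul_pow (t * r),
      mul_div_cancel_left₀ _ (by positivity)]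
    ring
  unfold Fm Theta
  rw [h0, h1, integral_const_mul,
    int_scale (g := fun z => _root_.eDen a b c ε Q z * φ (‖z - x‖ ^ 2 / (t * r) ^ 2)) x htr (Real.sqrt 10), mul_comm (t * r) (Real.sqrt 10)]
  field_simp

lemma zero_mem_S0 : (0 : M3) ∈ S0 := ⟨Matrix.isSymm_zero, Matrix.trace_zero _ _⟩

lemma in_big {x : E3} {r : ℝ} (hr : 0 < r) {y : E3} (hy : ‖y‖ < 10) : x + r • y ∈ ball x (10 * r) :=
  mem_scale hr hy (by linarith)

/-- smooth global extension of the rescaled map -/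
lemma exists_ext {Q : E3 → M3} {x : E3} {r : ℝ} (hr : 0 < r) (hQ : ContDiffOn ℝ ∞ Q (ball x (10 * r)))
    (hS : ∀ y ∈ ball x (10 * r), Q y ∈ S0) :
    ∃ u : E3 → M3, ContDiff ℝ ∞ u ∧ (∀ y, u y ∈ S0) ∧ Agr u Q x r 5 := by
  let ζ : ContDiffBump (0 : E3) := ⟨5, 9, by norm_num, by norm_num⟩
  have hz : ∀ y : E3, 9 ≤ ‖y‖ → ζ y = 0 := fun y hy => ζ.zero_of_le_dist (by simpa [ζ] using hy)
  refine ⟨fun y => ζ y • Q (x + r • y), ?_, ?_, ?_⟩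
  · rw [contDiff_iff_contDiffAt]
    intro y
    by_cases hy : ‖y‖ < 10
    · have hsc : ContDiffAt ℝ ∞ (fun y : E3 => x + r • y) y := (contDiff_const.add (contDiff_id.const_smul r)).contDiffAt
      have h2 : ContDiffAt ℝ ∞ Q (x + r • y) := hQ.contDiffAt (isOpen_ball.mem_nhds (in_big hr hy))
      have h3 : ContDiffAt ℝ ∞ (fun y => Q (x + r • y)) y := h2.comp y hsc
      exact ζ.contDiff.contDiffAt.smul h3
    · have : (fun y => ζ y • Q (x + r • y)) =ᶠ[𝓝 y] fun _ => (0 : M3) := by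
        filter_upwards [(continuous_norm.isOpen_preimage _ isOpen_Ioi).mem_nhds (show y ∈ norm ⁻¹' Ioi (9:ℝ) from by
          simp only [mem_preimage, mem_Ioi]; linarith)] with w hw
        rw [hz w (le_of_lt hw), zero_smul]
      exact contDiffAt_const.congr_of_eventuallyEq this
  · intro y
    by_cases hy : ‖y‖ < 10
    · exact S0_smul _ (hS _ (in_big hr hy))
    · simp only []
      rw [hz y (by linarith), zero_smul]; exact zero_mem_S0
  · intro y hy
    simp only []
    rw [ζ.one_of_mem_closedBall (by simpa [ζ] using hy.le), one_smul]

lemma sol_of {a b c M ε : ℝ} {Q u : E3 → M3} {x : E3} {r : ℝ} (hr : 0 < r) (hQ : ContDiffOn ℝ ∞ Q (ball x (10 * r)))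
    (hS : ∀ y ∈ ball x (10 * r), Q y ∈ S0) (hmin : IsLDGMin a b c ε (ball x (10 * r)) Q)
    (hM : ∀ y ∈ ball x (10 * r), frobNorm (Q y) ≤ M) (hu : ContDiff ℝ ∞ u) (huS : ∀ y, u y ∈ S0) (h : Agr u Q x r 5) :
    Sol a b c M (ε / r) u := by
  have h4 : Agr u Q x r 4 := fun y hy => h y (by linarith)
  refine ⟨hu, huS, ?_, ?_⟩
  · intro y hy
    have hy' : ‖y‖ < 4 := by simpa using hy
    rw [h4 y hy']
    exact hM _ (in_big hr (by linarith))
  · rintro P hP hPS ⟨R, hR, hPu⟩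
    classical
    let W : E3 → M3 := fun z => if ‖z - x‖ < 4 * r then P (r⁻¹ • (z - x)) else Q z
    have hn : ∀ z : E3, ‖r⁻¹ • (z - x)‖ = ‖z - x‖ / r := fun z => by
      rw [norm_smul, Real.norm_of_nonneg (by positivity)]; field_simp
    have hback : ∀ z : E3, x + r • (r⁻¹ • (z - x)) = z := fun z => by
      rw [smul_smul, mul_inv_cancel₀ hr.ne', one_smul]; abel
    have hPQ : ∀ z : E3, R * r ≤ ‖z - x‖ → ‖z - x‖ < 5 * r → P (r⁻¹ • (z - x)) = Q z := by
      intro z h1 h2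
      rw [hPu _ (by rw [hn, le_div_iff₀ hr]; exact h1), h _ (by rw [hn, div_lt_iff₀ hr]; exact h2), hback]
    have hW5 : ∀ z : E3, ‖z - x‖ < 5 * r → W z = P (r⁻¹ • (z - x)) := by
      intro z hz
      by_cases h1 : ‖z - x‖ < 4 * r
      · simp only [W, if_pos h1]
      · simp only [W, if_neg h1]
        rw [hPQ z (by push Not at h1; nlinarith) hz]
    have hWQ : ∀ z : E3, R * r < ‖z - x‖ → W z = Q z := by
      intro z hz
      by_cases h1 : ‖z - x‖ < 4 * r
      · rw [hW5 z (by linarith), hPQ z hz.le (by linarith)]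
      · simp only [W, if_neg h1]
    have hcn : Continuous fun z : E3 => ‖z - x‖ := by fun_prop
    have key := hmin x (r * 4) (by positivity) (closedBall_subset_ball (by linarith)) W ?_ ?_ ?_
    · have hWP : Agr P W x r 4 := by
        intro y hy
        have : ‖x + r • y - x‖ < 5 * r := by
          rw [add_sub_cancel_left, norm_smul, Real.norm_of_nonneg hr.le]; nlinarith
        rw [hW5 _ this, add_sub_cancel_left, smul_smul, inv_mul_cancel₀ hr.ne', one_smul]
      rw [h4.energy a b c ε hr, hWP.energy a b c ε hr]
      exact mul_le_mul_of_nonneg_left key (by positivity)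
    · intro z hz
      apply ContDiffAt.contDiffWithinAt
      by_cases h1 : ‖z - x‖ < 5 * r
      · have hsc : ContDiff ℝ ∞ (fun z : E3 => r⁻¹ • (z - x)) := (contDiff_id.sub contDiff_const).const_smul r⁻¹
        refine (hP.comp hsc).contDiffAt.congr_of_eventuallyEq ?_
        filter_upwards [(hcn.isOpen_preimage _ isOpen_Iio).mem_nhds (show z ∈ _ ⁻¹' Iio (5 * r) from h1)] with w hw
        exact hW5 w hw
      · refine (hQ.contDiffAt (isOpen_ball.mem_nhds hz)).congr_of_eventuallyEq ?_
        filter_upwards [(hcn.isOpen_preimage _ isOpen_Ioi).mem_nhds (show z ∈ _ ⁻¹' Ioi (R * r) from by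
          simp only [mem_preimage, mem_Ioi]; push Not at h1; nlinarith)] with w hw
        exact hWQ w hw
    · intro y hy
      by_cases h1 : ‖y - x‖ < 4 * r
      · simp only [W, if_pos h1]; exact hPS _
      · simp only [W, if_neg h1]; exact hS y hy
    · refine ⟨closedBall x (R * r), isCompact_closedBall _ _, closedBall_subset_ball (by nlinarith), fun y hy => hWQ y ?_⟩
      rw [mem_closedBall, dist_eq_norm] at hy
      push Not at hy
      exact hy

theorem main (a b c : ℝ) (ha : 0 ≤ a) (hb : 0 < b) (hc : 0 < c)
    (φ : ℝ → ℝ) (hφ : AdmissibleCutoff φ)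
    (M δ : ℝ) (hM : 0 < M) (hδ : 0 < δ) :
    ∃ η Λ : ℝ, 0 < η ∧ 0 < Λ ∧
      ∀ ε ∈ Ioo (0 : ℝ) 1, ∀ (x : E3) (r : ℝ), Λ * ε < r → r < 1 →
        ∀ Q : E3 → M3,
          ContDiffOn ℝ (⊤ : ℕ∞) Q (ball x (10 * r)) →
          (∀ y ∈ ball x (10 * r), Q y ∈ S0) →
          IsLDGMin a b c ε (ball x (10 * r)) Q →
          (∀ y ∈ ball x (10 * r),
            r⁻¹ * energy a b c ε Q (ball x (10 * r)) + frobNorm (Q y) ≤ M) →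
          Theta a b c ε φ Q x r - Theta a b c ε φ Q x (r / 2) < η →
          sInf ((fun v : E3 => r⁻¹ * ∫ y in ball x r, frobSq (dirD Q v y)) ''
            sphere (0 : E3) 1) < η →
          (∀ y ∈ ball x (r / 2), distN a b c (Q y) < δ) ∧
            r / 2 ≤ regScale a b c ε Q x := by
  obtain ⟨η, hη, hcore⟩ := core (φ := φ) ha hb hc hφ hM
  have hC := C2_pos ha hb hc
  obtain ⟨Λ, hΛ4, hΛ⟩ : ∃ Λ : ℝ, 4 ≤ Λ ∧ C2 a b c * 4 / δ ^ 2 < Λ ^ 2 := by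
    refine ⟨max 4 (C2 a b c * 4 / δ ^ 2), le_max_left _ _, ?_⟩
    have h1 := le_max_left 4 (C2 a b c * 4 / δ ^ 2)
    have h2 := le_max_right 4 (C2 a b c * 4 / δ ^ 2)
    nlinarith
  have hΛ0 : 0 < Λ := by linarith
  refine ⟨η, Λ, hη, hΛ0, ?_⟩
  rintro ε ⟨hε, -⟩ x r hr hr1 Q hQ hS hmin hMQ hT hinf
  have hr0 : 0 < r := lt_trans (by positivity) hr
  have hE : 0 ≤ r⁻¹ * energy a b c ε Q (ball x (10 * r)) :=
    mul_nonneg (by positivity) (setIntegral_nonneg measurableSet_ball fun y hy => eDen_nonneg ha hb hc ε (hS y hy))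
  obtain ⟨u, hu, huS, hA⟩ := exists_ext hr0 hQ hS
  have h4 : Agr u Q x r 4 := fun y hy => hA y (by linarith)
  have hsol : Sol a b c M (ε / r) u := sol_of hr0 hQ hS hmin (fun y hy => by linarith [hMQ y hy]) hu huS hA
  have hεr : Λ * (ε / r) < 1 := by rw [← mul_div_assoc, div_lt_one hr0]; exact hr
  have hεr0 : 0 < ε / r := by positivity
  have hpin := pinch ha hb hc hφ hsol (η := η) (by
    rw [h4.theta a b c ε hr0 hφ one_pos le_rfl, h4.theta a b c ε hr0 hφ (t := 1/2) (by norm_num) (by norm_num), one_mul,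
      show 1 / 2 * r = r / 2 by ring]
    exact hT)
  obtain ⟨_, ⟨v, hv, rfl⟩, hvη⟩ := exists_lt_of_csInf_lt ((NormedSpace.sphere_nonempty.2 zero_le_one).image _) hinf
  have hv1 : ‖v‖ = 1 := by simpa using hv
  have hdir : ∫ y in ball (0:E3) 1, frobSq (dirD u v y) ≤ η := by rw [h4.dirD hr0 v]; exact hvη.le
  have hfin := hcore (ε / r) hεr0 (by nlinarith) u hsol v hv1 hpin hdir
  have hpt : ∀ z ∈ ball x (r / 2), r ^ 2 * eDen a b c ε Q z ≤ 4 ∧ 1 / (ε / r) ^ 2 * fbulk a b c (Q z) ≤ 4 := by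
    intro z hz
    have hn : ‖r⁻¹ • (z - x)‖ < 1 / 2 := by
      rw [norm_smul, Real.norm_of_nonneg (by positivity), inv_mul_lt_iff₀ hr0, ← dist_eq_norm]
      rw [mem_ball] at hz; linarith
    have hback : x + r • (r⁻¹ • (z - x)) = z := by
      rw [smul_smul, mul_inv_cancel₀ hr0.ne', one_smul]; abel
    have h1 := hfin (r⁻¹ • (z - x)) (by simpa using hn)
    constructor
    · rw [h4.eDen a b c ε hr0 (by linarith), hback] at h1
      exact h1
    · unfold eDen at h1
      rw [h4 _ (by linarith), hback] at h1
      have := gradSq_nonneg u (r⁻¹ • (z - x))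
      linarith
  constructor
  · intro y hy
    have hyS : Q y ∈ S0 := hS y (ball_subset_ball (by linarith) hy)
    obtain ⟨p, hp, hpQ⟩ := exists_near_N ha hb hc hyS
    have h2 := (hpt y hy).2
    have hf0 := fbulk_nonneg ha hb hc hyS
    have h3 : fbulk a b c (Q y) ≤ 4 * (ε / r) ^ 2 := by
      rw [one_div, inv_mul_le_iff₀ (by positivity)] at h2; linarith
    have h5 : frobSq (Q y - p) < δ ^ 2 := by
      rw [div_lt_iff₀ (by positivity)] at hΛ
      have h6 : (Λ * (ε / r)) ^ 2 < 1 := by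
        have : 0 < Λ * (ε / r) := by positivity
        nlinarith
      calc frobSq (Q y - p) ≤ C2 a b c * (4 * (ε / r) ^ 2) := hpQ.trans (mul_le_mul_of_nonneg_left h3 hC.le)
        _ = (C2 a b c * 4) * (ε / r) ^ 2 := by ring
        _ < (Λ ^ 2 * δ ^ 2) * (ε / r) ^ 2 := mul_lt_mul_of_pos_right hΛ (by positivity)
        _ = δ ^ 2 * (Λ * (ε / r)) ^ 2 := by ring
        _ ≤ δ ^ 2 * 1 := mul_le_mul_of_nonneg_left h6.le (by positivity)
        _ = δ ^ 2 := mul_one _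
    refine (distN_le hp).trans_lt ?_
    unfold frobNorm
    rw [Real.sqrt_lt' hδ]
    exact h5
  · refine le_csSup ⟨1, fun ρ hρ => hρ.2.1⟩ ⟨by positivity, by linarith, fun y hy => ?_⟩
    have := (hpt y hy).1
    nlinarith

end Part31

end LDG

/-- small density pinching plus almost one-directional invariance
implies good behavior (Lemma on the regular scale). -/
theorem stmt7 (a b c : ℝ) (ha : 0 ≤ a) (hb : 0 < b) (hc : 0 < c)
    (φ : ℝ → ℝ) (hφ : AdmissibleCutoff φ)
    (M δ : ℝ) (hM : 0 < M) (hδ : 0 < δ) :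
    ∃ η Λ : ℝ, 0 < η ∧ 0 < Λ ∧
      ∀ ε ∈ Ioo (0 : ℝ) 1, ∀ (x : E3) (r : ℝ), Λ * ε < r → r < 1 →
        ∀ Q : E3 → M3,
          ContDiffOn ℝ (⊤ : ℕ∞) Q (ball x (10 * r)) →
          (∀ y ∈ ball x (10 * r), Q y ∈ S0) →
          IsLDGMin a b c ε (ball x (10 * r)) Q →
          (∀ y ∈ ball x (10 * r),
            r⁻¹ * energy a b c ε Q (ball x (10 * r)) + frobNorm (Q y) ≤ M) →
          Theta a b c ε φ Q x r - Theta a b c ε φ Q x (r / 2) < η →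
          sInf ((fun v : E3 => r⁻¹ * ∫ y in ball x r, frobSq (dirD Q v y)) ''
            sphere (0 : E3) 1) < η →
          (∀ y ∈ ball x (r / 2), distN a b c (Q y) < δ) ∧
            r / 2 ≤ regScale a b c ε Q x := by
  exact LDG.main a b c ha hb hc φ hφ M δ hM hδ

end
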